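/- Fix k ≥ 1. For almost all n ≤ x (i.e., all but o(x) integers n ≤ x as x → ∞), log(n/λ_k(n)) = (1/(k−1)!)·(log log n)^k·(log log log n)·(1 + o(1)), where λ_k is the k-fold iterated Carmichael function. -/

import Mathlib

open Filter

/-- The Carmichael lambda function: the exponent of the multiplicative group `(ℤ/nℤ)ˣ`. -/
noncomputable def carmichael (n : ℕ) : ℕ := Monoid.exponent (ZMod n)ˣ

namespace ICM

/-- primes up to `x` -/
def Pr (x : ℕ) : Finset ℕ := (Finset.range (x + 1)).filter Nat.Prime

lemma mem_Pr {x p : ℕ} : p ∈ Pr x ↔ p ≤ x ∧ p.Prime := by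
  simp [Pr, Nat.lt_succ_iff]

lemma Pr_subset {x y : ℕ} (h : x ≤ y) : Pr x ⊆ Pr y := by
  intro p; simp only [mem_Pr]; rintro ⟨a, b⟩; exact ⟨a.trans h, b⟩

lemma abel_bound {E : Type*} [NormedAddCommGroup E] [NormedSpace ℝ E] (w : ℕ → ℝ) (g : ℕ → E)
    (a b : ℕ) (G : ℝ) (hab : a < b)
    (hw : ∀ m, a < m → m < b → w (m + 1) ≤ w m) (hw0 : ∀ m, a < m → m ≤ b → 0 ≤ w m)
    (hG : ∀ c, a ≤ c → c ≤ b → ‖∑ m ∈ Finset.Ioc a c, g m‖ ≤ G) :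
    ‖∑ m ∈ Finset.Ioc a b, w m • g m‖ ≤ w (a + 1) * G := by
  have key : ∀ c, a + 1 ≤ c → c ≤ b →
      ‖∑ m ∈ Finset.Ioc a c, w m • g m - w c • ∑ m ∈ Finset.Ioc a c, g m‖
        ≤ (w (a + 1) - w c) * G := by
    intro c hc
    induction c, hc using Nat.le_induction with
    | base => intro _; simp
    | succ c hc ih =>
      intro hcb
      have ih := ih (by omega)
      rw [Finset.sum_Ioc_succ_top (by omega), Finset.sum_Ioc_succ_top (by omega)]
      have e : ∑ m ∈ Finset.Ioc a c, w m • g m + w (c + 1) • g (c + 1) -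
          w (c + 1) • (∑ m ∈ Finset.Ioc a c, g m + g (c + 1)) =
          (∑ m ∈ Finset.Ioc a c, w m • g m - w c • ∑ m ∈ Finset.Ioc a c, g m) +
          (w c - w (c + 1)) • ∑ m ∈ Finset.Ioc a c, g m := by
        rw [sub_smul, smul_add]; abel
      rw [e]
      refine (norm_add_le _ _).trans ?_
      rw [norm_smul, Real.norm_of_nonneg (by linarith [hw c (by omega) (by omega)])]
      have := mul_le_mul_of_nonneg_left (hG c (by omega) (by omega))
        (by linarith [hw c (by omega) (by omega)] : (0:ℝ) ≤ w c - w (c + 1))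
      linarith
  have h1 := key b hab le_rfl
  have h2 := hG b hab.le le_rfl
  have h0 := hw0 b hab le_rfl
  calc ‖∑ m ∈ Finset.Ioc a b, w m • g m‖
      = ‖(∑ m ∈ Finset.Ioc a b, w m • g m - w b • ∑ m ∈ Finset.Ioc a b, g m) +
        w b • ∑ m ∈ Finset.Ioc a b, g m‖ := by simp
    _ ≤ _ := norm_add_le _ _
    _ ≤ (w (a + 1) - w b) * G + w b * G := by
        gcongr
        rw [norm_smul, Real.norm_of_nonneg h0]; gcongr
    _ = _ := by ring

lemma sum_period {E : Type*} [AddCommGroup E] (g : ℕ → E) (D : ℕ)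
    (hp : ∀ n, g (n + D) = g n) (a : ℕ) :
    ∑ i ∈ Finset.Ioc a (a + D), g i = ∑ i ∈ Finset.range D, g i := by
  induction a with
  | zero =>
    rw [zero_add, Finset.range_eq_Ico]
    rcases Nat.eq_zero_or_pos D with h | h
    · subst h; simp
    · have h1 := Finset.sum_Ioc_add_eq_sum_Icc (f := g) (Nat.zero_le D)
      have h2 := Finset.sum_Ico_add_eq_sum_Icc (f := g) (Nat.zero_le D)
      have h3 : g D = g 0 := by simpa using hp 0
      rw [← h2, h3] at h1
      exact add_right_cancel h1
  | succ a ih =>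
    rcases Nat.eq_zero_or_pos D with h | h
    · subst h; simp
    · rw [← ih]
      have e1 : ∑ i ∈ Finset.Ioc a (a + 1 + D), g i = g (a + 1) + ∑ i ∈ Finset.Ioc (a + 1) (a + 1 + D), g i := by
        rw [← Finset.sum_Ioc_consecutive g (show a ≤ a + 1 by omega) (by omega)]; simp
      have e2 : ∑ i ∈ Finset.Ioc a (a + 1 + D), g i = ∑ i ∈ Finset.Ioc a (a + D), g i + g (a + 1 + D) := by
        rw [show a + 1 + D = a + D + 1 by omega, Finset.sum_Ioc_succ_top (by omega)]
      rw [hp, e1] at e2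
      rw [add_comm] at e2
      exact add_right_cancel e2

lemma periodic_sum_bound {E : Type*} [NormedAddCommGroup E] (g : ℕ → E) (D : ℕ) (hD : 0 < D)
    (hp : ∀ n, g (n + D) = g n) (h0 : ∑ i ∈ Finset.range D, g i = 0) (M : ℝ)
    (hb : ∀ n, ‖g n‖ ≤ M) (a b : ℕ) :
    ‖∑ i ∈ Finset.Ioc a b, g i‖ ≤ D * M := by
  have hM : 0 ≤ M := (norm_nonneg _).trans (hb 0)
  induction h : b - a using Nat.strong_induction_on generalizing a with
  | _ n ih =>
    rcases lt_or_ge b (a + D) with hlt | hge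
    · refine (norm_sum_le _ _).trans ?_
      refine (Finset.sum_le_card_nsmul _ _ M (fun i _ => hb i)).trans ?_
      rw [nsmul_eq_mul, Nat.card_Ioc]
      gcongr
      omega
    · rw [← Finset.sum_Ioc_consecutive g (show a ≤ a + D by omega) hge, sum_period g D hp, h0,
        zero_add]
      exact ih _ (by omega) (a + D) rfl

lemma PL {E : Type*} [NormedAddCommGroup E] [NormedSpace ℝ E] (w : ℕ → ℝ) (g : ℕ → E) (D : ℕ)
    (hD : 0 < D) (hp : ∀ n, g (n + D) = g n) (h0 : ∑ i ∈ Finset.range D, g i = 0) (M : ℝ)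
    (hb : ∀ n, ‖g n‖ ≤ M) (a b : ℕ) (hw : ∀ m, a < m → w (m + 1) ≤ w m)
    (hw0 : ∀ m, a < m → 0 ≤ w m) :
    ‖∑ m ∈ Finset.Ioc a b, w m • g m‖ ≤ w (a + 1) * (D * M) := by
  rcases lt_or_ge a b with h | h
  · exact abel_bound w g a b _ h (fun m h _ => hw m h) (fun m h _ => hw0 m h)
      (fun c _ _ => periodic_sum_bound g D hD hp h0 M hb a c)
  · have hM : 0 ≤ M := (norm_nonneg _).trans (hb 0)
    rw [Finset.Ioc_eq_empty (by omega)]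
    simp only [Finset.sum_empty, norm_zero]
    have := hw0 (a + 1) (by omega)
    positivity

end ICM

namespace ICM

/-- sieve support -/
def sL (d z : ℕ) : Finset ℕ := (Finset.Icc 1 z).filter (fun l => Squarefree l ∧ l.Coprime d)

noncomputable def sS (d z : ℕ) : ℝ := ∑ l ∈ sL d z, (1 / (l : ℝ))

noncomputable def sLam (d z e : ℕ) : ℝ :=
  (ArithmeticFunction.moebius e : ℝ) * (e / sS d z) * ∑ l ∈ (sL d z).filter (e ∣ ·), (1 / (l : ℝ))

lemma mem_sL {d z l : ℕ} : l ∈ sL d z ↔ (1 ≤ l ∧ l ≤ z) ∧ Squarefree l ∧ l.Coprime d := by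
  simp [sL]

lemma one_mem_sL {d z : ℕ} (hz : 1 ≤ z) : 1 ∈ sL d z := by
  simp [mem_sL, hz]

lemma sS_pos {d z : ℕ} (hz : 1 ≤ z) : 0 < sS d z := by
  unfold sS
  refine Finset.sum_pos' (fun i _ => by positivity) ⟨1, one_mem_sL hz, by norm_num⟩

lemma sLam_one {d z : ℕ} (hz : 1 ≤ z) : sLam d z 1 = 1 := by
  have := (sS_pos (d := d) hz).ne'
  simp only [sLam, ArithmeticFunction.moebius_apply_one, Int.cast_one, Nat.cast_one, one_mul,
    one_dvd, Finset.filter_true]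
  rw [← sS]; field_simp

lemma abs_sLam_le {d z e : ℕ} (hz : 1 ≤ z) : |sLam d z e| ≤ e := by
  have h0 := sS_pos (d := d) hz
  have h1 : ∑ l ∈ (sL d z).filter (e ∣ ·), (1 / (l : ℝ)) ≤ sS d z := by
    refine Finset.sum_le_sum_of_subset_of_nonneg (Finset.filter_subset _ _) ?_
    intros; positivity
  have h2 : 0 ≤ ∑ l ∈ (sL d z).filter (e ∣ ·), (1 / (l : ℝ)) := by positivity
  have h3 : |(ArithmeticFunction.moebius e : ℝ)| ≤ 1 := by
    have := ArithmeticFunction.abs_moebius_le_one (n := e)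
    exact_mod_cast this
  rw [sLam, abs_mul, abs_mul, abs_of_nonneg h2, abs_of_nonneg (by positivity : (0:ℝ) ≤ e / sS d z)]
  calc _ ≤ 1 * (e / sS d z) * sS d z := by gcongr
    _ = e := by field_simp

lemma sum_moebius_between {h l : ℕ} (hh : Squarefree h) (hl : l ∣ h) :
    ∑ e ∈ h.divisors.filter (l ∣ ·), ArithmeticFunction.moebius e
      = if h = l then ArithmeticFunction.moebius l else 0 := by
  obtain ⟨k, rfl⟩ := hl
  have hcop : l.Coprime k := Nat.coprime_of_squarefree_mul hh
  have hne : l * k ≠ 0 := hh.ne_zero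
  have hl0 : l ≠ 0 := left_ne_zero_of_mul hne
  have hk0 : k ≠ 0 := right_ne_zero_of_mul hne
  have e1 : (l * k).divisors.filter (l ∣ ·) = k.divisors.image (l * ·) := by
    ext e
    simp only [Finset.mem_filter, Nat.mem_divisors, Finset.mem_image]
    constructor
    · rintro ⟨⟨h1, _⟩, f, rfl⟩
      exact ⟨f, ⟨Nat.dvd_of_mul_dvd_mul_left (Nat.pos_of_ne_zero hl0) h1, hk0⟩, rfl⟩
    · rintro ⟨f, ⟨hf, _⟩, rfl⟩
      exact ⟨⟨Nat.mul_dvd_mul_left _ hf, hne⟩, dvd_mul_right _ _⟩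
  rw [e1, Finset.sum_image (fun a _ b _ hab => Nat.eq_of_mul_eq_mul_left (Nat.pos_of_ne_zero hl0) hab)]
  have e2 : ∀ f ∈ k.divisors, ArithmeticFunction.moebius (l * f)
      = ArithmeticFunction.moebius l * ArithmeticFunction.moebius f := by
    intro f hf
    exact ArithmeticFunction.isMultiplicative_moebius.map_mul_of_coprime
      (hcop.coprime_dvd_right (Nat.dvd_of_mem_divisors hf))
  rw [Finset.sum_congr rfl e2, ← Finset.mul_sum]
  have e3 : ∑ f ∈ k.divisors, ArithmeticFunction.moebius f = if k = 1 then 1 else 0 := by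
    have := ArithmeticFunction.coe_mul_zeta_apply (f := ArithmeticFunction.moebius) (x := k)
    rw [← this, ArithmeticFunction.moebius_mul_coe_zeta, ArithmeticFunction.one_apply]
  rw [e3]
  by_cases hk : k = 1
  · subst hk; simp
  · rw [if_neg hk, if_neg]
    · simp
    · intro h; apply hk
      exact Nat.eq_of_mul_eq_mul_left (Nat.pos_of_ne_zero hl0) (by rw [h, mul_one])

lemma sum_sLam_div {d z l : ℕ} (hl : l ∈ sL d z) :
    ∑ e ∈ (sL d z).filter (l ∣ ·), sLam d z e / e =
      (ArithmeticFunction.moebius l : ℝ) / (l * sS d z) := by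
  have hz : 1 ≤ z := by have := (mem_sL.1 hl).1; omega
  have h0 := (sS_pos (d := d) hz).ne'
  have e1 : ∀ e ∈ (sL d z).filter (l ∣ ·), sLam d z e / e =
      ∑ h ∈ sL d z, if e ∣ h then (ArithmeticFunction.moebius e : ℝ) / (h * sS d z) else 0 := by
    intro e he
    have he0 : (e : ℝ) ≠ 0 := by
      have := (mem_sL.1 (Finset.mem_filter.1 he).1).1.1
      positivity
    rw [sLam, ← Finset.sum_filter, Finset.mul_sum, Finset.sum_div]
    refine Finset.sum_congr rfl fun h hh => ?_
    field_simp
  rw [Finset.sum_congr rfl e1, Finset.sum_comm]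
  have e2 : ∀ h ∈ sL d z, (∑ e ∈ (sL d z).filter (l ∣ ·),
      if e ∣ h then (ArithmeticFunction.moebius e : ℝ) / (h * sS d z) else 0) =
      if h = l then (ArithmeticFunction.moebius l : ℝ) / (l * sS d z) else 0 := by
    intro h hh
    have hh' := mem_sL.1 hh
    rw [← Finset.sum_filter, Finset.filter_filter]
    by_cases hlh : l ∣ h
    · have e3 : (sL d z).filter (fun e => l ∣ e ∧ e ∣ h) = h.divisors.filter (l ∣ ·) := by
        ext e
        simp only [Finset.mem_filter, Nat.mem_divisors, mem_sL]
        constructor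
        · rintro ⟨_, h1, h2⟩; exact ⟨⟨h2, hh'.2.1.ne_zero⟩, h1⟩
        · rintro ⟨⟨h2, h3⟩, h1⟩
          exact ⟨⟨⟨Nat.pos_of_dvd_of_pos h2 hh'.1.1, (Nat.le_of_dvd hh'.1.1 h2).trans hh'.1.2⟩,
            hh'.2.1.squarefree_of_dvd h2, hh'.2.2.coprime_dvd_left h2⟩, h1, h2⟩
      rw [e3, ← Finset.sum_div]
      have := sum_moebius_between hh'.2.1 hlh
      rw [← Int.cast_sum, this]
      split_ifs with h4
      · rw [h4]
      · simp
    · rw [if_neg (by rintro rfl; exact hlh dvd_rfl), Finset.filter_eq_empty_iff.2]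
      · simp
      · rintro e _ ⟨h1, h2⟩; exact hlh (h1.trans h2)
  rw [Finset.sum_congr rfl e2, Finset.sum_ite_eq' , if_pos hl]

lemma sQ_le {d z : ℕ} (hz : 1 ≤ z) :
    ∑ e ∈ sL d z, ∑ e' ∈ sL d z, sLam d z e * sLam d z e' / (Nat.lcm e e' : ℝ) ≤ 1 / sS d z := by
  have h0 := (sS_pos (d := d) hz)
  have e1 : ∀ e ∈ sL d z, ∀ e' ∈ sL d z, sLam d z e * sLam d z e' / (Nat.lcm e e' : ℝ) =
      ∑ l ∈ sL d z, (l.totient : ℝ) * ((if l ∣ e then sLam d z e / e else 0) *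
        (if l ∣ e' then sLam d z e' / e' else 0)) := by
    intro e he e' he'
    have he := mem_sL.1 he
    have he' := mem_sL.1 he'
    have p1 : (0:ℝ) < e := by exact_mod_cast he.1.1
    have p2 : (0:ℝ) < e' := by exact_mod_cast he'.1.1
    have hg : ((Nat.gcd e e' : ℕ) : ℝ) = ∑ l ∈ (sL d z).filter (fun l => l ∣ e ∧ l ∣ e'), (l.totient : ℝ) := by
      rw [← Nat.sum_totient (Nat.gcd e e')]
      push_cast
      refine Finset.sum_congr ?_ (fun _ _ => rfl)
      ext l
      simp only [Finset.mem_filter, Nat.mem_divisors, mem_sL, Nat.dvd_gcd_iff]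
      constructor
      · rintro ⟨⟨h2, h3⟩, h1⟩
        exact ⟨⟨⟨Nat.pos_of_dvd_of_pos h2 he.1.1, (Nat.le_of_dvd he.1.1 h2).trans he.1.2⟩,
            he.2.1.squarefree_of_dvd h2, he.2.2.coprime_dvd_left h2⟩, h2, h3⟩
      · rintro ⟨_, h1, h2⟩
        exact ⟨⟨h1, h2⟩, (Nat.gcd_pos_of_pos_left _ he.1.1).ne'⟩
    have hgl : ((Nat.gcd e e' : ℕ) : ℝ) * (Nat.lcm e e' : ℕ) = e * e' := by
      exact_mod_cast Nat.gcd_mul_lcm e e'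
    have hl : (0:ℝ) < (Nat.lcm e e' : ℕ) := by
      exact_mod_cast Nat.lcm_pos he.1.1 he'.1.1
    have : sLam d z e * sLam d z e' / (Nat.lcm e e' : ℝ) =
        (Nat.gcd e e' : ℕ) * (sLam d z e / e * (sLam d z e' / e')) := by
      field_simp
      linear_combination (-(sLam d z e * sLam d z e')) * hgl
    rw [this, hg, Finset.sum_mul, Finset.sum_filter]
    refine Finset.sum_congr rfl fun l _ => ?_
    by_cases a : l ∣ e <;> by_cases b : l ∣ e' <;> simp [a, b]
  rw [Finset.sum_congr rfl fun e he => Finset.sum_congr rfl (e1 e he)]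
  have e2 : ∑ e ∈ sL d z, ∑ e' ∈ sL d z, ∑ l ∈ sL d z, (l.totient : ℝ) * ((if l ∣ e then sLam d z e / e else 0) *
        (if l ∣ e' then sLam d z e' / e' else 0)) = ∑ l ∈ sL d z, (l.totient : ℝ) *
        (∑ e ∈ (sL d z).filter (l ∣ ·), sLam d z e / e) ^ 2 := by
    have : ∀ e ∈ sL d z, ∑ e' ∈ sL d z, ∑ l ∈ sL d z, (l.totient : ℝ) * ((if l ∣ e then sLam d z e / e else 0) *
        (if l ∣ e' then sLam d z e' / e' else 0)) = ∑ l ∈ sL d z, ∑ e' ∈ sL d z, (l.totient : ℝ) * ((if l ∣ e then sLam d z e / e else 0) *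
        (if l ∣ e' then sLam d z e' / e' else 0)) := fun e _ => Finset.sum_comm
    rw [Finset.sum_congr rfl this, Finset.sum_comm]
    refine Finset.sum_congr rfl fun l _ => ?_
    rw [Finset.sum_filter, sq, Finset.sum_mul_sum, Finset.mul_sum]
    refine Finset.sum_congr rfl fun e _ => ?_
    rw [Finset.mul_sum]
  rw [e2]
  have e3 : ∀ l ∈ sL d z, (l.totient : ℝ) *
        (∑ e ∈ (sL d z).filter (l ∣ ·), sLam d z e / e) ^ 2 ≤ (1 / (l:ℝ)) * (1 / (sS d z) ^ 2) := by
    intro l hl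
    rw [sum_sLam_div hl]
    have hl' := mem_sL.1 hl
    have p1 : (0:ℝ) < l := by exact_mod_cast hl'.1.1
    have hm : ((ArithmeticFunction.moebius l : ℝ)) ^ 2 ≤ 1 := by
      have := ArithmeticFunction.abs_moebius_le_one (n := l)
      have : |(ArithmeticFunction.moebius l : ℝ)| ≤ 1 := by exact_mod_cast this
      exact (sq_le_one_iff_abs_le_one _).2 this
    have ht : (l.totient : ℝ) ≤ l := by exact_mod_cast Nat.totient_le l
    calc _ = (l.totient : ℝ) * (ArithmeticFunction.moebius l : ℝ) ^ 2 / (l * sS d z) ^ 2 := by ring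
      _ ≤ l * 1 / (l * sS d z) ^ 2 := by gcongr
      _ = _ := by field_simp
  refine (Finset.sum_le_sum e3).trans ?_
  rw [← Finset.sum_mul, ← sS]
  apply le_of_eq; field_simp

end ICM

namespace ICM

lemma sum_inv_Ioc_le_log {a b : ℕ} (ha : 0 < a) (hab : a ≤ b) :
    ∑ m ∈ Finset.Ioc a b, (1 / (m : ℝ)) ≤ Real.log b - Real.log a := by
  induction b, hab using Nat.le_induction with
  | base => simp
  | succ b hb ih =>
    rw [Finset.sum_Ioc_succ_top (by omega)]
    have hb0 : (0:ℝ) < b := by exact_mod_cast (by omega : 0 < b)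
    have : (1:ℝ) / ((b + 1 : ℕ) : ℝ) ≤ Real.log ((b + 1 : ℕ) : ℝ) - Real.log b := by
      rw [← Real.log_div (by positivity) (by positivity)]
      have h := Real.one_sub_inv_le_log_of_pos (x := ((b + 1 : ℕ) : ℝ) / b) (by positivity)
      refine le_trans (le_of_eq ?_) h
      push_cast; field_simp; ring
    linarith

lemma log_le_sum_inv (z : ℕ) : Real.log z ≤ ∑ n ∈ Finset.Icc 1 z, (1 / (n : ℝ)) := by
  rcases Nat.eq_zero_or_pos z with h | h
  · subst h; simp
  have h1 := log_add_one_le_harmonic z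
  rw [harmonic_eq_sum_Icc] at h1
  push_cast at h1
  simp only [one_div]
  refine le_trans ?_ h1
  apply Real.log_le_log <;> [positivity; linarith]

lemma sum_inv_sq_le_two (z : ℕ) : ∑ n ∈ Finset.Icc 1 z, (1 / (n : ℝ) ^ 2) ≤ 2 := by
  have : ∀ z : ℕ, 1 ≤ z → ∑ n ∈ Finset.Icc 1 z, (1 / (n : ℝ) ^ 2) ≤ 2 - 1 / (z : ℝ) := by
    intro z hz
    induction z, hz using Nat.le_induction with
    | base => norm_num
    | succ z hz ih =>
      rw [Finset.sum_Icc_succ_top (by omega)]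
      have hz0 : (0:ℝ) < z := by exact_mod_cast hz
      have : (1:ℝ) / ((z + 1 : ℕ) : ℝ) ^ 2 ≤ 1 / z - 1 / ((z + 1 : ℕ) : ℝ) := by
        push_cast
        rw [div_sub_div _ _ (by positivity) (by positivity), div_le_div_iff₀ (by positivity) (by positivity)]
        nlinarith
      linarith
  rcases Nat.eq_zero_or_pos z with h | h
  · subst h; simp
  · have := this z h
    have : (0:ℝ) ≤ 1 / z := by positivity
    linarith

lemma sum_sqfree_div (d : ℕ) (hd : 1 ≤ d) :
    (∑ g ∈ d.divisors.filter Squarefree, (1 / (g : ℝ))) * (d.totient / d) ≤ 1 := by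
  have e1 : ∑ g ∈ d.divisors.filter Squarefree, (1 / (g : ℝ)) = ∏ p ∈ d.primeFactors, (1 + 1 / (p:ℝ)) := by
    rw [Finset.prod_one_add]
    rw [Nat.sum_divisors_filter_squarefree (by omega)]
    have : (UniqueFactorizationMonoid.normalizedFactors d).toFinset = d.primeFactors := by
      rw [Nat.factors_eq]; rfl
    rw [this]
    refine Finset.sum_congr rfl fun i _ => ?_
    rw [show i.val.prod = ∏ p ∈ i, p by simp]
    push_cast
    simp
  have hd0 : (d:ℝ) ≠ 0 := by positivity
  have e2 : (d.totient : ℝ) / d = ∏ p ∈ d.primeFactors, (1 - 1 / (p:ℝ)) := by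
    have := Nat.totient_eq_mul_prod_factors d
    have : (d.totient : ℝ) = d * ∏ p ∈ d.primeFactors, (1 - (p:ℝ)⁻¹) := by
      have h2 := congrArg (fun q : ℚ => (q : ℝ)) this
      simpa using h2
    rw [this]
    field_simp
  rw [e1, e2, ← Finset.prod_mul_distrib]
  refine Finset.prod_le_one ?_ ?_
  · intro p hp
    have : (1:ℝ) ≤ p := by exact_mod_cast (Nat.prime_of_mem_primeFactors hp).one_lt.le
    have : 1 / (p:ℝ) ≤ 1 := by rw [div_le_one (by linarith)]; exact this
    have h0 : 0 ≤ 1 / (p:ℝ) := by positivity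
    apply mul_nonneg <;> linarith
  · intro p hp
    nlinarith [sq_nonneg (1 / (p:ℝ))]

lemma sS_lower (d z : ℕ) (hd : 1 ≤ d) :
    (d.totient / d : ℝ) * (Real.log z / 2) ≤ sS d z := by
  have hex : ∀ n : ℕ, ∃ t : ℕ × ℕ × ℕ, 1 ≤ n → t.1 ^ 2 * (t.2.1 * t.2.2) = n ∧ t.2.1 ∣ d ∧
      Squarefree t.2.1 ∧ Squarefree t.2.2 ∧ t.2.2.Coprime d := by
    intro n
    obtain ⟨a, b, hab, ha⟩ := Nat.sq_mul_squarefree n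
    refine ⟨(b, Nat.gcd a d, a / Nat.gcd a d), fun _ => ?_⟩
    obtain ⟨c, hc⟩ := Nat.gcd_dvd_left a d
    have hg : 0 < Nat.gcd a d := Nat.gcd_pos_of_pos_right _ hd
    have hdiv : a / Nat.gcd a d = c := Nat.div_eq_of_eq_mul_right hg hc
    simp only [hdiv]
    refine ⟨by rw [← hc, hab], Nat.gcd_dvd_right _ _, ha.squarefree_of_dvd (Nat.gcd_dvd_left _ _),
      ha.squarefree_of_dvd ⟨_, by rw [mul_comm]; exact hc⟩, ?_⟩
    have h1 : (Nat.gcd a d).Coprime c := by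
      apply Nat.coprime_of_squarefree_mul; rw [← hc]; exact ha
    rw [Nat.coprime_iff_gcd_eq_one]
    have h2 : Nat.gcd c d ∣ Nat.gcd a d := Nat.gcd_dvd_gcd_of_dvd_left _ ⟨_, by rw [mul_comm]; exact hc⟩
    have h3 : Nat.gcd c d ∣ Nat.gcd (Nat.gcd a d) c := Nat.dvd_gcd h2 (Nat.gcd_dvd_left _ _)
    rw [h1] at h3
    exact Nat.dvd_one.1 h3
  choose t ht using hex
  have h1 : ∑ n ∈ Finset.Icc 1 z, (1 / (n : ℝ)) ≤
      ∑ s ∈ (Finset.Icc 1 z) ×ˢ ((d.divisors.filter Squarefree) ×ˢ sL d z),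
        (1 / (s.1 : ℝ) ^ 2) * ((1 / (s.2.1 : ℝ)) * (1 / (s.2.2 : ℝ))) := by
    have inj : Set.InjOn t (Finset.Icc 1 z) := by
      intro n hn m hm h
      simp only [Finset.coe_Icc, Set.mem_Icc] at hn hm
      rw [← (ht n hn.1).1, ← (ht m hm.1).1, h]
    calc ∑ n ∈ Finset.Icc 1 z, (1 / (n : ℝ)) = ∑ n ∈ Finset.Icc 1 z,
          (1 / ((t n).1 : ℝ) ^ 2) * ((1 / ((t n).2.1 : ℝ)) * (1 / ((t n).2.2 : ℝ))) := by
          refine Finset.sum_congr rfl fun n hn => ?_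
          have := (ht n (Finset.mem_Icc.1 hn).1).1
          conv_lhs => rw [← this]
          push_cast
          field_simp
      _ = ∑ s ∈ (Finset.Icc 1 z).image t, (1 / (s.1 : ℝ) ^ 2) * ((1 / (s.2.1 : ℝ)) * (1 / (s.2.2 : ℝ))) := by
          rw [Finset.sum_image inj]
      _ ≤ _ := by
          refine Finset.sum_le_sum_of_subset_of_nonneg ?_ (fun _ _ _ => by positivity)
          intro s hs
          obtain ⟨n, hn, rfl⟩ := Finset.mem_image.1 hs
          have hn := Finset.mem_Icc.1 hn
          obtain ⟨a1, a2, a3, a4, a5⟩ := ht n hn.1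
          have hpos : 0 < (t n).1 ^ 2 * ((t n).2.1 * (t n).2.2) := by rw [a1]; omega
          have p1 : 0 < (t n).1 := by
            rcases Nat.eq_zero_or_pos (t n).1 with h | h
            · rw [h] at hpos; simp at hpos
            · exact h
          have p2 : 0 < (t n).2.2 := Nat.pos_of_ne_zero a4.ne_zero
          simp only [Finset.mem_product, Finset.mem_Icc, Finset.mem_filter, Nat.mem_divisors, mem_sL]
          refine ⟨⟨p1, ?_⟩, ⟨⟨a2, by omega⟩, a3⟩, ⟨p2, ?_⟩, a4, a5⟩
          · refine (Nat.le_of_dvd (by omega) ?_).trans hn.2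
            exact (dvd_pow_self _ two_ne_zero).trans ⟨_, a1.symm⟩
          · refine (Nat.le_of_dvd (by omega) ?_).trans hn.2
            exact ((dvd_mul_left _ _).trans (dvd_mul_left _ _)).trans (dvd_of_eq a1)
  simp only [Finset.sum_product, ← Finset.mul_sum, ← Finset.sum_mul] at h1
  rw [← sS] at h1
  have h2 := sum_inv_sq_le_two z
  have h3 := sum_sqfree_div d hd
  have h4 := log_le_sum_inv z
  have hS : 0 ≤ sS d z := Finset.sum_nonneg fun _ _ => by positivity
  set G := ∑ g ∈ d.divisors.filter Squarefree, (1 / (g : ℝ))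
  have hG : 0 ≤ G := Finset.sum_nonneg fun _ _ => by positivity
  have hphi : (0:ℝ) ≤ d.totient / d := by positivity
  have h5 : Real.log z ≤ 2 * (G * sS d z) := h4.trans (h1.trans (by gcongr))
  calc (d.totient / d : ℝ) * (Real.log z / 2) ≤ (d.totient / d : ℝ) * (G * sS d z) := by
        gcongr; linarith
    _ = (G * (d.totient / d : ℝ)) * sS d z := by ring
    _ ≤ 1 * sS d z := by gcongr
    _ = _ := one_mul _

end ICM

namespace ICM

lemma existsUnique_ap {E d : ℕ} (hE : 0 < E) (h : E.Coprime d) :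
    ∃ m₀, m₀ < E ∧ ∀ m, m < E → (E ∣ 1 + d * m ↔ m = m₀) := by
  have : NeZero E := ⟨hE.ne'⟩
  let u := ZMod.unitOfCoprime d h.symm
  refine ⟨(-(u⁻¹ : (ZMod E)ˣ) : ZMod E).val, ZMod.val_lt _, fun m hm => ?_⟩
  have key : E ∣ 1 + d * m ↔ ((1 + d * m : ℕ) : ZMod E) = 0 := (ZMod.natCast_eq_zero_iff _ _).symm
  rw [key]
  have hu : (d : ZMod E) = (u : ZMod E) := rfl
  push_cast
  rw [hu]
  constructor
  · intro h0
    have h1 : (m : ZMod E) = -(u⁻¹ : (ZMod E)ˣ) := by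
      have h2 : (u⁻¹ : (ZMod E)ˣ) * (1 + (u : ZMod E) * m) = 0 := by rw [h0, mul_zero]
      rw [mul_add, mul_one, ← mul_assoc, Units.inv_mul, one_mul] at h2
      exact (neg_eq_of_add_eq_zero_right h2).symm
    rw [← h1, ZMod.val_natCast, Nat.mod_eq_of_lt hm]
  · rintro rfl
    simp

lemma ap_log_sum {E d : ℕ} (hE : 0 < E) (h : E.Coprime d) (a b : ℕ) :
    |∑ m ∈ Finset.Ioc a b, (1 / (m : ℝ)) * (if E ∣ 1 + d * m then 1 else 0) -
      (1 / E) * ∑ m ∈ Finset.Ioc a b, (1 / (m : ℝ))| ≤ E / (a + 1) := by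
  have hE1 : (1:ℝ) ≤ E := by exact_mod_cast hE
  have := PL (fun m => 1 / (m : ℝ)) (fun m => (if E ∣ 1 + d * m then (1:ℝ) else 0) - 1 / E) E hE
    (by
      intro n
      have : E ∣ 1 + d * (n + E) ↔ E ∣ 1 + d * n := by
        rw [mul_add, ← add_assoc]
        exact Nat.dvd_add_left (Dvd.intro_left _ rfl)
      simp only [this])
    (by
      obtain ⟨m₀, h1, h2⟩ := existsUnique_ap hE h
      rw [Finset.sum_sub_distrib]
      have : ∀ m ∈ Finset.range E, (if E ∣ 1 + d * m then (1:ℝ) else 0) = if m = m₀ then 1 else 0 := by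
        intro m hm
        have := h2 m (Finset.mem_range.1 hm)
        simp only [this]
      rw [Finset.sum_congr rfl this, Finset.sum_ite_eq', if_pos (Finset.mem_range.2 h1)]
      simp only [Finset.sum_const, Finset.card_range, nsmul_eq_mul]
      field_simp; norm_num) 1
    (by
      intro n
      have h3 : 1 / (E:ℝ) ≤ 1 := by rw [div_le_one (by linarith)]; exact hE1
      have h4 : 0 ≤ 1 / (E:ℝ) := by positivity
      rw [Real.norm_eq_abs, abs_le]
      split_ifs <;> constructor <;> linarith)
    a b
    (by
      intro m hm
      have : (0:ℝ) < m := by exact_mod_cast (by omega : 0 < m)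
      apply one_div_le_one_div_of_le this; push_cast; linarith)
    (by intro m _; positivity)
  rw [Real.norm_eq_abs] at this
  refine le_trans (le_of_eq ?_) (this.trans (le_of_eq ?_))
  · congr 1
    rw [Finset.mul_sum, ← Finset.sum_sub_distrib]
    refine Finset.sum_congr rfl fun m _ => ?_
    simp only [smul_eq_mul]; ring
  · push_cast; field_simp

lemma sieve_scale (d z : ℕ) (hd : 1 ≤ d) (hz : 2 ≤ z) :
    ∑ m ∈ Finset.Ioc (z ^ 8) ((z ^ 8) ^ 2), (if (1 + d * m).Prime then 1 / (m : ℝ) else 0)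
      ≤ 17 * d / d.totient := by
  set M := z ^ 8 with hM
  have hz1 : 1 ≤ z := by omega
  have hzR : (2:ℝ) ≤ z := by exact_mod_cast hz
  have hMz : z ≤ M := by rw [hM]; exact Nat.le_self_pow (by norm_num) z
  set H := ∑ m ∈ Finset.Ioc M (M ^ 2), (1 / (m : ℝ)) with hH
  have hH0 : 0 ≤ H := Finset.sum_nonneg fun _ _ => by positivity
  have s1 : ∀ m ∈ Finset.Ioc M (M ^ 2), (if (1 + d * m).Prime then 1 / (m : ℝ) else 0) ≤
      ∑ e ∈ sL d z, ∑ e' ∈ sL d z, (sLam d z e * sLam d z e') *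
        ((1 / (m : ℝ)) * (if Nat.lcm e e' ∣ 1 + d * m then 1 else 0)) := by
    intro m hm
    have hm := Finset.mem_Ioc.1 hm
    have e1 : ∑ e ∈ sL d z, ∑ e' ∈ sL d z, (sLam d z e * sLam d z e') *
        ((1 / (m : ℝ)) * (if Nat.lcm e e' ∣ 1 + d * m then 1 else 0)) =
        (1 / (m:ℝ)) * (∑ e ∈ sL d z, if e ∣ 1 + d * m then sLam d z e else 0) ^ 2 := by
      rw [sq, Finset.sum_mul_sum, Finset.mul_sum]
      refine Finset.sum_congr rfl fun e _ => ?_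
      rw [Finset.mul_sum]
      refine Finset.sum_congr rfl fun e' _ => ?_
      by_cases a : e ∣ 1 + d * m <;> by_cases b : e' ∣ 1 + d * m <;>
        simp [Nat.lcm_dvd_iff, a, b]
      ring
    rw [e1]
    split_ifs with hp
    · have : (∑ e ∈ sL d z, if e ∣ 1 + d * m then sLam d z e else 0) = 1 := by
        rw [Finset.sum_eq_single 1]
        · simp [sLam_one hz1]
        · intro e he hne
          rw [if_neg]
          intro hdvd
          rcases (Nat.dvd_prime hp).1 hdvd with h | h
          · exact hne h
          · have := (mem_sL.1 he).1.2
            nlinarith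
        · intro h; exact absurd (one_mem_sL hz1) h
      rw [this]; simp
    · positivity
  refine (Finset.sum_le_sum s1).trans ?_
  rw [Finset.sum_comm]
  have s2 : ∀ e ∈ sL d z, ∑ m ∈ Finset.Ioc M (M ^ 2), ∑ e' ∈ sL d z, (sLam d z e * sLam d z e') *
        ((1 / (m : ℝ)) * (if Nat.lcm e e' ∣ 1 + d * m then 1 else 0)) ≤
      ∑ e' ∈ sL d z, (H * (sLam d z e * sLam d z e' / (Nat.lcm e e' : ℝ)) + (z:ℝ)^4 / M) := by
    intro e he
    rw [Finset.sum_comm]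
    refine Finset.sum_le_sum fun e' he' => ?_
    rw [← Finset.mul_sum]
    have he1 := mem_sL.1 he
    have he1' := mem_sL.1 he'
    have hlpos : 0 < Nat.lcm e e' := Nat.lcm_pos he1.1.1 he1'.1.1
    have hlc : (Nat.lcm e e').Coprime d :=
      Nat.Coprime.coprime_dvd_left (Nat.lcm_dvd_mul e e') (he1.2.2.mul_left he1'.2.2)
    have h1 := ap_log_sum hlpos hlc M (M ^ 2)
    have hlz : ((Nat.lcm e e' : ℕ) : ℝ) ≤ z ^ 2 := by
      have : Nat.lcm e e' ≤ z ^ 2 := by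
        refine (Nat.le_of_dvd (Nat.mul_pos he1.1.1 he1'.1.1) (Nat.lcm_dvd_mul e e')).trans ?_
        rw [sq]; exact Nat.mul_le_mul he1.1.2 he1'.1.2
      exact_mod_cast this
    set T := ∑ m ∈ Finset.Ioc M (M ^ 2), (1 / (m : ℝ)) * (if Nat.lcm e e' ∣ 1 + d * m then 1 else 0)
    have hla : |sLam d z e * sLam d z e'| ≤ z ^ 2 := by
      rw [abs_mul, sq]
      have a1 : (e:ℝ) ≤ z := by exact_mod_cast he1.1.2
      have a2 : (e':ℝ) ≤ z := by exact_mod_cast he1'.1.2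
      exact mul_le_mul ((abs_sLam_le hz1).trans a1) ((abs_sLam_le hz1).trans a2) (abs_nonneg _) (by positivity)
    have hM0 : (0:ℝ) < M := by positivity
    have h2 : |T - 1 / (Nat.lcm e e' : ℕ) * H| ≤ z ^ 2 / M := by
      refine h1.trans ?_
      gcongr; linarith
    have h3 : |(sLam d z e * sLam d z e') * (T - 1 / (Nat.lcm e e' : ℕ) * H)| ≤ z^2 * (z ^ 2 / M) := by
      rw [abs_mul]; gcongr
    have h4 := (abs_le.1 h3).2
    have h5 : (z:ℝ)^2 * (z ^ 2 / M) = z ^ 4 / M := by ring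
    rw [h5] at h4
    calc _ = H * (sLam d z e * sLam d z e' / (Nat.lcm e e' : ℝ)) + (sLam d z e * sLam d z e') * (T - 1 / (Nat.lcm e e' : ℕ) * H) := by ring
      _ ≤ _ := by linarith
  refine (Finset.sum_le_sum s2).trans ?_
  simp only [Finset.sum_add_distrib, ← Finset.mul_sum, Finset.sum_const, nsmul_eq_mul]
  have hcard : ((sL d z).card : ℝ) ≤ z := by
    have : (sL d z).card ≤ z := by
      refine (Finset.card_filter_le _ _).trans ?_
      simp
    exact_mod_cast this
  have hS := sS_pos (d := d) hz1
  have hQ := sQ_le (d := d) hz1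
  have hSl := sS_lower d z hd
  have hMR : (M:ℝ) = z ^ 8 := by rw [hM]; push_cast; rfl
  have hHle : H ≤ 8 * Real.log z := by
    have := sum_inv_Ioc_le_log (a := M) (b := M ^ 2) (by positivity) (Nat.le_self_pow (by norm_num) M)
    refine this.trans ?_
    push_cast
    rw [hMR, Real.log_pow, Real.log_pow]; push_cast; linarith
  have hlog : 0 < Real.log z := Real.log_pos (by linarith)
  have hphi : (0:ℝ) < d.totient := by exact_mod_cast Nat.totient_pos.2 hd
  have hd0 : (0:ℝ) < d := by exact_mod_cast hd
  have hphile : (d.totient : ℝ) ≤ d := by exact_mod_cast Nat.totient_le d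
  have h6 : H * (∑ e ∈ sL d z, ∑ e' ∈ sL d z, sLam d z e * sLam d z e' / (Nat.lcm e e' : ℝ))
      ≤ 16 * d / d.totient := by
    calc _ ≤ (8 * Real.log z) * (1 / sS d z) := by
          refine (mul_le_mul_of_nonneg_left hQ hH0).trans ?_
          gcongr
      _ ≤ (8 * Real.log z) * (1 / ((d.totient / d : ℝ) * (Real.log z / 2))) := by
          gcongr
      _ = _ := by field_simp; norm_num
  have h7 : ((sL d z).card : ℝ) * (((sL d z).card : ℝ) * ((z:ℝ)^4 / M)) ≤ d / d.totient := by
    calc _ ≤ (z:ℝ) * (z * (z ^ 4 / M)) := by gcongr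
      _ = 1 / z ^ 2 := by rw [hMR]; field_simp
      _ ≤ 1 := by rw [div_le_one (by positivity)]; nlinarith
      _ ≤ _ := by rw [le_div_iff₀ hphi]; linarith
  refine (add_le_add h6 h7).trans (le_of_eq ?_)
  ring

lemma sieve_all (d : ℕ) (hd : 1 ≤ d) (J : ℕ) :
    ∑ m ∈ Finset.Ioc 0 ((2 ^ (2 ^ J)) ^ 8), (if (1 + d * m).Prime then 1 / (m : ℝ) else 0)
      ≤ (256 + 17 * J) * d / d.totient := by
  have hphi : (0:ℝ) < d.totient := by exact_mod_cast Nat.totient_pos.2 hd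
  have hphile : (d.totient : ℝ) ≤ d := by exact_mod_cast Nat.totient_le d
  induction J with
  | zero =>
    calc _ ≤ ∑ m ∈ Finset.Ioc 0 256, (1:ℝ) := by
          norm_num only
          refine Finset.sum_le_sum fun m hm => ?_
          have hm := (Finset.mem_Ioc.1 hm).1
          have : (1:ℝ) ≤ m := by exact_mod_cast hm
          split_ifs
          · rw [div_le_one (by linarith)]; exact this
          · norm_num
      _ = 256 := by simp
      _ ≤ _ := by rw [le_div_iff₀ hphi]; push_cast; nlinarith
  | succ J ih =>
    have e : (2 ^ (2 ^ (J + 1))) ^ 8 = ((2 ^ (2 ^ J)) ^ 8) ^ 2 := by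
      rw [pow_succ 2 J, pow_mul]; ring
    rw [e, ← Finset.sum_Ioc_consecutive _ (Nat.zero_le ((2 ^ (2 ^ J)) ^ 8)) (Nat.le_self_pow (by norm_num) _)]
    have := sieve_scale d (2 ^ (2 ^ J)) hd (Nat.le_self_pow (by positivity) 2)
    calc _ ≤ (256 + 17 * (J:ℝ)) * d / d.totient + 17 * d / d.totient := add_le_add ih this
      _ = _ := by push_cast; ring

/-- Brun–Titchmarsh type bound. -/
theorem T1 : ∃ C : ℝ, 0 < C ∧ ∀ d x : ℕ, 1 ≤ d → 16 ≤ x →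
    ∑ p ∈ (Pr x).filter (fun p => d ∣ p - 1), (1 / (p : ℝ)) ≤ C * Real.log (Real.log x) / d.totient := by
  refine ⟨400, by norm_num, fun d x hd hx => ?_⟩
  have hx' : (16:ℝ) ≤ x := by exact_mod_cast hx
  have hlog2 := Real.log_two_gt_d9
  have hlx : 2.77 ≤ Real.log x := by
    have : Real.log 16 ≤ Real.log x := Real.log_le_log (by norm_num) hx'
    have h16 : Real.log 16 = 4 * Real.log 2 := by
      rw [show (16:ℝ) = 2 ^ 4 by norm_num, Real.log_pow]; norm_num
    linarith
  have hy : 1 ≤ Real.log (Real.log x) := by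
    rw [Real.le_log_iff_exp_le (by linarith)]
    have := Real.exp_one_lt_d9
    linarith
  set y := Real.log (Real.log x) with hyd
  set J := ⌈2 * y⌉₊ with hJ
  have hJ1 : 2 * y ≤ J := Nat.le_ceil _
  have hJ2 : (J:ℝ) < 2 * y + 1 := Nat.ceil_lt_add_one (by linarith)
  have hxJ : x ≤ (2 ^ (2 ^ J)) ^ 8 := by
    have h1 : Real.log x ≤ (2:ℝ) ^ J := by
      rw [← Real.exp_log (show 0 < Real.log x by linarith), ← hyd]
      have : (2:ℝ) ^ J = Real.exp (J * Real.log 2) := by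
        rw [mul_comm, Real.exp_mul, Real.exp_log (by norm_num), Real.rpow_natCast]
      rw [this]
      apply Real.exp_le_exp.2
      nlinarith
    have h2 : (x:ℝ) ≤ ((2 ^ (2 ^ J)) ^ 8 : ℕ) := by
      push_cast
      rw [← Real.log_le_log_iff (by linarith) (by positivity), Real.log_pow, Real.log_pow]
      push_cast
      have : (0:ℝ) < 2 ^ J := by positivity
      nlinarith
    exact_mod_cast h2
  have hd0 : (0:ℝ) < d := by exact_mod_cast hd
  have hphi : (0:ℝ) < d.totient := by exact_mod_cast Nat.totient_pos.2 hd
  have step : ∑ p ∈ (Pr x).filter (fun p => d ∣ p - 1), (1 / (p : ℝ)) ≤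
      (1 / d) * ∑ m ∈ Finset.Ioc 0 ((2 ^ (2 ^ J)) ^ 8), (if (1 + d * m).Prime then 1 / (m : ℝ) else 0) := by
    have hinj : Set.InjOn (fun p => (p - 1) / d) ((Pr x).filter (fun p => d ∣ p - 1) : Finset ℕ) := by
      intro p hp q hq h
      simp only [Finset.coe_filter, Set.mem_ofPred_eq, mem_Pr] at hp hq
      obtain ⟨a, ha⟩ := hp.2
      obtain ⟨b, hb⟩ := hq.2
      simp only [ha, hb, Nat.mul_div_cancel_left _ hd] at h
      have := hp.1.2.two_le; have := hq.1.2.two_le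
      subst h; omega
    calc _ ≤ ∑ p ∈ (Pr x).filter (fun p => d ∣ p - 1), (1 / d : ℝ) * (fun m : ℕ =>
            (if (1 + d * m).Prime then 1 / (m : ℝ) else 0)) ((p - 1) / d) := by
          refine Finset.sum_le_sum fun p hp => ?_
          obtain ⟨hp1, a, ha⟩ := Finset.mem_filter.1 hp
          have hp1 := mem_Pr.1 hp1
          have := hp1.2.two_le
          have hpa : 1 + d * a = p := by omega
          have ha0 : 0 < a := by rcases Nat.eq_zero_or_pos a with h | h; · subst h; omega
                                 · exact h
          have ha0' : (0:ℝ) < a := by exact_mod_cast ha0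
          simp only [ha, Nat.mul_div_cancel_left _ hd, hpa, hp1.2, if_true]
          rw [← hpa]; push_cast
          rw [div_mul_div_comm, one_mul]
          apply one_div_le_one_div_of_le (by positivity); linarith
      _ = (1 / d : ℝ) * ∑ m ∈ ((Pr x).filter (fun p => d ∣ p - 1)).image (fun p => (p - 1) / d),
            (if (1 + d * m).Prime then 1 / (m : ℝ) else 0) := by
          rw [← Finset.mul_sum, Finset.sum_image hinj]
      _ ≤ _ := by
          refine mul_le_mul_of_nonneg_left (Finset.sum_le_sum_of_subset_of_nonneg ?_
            (fun m _ _ => by split_ifs <;> positivity)) (by positivity)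
          intro m hm
          obtain ⟨p, hp, rfl⟩ := Finset.mem_image.1 hm
          obtain ⟨hp1, a, ha⟩ := Finset.mem_filter.1 hp
          have hp1 := mem_Pr.1 hp1
          have := hp1.2.two_le
          have ha0 : 0 < a := by rcases Nat.eq_zero_or_pos a with h | h; · subst h; omega
                                 · exact h
          simp only [ha, Nat.mul_div_cancel_left _ hd, Finset.mem_Ioc]
          refine ⟨ha0, ?_⟩
          have : a ≤ d * a := Nat.le_mul_of_pos_left _ hd
          omega
  refine step.trans ?_
  have h3 := sieve_all d hd J
  calc _ ≤ (1 / d) * ((256 + 17 * J) * d / d.totient : ℝ) := by gcongr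
    _ = (256 + 17 * J) / d.totient := by field_simp
    _ ≤ _ := by gcongr; linarith

end ICM

namespace ICM

open scoped ArithmeticFunction.vonMangoldt

/-- iterated logarithm -/
noncomputable def LL (x : ℕ) : ℝ := Real.log (Real.log x)

lemma sum_antidiag {E : Type*} [AddCommMonoid E] (F : ℕ → ℕ → E) (N : ℕ) :
    ∑ n ∈ Finset.Ioc 0 N, ∑ x ∈ n.divisorsAntidiagonal, F x.1 x.2 =
      ∑ a ∈ Finset.Ioc 0 N, ∑ b ∈ Finset.Ioc 0 (N / a), F a b := by
  rw [Finset.sum_sigma', Finset.sum_sigma']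
  refine Finset.sum_nbij' (fun s => ⟨s.2.1, s.2.2⟩) (fun t => ⟨t.1 * t.2, (t.1, t.2)⟩) ?_ ?_ ?_ ?_ ?_
  · rintro ⟨n, a, b⟩ h
    simp only [Finset.mem_sigma, Finset.mem_Ioc, Nat.mem_divisorsAntidiagonal] at h ⊢
    obtain ⟨⟨h1, h2⟩, h3, h4⟩ := h
    subst h3
    have ha : 0 < a := by
      rcases Nat.eq_zero_or_pos a with h | h
      · subst h; simp at h1
      · exact h
    have hb : 0 < b := by
      rcases Nat.eq_zero_or_pos b with h | h
      · subst h; simp at h1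
      · exact h
    refine ⟨⟨ha, (Nat.le_mul_of_pos_right a hb).trans h2⟩, hb, ?_⟩
    rw [Nat.le_div_iff_mul_le ha, mul_comm]; exact h2
  · rintro ⟨a, b⟩ h
    simp only [Finset.mem_sigma, Finset.mem_Ioc, Nat.mem_divisorsAntidiagonal] at h ⊢
    obtain ⟨⟨h1, h2⟩, h3, h4⟩ := h
    rw [Nat.le_div_iff_mul_le h1, mul_comm] at h4
    exact ⟨⟨Nat.mul_pos h1 h3, h4⟩, by simp, (Nat.mul_pos h1 h3).ne'⟩
  · rintro ⟨n, a, b⟩ h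
    simp only [Finset.mem_sigma, Finset.mem_Ioc, Nat.mem_divisorsAntidiagonal] at h
    obtain ⟨⟨h1, h2⟩, h3, h4⟩ := h
    subst h3; rfl
  · rintro ⟨a, b⟩ h; rfl
  · rintro ⟨n, a, b⟩ h; rfl

lemma sum_log_eq (N : ℕ) : ∑ n ∈ Finset.Ioc 0 N, Real.log n = ∑ d ∈ Finset.Ioc 0 N, Λ d * (N / d : ℕ) := by
  have h := sum_antidiag (fun a _ => Λ a) N
  simp only [Finset.sum_const, Nat.card_Ioc, Nat.sub_zero, nsmul_eq_mul] at h
  rw [Finset.sum_congr rfl (fun d _ => mul_comm _ _), ← h]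
  refine Finset.sum_congr rfl fun n _ => ?_
  rw [← ArithmeticFunction.vonMangoldt_sum, Nat.sum_divisorsAntidiagonal (fun i _ => Λ i)]

lemma sum_log_lower (N : ℕ) (hN : 1 ≤ N) : N * Real.log N - N ≤ ∑ n ∈ Finset.Ioc 0 N, Real.log n := by
  induction N, hN using Nat.le_induction with
  | base => simp
  | succ N hN ih =>
    rw [Finset.sum_Ioc_succ_top (by omega)]
    have hN0 : (0:ℝ) < N := by exact_mod_cast hN
    have h : Real.log ((N + 1 : ℕ) : ℝ) - Real.log N ≤ 1 / N := by
      rw [← Real.log_div (by positivity) (by positivity)]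
      refine (Real.log_le_sub_one_of_pos (by positivity)).trans (le_of_eq ?_)
      push_cast; field_simp; ring
    have h2 : N * (Real.log ((N + 1 : ℕ) : ℝ) - Real.log N) ≤ 1 := by
      calc _ ≤ (N:ℝ) * (1 / N) := by gcongr
        _ = 1 := by field_simp
    push_cast at *
    nlinarith

lemma sum_log_upper (N : ℕ) : ∑ n ∈ Finset.Ioc 0 N, Real.log n ≤ N * Real.log N := by
  calc _ ≤ ∑ n ∈ Finset.Ioc 0 N, Real.log N := by
        refine Finset.sum_le_sum fun n hn => ?_
        have hn := Finset.mem_Ioc.1 hn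
        apply Real.log_le_log
        · exact_mod_cast hn.1
        · exact_mod_cast hn.2
    _ = _ := by simp

lemma psi_bound : ∃ C : ℝ, 0 < C ∧ ∀ N : ℕ, ∑ n ∈ Finset.Ioc 0 N, Λ n ≤ C * N := by
  refine ⟨Real.log 4 + 4, by positivity, fun N => ?_⟩
  have := Chebyshev.psi_le_const_mul_self (x := (N:ℝ)) (by positivity)
  simpa [Chebyshev.psi] using this

lemma mertens1 : ∃ C : ℝ, 0 < C ∧ ∀ t : ℕ, 1 ≤ t →
    |∑ n ∈ Finset.Ioc 0 t, Λ n / n - Real.log t| ≤ C := by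
  obtain ⟨C, hC, h⟩ := psi_bound
  refine ⟨C + 1, by positivity, fun t ht => ?_⟩
  have ht0 : (0:ℝ) < t := by exact_mod_cast ht
  have h1 := sum_log_lower t ht
  have h2 := sum_log_upper t
  rw [sum_log_eq] at h1 h2
  have h3 : ∑ d ∈ Finset.Ioc 0 t, Λ d * (t / d : ℕ) ≤ t * ∑ n ∈ Finset.Ioc 0 t, Λ n / n := by
    rw [Finset.mul_sum]
    refine Finset.sum_le_sum fun d hd => ?_
    have : ((t / d : ℕ) : ℝ) ≤ t / d := Nat.cast_div_le
    calc _ ≤ Λ d * (t / d : ℝ) := by gcongr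
      _ = _ := by ring
  have h4 : t * ∑ n ∈ Finset.Ioc 0 t, Λ n / n ≤ ∑ d ∈ Finset.Ioc 0 t, Λ d * (t / d : ℕ) + C * t := by
    refine le_trans ?_ (add_le_add_right (h t) _)
    rw [← Finset.sum_add_distrib, Finset.mul_sum]
    refine Finset.sum_le_sum fun d hd => ?_
    have : (t / d : ℝ) ≤ ((t / d : ℕ) : ℝ) + 1 := by
      have := Nat.lt_floor_add_one ((t:ℝ) / d)
      rw [Nat.floor_div_natCast, Nat.floor_natCast] at this
      exact this.le
    calc _ = Λ d * (t / d : ℝ) := by ring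
      _ ≤ Λ d * (((t / d : ℕ) : ℝ) + 1) := by gcongr
      _ = _ := by ring
  set S := ∑ n ∈ Finset.Ioc 0 t, Λ n / n
  rw [abs_le]
  constructor
  · have : t * (-(C+1)) ≤ t * (S - Real.log t) := by nlinarith
    exact le_of_mul_le_mul_left this ht0
  · have : t * (S - Real.log t) ≤ t * (C + 1) := by nlinarith
    exact le_of_mul_le_mul_left this ht0

lemma tail_sqrt (a : ℕ → ℝ) (C : ℝ) (ha : ∀ n, 0 ≤ a n)
    (hA : ∀ N : ℕ, ∑ n ∈ Finset.Ioc 0 N, a n ≤ C * Real.sqrt N) (N₀ N : ℕ) (h0 : 1 ≤ N₀) :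
    ∑ n ∈ Finset.Ioc N₀ N, a n / n ≤ 2 * C / Real.sqrt N₀ := by
  have hC : 0 ≤ C := by
    have := hA 1
    have h2 : 0 ≤ ∑ n ∈ Finset.Ioc 0 1, a n := Finset.sum_nonneg fun _ _ => ha _
    simp at this h2; linarith
  rcases lt_or_ge N N₀ with hlt | hle
  · rw [Finset.Ioc_eq_empty (by omega)]; simp; positivity
  have key : ∑ n ∈ Finset.Ioc N₀ N, a n / n - (∑ n ∈ Finset.Ioc 0 N, a n) / N ≤
      2 * C * (1 / Real.sqrt N₀ - 1 / Real.sqrt N) := by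
    induction N, hle using Nat.le_induction with
    | base =>
      simp
      have h2 : 0 ≤ ∑ n ∈ Finset.Ioc 0 N₀, a n := Finset.sum_nonneg fun _ _ => ha _
      positivity
    | succ N hN ih =>
      rw [Finset.sum_Ioc_succ_top (by omega), Finset.sum_Ioc_succ_top (by omega)]
      have hN0 : (0:ℝ) < N := by exact_mod_cast (by omega : 0 < N)
      set A := ∑ n ∈ Finset.Ioc 0 N, a n
      have e : ∑ n ∈ Finset.Ioc N₀ N, a n / n + a (N+1) / (N+1 : ℕ) - (A + a (N+1)) / (N+1:ℕ)
          = (∑ n ∈ Finset.Ioc N₀ N, a n / n - A / N) + A / (N * (N+1)) := by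
        push_cast; field_simp; ring
      rw [e]
      have h1 : A / (N * (N+1)) ≤ C * Real.sqrt N / (N * (N+1)) := by gcongr; exact hA N
      set s := Real.sqrt N with hs
      set r := Real.sqrt ((N + 1 : ℕ) : ℝ) with hr
      have hs0 : 0 < s := Real.sqrt_pos.2 hN0
      have hr0 : 0 < r := Real.sqrt_pos.2 (by positivity)
      have hs2 : s ^ 2 = N := Real.sq_sqrt hN0.le
      have hr2 : r ^ 2 = N + 1 := by rw [hr, Real.sq_sqrt (by positivity)]; push_cast; rfl
      have hsr : s ≤ r := Real.sqrt_le_sqrt (by push_cast; linarith)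
      have h2 : C * s / (N * (N+1)) ≤ 2 * C * (1 / s - 1 / r) := by
        rw [← hs2]
        rw [show s ^ 2 + 1 = r ^ 2 by rw [hr2, hs2]]
        have h3 : 1 / s - 1 / r = 1 / (s * r * (r + s)) := by
          field_simp
          nlinarith
        rw [h3]
        calc C * s / (s ^ 2 * r ^ 2) = 2 * C * (1 / (s * r * (r + r))) := by field_simp; norm_num
          _ ≤ _ := by gcongr
      have ih := ih
      calc _ ≤ 2 * C * (1 / Real.sqrt N₀ - 1 / s) + 2 * C * (1 / s - 1 / r) := by linarith
        _ = _ := by ring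
  have hN0 : (0:ℝ) < N := by exact_mod_cast (by omega : 0 < N)
  have h1 : (∑ n ∈ Finset.Ioc 0 N, a n) / N ≤ C / Real.sqrt N := by
    calc _ ≤ C * Real.sqrt N / N := by gcongr; exact hA N
      _ = C * Real.sqrt N / (Real.sqrt N * Real.sqrt N) := by rw [Real.mul_self_sqrt hN0.le]
      _ = _ := by have : 0 < Real.sqrt N := Real.sqrt_pos.2 hN0
                  field_simp
  have h2 : 0 ≤ C / Real.sqrt N := by positivity
  calc _ ≤ 2 * C * (1 / Real.sqrt N₀ - 1 / Real.sqrt N) + C / Real.sqrt N := by linarith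
    _ = 2 * C / Real.sqrt N₀ - C / Real.sqrt N := by ring
    _ ≤ _ := by linarith

lemma tail_sq (a : ℕ → ℝ) (C : ℝ) (ha : ∀ n, 0 ≤ a n)
    (hA : ∀ N : ℕ, ∑ n ∈ Finset.Ioc 0 N, a n ≤ C * N) (N₀ N : ℕ) (h0 : 1 ≤ N₀) :
    ∑ n ∈ Finset.Ioc N₀ N, a n / (n:ℝ) ^ 2 ≤ 2 * C / N₀ := by
  have hC : 0 ≤ C := by
    have := hA 1
    have h2 : 0 ≤ ∑ n ∈ Finset.Ioc 0 1, a n := Finset.sum_nonneg fun _ _ => ha _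
    simp at this h2; linarith
  rcases lt_or_ge N N₀ with hlt | hle
  · rw [Finset.Ioc_eq_empty (by omega)]; simp; positivity
  have key : ∑ n ∈ Finset.Ioc N₀ N, a n / (n:ℝ) ^ 2 - (∑ n ∈ Finset.Ioc 0 N, a n) / (N:ℝ) ^ 2 ≤
      2 * C * (1 / N₀ - 1 / N) := by
    induction N, hle using Nat.le_induction with
    | base =>
      simp
      have h2 : 0 ≤ ∑ n ∈ Finset.Ioc 0 N₀, a n := Finset.sum_nonneg fun _ _ => ha _
      positivity
    | succ N hN ih =>
      rw [Finset.sum_Ioc_succ_top (by omega), Finset.sum_Ioc_succ_top (by omega)]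
      have hN0 : (0:ℝ) < N := by exact_mod_cast (by omega : 0 < N)
      set A := ∑ n ∈ Finset.Ioc 0 N, a n
      have e : ∑ n ∈ Finset.Ioc N₀ N, a n / (n:ℝ) ^ 2 + a (N+1) / ((N+1 : ℕ) : ℝ) ^ 2 - (A + a (N+1)) / ((N+1:ℕ) : ℝ) ^ 2
          = (∑ n ∈ Finset.Ioc N₀ N, a n / (n:ℝ) ^ 2 - A / (N:ℝ) ^ 2) + A * (1 / (N:ℝ) ^ 2 - 1 / ((N+1:ℕ) : ℝ) ^ 2) := by
        ring
      rw [e]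
      have h3 : 1 / (N:ℝ) ^ 2 - 1 / ((N+1:ℕ) : ℝ) ^ 2 = (2 * N + 1) / (N ^ 2 * (N+1) ^ 2) := by
        push_cast; field_simp; ring
      have h1 : A * (1 / (N:ℝ) ^ 2 - 1 / ((N+1:ℕ) : ℝ) ^ 2) ≤ 2 * C * (1 / N - 1 / (N + 1 : ℕ)) := by
        rw [h3]
        have h4 : 2 * C * (1 / (N:ℝ) - 1 / (N + 1 : ℕ)) = (C * N) * ((2 * N + 2) / (N ^ 2 * (N+1) ^ 2)) := by
          push_cast; field_simp; ring
        rw [h4]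
        gcongr
        · exact hA N
        · norm_num
      calc _ ≤ 2 * C * (1 / N₀ - 1 / N) + 2 * C * (1 / (N:ℝ) - 1 / (N + 1 : ℕ)) := by linarith
        _ = _ := by ring
  have hN0 : (0:ℝ) < N := by exact_mod_cast (by omega : 0 < N)
  have h1 : (∑ n ∈ Finset.Ioc 0 N, a n) / (N:ℝ) ^ 2 ≤ C / N := by
    calc _ ≤ C * N / (N:ℝ) ^ 2 := by gcongr; exact hA N
      _ = _ := by field_simp
  have h2 : 0 ≤ C / N := by positivity
  calc _ ≤ 2 * C * (1 / N₀ - 1 / N) + C / N := by linarith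
    _ = 2 * C / N₀ - C / N := by ring
    _ ≤ _ := by linarith

end ICM

namespace ICM
open scoped ArithmeticFunction.vonMangoldt

lemma sum_Pr (x : ℕ) (f : ℕ → ℝ) :
    ∑ p ∈ Pr x, f p = ∑ n ∈ Finset.Ioc 0 x, if n.Prime then f n else 0 := by
  rw [← Finset.sum_filter]
  refine Finset.sum_congr ?_ (fun _ _ => rfl)
  ext p
  simp only [mem_Pr, Finset.mem_filter, Finset.mem_Ioc]
  constructor
  · rintro ⟨a, b⟩; exact ⟨⟨b.pos, a⟩, b⟩
  · rintro ⟨⟨_, a⟩, b⟩; exact ⟨a, b⟩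

/-- the non-prime part of the von Mangoldt function -/
noncomputable def np (n : ℕ) : ℝ := if n.Prime then 0 else Λ n
/-- the prime part of the von Mangoldt function -/
noncomputable def lp (n : ℕ) : ℝ := if n.Prime then Real.log n else 0

lemma np_nonneg (n : ℕ) : 0 ≤ np n := by unfold np; split_ifs <;> simp

lemma lp_nonneg (n : ℕ) : 0 ≤ lp n := by
  unfold lp; split_ifs with h
  · exact Real.log_natCast_nonneg n
  · rfl

lemma lp_add_np (n : ℕ) : lp n + np n = Λ n := by
  unfold np lp; split_ifs with h
  · rw [ArithmeticFunction.vonMangoldt_apply_prime h, add_zero]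
  · rw [zero_add]

lemma theta_bound : ∃ C : ℝ, 0 < C ∧ ∀ N : ℕ, ∑ n ∈ Finset.Ioc 0 N, lp n ≤ C * N := by
  obtain ⟨C, hC, h⟩ := psi_bound
  refine ⟨C, hC, fun N => (Finset.sum_le_sum fun n _ => ?_).trans (h N)⟩
  rw [← lp_add_np]; linarith [np_nonneg n]

lemma np_sum : ∃ C : ℝ, 0 < C ∧ ∀ N : ℕ, ∑ n ∈ Finset.Ioc 0 N, np n ≤ C * Real.sqrt N := by
  obtain ⟨C, hC⟩ := Chebyshev.psi_sub_theta_le_mul_sqrt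
  refine ⟨max C 1, by positivity, fun N => ?_⟩
  have h := hC N
  have e : ∑ n ∈ Finset.Ioc 0 N, np n = Chebyshev.psi N - Chebyshev.theta N := by
    rw [Chebyshev.psi, Chebyshev.theta, Nat.floor_natCast, Finset.sum_filter, ← Finset.sum_sub_distrib]
    refine Finset.sum_congr rfl fun n _ => ?_
    rw [← lp_add_np, lp]; ring
  rw [e]
  refine h.trans ?_
  gcongr; exact le_max_left _ _

lemma np_tail : ∃ C : ℝ, 0 < C ∧ ∀ N₀ N : ℕ, 1 ≤ N₀ →
    ∑ n ∈ Finset.Ioc N₀ N, np n / n ≤ C / Real.sqrt N₀ := by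
  obtain ⟨C, hC, h⟩ := np_sum
  exact ⟨2 * C, by positivity, fun N₀ N h0 => tail_sqrt np C np_nonneg h N₀ N h0⟩

lemma lp_tail_sq : ∃ C : ℝ, 0 < C ∧ ∀ N₀ N : ℕ, 1 ≤ N₀ →
    ∑ n ∈ Finset.Ioc N₀ N, lp n / (n:ℝ) ^ 2 ≤ C / N₀ := by
  obtain ⟨C, hC, h⟩ := theta_bound
  exact ⟨2 * C, by positivity, fun N₀ N h0 => tail_sq lp C lp_nonneg h N₀ N h0⟩

lemma np_total : ∃ C : ℝ, 0 < C ∧ ∀ N : ℕ, ∑ n ∈ Finset.Ioc 0 N, np n / n ≤ C := by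
  obtain ⟨C, hC, h⟩ := np_tail
  refine ⟨C, hC, fun N => ?_⟩
  rcases Nat.eq_zero_or_pos N with h0 | h0
  · subst h0; simp; exact hC.le
  · have := h 1 N le_rfl
    rw [← Finset.sum_Ioc_consecutive _ (Nat.zero_le 1) h0]
    simp [np] at this ⊢
    exact this

lemma lp_sq_total : ∃ C : ℝ, 0 < C ∧ ∀ N : ℕ, ∑ n ∈ Finset.Ioc 0 N, lp n / (n:ℝ) ^ 2 ≤ C := by
  obtain ⟨C, hC, h⟩ := lp_tail_sq
  refine ⟨C, hC, fun N => ?_⟩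
  rcases Nat.eq_zero_or_pos N with h0 | h0
  · subst h0; simp; exact hC.le
  · have := h 1 N le_rfl
    rw [← Finset.sum_Ioc_consecutive _ (Nat.zero_le 1) h0]
    simp [lp] at this ⊢
    exact this

lemma mertens_p : ∃ C : ℝ, 0 < C ∧ ∀ t : ℕ, 1 ≤ t →
    |∑ n ∈ Finset.Ioc 0 t, lp n / n - Real.log t| ≤ C := by
  obtain ⟨C, hC, h⟩ := mertens1
  obtain ⟨D, hD, h'⟩ := np_total
  refine ⟨C + D, by positivity, fun t ht => ?_⟩
  have h1 := abs_le.1 (h t ht)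
  have h2 := h' t
  have h3 : 0 ≤ ∑ n ∈ Finset.Ioc 0 t, np n / n :=
    Finset.sum_nonneg fun n _ => div_nonneg (np_nonneg n) (by positivity)
  have e : ∑ n ∈ Finset.Ioc 0 t, Λ n / n = ∑ n ∈ Finset.Ioc 0 t, lp n / n + ∑ n ∈ Finset.Ioc 0 t, np n / n := by
    rw [← Finset.sum_add_distrib]
    refine Finset.sum_congr rfl fun n _ => ?_
    rw [← lp_add_np]; ring
  rw [e] at h1
  rw [abs_le]; constructor <;> linarith [h1.1, h1.2]

lemma sum_inv_approx {t : ℕ} (ht : 1 ≤ t) : |∑ n ∈ Finset.Ioc 0 t, 1 / (n:ℝ) - Real.log t| ≤ 1 := by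
  have h1 := log_le_sum_inv t
  have h2 := sum_inv_Ioc_le_log (a := 1) one_pos ht
  have h3 : ∑ n ∈ Finset.Ioc 0 t, 1 / (n:ℝ) = 1 + ∑ n ∈ Finset.Ioc 1 t, 1 / (n:ℝ) := by
    rw [← Finset.sum_Ioc_consecutive _ (Nat.zero_le 1) ht]; simp
  rw [show Finset.Icc 1 t = Finset.Ioc 0 t from rfl] at h1
  simp at h2
  rw [abs_le]
  simp only [one_div] at *
  constructor <;> linarith

lemma mertens_interval : ∃ C : ℝ, 0 < C ∧ ∀ a b : ℕ, 1 ≤ a → a ≤ b →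
    |∑ n ∈ Finset.Ioc a b, (lp n / n - 1 / n)| ≤ C := by
  obtain ⟨C, hC, h⟩ := mertens_p
  refine ⟨2 * (C + 1), by positivity, fun a b ha hab => ?_⟩
  have h1 := abs_le.1 (h a ha)
  have h2 := abs_le.1 (h b (ha.trans hab))
  have h3 := abs_le.1 (sum_inv_approx ha)
  have h4 := abs_le.1 (sum_inv_approx (ha.trans hab))
  rw [Finset.sum_sub_distrib]
  rw [← Finset.sum_Ioc_consecutive _ (Nat.zero_le a) hab] at h2 h4
  rw [abs_le]; constructor <;> linarith [h1.1, h1.2, h2.1, h2.2, h3.1, h3.2, h4.1, h4.2]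

lemma log_pos_nat {n : ℕ} (hn : 2 ≤ n) : 0 < Real.log n := Real.log_pos (by exact_mod_cast hn)

lemma LL_succ_sub {n : ℕ} (hn : 2 ≤ n) :
    1 / (((n + 1 : ℕ) : ℝ) * Real.log (n + 1 : ℕ)) ≤ LL (n + 1) - LL n ∧
    LL (n + 1) - LL n ≤ 1 / (n * Real.log n) := by
  have h0 : (0:ℝ) < n := by exact_mod_cast (by omega : 0 < n)
  have h1 := log_pos_nat hn
  have h2 := log_pos_nat (show 2 ≤ n + 1 by omega)
  set u := Real.log n with hu
  set v := Real.log (n + 1 : ℕ) with hv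
  have e : LL (n + 1) - LL n = Real.log (v / u) := by
    rw [LL, LL, Real.log_div h2.ne' h1.ne']
  have hvu1 : v - u ≤ 1 / n := by
    rw [hu, hv, ← Real.log_div (by positivity) (by positivity)]
    refine (Real.log_le_sub_one_of_pos (by positivity)).trans (le_of_eq ?_)
    push_cast; field_simp; ring
  have hvu2 : 1 / ((n + 1 : ℕ) : ℝ) ≤ v - u := by
    rw [hu, hv, ← Real.log_div (by positivity) (by positivity)]
    refine le_trans (le_of_eq ?_) (Real.one_sub_inv_le_log_of_pos (by positivity))
    push_cast; field_simp; ring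
  rw [e]
  constructor
  · refine le_trans ?_ (Real.one_sub_inv_le_log_of_pos (by positivity))
    have : 1 - (v / u)⁻¹ = (v - u) / v := by field_simp
    rw [this]
    calc _ = (1 / ((n + 1 : ℕ) : ℝ)) / v := by field_simp
      _ ≤ _ := by gcongr
  · refine (Real.log_le_sub_one_of_pos (by positivity)).trans ?_
    have : v / u - 1 = (v - u) / u := by field_simp
    rw [this]
    calc _ ≤ (1 / n) / u := by gcongr
      _ = _ := by field_simp

lemma LL_mono {a b : ℕ} (ha : 2 ≤ a) (hab : a ≤ b) : LL a ≤ LL b := by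
  unfold LL
  have h0 : (0:ℝ) < a := by exact_mod_cast (by omega : 0 < a)
  apply Real.log_le_log (log_pos_nat ha)
  apply Real.log_le_log h0
  exact_mod_cast hab

lemma sum_inv_nlog {a b : ℕ} (ha : 2 ≤ a) (hab : a ≤ b) :
    ∑ n ∈ Finset.Ioc a b, 1 / ((n:ℝ) * Real.log n) ≤ LL b - LL a ∧
    LL b - LL a - 1 / (a * Real.log a) ≤ ∑ n ∈ Finset.Ioc a b, 1 / ((n:ℝ) * Real.log n) := by
  have h1 : ∀ b, a ≤ b → ∑ n ∈ Finset.Ioc a b, 1 / ((n:ℝ) * Real.log n) ≤ LL b - LL a ∧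
     LL b - LL a - 1 / (a * Real.log a) + 1 / (b * Real.log b) ≤ ∑ n ∈ Finset.Ioc a b, 1 / ((n:ℝ) * Real.log n) := by
    intro b hab
    induction b, hab using Nat.le_induction with
    | base => simp
    | succ b hb ih =>
      rw [Finset.sum_Ioc_succ_top (by omega)]
      have := LL_succ_sub (show 2 ≤ b by omega)
      constructor <;> linarith [ih.1, ih.2, this.1, this.2]
  refine ⟨(h1 b hab).1, le_trans ?_ (h1 b hab).2⟩
  have h0 : (0:ℝ) < b := by exact_mod_cast (by omega : 0 < b)
  have := log_pos_nat (show 2 ≤ b by omega)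
  have : 0 < 1 / (b * Real.log b) := by positivity
  linarith

/-- transfer from log-weighted to unweighted sums -/
lemma transfer (c : ℕ → ℝ) (κ G : ℝ) (a b : ℕ) (ha : 2 ≤ a) (hab : a ≤ b)
    (h : ∀ b', a ≤ b' → b' ≤ b → |∑ n ∈ Finset.Ioc a b', (c n - κ * (1 / n))| ≤ G) :
    |∑ n ∈ Finset.Ioc a b, c n / Real.log n - κ * (LL b - LL a)| ≤ (G + |κ|) / Real.log a := by
  have hG : 0 ≤ G := (abs_nonneg _).trans (h a le_rfl hab)
  have hla := log_pos_nat ha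
  have ha0 : (2:ℝ) ≤ a := by exact_mod_cast ha
  have h1 : |∑ n ∈ Finset.Ioc a b, (c n / Real.log n - κ * (1 / (n * Real.log n)))| ≤ G / Real.log a := by
    rcases hab.eq_or_lt with rfl | hlt
    · simp; positivity
    have := abel_bound (fun n : ℕ => 1 / Real.log n) (fun n => c n - κ * (1 / n)) a b G hlt
      (by
        intro m h1 _
        have := log_pos_nat (show 2 ≤ m by omega)
        apply one_div_le_one_div_of_le this
        have : (0:ℝ) < m := by exact_mod_cast (by omega : 0 < m)
        apply Real.log_le_log this; push_cast; linarith)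
      (by intro m h1 _; have := log_pos_nat (show 2 ≤ m by omega); positivity)
      (by intro b' h1 h2; exact h b' h1 h2)
    rw [Real.norm_eq_abs] at this
    calc _ = |∑ m ∈ Finset.Ioc a b, (1 / Real.log m) • (c m - κ * (1 / m))| := by
          congr 1
          refine Finset.sum_congr rfl fun n _ => ?_
          rw [smul_eq_mul, one_div_mul_eq_div, sub_div]
          congr 1
          rw [one_div, one_div, mul_inv]; ring
      _ ≤ _ := this
      _ = G / Real.log (a + 1 : ℕ) := by ring
      _ ≤ _ := by
        gcongr; linarith
  have h2 := sum_inv_nlog ha hab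
  have h3 : |κ * ∑ n ∈ Finset.Ioc a b, 1 / ((n:ℝ) * Real.log n) - κ * (LL b - LL a)| ≤ |κ| / Real.log a := by
    rw [← mul_sub, abs_mul, div_eq_mul_one_div |κ|]
    gcongr
    have h4 : 1 / (a * Real.log a) ≤ 1 / Real.log a := by
      apply one_div_le_one_div_of_le hla; nlinarith
    rw [abs_le]; constructor <;> linarith [h2.1, h2.2, show 0 < 1 / Real.log a by positivity]
  rw [Finset.sum_sub_distrib, ← Finset.mul_sum] at h1
  rw [add_div]
  calc _ = |(∑ n ∈ Finset.Ioc a b, c n / Real.log n - κ * ∑ n ∈ Finset.Ioc a b, 1 / ((n:ℝ) * Real.log n)) +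
      (κ * ∑ n ∈ Finset.Ioc a b, 1 / ((n:ℝ) * Real.log n) - κ * (LL b - LL a))| := by ring_nf
    _ ≤ _ := abs_add_le _ _
    _ ≤ _ := add_le_add h1 h3

/-- indicator of primes over n -/
noncomputable def pinv (n : ℕ) : ℝ := if n.Prime then 1 / (n:ℝ) else 0

lemma pinv_nonneg (n : ℕ) : 0 ≤ pinv n := by unfold pinv; split_ifs <;> positivity

lemma lp_div_log (n : ℕ) : (lp n / n) / Real.log n = pinv n := by
  unfold lp pinv
  split_ifs with h
  · have := log_pos_nat h.two_le
    have : (0:ℝ) < n := by exact_mod_cast h.pos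
    field_simp
  · simp

lemma mertens2 : ∃ C : ℝ, 0 < C ∧ ∀ a b : ℕ, 2 ≤ a → a ≤ b →
    |∑ n ∈ Finset.Ioc a b, pinv n - (LL b - LL a)| ≤ C / Real.log a := by
  obtain ⟨C, hC, h⟩ := mertens_interval
  refine ⟨C + 1, by positivity, fun a b ha hab => ?_⟩
  have := transfer (fun n => lp n / n) 1 C a b ha hab
    (by intro b' h1 _; simpa using h a b' (by omega) h1)
  simpa [lp_div_log] using this

lemma mertens2_total : ∃ C : ℝ, 0 < C ∧ ∀ t : ℕ, 2 ≤ t →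
    |∑ p ∈ Pr t, 1 / (p:ℝ) - LL t| ≤ C := by
  obtain ⟨C, hC, h⟩ := mertens2
  refine ⟨C / Real.log 2 + |1/2 - LL 2| + 1, by positivity, fun t ht => ?_⟩
  have h1 := h 2 t le_rfl ht
  rw [sum_Pr]
  change |∑ n ∈ Finset.Ioc 0 t, pinv n - LL t| ≤ _
  rw [← Finset.sum_Ioc_consecutive _ (Nat.zero_le 2) ht]
  have e : ∑ n ∈ Finset.Ioc 0 2, pinv n = 1 / 2 := by
    rw [show Finset.Ioc 0 2 = {1, 2} by rfl]
    rw [Finset.sum_pair (by norm_num)]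
    simp [pinv, Nat.prime_two, Nat.not_prime_one]
  rw [e]
  have e2 : 1 / 2 + ∑ i ∈ Finset.Ioc 2 t, pinv i - LL t = (∑ i ∈ Finset.Ioc 2 t, pinv i - (LL t - LL 2)) + (1/2 - LL 2) := by ring
  rw [e2]
  refine (abs_add_le _ _).trans ?_
  push_cast at h1
  linarith

lemma mertens_q : ∃ C : ℝ, 0 < C ∧ ∀ t : ℕ, 1 ≤ t →
    |∑ q ∈ Pr t, Real.log q / ((q:ℝ) - 1) - Real.log t| ≤ C := by
  obtain ⟨C, hC, h⟩ := mertens_p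
  obtain ⟨D, hD, h'⟩ := lp_sq_total
  refine ⟨C + 2 * D, by positivity, fun t ht => ?_⟩
  rw [sum_Pr]
  have key : ∀ n ∈ Finset.Ioc 0 t, lp n / n ≤ (if n.Prime then Real.log n / ((n:ℝ) - 1) else 0) ∧
      (if n.Prime then Real.log n / ((n:ℝ) - 1) else 0) ≤ lp n / n + 2 * (lp n / (n:ℝ) ^ 2) := by
    intro n _
    unfold lp
    split_ifs with hp
    · have := log_pos_nat hp.two_le
      have h2 : (2:ℝ) ≤ n := by exact_mod_cast hp.two_le
      constructor
      · gcongr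
        · linarith
        · linarith
      · have : Real.log n / n + 2 * (Real.log n / (n:ℝ) ^ 2) = Real.log n * ((n + 2) / (n:ℝ) ^ 2) := by
          field_simp
        rw [this, div_eq_mul_one_div]
        refine mul_le_mul_of_nonneg_left ?_ (by positivity)
        rw [div_le_div_iff₀ (by linarith) (by positivity)]
        nlinarith
    · simp
  have h1 := abs_le.1 (h t ht)
  have h2 := h' t
  have h3 := Finset.sum_le_sum fun n hn => (key n hn).1
  have h4 := Finset.sum_le_sum fun n hn => (key n hn).2
  rw [Finset.sum_add_distrib, ← Finset.mul_sum] at h4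
  rw [abs_le]; constructor <;> linarith [h1.1, h1.2]

end ICM

namespace ICM
open scoped ArithmeticFunction.vonMangoldt

section chars
variable {q : ℕ} [NeZero q] (χ : DirichletCharacter ℂ q)

lemma chi_range_sum (hχ : χ ≠ 1) : ∑ i ∈ Finset.range q, χ (i : ZMod q) = 0 := by
  rw [← MulChar.sum_eq_zero_of_ne_one hχ]
  refine Finset.sum_nbij' (fun i => (i : ZMod q)) ZMod.val ?_ ?_ ?_ ?_ ?_
  · simp
  · intro a _; simpa using ZMod.val_lt a
  · intro a ha; exact ZMod.val_cast_of_lt (by simpa using ha)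
  · intro a _; simp
  · intros; rfl

lemma chi_PL (hχ : χ ≠ 1) (w : ℕ → ℝ) (a b : ℕ) (hw : ∀ m, a < m → w (m + 1) ≤ w m)
    (hw0 : ∀ m, a < m → 0 ≤ w m) :
    ‖∑ m ∈ Finset.Ioc a b, (w m : ℂ) * χ (m : ZMod q)‖ ≤ w (a + 1) * q := by
  have := PL w (fun m => χ (m : ZMod q)) q (Nat.pos_of_ne_zero (NeZero.ne q)) (by intro n; simp)
    (chi_range_sum χ hχ) 1 (fun n => χ.norm_le_one _) a b hw hw0
  simpa [Complex.real_smul] using this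

/-- partial sums of `χ(n)/n` -/
noncomputable def Sχ (N : ℕ) : ℂ := ∑ n ∈ Finset.Ioc 0 N, ((1 / (n:ℝ) : ℝ) : ℂ) * χ (n : ZMod q)

lemma Ioc_sub {E : Type*} [AddCommGroup E] (f : ℕ → E) {a b : ℕ} (hab : a ≤ b) :
    ∑ n ∈ Finset.Ioc 0 b, f n - ∑ n ∈ Finset.Ioc 0 a, f n = ∑ n ∈ Finset.Ioc a b, f n := by
  rw [sub_eq_iff_eq_add, add_comm, Finset.sum_Ioc_consecutive _ (Nat.zero_le _) hab]

lemma Sχ_sub (hχ : χ ≠ 1) {a b : ℕ} (hab : a ≤ b) : ‖Sχ χ b - Sχ χ a‖ ≤ q / ((a:ℝ) + 1) := by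
  rw [Sχ, Sχ, Ioc_sub _ hab]
  refine (chi_PL χ hχ (fun n => 1 / (n:ℝ)) a b ?_ ?_).trans ?_
  · intro m hm
    have : (0:ℝ) < m := by exact_mod_cast (by omega : 0 < m)
    exact one_div_le_one_div_of_le this (by push_cast; linarith)
  · intro m _; positivity
  · push_cast
    rw [one_div_mul_eq_div]

lemma Sχ_lim (hχ : χ ≠ 1) : ∃ l : ℂ, Tendsto (Sχ χ) atTop (nhds l) ∧
    ∀ N : ℕ, ‖l - Sχ χ N‖ ≤ q / ((N:ℝ) + 1) := by
  have hc : CauchySeq (Sχ χ) := by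
    refine cauchySeq_of_le_tendsto_0 (fun N : ℕ => 2 * (q / ((N:ℝ) + 1))) ?_ ?_
    · intro n m N hn hm
      rw [dist_eq_norm]
      have h1 := Sχ_sub χ hχ hn
      have h2 := Sχ_sub χ hχ hm
      calc ‖Sχ χ n - Sχ χ m‖ = ‖(Sχ χ n - Sχ χ N) - (Sχ χ m - Sχ χ N)‖ := by congr 1; ring
        _ ≤ _ := (norm_sub_le _ _).trans (by linarith)
    · have : Tendsto (fun N : ℕ => ((N:ℝ) + 1)) atTop atTop :=
        tendsto_atTop_add_const_right _ _ tendsto_natCast_atTop_atTop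
      simpa using (this.const_div_atTop (q:ℝ)).const_mul 2
  obtain ⟨l, hl⟩ := cauchySeq_tendsto_of_complete hc
  refine ⟨l, hl, fun N => ?_⟩
  refine le_of_tendsto ((hl.sub_const (Sχ χ N)).norm) ?_
  filter_upwards [eventually_ge_atTop N] with b hb
  exact Sχ_sub χ hχ hb

/-- `L(1,χ)` -/
noncomputable def Lone : ℂ := if h : χ ≠ 1 then (Sχ_lim χ h).choose else 0

lemma Lone_tendsto (hχ : χ ≠ 1) : Tendsto (Sχ χ) atTop (nhds (Lone χ)) := by
  rw [Lone, dif_pos hχ]; exact (Sχ_lim χ hχ).choose_spec.1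

lemma Lone_sub (hχ : χ ≠ 1) (N : ℕ) : ‖Lone χ - Sχ χ N‖ ≤ q / ((N:ℝ) + 1) := by
  rw [Lone, dif_pos hχ]; exact (Sχ_lim χ hχ).choose_spec.2 N

lemma Lone_le (hχ : χ ≠ 1) : ‖Lone χ‖ ≤ q := by
  simpa [Sχ] using Lone_sub χ hχ 0

lemma wx_nonneg {x : ℝ} (hx : 0 < x) (n : ℕ) (hn : 1 ≤ n) : 0 ≤ (1 / (n:ℝ)) * (1 - (n:ℝ) ^ (-x)) := by
  have h1 : (1:ℝ) ≤ n := by exact_mod_cast hn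
  have : (n:ℝ) ^ (-x) ≤ 1 := Real.rpow_le_one_of_one_le_of_nonpos h1 (by linarith)
  have := sub_nonneg.2 this
  positivity

lemma wx_le {x : ℝ} (n : ℕ) (hn : 1 ≤ n) (hx : 0 < x) :
    (1 / (n:ℝ)) * (1 - (n:ℝ) ^ (-x)) ≤ x := by
  have h1 : (1:ℝ) ≤ n := by exact_mod_cast hn
  have h0 : (0:ℝ) < n := by linarith
  have h2 : 1 - (n:ℝ) ^ (-x) ≤ x * Real.log n := by
    rw [Real.rpow_def_of_pos h0]
    have := Real.add_one_le_exp (Real.log n * -x)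
    linarith
  have h3 : Real.log n ≤ n := (Real.log_le_sub_one_of_pos h0).trans (by linarith)
  rw [one_div_mul_eq_div, div_le_iff₀ h0]
  nlinarith

lemma wx_anti {x : ℝ} (n : ℕ) (hn : 3 ≤ n) (hx : 0 < x) :
    (1 / ((n+1:ℕ):ℝ)) * (1 - ((n+1:ℕ):ℝ) ^ (-x)) ≤ (1 / (n:ℝ)) * (1 - (n:ℝ) ^ (-x)) := by
  have h1 : (3:ℝ) ≤ n := by exact_mod_cast hn
  have h0 : (0:ℝ) < n := by linarith
  have hn1 : (0:ℝ) < (n:ℝ) + 1 := by linarith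
  have hlog : 1 ≤ Real.log n := by
    rw [Real.le_log_iff_exp_le h0]
    exact Real.exp_one_lt_three.le.trans h1
  push_cast
  have hA : 1 - x / n ≤ (1 + 1 / (n:ℝ)) ^ (-x) := by
    rw [Real.rpow_def_of_pos (by positivity)]
    have h2 := Real.add_one_le_exp (Real.log (1 + 1 / (n:ℝ)) * -x)
    have h3 : Real.log (1 + 1 / (n:ℝ)) ≤ 1 / n := by
      have := Real.log_le_sub_one_of_pos (x := 1 + 1 / (n:ℝ)) (by positivity)
      linarith
    have h4 : Real.log (1 + 1 / (n:ℝ)) * x ≤ 1 / n * x := mul_le_mul_of_nonneg_right h3 hx.le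
    have : 1 / (n:ℝ) * x = x / n := by ring
    linarith
  have hB : ((n:ℝ) + 1) ^ (-x) = (n:ℝ) ^ (-x) * (1 + 1 / (n:ℝ)) ^ (-x) := by
    rw [← Real.mul_rpow h0.le (by positivity)]
    congr 1; field_simp
  have hC : (n:ℝ) ^ (-x) * (1 + x) ≤ 1 := by
    rw [Real.rpow_def_of_pos h0]
    have h5 : Real.exp (Real.log n * -x) ≤ Real.exp (-x) := Real.exp_le_exp.2 (by nlinarith)
    have h6 : 1 + x ≤ Real.exp x := by linarith [Real.add_one_le_exp x]
    calc _ ≤ Real.exp (-x) * Real.exp x := mul_le_mul h5 h6 (by linarith) (Real.exp_pos _).le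
      _ = 1 := by rw [← Real.exp_add]; simp
  have hpos : 0 < (n:ℝ) ^ (-x) := Real.rpow_pos_of_pos h0 _
  rw [one_div_mul_eq_div, one_div_mul_eq_div, div_le_div_iff₀ hn1 h0, hB]
  have hD : (n:ℝ) ^ (-x) * (n - x) ≤ (n:ℝ) ^ (-x) * (1 + 1 / (n:ℝ)) ^ (-x) * n := by
    have : (n:ℝ) - x = (1 - x / n) * n := by field_simp
    rw [this, ← mul_assoc]
    exact mul_le_mul_of_nonneg_right (mul_le_mul_of_nonneg_left hA hpos.le) h0.le
  nlinarith


lemma LS_tendsto (x : ℝ) (hx : 0 < x) : Tendsto (fun N : ℕ => ∑ n ∈ Finset.Ioc 0 N,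
    (((1 / (n:ℝ)) * (n:ℝ) ^ (-x) : ℝ) : ℂ) * χ (n : ZMod q)) atTop (nhds (LSeries (fun n : ℕ => (χ n : ℂ)) (1 + x))) := by
  have hs := χ.LSeriesSummable_of_one_lt_re (s := 1 + x) (by simpa using hx)
  have h := hs.LSeriesHasSum.tendsto_sum_nat
  have h2 := h.comp (tendsto_add_atTop_nat 1)
  refine h2.congr (fun N => ?_)
  simp only [Function.comp]
  rw [Finset.sum_range_eq_add_Ico _ (by omega)]
  simp only [LSeries.term_zero, zero_add]
  refine Finset.sum_congr (by ext; simp; omega) (fun n hn => ?_)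
  have hn0 : n ≠ 0 := by have := (Finset.mem_Ioc.1 hn).1; omega
  have hn1 : (0:ℝ) < n := by exact_mod_cast Nat.pos_of_ne_zero hn0
  rw [LSeries.term_of_ne_zero hn0]
  have : ((n:ℂ) ^ (1 + (x:ℂ))) = (((n:ℝ) ^ (1 + x) : ℝ) : ℂ) := by
    rw [Complex.ofReal_cpow hn1.le]; push_cast; rfl
  rw [this, Real.rpow_add hn1, Real.rpow_neg hn1.le, Real.rpow_one]
  push_cast
  field_simp

lemma LS_sub (hχ : χ ≠ 1) (x : ℝ) (hx : 0 < x) : ‖Lone χ - LSeries (fun n : ℕ => (χ n : ℂ)) (1 + x)‖ ≤ 2 * q * x := by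
  have h := ((Lone_tendsto χ hχ).sub (LS_tendsto χ x hx)).norm
  have hq : (2:ℝ) ≤ q := by
    have : q ≠ 1 := by
      rintro rfl
      exact hχ (Subsingleton.elim _ _)
    have := NeZero.ne q
    exact_mod_cast (by omega : 2 ≤ q)
  refine le_of_tendsto h ?_
  filter_upwards [eventually_ge_atTop 2] with N hN
  rw [Sχ, ← Finset.sum_sub_distrib]
  have e : ∀ n ∈ Finset.Ioc 0 N, ((1 / (n:ℝ) : ℝ) : ℂ) * χ (n : ZMod q) -
      (((1 / (n:ℝ)) * (n:ℝ) ^ (-x) : ℝ) : ℂ) * χ (n : ZMod q) =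
      (((1 / (n:ℝ)) * (1 - (n:ℝ) ^ (-x)) : ℝ) : ℂ) * χ (n : ZMod q) := by
    intro n _; push_cast; ring
  rw [Finset.sum_congr rfl e, ← Finset.sum_Ioc_consecutive _ (Nat.zero_le 2) hN]
  have h1 := chi_PL χ hχ (fun n => (1 / (n:ℝ)) * (1 - (n:ℝ) ^ (-x))) 2 N
    (fun m hm => wx_anti m (by omega) hx) (fun m hm => wx_nonneg hx m (by omega))
  have h2 := wx_le 3 (by norm_num) hx
  have h3 := wx_le 2 (by norm_num) hx
  have h4 := wx_nonneg hx 2 (by norm_num)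
  have h5 : ‖∑ n ∈ Finset.Ioc 0 (2:ℕ), (((1 / (n:ℝ)) * (1 - (n:ℝ) ^ (-x)) : ℝ) : ℂ) * χ (n : ZMod q)‖ ≤ x := by
    rw [show Finset.Ioc 0 (2:ℕ) = {1, 2} by rfl, Finset.sum_pair (by norm_num)]
    rw [show (((1 / ((1:ℕ):ℝ)) * (1 - ((1:ℕ):ℝ) ^ (-x)) : ℝ) : ℂ) = 0 by simp, zero_mul, zero_add, norm_mul,
      Complex.norm_real, Real.norm_of_nonneg h4]
    calc _ ≤ x * 1 := mul_le_mul h3 (χ.norm_le_one _) (norm_nonneg _) hx.le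
      _ = x := mul_one x
  refine (norm_add_le _ _).trans ?_
  have h6 : (1 / ((3:ℕ):ℝ)) * (1 - ((3:ℕ):ℝ) ^ (-x)) * q ≤ x * q := mul_le_mul_of_nonneg_right h2 (by linarith)
  have h7 : ‖∑ m ∈ Finset.Ioc 2 N, (((1 / (m:ℝ)) * (1 - (m:ℝ) ^ (-x)) : ℝ) : ℂ) * χ (m : ZMod q)‖ ≤ x * q := h1.trans h6
  nlinarith

end chars
end ICM

namespace ICM
open scoped ArithmeticFunction.vonMangoldt

lemma zeta_partial {x : ℝ} (hx : 0 < x) (N : ℕ) (hN : 1 ≤ N) :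
    ∑ n ∈ Finset.Ioc 0 N, (1 / (n:ℝ)) * (n:ℝ) ^ (-x) ≤ 1 + (1 / x) * (1 - (N:ℝ) ^ (-x)) := by
  induction N, hN using Nat.le_induction with
  | base => simp
  | succ m hm ih =>
    rw [Finset.sum_Ioc_succ_top (Nat.zero_le _)]
    have h0 : (0:ℝ) < m := by exact_mod_cast hm
    have h1 : (0:ℝ) < (m:ℝ) + 1 := by linarith
    push_cast
    have hB : (m:ℝ) ^ (-x) = ((m:ℝ) + 1) ^ (-x) * (1 - 1 / ((m:ℝ) + 1)) ^ (-x) := by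
      have e : 1 - 1 / ((m:ℝ) + 1) = m / (m + 1) := by field_simp; ring
      rw [e, ← Real.mul_rpow h1.le (by positivity)]
      congr 1; field_simp
    have hA : 1 + x / ((m:ℝ) + 1) ≤ (1 - 1 / ((m:ℝ) + 1)) ^ (-x) := by
      have e : 1 - 1 / ((m:ℝ) + 1) = m / (m + 1) := by field_simp; ring
      have hp : 0 < 1 - 1 / ((m:ℝ) + 1) := by rw [e]; positivity
      rw [Real.rpow_def_of_pos hp]
      have h2 := Real.add_one_le_exp (Real.log (1 - 1 / ((m:ℝ) + 1)) * -x)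
      have h3 := Real.log_le_sub_one_of_pos hp
      have h4 : Real.log (1 - 1 / ((m:ℝ) + 1)) * x ≤ (1 - 1 / ((m:ℝ) + 1) - 1) * x :=
        mul_le_mul_of_nonneg_right h3 hx.le
      have : (1 - 1 / ((m:ℝ) + 1) - 1) * x = - (x / ((m:ℝ) + 1)) := by ring
      linarith
    have hpos : 0 < ((m:ℝ) + 1) ^ (-x) := Real.rpow_pos_of_pos h1 _
    have hC := mul_le_mul_of_nonneg_left hA hpos.le
    rw [← hB] at hC
    have hD : (1 / ((m:ℝ) + 1)) * ((m:ℝ) + 1) ^ (-x) ≤ (1 / x) * ((m:ℝ) ^ (-x) - ((m:ℝ) + 1) ^ (-x)) := by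
      rw [one_div_mul_eq_div x, le_div_iff₀ hx]
      have : 1 / ((m:ℝ) + 1) * (((m:ℝ) + 1) ^ (-x)) * x = ((m:ℝ) + 1) ^ (-x) * (1 + x / ((m:ℝ) + 1)) - ((m:ℝ) + 1) ^ (-x) := by ring
      linarith
    linarith

section chars
variable {q : ℕ} [NeZero q] (χ : DirichletCharacter ℂ q)

lemma LS_bound (x : ℝ) (hx : 0 < x) (hx1 : x ≤ 1) : ‖LSeries (fun n : ℕ => (χ n : ℂ)) (1 + x)‖ ≤ 2 / x := by
  refine le_of_tendsto (LS_tendsto χ x hx).norm ?_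
  filter_upwards [eventually_ge_atTop 1] with N hN
  have h := zeta_partial hx N hN
  have hp : 0 < (N:ℝ) ^ (-x) := Real.rpow_pos_of_pos (by exact_mod_cast hN) _
  have h2 : ‖∑ n ∈ Finset.Ioc 0 N, (((1 / (n:ℝ)) * (n:ℝ) ^ (-x) : ℝ) : ℂ) * χ (n : ZMod q)‖ ≤
      ∑ n ∈ Finset.Ioc 0 N, (1 / (n:ℝ)) * (n:ℝ) ^ (-x) := by
    refine (norm_sum_le _ _).trans (Finset.sum_le_sum fun n hn => ?_)
    have : 0 ≤ (1 / (n:ℝ)) * (n:ℝ) ^ (-x) := by positivity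
    rw [norm_mul, Complex.norm_real, Real.norm_of_nonneg this]
    exact mul_le_of_le_one_right this (χ.norm_le_one _)
  refine h2.trans (h.trans ?_)
  have h3 : 1 ≤ 1 / x := by rw [le_div_iff₀ hx]; linarith
  have h4 : 1 / x * (1 - (N:ℝ) ^ (-x)) ≤ 1 / x * 1 := mul_le_mul_of_nonneg_left (by linarith) (by positivity)
  have : 2 / x = 1 / x + 1 / x := by ring
  linarith

lemma Lone_complex (hχ : χ ≠ 1) (hχ2 : χ ^ 2 ≠ 1) : 1 / (2048 * (q:ℝ) ^ 4) ≤ ‖Lone χ‖ := by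
  by_contra! hcon
  have hq : (1:ℝ) ≤ q := by exact_mod_cast Nat.pos_of_ne_zero (NeZero.ne q)
  set x : ℝ := 1 / (4096 * (q:ℝ) ^ 5) with hxdef
  have hx : 0 < x := by positivity
  have hq5 : (1:ℝ) ≤ (q:ℝ) ^ 5 := one_le_pow₀ hq
  have hx1 : x ≤ 1 / 2 := by
    rw [hxdef]; apply one_div_le_one_div_of_le <;> linarith
  have e1 : 2 * q * x = 1 / (2048 * (q:ℝ) ^ 4) := by rw [hxdef]; field_simp; norm_num
  have H := DirichletCharacter.norm_LSeries_product_ge_one χ hx 0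
  simp only [Complex.ofReal_zero, mul_zero, add_zero, norm_mul, norm_pow] at H
  have h1 := LS_bound (1 : DirichletCharacter ℂ q) x hx (by linarith)
  have h2 : ‖LSeries (fun n : ℕ => (χ n : ℂ)) (1 + x)‖ < 4 * q * x := by
    have := LS_sub χ hχ x hx
    rw [norm_sub_rev] at this
    have h3 := norm_sub_norm_le (LSeries (fun n : ℕ => (χ n : ℂ)) (1 + x)) (Lone χ)
    linarith
  have h3 : ‖LSeries (fun n : ℕ => ((χ ^ 2) n : ℂ)) (1 + x)‖ ≤ 2 * q := by
    have := LS_sub (χ ^ 2) hχ2 x hx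
    rw [norm_sub_rev] at this
    have h3 := norm_sub_norm_le (LSeries (fun n : ℕ => ((χ ^ 2) n : ℂ)) (1 + x)) (Lone (χ ^ 2))
    have h4 := Lone_le (χ ^ 2) hχ2
    have : 2 * q * x ≤ q := by nlinarith
    linarith
  have h4 : ‖LSeries (fun n : ℕ => (χ n : ℂ)) (1 + x)‖ ^ 4 < (4 * q * x) ^ 4 := pow_lt_pow_left₀ h2 (norm_nonneg _) (by norm_num)
  have h5 : ‖LSeries (fun n : ℕ => ((1 : DirichletCharacter ℂ q) n : ℂ)) (1 + x)‖ ^ 3 ≤ (2 / x) ^ 3 := pow_le_pow_left₀ (norm_nonneg _) h1 3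
  have h6 : ‖LSeries (fun n : ℕ => ((1 : DirichletCharacter ℂ q) n : ℂ)) (1 + x)‖ ^ 3 * ‖LSeries (fun n : ℕ => (χ n : ℂ)) (1 + x)‖ ^ 4 * ‖LSeries (fun n : ℕ => ((χ ^ 2) n : ℂ)) (1 + x)‖ <
      (2 / x) ^ 3 * (4 * q * x) ^ 4 * (2 * q) := by
    refine lt_of_le_of_lt (mul_le_mul_of_nonneg_left h3 (by positivity)) ?_
    refine mul_lt_mul_of_pos_right ?_ (by positivity)
    refine lt_of_le_of_lt (mul_le_mul_of_nonneg_right h5 (by positivity)) ?_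
    exact mul_lt_mul_of_pos_left h4 (by positivity)
  have h7 : (2 / x) ^ 3 * (4 * q * x) ^ 4 * (2 * q) = 1 := by
    have : (2 / x) ^ 3 * (4 * q * x) ^ 4 * (2 * q) = 4096 * (q:ℝ)^5 * x := by field_simp; ring
    rw [this, hxdef]; field_simp
  linarith

end chars
end ICM

namespace ICM
open scoped ArithmeticFunction.vonMangoldt

section chars
set_option linter.unusedSectionVars false
variable {q : ℕ} [NeZero q] (χ : DirichletCharacter ℂ q)

lemma zetaMul_apply (n : ℕ) : χ.zetaMul n = ∑ d ∈ n.divisors, χ (d : ZMod q) := by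
  rw [DirichletCharacter.zetaMul, ArithmeticFunction.coe_zeta_mul_apply]
  refine Finset.sum_congr rfl fun d hd => ?_
  change (if d = 0 then 0 else χ (d : ZMod q)) = _
  rw [if_neg (Nat.pos_of_mem_divisors hd).ne']

open scoped ComplexOrder in
lemma zetaMul_sq (hχ : χ ^ 2 = 1) (m : ℕ) (hm : m ≠ 0) : 1 ≤ χ.zetaMul (m ^ 2) := by
  rw [χ.isMultiplicative_zetaMul.multiplicative_factorization _ (pow_ne_zero 2 hm)]
  have : (1:ℂ) = ∏ p ∈ (m^2).factorization.support, 1 := by simp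
  rw [this, Finsupp.prod]
  refine Finset.prod_le_prod (fun _ _ => zero_le_one) (fun p hp => ?_)
  have hpp := Nat.prime_of_mem_primeFactors hp
  have e : (m^2).factorization p = 2 * m.factorization p := by simp
  rw [e]
  generalize m.factorization p = k
  rw [zetaMul_apply, Nat.sum_divisors_prime_pow hpp]
  simp only [Nat.cast_pow, map_pow]
  rcases MulChar.isQuadratic_iff_sq_eq_one.mpr hχ p with h | h | h
  · rw [h, Finset.sum_range_succ']
    simp
  · rw [h]; simp
    positivity
  · simp only [h, neg_one_geom_sum]
    rw [if_neg]
    simp [parity_simps]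

lemma zetaMul_re_nonneg (hχ : χ ^ 2 = 1) (n : ℕ) : 0 ≤ (χ.zetaMul n).re :=
  (Complex.le_def.1 (DirichletCharacter.zetaMul_nonneg hχ n)).1

lemma zetaMul_sq_re (hχ : χ ^ 2 = 1) (m : ℕ) (hm : m ≠ 0) : 1 ≤ (χ.zetaMul (m ^ 2)).re :=
  (Complex.le_def.1 (zetaMul_sq χ hχ m hm)).1

end chars

noncomputable def GS (t : ℝ) (n : ℕ) : ℝ := ∑ i ∈ Finset.range n, t ^ i

lemma GS_amgm (s : ℝ) (n : ℕ) : (n:ℝ) * s ^ (n - 1) ≤ GS (s^2) n := by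
  have h1 : GS (s^2) n = ∑ i ∈ Finset.range n, (s^2) ^ (n - 1 - i) := by
    rw [GS, ← Finset.sum_range_reflect]
  have h2 : 2 * GS (s^2) n = ∑ i ∈ Finset.range n, ((s^2)^i + (s^2) ^ (n - 1 - i)) := by
    rw [Finset.sum_add_distrib, ← h1, ← GS]; ring
  have h3 : ∑ i ∈ Finset.range n, (2 * s^(n-1)) ≤ ∑ i ∈ Finset.range n, ((s^2)^i + (s^2) ^ (n - 1 - i)) := by
    refine Finset.sum_le_sum fun i hi => ?_
    have : s^(n-1) = s^i * s^(n-1-i) := by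
      rw [← pow_add]; congr 1; have := Finset.mem_range.1 hi; omega
    have e1 : ∀ j : ℕ, (s^2)^j = (s^j)^2 := fun j => by rw [← pow_mul, ← pow_mul, mul_comm]
    rw [this, e1, e1]
    nlinarith [sq_nonneg (s^i - s^(n-1-i))]
  rw [← h2] at h3
  simp at h3
  linarith

lemma GS_eq (t : ℝ) (n : ℕ) : GS t n * (1 - t) = 1 - t ^ n := geom_sum_mul_neg t n

/-- Monsky weights -/
noncomputable def bM (t : ℝ) (n : ℕ) : ℝ := 1 / (n * (1 - t)) - t ^ n / (1 - t ^ n)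

lemma GS_pos {t : ℝ} (ht : 0 < t) {n : ℕ} (hn : 1 ≤ n) : 0 < GS t n :=
  Finset.sum_pos (fun i _ => pow_pos ht i) ⟨0, Finset.mem_range.2 (by omega)⟩

lemma bM_eq {t : ℝ} (ht : 0 < t) (ht1 : t < 1) {n : ℕ} (hn : 1 ≤ n) :
    bM t n = (1 / (1 - t)) * (1 / n - t ^ n / GS t n) := by
  have h1 : 0 < 1 - t := by linarith
  have h2 := GS_pos ht hn
  have h3 : (0:ℝ) < n := by exact_mod_cast hn
  rw [bM, ← GS_eq]
  field_simp

lemma bM_nonneg {t : ℝ} (ht : 0 < t) (ht1 : t < 1) {n : ℕ} (hn : 1 ≤ n) : 0 ≤ bM t n := by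
  rw [bM_eq ht ht1 hn]
  have h1 : 0 < 1 - t := by linarith
  have h2 := GS_pos ht hn
  have h3 : (0:ℝ) < n := by exact_mod_cast hn
  have h4 : n * t ^ n ≤ GS t n := by
    have : ∑ i ∈ Finset.range n, t ^ n ≤ GS t n :=
      Finset.sum_le_sum fun i hi => pow_le_pow_of_le_one ht.le ht1.le (Finset.mem_range.1 hi).le
    simpa using this
  refine mul_nonneg (by positivity) (sub_nonneg.2 ?_)
  rw [div_le_div_iff₀ h2 h3]; linarith

lemma bM_one {t : ℝ} (ht1 : t < 1) : bM t 1 = 1 := by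
  have h1 : 0 < 1 - t := by linarith
  rw [bM]; field_simp; push_cast; field_simp

lemma bM_anti {t : ℝ} (ht : 0 < t) (ht1 : t < 1) {n : ℕ} (hn : 1 ≤ n) : bM t (n+1) ≤ bM t n := by
  rw [bM_eq ht ht1 hn, bM_eq ht ht1 (by omega)]
  have h1 : 0 < 1 - t := by linarith
  have h2 := GS_pos ht hn
  have h2' := GS_pos ht (n := n+1) (by omega)
  have h3 : (0:ℝ) < n := by exact_mod_cast hn
  refine mul_le_mul_of_nonneg_left ?_ (by positivity)
  obtain ⟨s, hs, rfl⟩ : ∃ s, 0 < s ∧ t = s ^ 2 := ⟨Real.sqrt t, Real.sqrt_pos.2 ht, (Real.sq_sqrt ht.le).symm⟩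
  have hs1 : s ≤ 1 := by nlinarith
  have hS : GS (s^2) (n+1) = 1 + s^2 * GS (s^2) n := by
    rw [GS, GS, Finset.sum_range_succ', Finset.mul_sum]
    simp [pow_succ']
    ring
  have key : (n * (n+1)) * (s^2)^n ≤ GS (s^2) n * GS (s^2) (n+1) := by
    have a1 := GS_amgm s n
    have a2 := GS_amgm s (n+1)
    simp only [Nat.add_sub_cancel] at a2
    push_cast at a2
    calc (n * (n+1)) * (s^2)^n = (n * (n+1) * s^n) * s^n := by rw [← pow_mul, two_mul, pow_add]; ring
      _ ≤ (n * (n+1) * s^n) * s^(n-1) := mul_le_mul_of_nonneg_left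
          (pow_le_pow_of_le_one hs.le hs1 (by omega)) (by positivity)
      _ = (n * s^(n-1)) * ((n+1) * s^n) := by ring
      _ ≤ _ := mul_le_mul a1 a2 (by positivity) h2.le
  have e : (s^2)^n / GS (s^2) n - (s^2)^(n+1) / GS (s^2) (n+1) = (s^2)^n / (GS (s^2) n * GS (s^2) (n+1)) := by
    rw [div_sub_div _ _ h2.ne' h2'.ne']
    congr 1
    rw [hS]; ring
  have f : 1 / (n:ℝ) - 1 / ((n+1:ℕ):ℝ) = 1 / (n * (n+1)) := by push_cast; field_simp; ring
  have g : (s^2)^n / (GS (s^2) n * GS (s^2) (n+1)) ≤ 1 / (n * ((n:ℝ)+1)) := by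
    rw [div_le_div_iff₀ (by positivity) (by positivity)]; linarith
  linarith

section chars2
variable {q : ℕ} [NeZero q] (χ : DirichletCharacter ℂ q)

lemma monsky1 (hχ : χ ≠ 1) {t : ℝ} (ht : 0 < t) (ht1 : t < 1) (N : ℕ) :
    ‖(1 / (1 - t) : ℝ) * Sχ χ N - ∑ n ∈ Finset.Ioc 0 N, ((t ^ n / (1 - t ^ n) : ℝ) : ℂ) * χ (n : ZMod q)‖ ≤ q := by
  have h := chi_PL χ hχ (bM t) 0 N (fun m hm => bM_anti ht ht1 (by omega)) (fun m hm => bM_nonneg ht ht1 (by omega))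
  rw [zero_add, bM_one ht1, one_mul] at h
  convert! h using 2
  rw [Sχ, Finset.mul_sum, ← Finset.sum_sub_distrib]
  refine Finset.sum_congr rfl fun n _ => ?_
  rw [bM, ← mul_assoc, ← Complex.ofReal_mul, ← sub_mul, ← Complex.ofReal_sub]
  congr 3
  rw [one_div_mul_one_div, mul_comm]

lemma geom_err {t : ℝ} (ht : 0 < t) (ht1 : t < 1) {n N : ℕ} (hn : 1 ≤ n) :
    |t ^ n / (1 - t ^ n) - ∑ j ∈ Finset.Ioc 0 (N / n), t ^ (n * j)| ≤ t ^ N / (1 - t) := by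
  have hn0 : n ≠ 0 := by omega
  have hu : 0 < t ^ n := pow_pos ht n
  have hu1 : t ^ n ≤ t := by simpa using pow_le_pow_of_le_one ht.le ht1.le hn
  have h1 : 0 < 1 - t ^ n := by linarith
  have e : ∀ M : ℕ, t ^ n / (1 - t ^ n) - ∑ j ∈ Finset.Ioc 0 M, t ^ (n * j) = t ^ (n * (M + 1)) / (1 - t ^ n) := by
    intro M
    induction M with
    | zero => simp
    | succ M ih =>
      rw [Finset.sum_Ioc_succ_top (Nat.zero_le _), ← sub_sub, ih]
      field_simp
      ring
  rw [e, abs_of_nonneg (by positivity)]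
  refine div_le_div₀ (by positivity) (pow_le_pow_of_le_one ht.le ht1.le ?_) (by linarith) (by linarith)
  exact (Nat.lt_mul_div_succ N (by omega)).le

lemma monsky2 {t : ℝ} (ht : 0 < t) (ht1 : t < 1) (N : ℕ) :
    ‖∑ n ∈ Finset.Ioc 0 N, ((t ^ n / (1 - t ^ n) : ℝ) : ℂ) * χ (n : ZMod q)
      - ∑ k ∈ Finset.Ioc 0 N, ((t ^ k : ℝ) : ℂ) * χ.zetaMul k‖ ≤ N * (t ^ N / (1 - t)) := by
  have e : ∑ k ∈ Finset.Ioc 0 N, ((t ^ k : ℝ) : ℂ) * χ.zetaMul k =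
      ∑ n ∈ Finset.Ioc 0 N, ((∑ j ∈ Finset.Ioc 0 (N / n), t ^ (n * j) : ℝ) : ℂ) * χ (n : ZMod q) := by
    have := sum_antidiag (fun a b => ((t ^ (a * b) : ℝ) : ℂ) * χ (a : ZMod q)) N
    rw [Finset.sum_congr rfl (fun k hk => ?_), this]
    · refine Finset.sum_congr rfl fun n _ => ?_
      rw [← Finset.sum_mul]; push_cast; rfl
    · rw [zetaMul_apply, Nat.sum_divisorsAntidiagonal (fun a b => ((t ^ (a * b) : ℝ) : ℂ) * χ (a : ZMod q)),
        Finset.mul_sum]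
      refine Finset.sum_congr rfl fun d hd => ?_
      rw [Nat.mul_div_cancel' (Nat.dvd_of_mem_divisors hd)]
  rw [e, ← Finset.sum_sub_distrib]
  refine (norm_sum_le _ _).trans ?_
  have : ∀ n ∈ Finset.Ioc 0 N, ‖((t ^ n / (1 - t ^ n) : ℝ) : ℂ) * χ (n : ZMod q) -
      ((∑ j ∈ Finset.Ioc 0 (N / n), t ^ (n * j) : ℝ) : ℂ) * χ (n : ZMod q)‖ ≤ t ^ N / (1 - t) := by
    intro n hn
    rw [← sub_mul, ← Complex.ofReal_sub, norm_mul, Complex.norm_real, Real.norm_eq_abs]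
    have h1 : 0 < 1 - t := by linarith
    calc _ ≤ t ^ N / (1 - t) * 1 := mul_le_mul (geom_err ht ht1 (Finset.mem_Ioc.1 hn).1) (χ.norm_le_one _)
          (norm_nonneg _) (by positivity)
      _ = _ := mul_one _
  refine (Finset.sum_le_sum this).trans ?_
  simp

lemma Lone_real (hχ : χ ≠ 1) (hχ2 : χ ^ 2 = 1) : 1 / (32 * (q:ℝ)) ≤ ‖Lone χ‖ := by
  have hq : (1:ℝ) ≤ q := by exact_mod_cast Nat.pos_of_ne_zero (NeZero.ne q)
  set H : ℕ := 4 * q with hH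
  have hHr : (H:ℝ) = 4 * q := by rw [hH]; push_cast; ring
  have hH1 : (4:ℝ) ≤ H := by rw [hHr]; linarith
  set t : ℝ := 1 - 1 / (2 * (H:ℝ)^2) with htdef
  have h2H : 1 / (2 * (H:ℝ)^2) ≤ 1 / 2 := one_div_le_one_div_of_le (by norm_num) (by nlinarith)
  have h2H' : 0 < 1 / (2 * (H:ℝ)^2) := by positivity
  have ht : 0 < t := by linarith
  have ht1 : t < 1 := by linarith
  have e1 : 1 / (1 - t) = 2 * (H:ℝ)^2 := by rw [htdef]; field_simp; ring
  -- lower bound for the partial sums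
  have low : ∀ N : ℕ, H ^ 2 ≤ N → (H:ℝ) / 2 ≤ (∑ k ∈ Finset.Ioc 0 N, ((t ^ k : ℝ) : ℂ) * χ.zetaMul k).re := by
    intro N hN
    rw [Complex.re_sum]
    simp only [Complex.re_ofReal_mul]
    have s1 : ∑ k ∈ (Finset.Ioc 0 H).image (fun m => m ^ 2), t ^ k * (χ.zetaMul k).re ≤
        ∑ k ∈ Finset.Ioc 0 N, t ^ k * (χ.zetaMul k).re := by
      refine Finset.sum_le_sum_of_subset_of_nonneg ?_ (fun k _ _ => mul_nonneg (pow_nonneg ht.le _) (zetaMul_re_nonneg χ hχ2 k))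
      intro k hk
      simp only [Finset.mem_image, Finset.mem_Ioc] at hk ⊢
      obtain ⟨m, ⟨h1, h2⟩, rfl⟩ := hk
      exact ⟨by positivity, (Nat.pow_le_pow_left h2 2).trans hN⟩
    refine le_trans ?_ s1
    rw [Finset.sum_image (fun a _ b _ h => Nat.pow_left_injective (n := 2) (by norm_num) h)]
    have s2 : ∑ m ∈ Finset.Ioc 0 H, (1/2:ℝ) ≤ ∑ m ∈ Finset.Ioc 0 H, t ^ (m^2) * (χ.zetaMul (m^2)).re := by
      refine Finset.sum_le_sum fun m hm => ?_
      have hm' := Finset.mem_Ioc.1 hm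
      have h1 := zetaMul_sq_re χ hχ2 m (by omega)
      have h2 : 1 / 2 ≤ t ^ (m^2) := by
        have hb := one_add_mul_le_pow (a := -(1 / (2 * (H:ℝ)^2))) (by linarith) (m^2)
        have hmH : ((m^2:ℕ):ℝ) ≤ (H:ℝ)^2 := by exact_mod_cast Nat.pow_le_pow_left hm'.2 2
        have h3 : ((m^2:ℕ):ℝ) * (1 / (2 * (H:ℝ)^2)) ≤ (H:ℝ)^2 * (1 / (2 * (H:ℝ)^2)) :=
          mul_le_mul_of_nonneg_right hmH h2H'.le
        have h4 : (H:ℝ)^2 * (1 / (2 * (H:ℝ)^2)) = 1/2 := by field_simp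
        rw [htdef, sub_eq_add_neg]
        linarith
      nlinarith
    simp at s2
    linarith
  -- limit
  have hlim : Tendsto (fun N : ℕ => (1 / (1 - t)) * ‖Sχ χ N‖ + q + N * (t ^ N / (1 - t))) atTop
      (nhds ((1 / (1 - t)) * ‖Lone χ‖ + q + 0)) := by
    refine (((Lone_tendsto χ hχ).norm.const_mul _).add_const _).add ?_
    have := (tendsto_self_mul_const_pow_of_lt_one ht.le ht1).div_const (1 - t)
    simpa [mul_div_assoc] using this
  have hfin : (H:ℝ)/2 ≤ (1 / (1 - t)) * ‖Lone χ‖ + q + 0 := by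
    refine ge_of_tendsto hlim ?_
    filter_upwards [eventually_ge_atTop (H^2)] with N hN
    refine (low N hN).trans ((Complex.re_le_norm _).trans ?_)
    have m1 := monsky1 χ hχ ht ht1 N
    have m2 := monsky2 χ ht ht1 N
    set A := ∑ k ∈ Finset.Ioc 0 N, ((t ^ k : ℝ) : ℂ) * χ.zetaMul k
    set B := ∑ n ∈ Finset.Ioc 0 N, ((t ^ n / (1 - t ^ n) : ℝ) : ℂ) * χ (n : ZMod q)
    have : A = ((1 / (1 - t) : ℝ) : ℂ) * Sχ χ N - ((((1 / (1 - t) : ℝ) : ℂ) * Sχ χ N) - B) - (B - A) := by ring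
    rw [this]
    refine (norm_sub_le _ _).trans (add_le_add ((norm_sub_le _ _).trans (add_le_add (le_of_eq ?_) m1)) m2)
    rw [norm_mul, Complex.norm_real, Real.norm_of_nonneg]
    rw [e1]; positivity
  rw [e1, hHr] at hfin
  rw [div_le_iff₀ (by positivity)]
  nlinarith

lemma Lone_lower (hχ : χ ≠ 1) : 1 / (2048 * (q:ℝ)^4) ≤ ‖Lone χ‖ := by
  by_cases h : χ ^ 2 = 1
  · refine le_trans ?_ (Lone_real χ hχ h)
    have hq : (1:ℝ) ≤ q := by exact_mod_cast Nat.pos_of_ne_zero (NeZero.ne q)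
    have : (q:ℝ) ≤ (q:ℝ)^4 := le_self_pow₀ hq (by norm_num)
    apply one_div_le_one_div_of_le <;> linarith
  · exact Lone_complex χ hχ h

end chars2
end ICM

namespace ICM
open scoped ArithmeticFunction.vonMangoldt

section chars
set_option linter.unusedSectionVars false
variable {q : ℕ} [NeZero q] (χ : DirichletCharacter ℂ q)

/-- twisted Mertens sums -/
noncomputable def Mχ (t : ℕ) : ℂ := ∑ n ∈ Finset.Ioc 0 t, ((Λ n / n : ℝ) : ℂ) * χ (n : ZMod q)

lemma logsum_bound (hχ : χ ≠ 1) (t : ℕ) :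
    ‖∑ n ∈ Finset.Ioc 0 t, ((Real.log n / n : ℝ) : ℂ) * χ (n : ZMod q)‖ ≤ 3 * q := by
  have hq : (1:ℝ) ≤ q := by exact_mod_cast Nat.pos_of_ne_zero (NeZero.ne q)
  have hb : ∀ n : ℕ, 0 ≤ Real.log n / n ∧ Real.log n / n ≤ 1 := by
    intro n
    rcases Nat.eq_zero_or_pos n with h | h
    · simp [h]
    have h0 : (0:ℝ) < n := by exact_mod_cast h
    refine ⟨div_nonneg (Real.log_natCast_nonneg n) h0.le, ?_⟩
    rw [div_le_one h0]
    have := Real.log_le_sub_one_of_pos h0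
    linarith
  have ht : ∀ n : ℕ, ‖((Real.log n / n : ℝ) : ℂ) * χ (n : ZMod q)‖ ≤ 1 := by
    intro n
    rw [norm_mul, Complex.norm_real, Real.norm_of_nonneg (hb n).1]
    exact mul_le_one₀ (hb n).2 (norm_nonneg _) (χ.norm_le_one _)
  rcases le_or_gt t 2 with h2 | h2
  · refine (norm_sum_le _ _).trans ((Finset.sum_le_sum fun n _ => ht n).trans ?_)
    have : (t:ℝ) ≤ 2 := by exact_mod_cast h2
    simp; linarith
  rw [← Finset.sum_Ioc_consecutive _ (Nat.zero_le 2) h2.le]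
  have h1 := chi_PL χ hχ (fun n => Real.log n / n) 2 t (by
    intro m hm
    have hm3 : (3:ℝ) ≤ m := by exact_mod_cast hm
    refine Real.log_div_self_antitoneOn ?_ ?_ ?_
    · change Real.exp 1 ≤ _; linarith [Real.exp_one_lt_three]
    · change Real.exp 1 ≤ _; push_cast; linarith [Real.exp_one_lt_three]
    · push_cast; linarith) (fun m _ => (hb m).1)
  refine (norm_add_le _ _).trans ?_
  have h3 : ‖∑ n ∈ Finset.Ioc 0 (2:ℕ), ((Real.log n / n : ℝ) : ℂ) * χ (n : ZMod q)‖ ≤ 2 := by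
    refine (norm_sum_le _ _).trans ((Finset.sum_le_sum fun n _ => ht n).trans ?_)
    simp
  have h4 : Real.log ((2+1:ℕ):ℝ) / ((2+1:ℕ):ℝ) * q ≤ 1 * q := mul_le_mul_of_nonneg_right (hb (2+1)).2 (by linarith)
  have h5 := h1.trans h4
  linarith

lemma logsum_eq (t : ℕ) : ∑ n ∈ Finset.Ioc 0 t, ((Real.log n / n : ℝ) : ℂ) * χ (n : ZMod q) =
    ∑ d ∈ Finset.Ioc 0 t, (((Λ d / d : ℝ) : ℂ) * χ (d : ZMod q)) * Sχ χ (t / d) := by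
  have h := sum_antidiag (fun d m => (((Λ d / d : ℝ) : ℂ) * χ (d : ZMod q)) * (((1 / (m:ℝ) : ℝ) : ℂ) * χ (m : ZMod q))) t
  simp only [Sχ, Finset.mul_sum]
  rw [← h]
  refine Finset.sum_congr rfl fun n hn => ?_
  have hn0 : n ≠ 0 := by have := (Finset.mem_Ioc.1 hn).1; omega
  rw [← ArithmeticFunction.vonMangoldt_sum, ← Nat.sum_divisorsAntidiagonal (fun d _ => Λ d) (n := n), Finset.sum_div]
  push_cast
  rw [Finset.sum_mul]
  refine Finset.sum_congr rfl fun x hx => ?_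
  have hx' := Nat.mem_divisorsAntidiagonal.1 hx
  rw [← hx'.1]
  push_cast
  rw [map_mul]
  have h1 : (x.1:ℂ) ≠ 0 := by
    have : x.1 ≠ 0 := by rintro h; rw [h] at hx'; simp at hx'; omega
    exact_mod_cast this
  have h2 : (x.2:ℂ) ≠ 0 := by
    have : x.2 ≠ 0 := by rintro h; rw [h] at hx'; simp at hx'; omega
    exact_mod_cast this
  field_simp

end chars

lemma Mχ_bound : ∃ C : ℝ, 0 < C ∧ ∀ (q : ℕ) [NeZero q] (χ : DirichletCharacter ℂ q), χ ≠ 1 → ∀ t : ℕ,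
    ‖Mχ χ t‖ ≤ C * (q:ℝ)^5 := by
  obtain ⟨C, hC, hpsi⟩ := psi_bound
  refine ⟨2048 * (3 + C), by positivity, fun q _ χ hχ t => ?_⟩
  have hq : (1:ℝ) ≤ q := by exact_mod_cast Nat.pos_of_ne_zero (NeZero.ne q)
  rcases Nat.eq_zero_or_pos t with h0 | h0
  · subst h0; simp [Mχ]; positivity
  have ht : (0:ℝ) < t := by exact_mod_cast h0
  have h1 := logsum_bound χ hχ t
  rw [logsum_eq] at h1
  have h2 : ‖∑ d ∈ Finset.Ioc 0 t, (((Λ d / d : ℝ) : ℂ) * χ (d : ZMod q)) * (Lone χ - Sχ χ (t / d))‖ ≤ C * q := by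
    refine (norm_sum_le _ _).trans ?_
    calc _ ≤ ∑ d ∈ Finset.Ioc 0 t, Λ d * (q / t) := by
          refine Finset.sum_le_sum fun d hd => ?_
          have hd0 : (0:ℝ) < d := by exact_mod_cast (Finset.mem_Ioc.1 hd).1
          rw [norm_mul, norm_mul, Complex.norm_real, Real.norm_of_nonneg (div_nonneg ArithmeticFunction.vonMangoldt_nonneg hd0.le)]
          have h3 := Lone_sub χ hχ (t / d)
          have h4 : (t:ℝ) / d ≤ ((t/d:ℕ):ℝ) + 1 := (Nat.lt_floor_add_one ((t:ℝ)/d)).le.trans (by rw [Nat.floor_div_natCast]; simp)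
          have h5 : (q:ℝ) / (((t/d:ℕ):ℝ) + 1) ≤ q / (t / d) := div_le_div_of_nonneg_left (by linarith) (by positivity) h4
          have h6 : Λ d / d * ‖χ (d : ZMod q)‖ ≤ Λ d / d :=
            mul_le_of_le_one_right (div_nonneg ArithmeticFunction.vonMangoldt_nonneg hd0.le) (χ.norm_le_one _)
          calc _ ≤ Λ d / d * (q / (t / d)) := mul_le_mul h6 (h3.trans h5) (norm_nonneg _)
                (div_nonneg ArithmeticFunction.vonMangoldt_nonneg hd0.le)
            _ = _ := by field_simp
      _ = (∑ d ∈ Finset.Ioc 0 t, Λ d) * (q / t) := by rw [Finset.sum_mul]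
      _ ≤ C * t * (q / t) := mul_le_mul_of_nonneg_right (hpsi t) (by positivity)
      _ = C * q := by field_simp
  have e : Lone χ * Mχ χ t = ∑ d ∈ Finset.Ioc 0 t, (((Λ d / d : ℝ) : ℂ) * χ (d : ZMod q)) * (Lone χ - Sχ χ (t / d))
      + ∑ d ∈ Finset.Ioc 0 t, (((Λ d / d : ℝ) : ℂ) * χ (d : ZMod q)) * Sχ χ (t / d) := by
    rw [← Finset.sum_add_distrib, Mχ, Finset.mul_sum]
    refine Finset.sum_congr rfl fun d _ => by ring
  have h3 : ‖Lone χ‖ * ‖Mχ χ t‖ ≤ C * q + 3 * q := by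
    rw [← norm_mul, e]
    exact (norm_add_le _ _).trans (add_le_add h2 h1)
  have h4 := Lone_lower χ hχ
  have h5 : 1 / (2048 * (q:ℝ)^4) * ‖Mχ χ t‖ ≤ C * q + 3 * q :=
    (mul_le_mul_of_nonneg_right h4 (norm_nonneg _)).trans h3
  rw [one_div_mul_eq_div, div_le_iff₀ (by positivity)] at h5
  calc _ ≤ _ := h5
    _ = _ := by ring

lemma modEq_one_iff {q n : ℕ} (hn : 1 ≤ n) : ((n : ZMod q) = 1) ↔ q ∣ n - 1 := by
  rw [← ZMod.natCast_eq_zero_iff, Nat.cast_sub hn, Nat.cast_one, sub_eq_zero]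

/-- **T2** -/
lemma T2 : ∃ C : ℝ, 0 < C ∧ ∀ q t : ℕ, q.Prime → 1 ≤ t →
    |∑ n ∈ Finset.Ioc 0 t, (if q ∣ n - 1 then lp n / n else 0) - Real.log t / ((q:ℝ) - 1)| ≤ C * (q:ℝ)^5 := by
  obtain ⟨C, hC, hM⟩ := Mχ_bound
  obtain ⟨C1, hC1, hm⟩ := mertens1
  obtain ⟨C2, hC2, hnp⟩ := np_total
  refine ⟨C + C1 + 2 * C2 + 1, by positivity, fun q t hq ht => ?_⟩
  have : Fact q.Prime := ⟨hq⟩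
  have : NeZero q := ⟨hq.ne_zero⟩
  have hq2 : (2:ℝ) ≤ q := by exact_mod_cast hq.two_le
  have hq5 : (1:ℝ) ≤ (q:ℝ)^5 := one_le_pow₀ (by linarith)
  have hqm : 0 < (q:ℝ) - 1 := by linarith
  have htot : ((q.totient : ℕ) : ℂ) = (((q:ℝ) - 1 : ℝ) : ℂ) := by
    rw [Nat.totient_prime hq, Nat.cast_sub hq.one_lt.le]; push_cast; rfl
  set A : ℝ := ∑ n ∈ Finset.Ioc 0 t, (if q ∣ n - 1 then Λ n / n else 0) with hA
  have h1 : (((q:ℝ) - 1) * A : ℝ) = ∑ χ : DirichletCharacter ℂ q, Mχ χ t := by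
    simp only [Mχ]
    rw [Finset.sum_comm, hA, Finset.mul_sum, Complex.ofReal_sum]
    refine Finset.sum_congr rfl fun n hn => ?_
    rw [← Finset.mul_sum, DirichletCharacter.sum_characters_eq ℂ (n : ZMod q), htot]
    have := modEq_one_iff (q := q) (n := n) (Finset.mem_Ioc.1 hn).1
    by_cases h : q ∣ n - 1
    · rw [if_pos h, if_pos (this.2 h)]; push_cast; ring
    · rw [if_neg h, if_neg (fun h' => h (this.1 h'))]; simp
  have hcard : (Fintype.card (DirichletCharacter ℂ q) : ℝ) = (q:ℝ) - 1 := by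
    have := DirichletCharacter.sum_characters_eq ℂ (1 : ZMod q)
    simp only [map_one, if_true, Finset.sum_const, nsmul_eq_mul, mul_one, Finset.card_univ] at this
    rw [htot] at this
    exact_mod_cast this
  -- the principal character
  have hprin : ‖Mχ (1 : DirichletCharacter ℂ q) t - (Real.log t : ℝ)‖ ≤ C1 + 1 + C2 := by
    have e : Mχ (1 : DirichletCharacter ℂ q) t =
        ((∑ n ∈ Finset.Ioc 0 t, Λ n / n - ∑ n ∈ Finset.Ioc 0 t, (if q ∣ n then Λ n / n else 0) : ℝ) : ℂ) := by
      rw [Mχ, ← Finset.sum_sub_distrib, Complex.ofReal_sum]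
      refine Finset.sum_congr rfl fun n hn => ?_
      by_cases h : q ∣ n
      · have : ¬ IsUnit (n : ZMod q) := by
          rw [(ZMod.natCast_eq_zero_iff n q).2 h]; exact not_isUnit_zero
        rw [if_pos h, MulChar.map_nonunit _ this]; simp
      · have : IsUnit (n : ZMod q) := by
          rw [isUnit_iff_ne_zero, Ne, ZMod.natCast_eq_zero_iff]; exact h
        rw [if_neg h, MulChar.one_apply this]; simp
    have hB0 : 0 ≤ ∑ n ∈ Finset.Ioc 0 t, (if q ∣ n then Λ n / n else 0) :=
      Finset.sum_nonneg fun n _ => by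
        split_ifs
        · exact div_nonneg ArithmeticFunction.vonMangoldt_nonneg (Nat.cast_nonneg _)
        · exact le_rfl
    have hB1 : ∑ n ∈ Finset.Ioc 0 t, (if q ∣ n then Λ n / n else 0) ≤ 1 + C2 := by
      have : ∀ n ∈ Finset.Ioc 0 t, (if q ∣ n then Λ n / n else 0) ≤ (if n = q then 1 else 0) + np n / n := by
        intro n hn
        have hn0 : (0:ℝ) < n := by exact_mod_cast (Finset.mem_Ioc.1 hn).1
        have hnn : 0 ≤ np n / n := div_nonneg (np_nonneg n) hn0.le
        by_cases h : q ∣ n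
        · rw [if_pos h, ← lp_add_np]
          by_cases hp : n.Prime
          · have hqn : q = n := (Nat.prime_dvd_prime_iff_eq hq hp).1 h
            rw [if_pos hqn.symm, lp, if_pos hp, add_div]
            have : Real.log n / n ≤ 1 := by
              rw [div_le_one hn0]; have := Real.log_le_sub_one_of_pos hn0; linarith
            linarith
          · rw [lp, if_neg hp, zero_add]
            split_ifs <;> linarith
        · rw [if_neg h]
          split_ifs <;> linarith
      refine (Finset.sum_le_sum this).trans ?_
      rw [Finset.sum_add_distrib]
      refine add_le_add ?_ (hnp t)
      rw [Finset.sum_ite_eq']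
      split_ifs <;> norm_num
    have := hm t ht
    rw [e, ← Complex.ofReal_sub, Complex.norm_real, Real.norm_eq_abs]
    rw [abs_le] at this ⊢
    constructor <;> linarith
  have hothers : ‖∑ χ ∈ Finset.univ.erase (1 : DirichletCharacter ℂ q), Mχ χ t‖ ≤ ((q:ℝ) - 1) * (C * (q:ℝ)^5) := by
    refine (norm_sum_le _ _).trans ?_
    refine (Finset.sum_le_card_nsmul _ _ (C * (q:ℝ)^5) (fun χ hχ => hM q χ (Finset.ne_of_mem_erase hχ) t)).trans ?_
    rw [nsmul_eq_mul, ← hcard]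
    refine mul_le_mul_of_nonneg_right ?_ (by positivity)
    exact_mod_cast Finset.card_le_univ _
  have h2 : |((q:ℝ) - 1) * A - Real.log t| ≤ C1 + 1 + C2 + ((q:ℝ) - 1) * (C * (q:ℝ)^5) := by
    rw [← Real.norm_eq_abs, ← Complex.norm_real, Complex.ofReal_sub, h1,
      ← Finset.add_sum_erase _ _ (Finset.mem_univ (1 : DirichletCharacter ℂ q)), add_sub_right_comm]
    exact (norm_add_le _ _).trans (add_le_add hprin hothers)
  have h3 : |A - Real.log t / ((q:ℝ) - 1)| ≤ (C1 + 1 + C2) + C * (q:ℝ)^5 := by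
    have : A - Real.log t / ((q:ℝ) - 1) = (((q:ℝ) - 1) * A - Real.log t) / ((q:ℝ) - 1) := by field_simp
    rw [this, abs_div, abs_of_pos hqm, div_le_iff₀ hqm]
    refine h2.trans ?_
    have : (C1 + 1 + C2) * 1 ≤ (C1 + 1 + C2) * ((q:ℝ) - 1) := mul_le_mul_of_nonneg_left (by linarith) (by positivity)
    linarith
  have h4 : |A - ∑ n ∈ Finset.Ioc 0 t, (if q ∣ n - 1 then lp n / n else 0)| ≤ C2 := by
    rw [hA, ← Finset.sum_sub_distrib]
    refine (Finset.abs_sum_le_sum_abs _ _).trans (le_trans (Finset.sum_le_sum fun n hn => ?_) (hnp t))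
    have hn0 : (0:ℝ) < n := by exact_mod_cast (Finset.mem_Ioc.1 hn).1
    have hnn : 0 ≤ np n / n := div_nonneg (np_nonneg n) hn0.le
    split_ifs
    · rw [← lp_add_np, add_div, add_sub_cancel_left, abs_of_nonneg hnn]
    · simpa using hnn
  rw [abs_le] at h3 h4 ⊢
  have h5 : (C1 + 2 * C2 + 1) * 1 ≤ (C1 + 2 * C2 + 1) * (q:ℝ)^5 := mul_le_mul_of_nonneg_left hq5 (by positivity)
  constructor <;> nlinarith

lemma LL_nonneg {t : ℕ} (ht : 3 ≤ t) : 0 ≤ LL t := by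
  refine Real.log_nonneg ?_
  have h : (3:ℝ) ≤ t := by exact_mod_cast ht
  rw [Real.le_log_iff_exp_le (by linarith)]
  linarith [Real.exp_one_lt_three]

/-- sum of `1/p` over primes `p ≤ t`, `p ≡ 1 (mod q)` -/
noncomputable def AP (q t : ℕ) : ℝ := ∑ p ∈ (Pr t).filter (fun p => q ∣ p - 1), 1 / (p:ℝ)

lemma AP_eq (q t : ℕ) : AP q t = ∑ n ∈ Finset.Ioc 0 t, if q ∣ n - 1 then pinv n else 0 := by
  rw [AP, Finset.sum_filter, sum_Pr]
  refine Finset.sum_congr rfl fun n _ => ?_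
  unfold pinv
  split_ifs <;> rfl

lemma AP_nonneg (q t : ℕ) : 0 ≤ AP q t := Finset.sum_nonneg fun _ _ => by positivity

lemma AP_mono (q : ℕ) {s t : ℕ} (h : s ≤ t) : AP q s ≤ AP q t := by
  refine Finset.sum_le_sum_of_subset_of_nonneg ?_ (fun _ _ _ => by positivity)
  exact Finset.filter_subset_filter _ (Pr_subset h)

/-- **T2''** -/
lemma T2pp : ∃ C : ℝ, 0 < C ∧ ∀ q t : ℕ, q.Prime → 3 ≤ t →
    |AP q t - LL t / ((q:ℝ) - 1)| ≤ C * Real.log q / q := by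
  obtain ⟨C, hC, hT1⟩ := T1
  obtain ⟨D, hD, hT2⟩ := T2
  have small : ∀ q t : ℕ, q.Prime → 3 ≤ t → t ≤ 2 ^ (q ^ 6) →
      |AP q t - LL t / ((q:ℝ) - 1)| ≤ 12 * (C + 1) * Real.log q / q := by
    intro q t hq ht ht2
    have hq2 : (2:ℝ) ≤ q := by exact_mod_cast hq.two_le
    have hlq : 0 < Real.log q := log_pos_nat hq.two_le
    have hqm : 0 < (q:ℝ) - 1 := by linarith
    have h64 : 2 ^ 6 ≤ q ^ 6 := Nat.pow_le_pow_left hq.two_le 6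
    have hbig : 16 ≤ 2 ^ (q ^ 6) := by
      calc 16 = 2 ^ 4 := by norm_num
        _ ≤ 2 ^ (q ^ 6) := Nat.pow_le_pow_right (by norm_num) (by omega)
    have hLL : LL (2 ^ (q ^ 6) : ℕ) ≤ 6 * Real.log q := by
      unfold LL
      push_cast
      rw [Real.log_pow, Real.log_mul (by positivity) (Real.log_pos (by norm_num)).ne']
      push_cast
      rw [Real.log_pow]
      have : Real.log (Real.log 2) ≤ 0 := Real.log_nonpos (Real.log_pos (by norm_num)).le (by
        have := Real.log_two_lt_d9; linarith)
      push_cast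
      linarith
    have h1 : AP q t ≤ C * (6 * Real.log q) / ((q:ℝ) - 1) := by
      refine (AP_mono q ht2).trans ((hT1 q _ hq.one_lt.le hbig).trans ?_)
      rw [Nat.totient_prime hq, Nat.cast_sub hq.one_lt.le, Nat.cast_one]
      exact div_le_div_of_nonneg_right (mul_le_mul_of_nonneg_left hLL hC.le) hqm.le
    have h2 : LL t / ((q:ℝ) - 1) ≤ 6 * Real.log q / ((q:ℝ) - 1) :=
      div_le_div_of_nonneg_right ((LL_mono (by omega) ht2).trans hLL) hqm.le
    have h3 : 0 ≤ LL t / ((q:ℝ) - 1) := div_nonneg (LL_nonneg ht) hqm.le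
    have h4 := AP_nonneg q t
    have h5 : 1 / ((q:ℝ) - 1) ≤ 2 / q := by
      rw [div_le_div_iff₀ hqm (by linarith)]; linarith
    have h6 : (C + 1) * (6 * Real.log q) / ((q:ℝ) - 1) ≤ 12 * (C + 1) * Real.log q / q := by
      calc (C + 1) * (6 * Real.log q) / ((q:ℝ) - 1) = (C + 1) * (6 * Real.log q) * (1 / ((q:ℝ) - 1)) := by ring
        _ ≤ (C + 1) * (6 * Real.log q) * (2 / q) := mul_le_mul_of_nonneg_left h5 (by positivity)
        _ = _ := by ring
    have h7 : (C + 1) * (6 * Real.log q) / ((q:ℝ) - 1) = C * (6 * Real.log q) / ((q:ℝ) - 1) + 6 * Real.log q / ((q:ℝ) - 1) := by ring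
    rw [abs_le]; constructor <;> linarith [div_nonneg (by positivity : 0 ≤ C * (6 * Real.log q)) hqm.le, div_nonneg (by positivity : 0 ≤ (6 * Real.log q)) hqm.le]
  refine ⟨12 * (C + 1) + 4 * (2 * D + 3), by positivity, fun q t hq ht => ?_⟩
  have hq2 : (2:ℝ) ≤ q := by exact_mod_cast hq.two_le
  have hq0 : (0:ℝ) < q := by linarith
  have hlq : 0 < Real.log q := log_pos_nat hq.two_le
  have hqm : 0 < (q:ℝ) - 1 := by linarith
  have hlq2 : 1 / 2 ≤ Real.log q := by
    have := Real.log_two_gt_d9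
    have := Real.log_le_log (by norm_num) hq2
    linarith
  rcases le_or_gt t (2 ^ (q ^ 6)) with h | h
  · refine (small q t hq ht h).trans ?_
    refine div_le_div_of_nonneg_right ?_ hq0.le
    refine mul_le_mul_of_nonneg_right ?_ hlq.le
    linarith
  set a : ℕ := 2 ^ (q ^ 6) with ha
  have h64 : 2 ^ 6 ≤ q ^ 6 := Nat.pow_le_pow_left hq.two_le 6
  have ha3 : 3 ≤ a := by
    calc 3 ≤ 2 ^ 4 := by norm_num
      _ ≤ 2 ^ (q ^ 6) := Nat.pow_le_pow_right (by norm_num) (by omega)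
  have h1 := small q a hq ha3 le_rfl
  set κ : ℝ := 1 / ((q:ℝ) - 1) with hκ
  have hκ1 : κ ≤ 1 := by rw [hκ, div_le_one hqm]; linarith
  have hκ0 : 0 < κ := by positivity
  have hq5 : (1:ℝ) ≤ (q:ℝ)^5 := one_le_pow₀ (by linarith)
  have h2 := transfer (fun n => if q ∣ n - 1 then lp n / n else 0) κ (2 * (D * (q:ℝ)^5) + 2) a t (by omega) h.le (by
    intro b hab hb
    have e1 := hT2 q a hq (by omega)
    have e2 := hT2 q b hq (by omega)
    have e3 := sum_inv_approx (t := a) (by omega)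
    have e4 := sum_inv_approx (t := b) (by omega)
    rw [← Ioc_sub _ hab, Finset.sum_sub_distrib, Finset.sum_sub_distrib, ← Finset.mul_sum, ← Finset.mul_sum]
    set S1 := ∑ n ∈ Finset.Ioc 0 a, (if q ∣ n - 1 then lp n / n else 0)
    set S2 := ∑ n ∈ Finset.Ioc 0 b, (if q ∣ n - 1 then lp n / n else 0)
    set H1 := ∑ n ∈ Finset.Ioc 0 a, 1 / (n:ℝ)
    set H2 := ∑ n ∈ Finset.Ioc 0 b, 1 / (n:ℝ)
    have : S2 - κ * H2 - (S1 - κ * H1) = (S2 - Real.log b / ((q:ℝ) - 1)) - (S1 - Real.log a / ((q:ℝ) - 1))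
        - κ * (H2 - Real.log b) + κ * (H1 - Real.log a) := by rw [hκ]; ring
    rw [this]
    have f1 : |κ * (H2 - Real.log b)| ≤ 1 := by
      rw [abs_mul, abs_of_pos hκ0]; exact mul_le_one₀ hκ1 (abs_nonneg _) e4
    have f2 : |κ * (H1 - Real.log a)| ≤ 1 := by
      rw [abs_mul, abs_of_pos hκ0]; exact mul_le_one₀ hκ1 (abs_nonneg _) e3
    rw [abs_le] at *
    constructor <;> linarith)
  have e0 : AP q t - AP q a = ∑ n ∈ Finset.Ioc a t, (if q ∣ n - 1 then lp n / n else 0) / Real.log n := by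
    rw [AP_eq, AP_eq, Ioc_sub _ h.le]
    refine Finset.sum_congr rfl fun n _ => ?_
    split_ifs
    · rw [lp_div_log]
    · simp
  rw [← e0] at h2
  have hla : Real.log a = (q:ℝ)^6 * Real.log 2 := by
    rw [ha]; push_cast; rw [Real.log_pow]; push_cast; ring
  have h3 : (2 * (D * (q:ℝ)^5) + 2 + |κ|) / Real.log a ≤ 4 * (2 * D + 3) * Real.log q / q := by
    rw [abs_of_pos hκ0, hla]
    have l2 : (1:ℝ)/2 ≤ Real.log 2 := by linarith [Real.log_two_gt_d9]
    have g1 : 2 * (D * (q:ℝ)^5) + 2 + κ ≤ (2 * D + 3) * (q:ℝ)^5 := by nlinarith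
    calc _ ≤ (2 * D + 3) * (q:ℝ)^5 / ((q:ℝ)^6 * (1 / 2)) := by
          refine div_le_div₀ (by positivity) g1 (by positivity) (mul_le_mul_of_nonneg_left l2 (by positivity))
      _ = 4 * (2 * D + 3) * (1 / 2) / q := by field_simp; ring
      _ ≤ _ := div_le_div_of_nonneg_right (mul_le_mul_of_nonneg_left hlq2 (by positivity)) hq0.le
  have h4 : AP q t - LL t / ((q:ℝ) - 1) = (AP q a - LL a / ((q:ℝ) - 1)) + (AP q t - AP q a - κ * (LL t - LL a)) := by
    rw [hκ]; ring
  rw [h4]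
  refine (abs_add_le _ _).trans ?_
  have h5 := h2.trans h3
  have : (12 * (C + 1) + 4 * (2 * D + 3)) * Real.log q / q = 12 * (C + 1) * Real.log q / q + 4 * (2 * D + 3) * Real.log q / q := by ring
  linarith

end ICM

namespace ICM
open scoped ArithmeticFunction.vonMangoldt

lemma range_sum_zmod {E : Type*} [AddCommMonoid E] {q : ℕ} [NeZero q] (F : ZMod q → E) :
    ∑ i ∈ Finset.range q, F (i : ZMod q) = ∑ a, F a := by
  refine Finset.sum_nbij' (fun i => (i : ZMod q)) ZMod.val ?_ ?_ ?_ ?_ ?_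
  · simp
  · intro a _; simpa using ZMod.val_lt a
  · intro a ha; exact ZMod.val_cast_of_lt (by simpa using ha)
  · intro a _; simp
  · intros; rfl

/-- the discrepancy function on residues -/
noncomputable def Dz (r : ℕ) (a : ZMod r) : ℝ :=
  (if a = 1 then 1 else 0) - (if a = 0 then 0 else 1 / ((r:ℝ) - 1))

/-- the discrepancy function -/
noncomputable def Dl (r n : ℕ) : ℝ := Dz r (n : ZMod r)

lemma Dz_sum {r : ℕ} (hr : r.Prime) (m : ℕ) [NeZero r] : ∑ a : ZMod r, Dz r ((m : ZMod r) * a) = 0 := by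
  have : Fact r.Prime := ⟨hr⟩
  have hr2 : (2:ℝ) ≤ r := by exact_mod_cast hr.two_le
  by_cases h : (m : ZMod r) = 0
  · simp [h, Dz]
  · have e : ∑ a : ZMod r, Dz r ((m : ZMod r) * a) = ∑ a : ZMod r, Dz r a :=
      Fintype.sum_bijective _ (mulLeft_bijective₀ _ h) _ _ (fun _ => rfl)
    rw [e]
    simp only [Dz, Finset.sum_sub_distrib]
    have e2 : ∑ a : ZMod r, (if a = 0 then (0:ℝ) else 1 / ((r:ℝ) - 1)) =
        ∑ a : ZMod r, (1 / ((r:ℝ) - 1)) - ∑ a : ZMod r, (if a = 0 then 1 / ((r:ℝ) - 1) else 0) := by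
      rw [← Finset.sum_sub_distrib]
      refine Finset.sum_congr rfl fun a _ => ?_
      split_ifs <;> ring
    rw [e2]
    simp only [Finset.sum_ite_eq', Finset.mem_univ, if_true, Finset.sum_const, Finset.card_univ, ZMod.card, nsmul_eq_mul]
    have : (r:ℝ) - 1 ≠ 0 := by linarith
    field_simp
    ring

lemma Dl_period (r m n : ℕ) : Dl r (m * (n + r)) = Dl r (m * n) := by simp [Dl]

lemma Dl_sum {r : ℕ} (hr : r.Prime) (m : ℕ) : ∑ k ∈ Finset.range r, Dl r (m * k) = 0 := by
  have : NeZero r := ⟨hr.ne_zero⟩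
  rw [← Dz_sum hr m, ← range_sum_zmod]
  simp [Dl]

lemma Dl_abs {r : ℕ} (hr : r.Prime) (n : ℕ) : |Dl r n| ≤ 1 := by
  have hr2 : (2:ℝ) ≤ r := by exact_mod_cast hr.two_le
  have : Fact r.Prime := ⟨hr⟩
  have h1 : 0 < 1 / ((r:ℝ) - 1) := by apply one_div_pos.2; linarith
  have h2 : 1 / ((r:ℝ) - 1) ≤ 1 := by rw [div_le_one] <;> linarith
  unfold Dl Dz
  split_ifs <;> rw [abs_le] <;> constructor <;> linarith

lemma Dl_prod_sum {r s : ℕ} (hr : r.Prime) (hs : s.Prime) (hrs : r ≠ s) (m n : ℕ) :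
    ∑ k ∈ Finset.range (r * s), Dl r (m * k) * Dl s (n * k) = 0 := by
  have : NeZero r := ⟨hr.ne_zero⟩
  have : NeZero s := ⟨hs.ne_zero⟩
  have hco : Nat.Coprime r s := (Nat.coprime_primes hr hs).2 hrs
  let e := ZMod.chineseRemainder hco
  have h1 : ∑ k ∈ Finset.range (r * s), Dl r (m * k) * Dl s (n * k) =
      ∑ a : ZMod (r * s), Dz r ((m : ZMod r) * (e a).1) * Dz s ((n : ZMod s) * (e a).2) := by
    rw [← range_sum_zmod]
    refine Finset.sum_congr rfl fun k _ => ?_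
    simp [Dl]
  have h2 : ∑ a : ZMod (r * s), Dz r ((m : ZMod r) * (e a).1) * Dz s ((n : ZMod s) * (e a).2) =
      ∑ p : ZMod r × ZMod s, Dz r ((m : ZMod r) * p.1) * Dz s ((n : ZMod s) * p.2) :=
    Fintype.sum_equiv e.toEquiv _ _ (fun _ => rfl)
  rw [h1, h2, Fintype.sum_prod_type]
  change ∑ x : ZMod r, ∑ y : ZMod s, Dz r ((m : ZMod r) * x) * Dz s ((n : ZMod s) * y) = 0
  rw [← Finset.sum_mul_sum, Dz_sum hr, zero_mul]

lemma Dl_PL {r : ℕ} (hr : r.Prime) (m : ℕ) (w : ℕ → ℝ) (a b : ℕ) (hw : ∀ k, a < k → w (k + 1) ≤ w k)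
    (hw0 : ∀ k, a < k → 0 ≤ w k) : |∑ k ∈ Finset.Ioc a b, w k * Dl r (m * k)| ≤ w (a + 1) * r := by
  have := PL w (fun k => Dl r (m * k)) r hr.pos (fun n => Dl_period r m n) (Dl_sum hr m) 1
    (fun n => Dl_abs hr _) a b hw hw0
  simpa using this

lemma Dl_prod_PL {r s : ℕ} (hr : r.Prime) (hs : s.Prime) (hrs : r ≠ s) (m n : ℕ) (a b : ℕ) :
    |∑ k ∈ Finset.Ioc a b, (1 / (k:ℝ)) * (Dl r (k * m) * Dl s (k * n))| ≤ (1 / ((a:ℝ) + 1)) * (r * s) := by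
  have := PL (fun k => 1 / (k:ℝ)) (fun k => Dl r (m * k) * Dl s (n * k)) (r * s) (Nat.mul_pos hr.pos hs.pos)
    (fun k => by simp [Dl]) (Dl_prod_sum hr hs hrs m n) 1
    (fun k => by
      rw [norm_mul]; exact mul_le_one₀ (Dl_abs hr _) (norm_nonneg _) (Dl_abs hs _)) a b
    (fun k hk => by
      have : (0:ℝ) < k := by exact_mod_cast (by omega : 0 < k)
      exact one_div_le_one_div_of_le this (by push_cast; linarith))
    (fun k _ => by positivity)
  simp only [smul_eq_mul, mul_one, Real.norm_eq_abs] at this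
  push_cast at this
  simpa [mul_comm] using this

lemma sum_antidiag_Ioc {E : Type*} [AddCommGroup E] (F : ℕ → ℕ → E) {M N : ℕ} (h : M ≤ N) :
    ∑ n ∈ Finset.Ioc M N, ∑ x ∈ n.divisorsAntidiagonal, F x.1 x.2 =
      ∑ a ∈ Finset.Ioc 0 N, ∑ b ∈ Finset.Ioc (M / a) (N / a), F a b := by
  rw [← Ioc_sub _ h, sum_antidiag, sum_antidiag]
  have : ∑ a ∈ Finset.Ioc 0 M, ∑ b ∈ Finset.Ioc 0 (M / a), F a b = ∑ a ∈ Finset.Ioc 0 N, ∑ b ∈ Finset.Ioc 0 (M / a), F a b := by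
    refine Finset.sum_subset (Finset.Ioc_subset_Ioc le_rfl h) (fun a ha hb => ?_)
    simp only [Finset.mem_Ioc, not_and, not_le] at ha hb
    rw [Nat.div_eq_of_lt (hb ha.1)]; simp
  rw [this, ← Finset.sum_sub_distrib]
  exact Finset.sum_congr rfl fun a _ => Ioc_sub _ (Nat.div_le_div_right h)

/-- truncation of an arithmetic function -/
noncomputable def trc (f : ArithmeticFunction ℝ) (U : ℕ) : ArithmeticFunction ℝ :=
  ⟨fun n => if n ≤ U then f n else 0, by simp⟩

lemma trc_apply (f : ArithmeticFunction ℝ) (U n : ℕ) : trc f U n = if n ≤ U then f n else 0 := rfl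

/-- Vaughan's identity -/
lemma vaughan (M L1 : ArithmeticFunction ℝ) :
    Λ - L1 = M * ArithmeticFunction.log - (M * L1) * (ArithmeticFunction.zeta : ArithmeticFunction ℝ)
      + ((ArithmeticFunction.moebius : ArithmeticFunction ℝ) - M) *
        ((ArithmeticFunction.zeta : ArithmeticFunction ℝ) * (Λ - L1)) := by
  have h1 : (ArithmeticFunction.moebius : ArithmeticFunction ℝ) * (ArithmeticFunction.zeta : ArithmeticFunction ℝ) = 1 :=
    ArithmeticFunction.coe_moebius_mul_coe_zeta
  have h2 : Λ * (ArithmeticFunction.zeta : ArithmeticFunction ℝ) = ArithmeticFunction.log :=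
    ArithmeticFunction.vonMangoldt_mul_zeta
  rw [← h2]
  linear_combination (-(Λ - L1)) * h1

end ICM

namespace ICM
open scoped ArithmeticFunction.vonMangoldt

lemma sum_inv_le_L (N : ℕ) (hN : 1 ≤ N) (a : ℕ) : ∑ m ∈ Finset.Ioc a N, 1 / (m:ℝ) ≤ 1 + Real.log N := by
  have h1 := (abs_le.1 (sum_inv_approx (t := N) hN)).2
  have h2 : ∑ m ∈ Finset.Ioc a N, 1 / (m:ℝ) ≤ ∑ m ∈ Finset.Ioc 0 N, 1 / (m:ℝ) :=
    Finset.sum_le_sum_of_subset_of_nonneg (Finset.Ioc_subset_Ioc (Nat.zero_le _) le_rfl) (fun _ _ _ => by positivity)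
  linarith

lemma conv_sum (f g : ArithmeticFunction ℝ) (D : ℕ → ℝ) {M N : ℕ} (h : M ≤ N) :
    ∑ n ∈ Finset.Ioc M N, (f * g) n / n * D n =
      ∑ a ∈ Finset.Ioc 0 N, f a / a * ∑ b ∈ Finset.Ioc (M / a) (N / a), g b / b * D (a * b) := by
  have := sum_antidiag_Ioc (fun a b => f a / a * (g b / b * D (a * b))) h
  simp only [← Finset.mul_sum] at this
  rw [← this]
  refine Finset.sum_congr rfl fun n hn => ?_
  rw [ArithmeticFunction.mul_apply, Finset.sum_div, Finset.sum_mul]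
  refine Finset.sum_congr rfl fun x hx => ?_
  have hx' := (Nat.mem_divisorsAntidiagonal.1 hx).1
  rw [← hx']
  push_cast
  rw [← mul_assoc, div_mul_div_comm]

/-- sum of discrepancies with coefficients -/
noncomputable def DD (S : Finset ℕ) (c : ℕ → ℝ) (n : ℕ) : ℝ := ∑ r ∈ S, c r * Dl r n

lemma card_S {R : ℕ} {S : Finset ℕ} (hS : ∀ r ∈ S, r.Prime ∧ R < r ∧ r ≤ R ^ 2) : (S.card : ℝ) ≤ (R:ℝ) ^ 2 := by
  have : S ⊆ Finset.Ioc 0 (R ^ 2) := fun r hr => Finset.mem_Ioc.2 ⟨(hS r hr).1.pos, (hS r hr).2.2⟩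
  have := Finset.card_le_card this
  rw [Nat.card_Ioc] at this
  exact_mod_cast this

lemma sum_S_le {R : ℕ} {S : Finset ℕ} (hS : ∀ r ∈ S, r.Prime ∧ R < r ∧ r ≤ R ^ 2) (c : ℕ → ℝ)
    (hc : ∀ r, |c r| ≤ 1) (f : ℕ → ℝ) (B : ℝ) (hB : ∀ r ∈ S, |f r| ≤ B) (hB0 : 0 ≤ B) :
    |∑ r ∈ S, c r * f r| ≤ (R:ℝ) ^ 2 * B := by
  calc |∑ r ∈ S, c r * f r| ≤ ∑ r ∈ S, |c r * f r| := Finset.abs_sum_le_sum_abs _ _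
    _ ≤ ∑ r ∈ S, B := Finset.sum_le_sum fun r hr => by
        rw [abs_mul]
        calc |c r| * |f r| ≤ 1 * B := mul_le_mul (hc r) (hB r hr) (abs_nonneg _) zero_le_one
          _ = B := one_mul B
    _ = S.card * B := by simp
    _ ≤ _ := mul_le_mul_of_nonneg_right (card_S hS) hB0

lemma DD_abs {R : ℕ} {S : Finset ℕ} (hS : ∀ r ∈ S, r.Prime ∧ R < r ∧ r ≤ R ^ 2) (c : ℕ → ℝ)
    (hc : ∀ r, |c r| ≤ 1) (n : ℕ) : |DD S c n| ≤ (R:ℝ) ^ 2 := by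
  have := sum_S_le hS c hc (fun r => Dl r n) 1 (fun r hr => Dl_abs (hS r hr).1 n) zero_le_one
  simpa [DD] using this

lemma typeI {R : ℕ} (hR : 2 ≤ R) {S : Finset ℕ} (hS : ∀ r ∈ S, r.Prime ∧ R < r ∧ r ≤ R ^ 2) (c : ℕ → ℝ)
    (hc : ∀ r, |c r| ≤ 1) (f g : ArithmeticFunction ℝ) (F W : ℝ) (hf : ∀ a, |f a| ≤ F)
    (hf0 : ∀ a, R ^ 20 < a → f a = 0) (hg : ∀ k : ℕ, R ^ 10 < k → g (k + 1) / ((k + 1 : ℕ):ℝ) ≤ g k / k)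
    (hg0 : ∀ k, 0 ≤ g k) (hW : ∀ k : ℕ, R ^ 10 < k → g k / k ≤ W) (N : ℕ) (hN : R ^ 30 ≤ N) :
    |∑ n ∈ Finset.Ioc (R ^ 30) N, (f * g) n / n * DD S c n| ≤ F * W * (R:ℝ) ^ 4 * (1 + Real.log N) := by
  have hF : 0 ≤ F := (abs_nonneg _).trans (hf 0)
  have hW0 : 0 ≤ W := le_trans (div_nonneg (hg0 _) (Nat.cast_nonneg _)) (hW (R ^ 10 + 1) (by omega))
  have hR0 : 0 < R := by omega
  rw [conv_sum f g _ hN]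
  have key : ∀ a ∈ Finset.Ioc 0 N, |f a / a * ∑ b ∈ Finset.Ioc (R ^ 30 / a) (N / a), g b / b * DD S c (a * b)|
      ≤ F * W * (R:ℝ) ^ 4 * (1 / (a:ℝ)) := by
    intro a ha
    have ha0 : 0 < a := (Finset.mem_Ioc.1 ha).1
    by_cases h : R ^ 20 < a
    · rw [hf0 a h]; simp; positivity
    push Not at h
    have hdiv : R ^ 10 ≤ R ^ 30 / a := by
      rw [Nat.le_div_iff_mul_le ha0]
      calc R ^ 10 * a ≤ R ^ 10 * R ^ 20 := Nat.mul_le_mul_left _ h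
        _ = R ^ 30 := by ring
    have e1 : ∑ b ∈ Finset.Ioc (R ^ 30 / a) (N / a), g b / b * DD S c (a * b) =
        ∑ r ∈ S, c r * ∑ b ∈ Finset.Ioc (R ^ 30 / a) (N / a), (g b / b) * Dl r (a * b) := by
      simp only [DD, Finset.mul_sum]
      rw [Finset.sum_comm]
      exact Finset.sum_congr rfl fun r _ => Finset.sum_congr rfl fun b _ => by ring
    have e2 : |∑ b ∈ Finset.Ioc (R ^ 30 / a) (N / a), g b / b * DD S c (a * b)| ≤ (R:ℝ) ^ 2 * (W * (R:ℝ) ^ 2) := by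
      rw [e1]
      refine sum_S_le hS c hc _ _ (fun r hr => ?_) (by positivity)
      refine (Dl_PL (hS r hr).1 a (fun b => g b / b) _ _ (fun k hk => hg k (by omega))
        (fun k _ => div_nonneg (hg0 _) (Nat.cast_nonneg _))).trans ?_
      refine mul_le_mul (hW _ (by omega)) ?_ (Nat.cast_nonneg _) hW0
      exact_mod_cast (hS r hr).2.2
    rw [abs_mul, abs_div, Nat.abs_cast]
    calc |f a| / a * _ ≤ F / a * ((R:ℝ) ^ 2 * (W * (R:ℝ) ^ 2)) := by
          refine mul_le_mul ?_ e2 (abs_nonneg _) (by positivity)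
          exact div_le_div_of_nonneg_right (hf a) (Nat.cast_nonneg _)
      _ = _ := by ring
  refine (Finset.abs_sum_le_sum_abs _ _).trans ((Finset.sum_le_sum key).trans ?_)
  rw [← Finset.mul_sum]
  refine mul_le_mul_of_nonneg_left (sum_inv_le_L N ?_ 0) (by positivity)
  exact (Nat.one_le_pow _ _ hR0).trans hN

end ICM

namespace ICM
open scoped ArithmeticFunction.vonMangoldt

lemma Dl_abs_le {r : ℕ} (hr : r.Prime) (n : ℕ) : |Dl r n| ≤ Dl r n + 2 / ((r:ℝ) - 1) := by
  have hr2 : (2:ℝ) ≤ r := by exact_mod_cast hr.two_le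
  have : Fact r.Prime := ⟨hr⟩
  have h1 : 0 < 1 / ((r:ℝ) - 1) := by apply one_div_pos.2; linarith
  have h2 : 2 / ((r:ℝ) - 1) = 2 * (1 / ((r:ℝ) - 1)) := by ring
  rw [h2]
  unfold Dl Dz
  split_ifs <;> rw [abs_le] <;> constructor <;> linarith

/-- inner sums of the type II estimate -/
noncomputable def XX (β : ℕ → ℝ) (M N r m : ℕ) : ℝ :=
  ∑ v ∈ Finset.Ioc (M / m) (N / m), β v / v * Dl r (m * v)

lemma XX_eq (β : ℕ → ℝ) (U M N r m : ℕ) (hm : 0 < m) (hβ : ∀ v, v ≤ U → β v = 0) :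
    XX β M N r m = ∑ v ∈ Finset.Ioc U N, if M < m * v ∧ m * v ≤ N then β v / v * Dl r (m * v) else 0 := by
  unfold XX
  rw [← Finset.sum_filter]
  symm
  refine Finset.sum_subset (fun v hv => ?_) (fun v hv hv2 => ?_)
  · simp only [Finset.mem_filter, Finset.mem_Ioc] at hv ⊢
    rw [Nat.div_lt_iff_lt_mul hm, Nat.le_div_iff_mul_le hm, mul_comm v m]
    exact hv.2
  · simp only [Finset.mem_filter, Finset.mem_Ioc, not_and] at hv hv2
    rw [Nat.div_lt_iff_lt_mul hm, Nat.le_div_iff_mul_le hm, mul_comm v m] at hv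
    have : v ≤ U := by
      by_contra hU
      push Not at hU
      exact hv2 ⟨hU, (Nat.le_mul_of_pos_left v hm).trans hv.2⟩ hv.1 hv.2
    rw [hβ v this]; simp

lemma XX_bound {R : ℕ} (hR : 2 ≤ R) (β : ℕ → ℝ) (H : ℝ) (M N r m : ℕ) (hN : 1 ≤ N) (hm : 0 < m) (hr : r.Prime)
    (hrR : r ≤ R ^ 2)
    (hβ : ∀ v, v ≤ R ^ 10 → β v = 0) (hH : ∀ v, v ≤ N → |β v| ≤ H) :
    |XX β M N r m| ≤ 5 * H * (1 + Real.log N) / r := by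
  have hH0 : 0 ≤ H := (abs_nonneg _).trans (hH 0 (Nat.zero_le _))
  have hR0 : (2:ℝ) ≤ R := by exact_mod_cast hR
  have hr2 : (2:ℝ) ≤ r := by exact_mod_cast hr.two_le
  have hrR' : (r:ℝ) ≤ (R:ℝ) ^ 2 := by exact_mod_cast hrR
  have hL : 1 ≤ 1 + Real.log N := by
    have : 0 ≤ Real.log N := Real.log_natCast_nonneg N
    linarith
  rw [XX_eq β (R ^ 10) M N r m hm hβ]
  have h1 : |∑ v ∈ Finset.Ioc (R ^ 10) N, if M < m * v ∧ m * v ≤ N then β v / v * Dl r (m * v) else 0| ≤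
      ∑ v ∈ Finset.Ioc (R ^ 10) N, H * (1 / (v:ℝ) * Dl r (m * v) + 2 / ((r:ℝ) - 1) * (1 / (v:ℝ))) := by
    refine (Finset.abs_sum_le_sum_abs _ _).trans (Finset.sum_le_sum fun v hv => ?_)
    have hD := Dl_abs_le hr (m * v)
    have hb := hH v (Finset.mem_Ioc.1 hv).2
    have : |β v / v * Dl r (m * v)| ≤ H * (1 / (v:ℝ) * Dl r (m * v) + 2 / ((r:ℝ) - 1) * (1 / (v:ℝ))) := by
      rw [abs_mul, abs_div, Nat.abs_cast]
      calc |β v| / v * |Dl r (m * v)| ≤ H / v * (Dl r (m * v) + 2 / ((r:ℝ) - 1)) :=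
            mul_le_mul (div_le_div_of_nonneg_right hb (Nat.cast_nonneg _)) hD (abs_nonneg _) (by positivity)
        _ = _ := by ring
    split_ifs
    · exact this
    · rw [abs_zero]; exact (abs_nonneg _).trans this
  refine h1.trans ?_
  rw [← Finset.mul_sum, Finset.sum_add_distrib, ← Finset.mul_sum]
  have h2 := (le_abs_self _).trans (Dl_PL hr m (fun k => 1 / (k:ℝ)) (R ^ 10) N (fun k hk => by
      have : (0:ℝ) < k := by exact_mod_cast (by omega : 0 < k)
      exact one_div_le_one_div_of_le this (by push_cast; linarith)) (fun k _ => by positivity))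
  have h3 := sum_inv_le_L N hN (R ^ 10)
  have h4 : 1 / (((R ^ 10 + 1 : ℕ)):ℝ) * r ≤ 1 / r := by
    rw [div_mul_eq_mul_div, one_mul, div_le_div_iff₀ (by positivity) (by positivity)]
    push_cast
    calc (r:ℝ) * r ≤ (R:ℝ) ^ 2 * (R:ℝ) ^ 2 := by gcongr
      _ = (R:ℝ) ^ 4 := by ring
      _ ≤ (R:ℝ) ^ 10 := pow_le_pow_right₀ (by linarith) (by norm_num)
      _ ≤ _ := by linarith
  have h5 : 2 / ((r:ℝ) - 1) ≤ 4 / r := by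
    rw [div_le_div_iff₀ (by linarith) (by linarith)]; linarith
  have h6 : 2 / ((r:ℝ) - 1) * ∑ i ∈ Finset.Ioc (R ^ 10) N, 1 / (i:ℝ) ≤ 4 / r * (1 + Real.log N) :=
    mul_le_mul h5 h3 (Finset.sum_nonneg fun _ _ => by positivity) (by positivity)
  calc H * _ ≤ H * (1 / r + 4 / r * (1 + Real.log N)) :=
        mul_le_mul_of_nonneg_left (add_le_add (h2.trans h4) h6) hH0
    _ ≤ H * (1 / r * (1 + Real.log N) + 4 / r * (1 + Real.log N)) := by
        refine mul_le_mul_of_nonneg_left (add_le_add ?_ le_rfl) hH0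
        exact le_mul_of_one_le_right (by positivity) hL
    _ = _ := by ring

lemma XX_cross {R : ℕ} (hR : 2 ≤ R) (β : ℕ → ℝ) (H : ℝ) (M N r s : ℕ) (hN : 1 ≤ N) (hr : r.Prime) (hs : s.Prime)
    (hrs : r ≠ s) (hrR : r ≤ R ^ 2) (hsR : s ≤ R ^ 2)
    (hβ : ∀ v, v ≤ R ^ 10 → β v = 0) (hH : ∀ v, v ≤ N → |β v| ≤ H) :
    |∑ m ∈ Finset.Ioc (R ^ 10) N, 1 / (m:ℝ) * (XX β M N r m * XX β M N s m)| ≤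
      (H * (1 + Real.log N)) ^ 2 / (R:ℝ) ^ 6 := by
  have hH0 : 0 ≤ H := (abs_nonneg _).trans (hH 0 (Nat.zero_le _))
  have hR0 : (2:ℝ) ≤ R := by exact_mod_cast hR
  have hrR' : (r:ℝ) ≤ (R:ℝ) ^ 2 := by exact_mod_cast hrR
  have hsR' : (s:ℝ) ≤ (R:ℝ) ^ 2 := by exact_mod_cast hsR
  set I := Finset.Ioc (R ^ 10) N with hI
  have e1 : ∑ m ∈ I, 1 / (m:ℝ) * (XX β M N r m * XX β M N s m) =
      ∑ v ∈ I, ∑ v' ∈ I, (β v / v) * (β v' / v') * ∑ m ∈ I,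
        if (M < m * v ∧ m * v ≤ N) ∧ (M < m * v' ∧ m * v' ≤ N) then
          1 / (m:ℝ) * (Dl r (m * v) * Dl s (m * v')) else 0 := by
    have : ∀ m ∈ I, 1 / (m:ℝ) * (XX β M N r m * XX β M N s m) =
        ∑ v ∈ I, ∑ v' ∈ I, (β v / v) * (β v' / v') *
        if (M < m * v ∧ m * v ≤ N) ∧ (M < m * v' ∧ m * v' ≤ N) then
          1 / (m:ℝ) * (Dl r (m * v) * Dl s (m * v')) else 0 := by
      intro m hm
      have hm0 : 0 < m := by have := (Finset.mem_Ioc.1 hm).1; omega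
      rw [XX_eq β (R ^ 10) M N r m hm0 hβ, XX_eq β (R ^ 10) M N s m hm0 hβ, Finset.sum_mul_sum, Finset.mul_sum]
      refine Finset.sum_congr rfl fun v _ => ?_
      rw [Finset.mul_sum]
      refine Finset.sum_congr rfl fun v' _ => ?_
      by_cases hA : M < m * v ∧ m * v ≤ N <;> by_cases hB : M < m * v' ∧ m * v' ≤ N <;>
        simp only [hA, hB, and_self, and_true, and_false, true_and, false_and, if_true, if_false] <;> ring
    rw [Finset.sum_congr rfl this, Finset.sum_comm]
    refine Finset.sum_congr rfl fun v _ => ?_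
    rw [Finset.sum_comm]
    refine Finset.sum_congr rfl fun v' _ => ?_
    rw [Finset.mul_sum]
  rw [e1]
  have e2 : ∀ v ∈ I, ∀ v' ∈ I, |∑ m ∈ I,
        if (M < m * v ∧ m * v ≤ N) ∧ (M < m * v' ∧ m * v' ≤ N) then
          1 / (m:ℝ) * (Dl r (m * v) * Dl s (m * v')) else 0| ≤ 1 / (R:ℝ) ^ 6 := by
    intro v hv v' hv'
    have hv0 : 0 < v := by have := (Finset.mem_Ioc.1 hv).1; omega
    have hv0' : 0 < v' := by have := (Finset.mem_Ioc.1 hv').1; omega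
    rw [← Finset.sum_filter]
    have : I.filter (fun m => (M < m * v ∧ m * v ≤ N) ∧ (M < m * v' ∧ m * v' ≤ N)) =
        Finset.Ioc (max (R ^ 10) (max (M / v) (M / v'))) (min N (min (N / v) (N / v'))) := by
      ext m
      simp only [hI, Finset.mem_filter, Finset.mem_Ioc, max_lt_iff, le_min_iff, Nat.div_lt_iff_lt_mul hv0,
        Nat.div_lt_iff_lt_mul hv0', Nat.le_div_iff_mul_le hv0, Nat.le_div_iff_mul_le hv0']
      tauto
    rw [this]
    refine (Dl_prod_PL hr hs hrs v v' _ _).trans ?_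
    have hle : ((R:ℝ) ^ 10) ≤ ((max (R ^ 10) (max (M / v) (M / v')) : ℕ) : ℝ) := by
      exact_mod_cast le_max_left _ _
    rw [div_mul_eq_mul_div, one_mul, div_le_div_iff₀ (by positivity) (by positivity)]
    calc (r:ℝ) * s * (R:ℝ) ^ 6 ≤ (R:ℝ) ^ 2 * (R:ℝ) ^ 2 * (R:ℝ) ^ 6 := by gcongr
      _ = (R:ℝ) ^ 10 := by ring
      _ ≤ _ := by linarith
  have e3 : ∀ v ∈ I, |β v / v| ≤ H * (1 / (v:ℝ)) := fun v hv => by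
    rw [abs_div, Nat.abs_cast, mul_one_div]
    exact div_le_div_of_nonneg_right (hH v (Finset.mem_Ioc.1 hv).2) (Nat.cast_nonneg _)
  calc _ ≤ ∑ v ∈ I, ∑ v' ∈ I, (H * (1 / (v:ℝ))) * (H * (1 / (v':ℝ))) * (1 / (R:ℝ) ^ 6) := by
        refine (Finset.abs_sum_le_sum_abs _ _).trans (Finset.sum_le_sum fun v hv => ?_)
        refine (Finset.abs_sum_le_sum_abs _ _).trans (Finset.sum_le_sum fun v' hv' => ?_)
        rw [abs_mul, abs_mul]
        have a1 := e3 v hv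
        have a2 := e3 v' hv'
        have a3 := e2 v hv v' hv'
        gcongr
    _ = (H * ∑ v ∈ I, 1 / (v:ℝ)) ^ 2 / (R:ℝ) ^ 6 := by
        simp only [← Finset.sum_mul, ← Finset.mul_sum]
        ring
    _ ≤ _ := by
        have := sum_inv_le_L N hN (R ^ 10)
        have h0 : 0 ≤ ∑ v ∈ I, 1 / (v:ℝ) := Finset.sum_nonneg fun _ _ => by positivity
        gcongr

end ICM

namespace ICM
open scoped ArithmeticFunction.vonMangoldt

lemma cs_w {ι : Type*} (s : Finset ι) (w f : ι → ℝ) (hw : ∀ i ∈ s, 0 ≤ w i) :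
    (∑ i ∈ s, w i * f i) ^ 2 ≤ (∑ i ∈ s, w i) * ∑ i ∈ s, w i * f i ^ 2 :=
  Finset.sum_sq_le_sum_mul_sum_of_sq_le_mul s hw (fun i hi => mul_nonneg (hw i hi) (sq_nonneg _))
    (fun i _ => le_of_eq (by ring))

lemma typeII {R : ℕ} (hR : 2 ≤ R) {S : Finset ℕ} (hS : ∀ r ∈ S, r.Prime ∧ R < r ∧ r ≤ R ^ 2) (c : ℕ → ℝ)
    (hc : ∀ r, |c r| ≤ 1) (α β : ArithmeticFunction ℝ) (H : ℝ) (hα : ∀ a, |α a| ≤ 1)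
    (hα0 : ∀ a, a ≤ R ^ 10 → α a = 0) (N : ℕ) (hN : R ^ 30 ≤ N)
    (hβ : ∀ v, v ≤ R ^ 10 → β v = 0) (hH : ∀ v, v ≤ N → |β v| ≤ H) :
    (∑ n ∈ Finset.Ioc (R ^ 30) N, (α * β) n / n * DD S c n) ^ 2 ≤ 51 * H ^ 2 * (1 + Real.log N) ^ 4 / R := by
  have hR0 : 0 < R := by omega
  have hR1 : (2:ℝ) ≤ R := by exact_mod_cast hR
  have hN1 : 1 ≤ N := (Nat.one_le_pow _ _ hR0).trans hN
  have hL : 1 ≤ 1 + Real.log N := by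
    have : 0 ≤ Real.log N := Real.log_natCast_nonneg N
    linarith
  set L := 1 + Real.log N with hLdef
  set M := R ^ 30
  set I := Finset.Ioc (R ^ 10) N with hI
  have hLI : ∑ m ∈ I, 1 / (m:ℝ) ≤ L := sum_inv_le_L N hN1 _
  have hLI0 : 0 ≤ ∑ m ∈ I, 1 / (m:ℝ) := Finset.sum_nonneg fun _ _ => by positivity
  set X : ℕ → ℕ → ℝ := fun r m => XX (fun v => β v) M N r m with hX
  set Z : ℕ → ℝ := fun m => ∑ r ∈ S, c r * X r m with hZ
  have e0 : ∀ m, ∑ b ∈ Finset.Ioc (M / m) (N / m), β b / b * DD S c (m * b) = Z m := by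
    intro m
    simp only [hZ, hX, XX, DD, Finset.mul_sum]
    rw [Finset.sum_comm]
    exact Finset.sum_congr rfl fun r _ => Finset.sum_congr rfl fun b _ => by ring
  rw [conv_sum α β _ hN]
  simp only [e0]
  have e1 : |∑ m ∈ Finset.Ioc 0 N, α m / m * Z m| ≤ ∑ m ∈ I, 1 / (m:ℝ) * |Z m| := by
    have : ∑ m ∈ Finset.Ioc 0 N, α m / m * Z m = ∑ m ∈ I, α m / m * Z m := by
      symm
      refine Finset.sum_subset (Finset.Ioc_subset_Ioc (Nat.zero_le _) le_rfl) (fun m hm hm2 => ?_)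
      simp only [hI, Finset.mem_Ioc, not_and, not_le] at hm hm2
      rw [hα0 m (by by_contra h; have := hm2 (by omega); omega)]; simp
    rw [this]
    refine (Finset.abs_sum_le_sum_abs _ _).trans (Finset.sum_le_sum fun m _ => ?_)
    rw [abs_mul, abs_div, Nat.abs_cast]
    exact mul_le_mul_of_nonneg_right (div_le_div_of_nonneg_right (hα m) (Nat.cast_nonneg _)) (abs_nonneg _)
  have e2 : ∑ m ∈ I, 1 / (m:ℝ) * |Z m| ^ 2 = ∑ r ∈ S, ∑ s ∈ S, c r * c s * ∑ m ∈ I, 1 / (m:ℝ) * (X r m * X s m) := by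
    have : ∀ m ∈ I, 1 / (m:ℝ) * |Z m| ^ 2 = ∑ r ∈ S, ∑ s ∈ S, c r * c s * (1 / (m:ℝ) * (X r m * X s m)) := by
      intro m _
      rw [sq_abs, sq, Finset.sum_mul_sum, Finset.mul_sum]
      refine Finset.sum_congr rfl fun r _ => ?_
      rw [Finset.mul_sum]
      exact Finset.sum_congr rfl fun s _ => by ring
    rw [Finset.sum_congr rfl this, Finset.sum_comm]
    refine Finset.sum_congr rfl fun r _ => ?_
    rw [Finset.sum_comm]
    refine Finset.sum_congr rfl fun s _ => ?_
    rw [Finset.mul_sum]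
  set E := (H * L) ^ 2 / (R:ℝ) ^ 6 with hE
  have hE0 : 0 ≤ E := by positivity
  have e3 : ∀ r ∈ S, ∀ s ∈ S, c r * c s * ∑ m ∈ I, 1 / (m:ℝ) * (X r m * X s m) ≤
      (if r = s then 25 * H ^ 2 * L ^ 3 * (1 / (r:ℝ) ^ 2) else 0) + E := by
    intro r hr s hs
    have hcc : |c r * c s| ≤ 1 := by
      rw [abs_mul]; exact mul_le_one₀ (hc r) (abs_nonneg _) (hc s)
    refine (le_abs_self _).trans ?_
    rw [abs_mul]
    refine (mul_le_of_le_one_left (abs_nonneg _) hcc).trans ?_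
    split_ifs with hrs
    · subst hrs
      have hr0 : (0:ℝ) < r := by exact_mod_cast (hS r hr).1.pos
      have hb : ∀ m ∈ I, |1 / (m:ℝ) * (X r m * X r m)| ≤ 25 * H ^ 2 * L ^ 2 * (1 / (r:ℝ) ^ 2) * (1 / (m:ℝ)) := by
        intro m hm
        have hm0 : 0 < m := by have := (Finset.mem_Ioc.1 hm).1; omega
        have hx := XX_bound hR (fun v => β v) H M N r m hN1 hm0 (hS r hr).1 (hS r hr).2.2 hβ hH
        rw [abs_mul, abs_mul, abs_of_nonneg (by positivity : (0:ℝ) ≤ 1 / (m:ℝ)), mul_comm]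
        refine mul_le_mul_of_nonneg_right ?_ (by positivity)
        calc |X r m| * |X r m| ≤ (5 * H * L / r) * (5 * H * L / r) := mul_self_le_mul_self (abs_nonneg _) hx
          _ = _ := by field_simp; ring
      calc _ ≤ ∑ m ∈ I, 25 * H ^ 2 * L ^ 2 * (1 / (r:ℝ) ^ 2) * (1 / (m:ℝ)) :=
            (Finset.abs_sum_le_sum_abs _ _).trans (Finset.sum_le_sum hb)
        _ ≤ 25 * H ^ 2 * L ^ 2 * (1 / (r:ℝ) ^ 2) * L := by
            rw [← Finset.mul_sum]; exact mul_le_mul_of_nonneg_left hLI (by positivity)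
        _ = 25 * H ^ 2 * L ^ 3 * (1 / (r:ℝ) ^ 2) := by ring
        _ ≤ _ := by linarith
    · rw [zero_add]
      exact XX_cross hR (fun v => β v) H M N r s hN1 (hS r hr).1 (hS s hs).1 hrs (hS r hr).2.2 (hS s hs).2.2 hβ hH
  have e4 : ∑ r ∈ S, 1 / (r:ℝ) ^ 2 ≤ 2 / (R:ℝ) := by
    have h1 : ∑ r ∈ S, 1 / (r:ℝ) ^ 2 ≤ ∑ r ∈ Finset.Ioc R (R ^ 2), 1 / (r:ℝ) ^ 2 :=
      Finset.sum_le_sum_of_subset_of_nonneg (fun r hr => Finset.mem_Ioc.2 (hS r hr).2) (fun _ _ _ => by positivity)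
    have h2 := tail_sq (fun _ => 1) 1 (fun _ => zero_le_one) (fun N => by simp) R (R ^ 2) hR0
    simpa using h1.trans h2
  have e5 : ∑ m ∈ I, 1 / (m:ℝ) * |Z m| ^ 2 ≤ 51 * H ^ 2 * L ^ 3 / R := by
    rw [e2]
    calc _ ≤ ∑ r ∈ S, ∑ s ∈ S, ((if r = s then 25 * H ^ 2 * L ^ 3 * (1 / (r:ℝ) ^ 2) else 0) + E) :=
          Finset.sum_le_sum fun r hr => Finset.sum_le_sum fun s hs => e3 r hr s hs
      _ = 25 * H ^ 2 * L ^ 3 * ∑ r ∈ S, 1 / (r:ℝ) ^ 2 + S.card * (S.card * E) := by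
          rw [Finset.mul_sum]
          simp only [Finset.sum_add_distrib, Finset.sum_const, nsmul_eq_mul, Finset.sum_ite_eq]
          congr 1
          refine Finset.sum_congr rfl fun r hr => by simp [hr]
      _ ≤ 25 * H ^ 2 * L ^ 3 * (2 / R) + (R:ℝ) ^ 2 * ((R:ℝ) ^ 2 * E) := by
          have := card_S hS
          gcongr
      _ = 25 * H ^ 2 * L ^ 3 * (2 / R) + H ^ 2 * L ^ 2 / (R:ℝ) ^ 2 := by
          rw [hE]; field_simp
      _ ≤ 25 * H ^ 2 * L ^ 3 * (2 / R) + H ^ 2 * L ^ 3 / (R:ℝ) := by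
          gcongr
          · norm_num
          · nlinarith
      _ = _ := by ring
  have hcs := cs_w I (fun m => 1 / (m:ℝ)) (fun m => |Z m|) (fun _ _ => by positivity)
  calc _ = |∑ m ∈ Finset.Ioc 0 N, α m / m * Z m| ^ 2 := (sq_abs _).symm
    _ ≤ (∑ m ∈ I, 1 / (m:ℝ) * |Z m|) ^ 2 := pow_le_pow_left₀ (abs_nonneg _) e1 2
    _ ≤ _ := hcs
    _ ≤ L * (51 * H ^ 2 * L ^ 3 / R) :=
        mul_le_mul hLI e5 (Finset.sum_nonneg fun _ _ => by positivity) (by linarith)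
    _ = _ := by ring

end ICM

namespace ICM
open scoped ArithmeticFunction.vonMangoldt

lemma moebius_abs (n : ℕ) : |((ArithmeticFunction.moebius : ArithmeticFunction ℝ) n)| ≤ 1 := by
  rw [ArithmeticFunction.intCoe_apply]
  exact_mod_cast ArithmeticFunction.abs_moebius_le_one

lemma zeta_conv_le (f : ArithmeticFunction ℝ) (hf0 : ∀ n, 0 ≤ f n) (hf : ∀ n, f n ≤ Λ n) (v : ℕ) :
    0 ≤ ((ArithmeticFunction.zeta : ArithmeticFunction ℝ) * f) v ∧
      ((ArithmeticFunction.zeta : ArithmeticFunction ℝ) * f) v ≤ Real.log v := by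
  rw [mul_comm, ArithmeticFunction.coe_mul_zeta_apply]
  refine ⟨Finset.sum_nonneg fun _ _ => hf0 _, ?_⟩
  rw [← ArithmeticFunction.vonMangoldt_sum]
  exact Finset.sum_le_sum fun _ _ => hf _

lemma conv_abs_le (m f : ArithmeticFunction ℝ) (hm : ∀ n, |m n| ≤ 1) (hf0 : ∀ n, 0 ≤ f n) (hf : ∀ n, f n ≤ Λ n) (a : ℕ) :
    |(m * f) a| ≤ Real.log a := by
  rw [ArithmeticFunction.mul_apply]
  calc _ ≤ ∑ x ∈ a.divisorsAntidiagonal, |m x.1 * f x.2| := Finset.abs_sum_le_sum_abs _ _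
    _ ≤ ∑ x ∈ a.divisorsAntidiagonal, Λ x.2 := Finset.sum_le_sum fun x _ => by
        rw [abs_mul, abs_of_nonneg (hf0 _)]
        exact (mul_le_of_le_one_left (hf0 _) (hm _)).trans (hf _)
    _ = Real.log a := by
        rw [Nat.sum_divisorsAntidiagonal' (f := fun _ d => Λ d), ArithmeticFunction.vonMangoldt_sum]

lemma trc_mul_zero (f g : ArithmeticFunction ℝ) (U V a : ℕ) (h : U * V < a) : (trc f U * trc g V) a = 0 := by
  rw [ArithmeticFunction.mul_apply]
  refine Finset.sum_eq_zero fun x hx => ?_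
  have hx' := (Nat.mem_divisorsAntidiagonal.1 hx).1
  rw [trc_apply, trc_apply]
  split_ifs with h1 h2
  · have := Nat.mul_le_mul h1 h2
    omega
  all_goals simp

lemma log_div_le {R k : ℕ} (hR : 2 ≤ R) (hk : R ^ 10 < k) : Real.log k / k ≤ 2 / (R:ℝ) ^ 5 := by
  have hR1 : (2:ℝ) ≤ R := by exact_mod_cast hR
  have hk' : (R:ℝ) ^ 10 ≤ k := by exact_mod_cast hk.le
  have hk0 : (0:ℝ) < k := lt_of_lt_of_le (by positivity) hk'
  have hs : (R:ℝ) ^ 5 ≤ Real.sqrt k := by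
    apply Real.le_sqrt_of_sq_le; calc ((R:ℝ) ^ 5) ^ 2 = (R:ℝ) ^ 10 := by ring
      _ ≤ (k:ℝ) := hk'
  have h1 : Real.log k ≤ 2 * Real.sqrt k := by
    have h2 : Real.log (Real.sqrt k) ≤ Real.sqrt k := by
      have := Real.log_le_sub_one_of_pos (Real.sqrt_pos.2 hk0); linarith
    rw [Real.log_sqrt hk0.le] at h2; linarith
  calc Real.log k / k ≤ 2 * Real.sqrt k / k := div_le_div_of_nonneg_right h1 hk0.le
    _ = 2 / Real.sqrt k := by
        rw [div_eq_div_iff hk0.ne' (Real.sqrt_pos.2 hk0).ne', mul_assoc, Real.mul_self_sqrt hk0.le]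
    _ ≤ _ := by gcongr

lemma T3a {R : ℕ} (hR : 2 ≤ R) {S : Finset ℕ} (hS : ∀ r ∈ S, r.Prime ∧ R < r ∧ r ≤ R ^ 2) (c : ℕ → ℝ)
    (hc : ∀ r, |c r| ≤ 1) (N : ℕ) (hN : R ^ 30 ≤ N) :
    |∑ n ∈ Finset.Ioc (R ^ 30) N, Λ n / n * DD S c n| ≤ 30 * (1 + Real.log N) ^ 3 / Real.sqrt R := by
  have hR0 : 0 < R := by omega
  have hR1 : (2:ℝ) ≤ R := by exact_mod_cast hR
  have hN1 : 1 ≤ N := (Nat.one_le_pow _ _ hR0).trans hN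
  have hlN : 0 ≤ Real.log N := Real.log_natCast_nonneg N
  set L := 1 + Real.log N with hLdef
  have hL : 1 ≤ L := by linarith
  have hsq : 0 < Real.sqrt R := Real.sqrt_pos.2 (by linarith)
  have hsqR : Real.sqrt R ≤ R := by
    rw [Real.sqrt_le_left (by linarith)]; nlinarith
  set mo : ArithmeticFunction ℝ := (ArithmeticFunction.moebius : ArithmeticFunction ℝ) with hmo
  set ze : ArithmeticFunction ℝ := (ArithmeticFunction.zeta : ArithmeticFunction ℝ) with hze
  set M1 := trc mo (R ^ 10) with hM1
  set L1 := trc Λ (R ^ 10) with hL1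
  have hM1b : ∀ n, |M1 n| ≤ 1 := fun n => by
    rw [hM1, trc_apply]; split_ifs
    · exact moebius_abs n
    · simp
  have hL1b : ∀ n, 0 ≤ L1 n ∧ L1 n ≤ Λ n := fun n => by
    rw [hL1, trc_apply]; split_ifs <;> simp
  have hV := vaughan M1 L1
  have e0 : ∀ n ∈ Finset.Ioc (R ^ 30) N, Λ n / n * DD S c n =
      (M1 * ArithmeticFunction.log) n / n * DD S c n - ((M1 * L1) * ze) n / n * DD S c n +
        ((mo - M1) * (ze * (Λ - L1))) n / n * DD S c n := by
    intro n hn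
    have h1 : (Λ - L1) n = Λ n := by
      have h3 : L1 n = 0 := by
        rw [hL1, trc_apply, if_neg]
        have := (Finset.mem_Ioc.1 hn).1
        have h4 : R ^ 10 ≤ R ^ 30 := Nat.pow_le_pow_right hR0 (by norm_num)
        omega
      rw [sub_eq_add_neg, ArithmeticFunction.add_apply, ArithmeticFunction.neg_apply, h3]; simp
    have h2 := congrArg (fun f : ArithmeticFunction ℝ => f n) hV
    simp only [sub_eq_add_neg, ArithmeticFunction.add_apply, ArithmeticFunction.neg_apply] at h2 h1 ⊢
    rw [← h1, h2]; ring
  rw [Finset.sum_congr rfl e0, Finset.sum_add_distrib, Finset.sum_sub_distrib]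
  have b1 : |∑ n ∈ Finset.Ioc (R ^ 30) N, (M1 * ArithmeticFunction.log) n / n * DD S c n| ≤ 2 * L ^ 3 / Real.sqrt R := by
    have := typeI hR hS c hc M1 ArithmeticFunction.log 1 (2 / (R:ℝ) ^ 5) hM1b
      (fun a ha => by
        rw [hM1, trc_apply, if_neg]
        have h4 : R ^ 10 ≤ R ^ 20 := Nat.pow_le_pow_right hR0 (by norm_num)
        omega)
      (fun k hk => by
        simp only [ArithmeticFunction.log_apply]
        have h4 : 2 ^ 10 ≤ R ^ 10 := Nat.pow_le_pow_left hR 10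
        have h5 : (3:ℝ) ≤ k := by exact_mod_cast (by omega : 3 ≤ k)
        have h6 : Real.exp 1 ≤ 3 := by have := Real.exp_one_lt_d9; linarith
        exact Real.log_div_self_antitoneOn (by simp; linarith) (by simp; linarith) (by push_cast; linarith))
      (fun k => by rw [ArithmeticFunction.log_apply]; exact Real.log_natCast_nonneg k)
      (fun k hk => by rw [ArithmeticFunction.log_apply]; exact log_div_le hR hk) N hN
    refine this.trans ?_
    calc 1 * (2 / (R:ℝ) ^ 5) * (R:ℝ) ^ 4 * L = 2 * L / R := by field_simp
      _ ≤ 2 * L ^ 3 / Real.sqrt R := by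
        gcongr
        exact le_self_pow₀ hL (by norm_num)
  have b2 : |∑ n ∈ Finset.Ioc (R ^ 30) N, ((M1 * L1) * ze) n / n * DD S c n| ≤ 20 * L ^ 3 / Real.sqrt R := by
    have hlogR : 0 ≤ Real.log R := Real.log_natCast_nonneg R
    have hlogR2 : Real.log R ≤ R := by
      have := Real.log_le_sub_one_of_pos (show (0:ℝ) < R by linarith); linarith
    have hsupp : ∀ a, R ^ 20 < a → (M1 * L1) a = 0 := fun a ha => by
      apply trc_mul_zero; calc R ^ 10 * R ^ 10 = R ^ 20 := by ring
        _ < a := ha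
    have := typeI hR hS c hc (M1 * L1) ze (20 * R) (1 / (R:ℝ) ^ 10)
      (fun a => by
        by_cases ha : R ^ 20 < a
        · rw [hsupp a ha]; simp
        · push Not at ha
          refine (conv_abs_le M1 L1 hM1b (fun n => (hL1b n).1) (fun n => (hL1b n).2) a).trans ?_
          rcases Nat.eq_zero_or_pos a with h0 | h0
          · subst h0; simp
          · have : Real.log a ≤ Real.log ((R:ℝ) ^ 20) :=
              Real.log_le_log (by exact_mod_cast h0) (by exact_mod_cast ha)
            rw [Real.log_pow] at this
            push_cast at this
            linarith)
      hsupp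
      (fun k hk => by
        have : (0:ℝ) < k := by exact_mod_cast (by omega : 0 < k)
        rw [hze, ArithmeticFunction.natCoe_apply, ArithmeticFunction.natCoe_apply,
          ArithmeticFunction.zeta_apply, ArithmeticFunction.zeta_apply, if_neg (by omega), if_neg (by omega)]
        push_cast
        exact one_div_le_one_div_of_le this (by linarith))
      (fun k => by rw [hze, ArithmeticFunction.natCoe_apply]; positivity)
      (fun k hk => by
        rw [hze, ArithmeticFunction.natCoe_apply, ArithmeticFunction.zeta_apply, if_neg (by omega)]
        push_cast
        exact one_div_le_one_div_of_le (by positivity) (by exact_mod_cast hk.le)) N hN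
    refine this.trans ?_
    calc 20 * (R:ℝ) * (1 / (R:ℝ) ^ 10) * (R:ℝ) ^ 4 * L = 20 * L / (R:ℝ) ^ 5 := by field_simp
      _ ≤ 20 * L ^ 3 / Real.sqrt R := by
        have : (R:ℝ) ≤ (R:ℝ) ^ 5 := le_self_pow₀ (by linarith) (by norm_num)
        have h3 := hsqR.trans this
        have : L ≤ L ^ 3 := le_self_pow₀ hL (by norm_num)
        gcongr
  have b3 : |∑ n ∈ Finset.Ioc (R ^ 30) N, ((mo - M1) * (ze * (Λ - L1))) n / n * DD S c n| ≤ 8 * L ^ 3 / Real.sqrt R := by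
    have hd0 : ∀ n, (Λ - L1) n = Λ n - L1 n := fun n => by
      rw [sub_eq_add_neg, ArithmeticFunction.add_apply, ArithmeticFunction.neg_apply]; ring
    have hm0 : ∀ n, (mo - M1) n = mo n - M1 n := fun n => by
      rw [sub_eq_add_neg, ArithmeticFunction.add_apply, ArithmeticFunction.neg_apply]; ring
    have hz := zeta_conv_le (Λ - L1) (fun n => by rw [hd0]; linarith [(hL1b n).2]) (fun n => by rw [hd0]; linarith [(hL1b n).1])
    have := typeII hR hS c hc (mo - M1) (ze * (Λ - L1)) L
      (fun a => by
        rw [hm0, hM1, trc_apply]; split_ifs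
        · simp
        · rw [sub_zero]; exact moebius_abs a)
      (fun a ha => by rw [hm0, hM1, trc_apply, if_pos ha, sub_self]) N hN
      (fun v hv => by
        rw [hze, mul_comm, ArithmeticFunction.coe_mul_zeta_apply]
        refine Finset.sum_eq_zero fun d hd => ?_
        rw [hd0, hL1, trc_apply, if_pos ((Nat.divisor_le hd).trans hv), sub_self])
      (fun v hv => by
        rw [abs_of_nonneg (hz v).1]
        refine (hz v).2.trans ?_
        rcases Nat.eq_zero_or_pos v with h0 | h0
        · subst h0; simp; linarith
        · have := Real.log_le_log (show (0:ℝ) < v by exact_mod_cast h0) (show (v:ℝ) ≤ N by exact_mod_cast hv)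
          linarith)
    refine abs_le_of_sq_le_sq (this.trans ?_) (by positivity)
    rw [div_pow, Real.sq_sqrt (by linarith), mul_pow]
    rw [div_le_div_iff_of_pos_right (by linarith)]
    have : 0 ≤ L ^ 6 := by positivity
    calc 51 * L ^ 2 * (1 + Real.log N) ^ 4 = 51 * L ^ 6 := by rw [← hLdef]; ring
      _ ≤ 8 ^ 2 * (L ^ 3) ^ 2 := by ring_nf; linarith
  have t1 := abs_sub (∑ n ∈ Finset.Ioc (R ^ 30) N, (M1 * ArithmeticFunction.log) n / n * DD S c n)
    (∑ n ∈ Finset.Ioc (R ^ 30) N, ((M1 * L1) * ze) n / n * DD S c n)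
  refine (abs_add_le _ _).trans ((add_le_add (t1.trans (add_le_add b1 b2)) b3).trans (le_of_eq (by ring)))

lemma T3b : ∃ C : ℝ, 0 < C ∧ ∀ R : ℕ, 2 ≤ R → ∀ S : Finset ℕ, (∀ r ∈ S, r.Prime ∧ R < r ∧ r ≤ R ^ 2) →
    ∀ c : ℕ → ℝ, (∀ r, |c r| ≤ 1) → ∀ N, R ^ 30 ≤ N →
    |∑ n ∈ Finset.Ioc (R ^ 30) N, pinv n * DD S c n| ≤ C * (1 + Real.log N) ^ 3 / Real.sqrt R := by
  obtain ⟨C0, hC0, hnp⟩ := np_tail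
  refine ⟨2 * (30 + C0), by positivity, fun R hR S hS c hc N hN => ?_⟩
  have hR0 : 0 < R := by omega
  have hR1 : (2:ℝ) ≤ R := by exact_mod_cast hR
  have hM1 : 1 ≤ R ^ 30 := Nat.one_le_pow _ _ hR0
  have hM2 : 2 ≤ R ^ 30 := hR.trans (Nat.le_self_pow (by norm_num) R)
  have hlN : 0 ≤ Real.log N := Real.log_natCast_nonneg N
  have hsq : 0 < Real.sqrt R := Real.sqrt_pos.2 (by linarith)
  have hsqR : Real.sqrt R ≤ R := by
    rw [Real.sqrt_le_left (by linarith)]; nlinarith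
  set L := 1 + Real.log N with hLdef
  have hL : 1 ≤ L := by linarith
  have hsqM : Real.sqrt ((R ^ 30 : ℕ):ℝ) = (R:ℝ) ^ 15 := by
    rw [show ((R ^ 30 : ℕ):ℝ) = ((R:ℝ) ^ 15) ^ 2 by push_cast; ring]
    exact Real.sqrt_sq (by positivity)
  have hmain : ∀ t, R ^ 30 ≤ t → t ≤ N → |∑ n ∈ Finset.Ioc (R ^ 30) t, lp n / n * DD S c n| ≤ (30 + C0) * L ^ 3 / Real.sqrt R := by
    intro t ht htN
    have h1 := T3a hR hS c hc t ht
    have hlt : Real.log t ≤ Real.log N :=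
      Real.log_le_log (by exact_mod_cast (by omega : 0 < t)) (by exact_mod_cast htN)
    have h0t : 0 ≤ Real.log t := Real.log_natCast_nonneg t
    have h1' : 30 * (1 + Real.log t) ^ 3 / Real.sqrt R ≤ 30 * L ^ 3 / Real.sqrt R := by
      gcongr
      linarith
    have h2 : |∑ n ∈ Finset.Ioc (R ^ 30) t, np n / n * DD S c n| ≤ C0 * L ^ 3 / Real.sqrt R := by
      calc _ ≤ ∑ n ∈ Finset.Ioc (R ^ 30) t, np n / n * (R:ℝ) ^ 2 := by
            refine (Finset.abs_sum_le_sum_abs _ _).trans (Finset.sum_le_sum fun n _ => ?_)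
            have hnn : 0 ≤ np n / n := div_nonneg (np_nonneg n) (Nat.cast_nonneg _)
            rw [abs_mul, abs_of_nonneg hnn]
            exact mul_le_mul_of_nonneg_left (DD_abs hS c hc n) hnn
        _ ≤ (C0 / Real.sqrt ((R ^ 30 : ℕ):ℝ)) * (R:ℝ) ^ 2 := by
            rw [← Finset.sum_mul]
            exact mul_le_mul_of_nonneg_right (hnp _ _ hM1) (by positivity)
        _ = C0 * 1 / (R:ℝ) ^ 13 := by rw [hsqM]; field_simp
        _ ≤ _ := by
            have h3 : Real.sqrt R ≤ (R:ℝ) ^ 13 := hsqR.trans (le_self_pow₀ (by linarith) (by norm_num))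
            have h4 : 1 ≤ L ^ 3 := one_le_pow₀ hL
            gcongr
    have h3 : ∑ n ∈ Finset.Ioc (R ^ 30) t, lp n / n * DD S c n = ∑ n ∈ Finset.Ioc (R ^ 30) t, Λ n / n * DD S c n
        - ∑ n ∈ Finset.Ioc (R ^ 30) t, np n / n * DD S c n := by
      rw [← Finset.sum_sub_distrib]
      refine Finset.sum_congr rfl fun n _ => ?_
      rw [← lp_add_np]; ring
    rw [h3]
    refine (abs_sub _ _).trans ((add_le_add (h1.trans h1') h2).trans (le_of_eq (by ring)))
  rcases hN.eq_or_lt with h | h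
  · rw [← h]; simp; positivity
  have hab := abel_bound (fun n => 1 / Real.log n) (fun n => lp n / n * DD S c n) (R ^ 30) N
    ((30 + C0) * L ^ 3 / Real.sqrt R) h
    (fun m hm _ => by
      have : 0 < Real.log m := log_pos_nat (by omega)
      exact one_div_le_one_div_of_le this (Real.log_le_log (by exact_mod_cast (by omega : 0 < m)) (by push_cast; linarith)))
    (fun m hm _ => one_div_nonneg.2 (Real.log_natCast_nonneg m))
    (fun t ht1 ht2 => hmain t ht1 ht2)
  have heq : ∑ n ∈ Finset.Ioc (R ^ 30) N, pinv n * DD S c n =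
      ∑ n ∈ Finset.Ioc (R ^ 30) N, (1 / Real.log n) • (lp n / n * DD S c n) := by
    refine Finset.sum_congr rfl fun n _ => ?_
    rw [← lp_div_log, smul_eq_mul]; ring
  rw [heq]
  refine hab.trans ?_
  have hw : 1 / Real.log ((R ^ 30 + 1 : ℕ):ℝ) ≤ 2 := by
    have h1 : Real.log 2 ≤ Real.log ((R ^ 30 + 1 : ℕ):ℝ) := Real.log_le_log (by norm_num) (by exact_mod_cast (by omega : 2 ≤ R ^ 30 + 1))
    have h2 := Real.log_two_gt_d9
    rw [div_le_iff₀ (by linarith)]; linarith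
  calc _ ≤ 2 * ((30 + C0) * L ^ 3 / Real.sqrt R) := mul_le_mul_of_nonneg_right hw (by positivity)
    _ = _ := by ring

/-- averaged Siegel-free prime number estimate: sum over moduli in a dyadic (squaring) range -/
theorem T3 : ∃ C : ℝ, 0 < C ∧ ∀ R : ℕ, 2 ≤ R → ∀ S : Finset ℕ, (∀ r ∈ S, r.Prime ∧ R < r ∧ r ≤ R ^ 2) →
    ∀ N, R ^ 30 ≤ N →
    ∑ r ∈ S, |∑ n ∈ Finset.Ioc (R ^ 30) N, pinv n * Dl r n| ≤ C * (1 + Real.log N) ^ 3 / Real.sqrt R := by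
  obtain ⟨C, hC, h⟩ := T3b
  refine ⟨C, hC, fun R hR S hS N hN => ?_⟩
  set f : ℕ → ℝ := fun r => ∑ n ∈ Finset.Ioc (R ^ 30) N, pinv n * Dl r n with hf
  have := h R hR S hS (fun r => if 0 ≤ f r then 1 else -1) (fun r => by split_ifs <;> simp) N hN
  refine le_trans (le_of_eq ?_) ((le_abs_self _).trans this)
  simp only [DD, Finset.mul_sum]
  rw [Finset.sum_comm]
  refine Finset.sum_congr rfl fun r _ => ?_
  have e : |f r| = (if 0 ≤ f r then 1 else -1) * f r := by
    split_ifs with h0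
    · rw [abs_of_nonneg h0, one_mul]
    · rw [abs_of_neg (by linarith)]; ring
  change |f r| = _
  rw [e]
  conv_lhs => rw [hf]
  rw [Finset.mul_sum]
  exact Finset.sum_congr rfl fun n _ => by ring

end ICM

namespace ICM

/-- additive function attached to `g` -/
noncomputable def TT (g : ℕ → ℝ) (n : ℕ) : ℝ := ∑ p ∈ n.primeFactors, g p
/-- shifted prime operator -/
noncomputable def BB (g : ℕ → ℝ) (p : ℕ) : ℝ := TT g (p - 1)
noncomputable def UU (x : ℕ) (g : ℕ → ℝ) : ℝ := ∑ p ∈ Pr x, g p / p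
noncomputable def WW (x : ℕ) (g : ℕ → ℝ) : ℝ := ∑ p ∈ Pr x, g p ^ 2 / p
noncomputable def VV (x : ℕ) (g : ℕ → ℝ) : ℝ := ∑ p ∈ Pr x, g p * (g p - 1) / p

lemma TT_nonneg {g : ℕ → ℝ} (hg : ∀ n, 0 ≤ g n) (n : ℕ) : 0 ≤ TT g n := Finset.sum_nonneg fun _ _ => hg _
lemma BB_nonneg {g : ℕ → ℝ} (hg : ∀ n, 0 ≤ g n) (n : ℕ) : 0 ≤ BB g n := TT_nonneg hg _
lemma BBi_nonneg {g : ℕ → ℝ} (hg : ∀ n, 0 ≤ g n) (j n : ℕ) : 0 ≤ (BB^[j] g) n := by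
  induction j generalizing n with
  | zero => exact hg n
  | succ j ih => rw [Function.iterate_succ_apply']; exact BB_nonneg ih n
lemma UU_nonneg {g : ℕ → ℝ} (hg : ∀ n, 0 ≤ g n) (x : ℕ) : 0 ≤ UU x g :=
  Finset.sum_nonneg fun _ _ => div_nonneg (hg _) (Nat.cast_nonneg _)
lemma WW_nonneg (g : ℕ → ℝ) (x : ℕ) : 0 ≤ WW x g :=
  Finset.sum_nonneg fun _ _ => by positivity
lemma TT_mono {g h : ℕ → ℝ} {n : ℕ} (H : ∀ p, p.Prime → g p ≤ h p) : TT g n ≤ TT h n :=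
  Finset.sum_le_sum fun p hp => H p (Nat.prime_of_mem_primeFactors hp)

lemma TT_eq (g : ℕ → ℝ) {n x : ℕ} (hn : n ≠ 0) (hx : n ≤ x) :
    TT g n = ∑ p ∈ Pr x, if p ∣ n then g p else 0 := by
  unfold TT
  rw [← Finset.sum_filter]
  refine Finset.sum_congr ?_ fun _ _ => rfl
  ext p
  simp only [Nat.mem_primeFactors, Finset.mem_filter, mem_Pr]
  constructor
  · rintro ⟨h1, h2, _⟩; exact ⟨⟨(Nat.le_of_dvd (Nat.pos_of_ne_zero hn) h2).trans hx, h1⟩, h2⟩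
  · rintro ⟨⟨_, h1⟩, h2⟩; exact ⟨h1, h2, hn⟩

/-- a weighted family of integers in which divisibility by primes behaves regularly -/
structure Dens (I : Finset ℕ) (w : ℕ → ℝ) (d : ℕ → ℕ) (x : ℕ) (K : ℝ) : Prop where
  hw : ∀ i ∈ I, 0 ≤ w i
  hd : ∀ i ∈ I, d i ≠ 0 ∧ d i ≤ x
  h1 : ∀ p : ℕ, p.Prime → ∑ i ∈ I, (if p ∣ d i then w i else 0) ≤ K / p
  h2 : ∀ p q : ℕ, p.Prime → q.Prime → p ≠ q → ∑ i ∈ I, (if p ∣ d i ∧ q ∣ d i then w i else 0) ≤ K / (p * q)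

lemma Dens.eq {I : Finset ℕ} {w : ℕ → ℝ} {d : ℕ → ℕ} {x : ℕ} {K : ℝ} (D : Dens I w d x K) (g : ℕ → ℝ) :
    ∑ i ∈ I, w i * TT g (d i) = ∑ p ∈ Pr x, g p * ∑ i ∈ I, (if p ∣ d i then w i else 0) := by
  have : ∀ i ∈ I, w i * TT g (d i) = ∑ p ∈ Pr x, g p * (if p ∣ d i then w i else 0) := by
    intro i hi
    rw [TT_eq g (D.hd i hi).1 (D.hd i hi).2, Finset.mul_sum]
    refine Finset.sum_congr rfl fun p _ => ?_
    split_ifs <;> ring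
  rw [Finset.sum_congr rfl this, Finset.sum_comm]
  exact Finset.sum_congr rfl fun p _ => by rw [Finset.mul_sum]

lemma Dens.first {I : Finset ℕ} {w : ℕ → ℝ} {d : ℕ → ℕ} {x : ℕ} {K : ℝ} (D : Dens I w d x K) {g : ℕ → ℝ}
    (hg : ∀ n, 0 ≤ g n) : ∑ i ∈ I, w i * TT g (d i) ≤ K * UU x g := by
  rw [D.eq, UU, Finset.mul_sum]
  refine Finset.sum_le_sum fun p hp => ?_
  calc _ ≤ g p * (K / p) := mul_le_mul_of_nonneg_left (D.h1 p (mem_Pr.1 hp).2) (hg p)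
    _ = _ := by ring

lemma Dens.cross {I : Finset ℕ} {w : ℕ → ℝ} {d : ℕ → ℕ} {x : ℕ} {K : ℝ} (D : Dens I w d x K) (hK : 0 ≤ K) {g : ℕ → ℝ}
    (hg : ∀ n, 0 ≤ g n) : ∑ i ∈ I, w i * (TT g (d i) ^ 2 - TT (fun p => g p ^ 2) (d i)) ≤ K * UU x g ^ 2 := by
  have e : ∀ i ∈ I, w i * (TT g (d i) ^ 2 - TT (fun p => g p ^ 2) (d i)) =
      ∑ p ∈ Pr x, ∑ q ∈ Pr x, if p = q then 0 else g p * g q * (if p ∣ d i ∧ q ∣ d i then w i else 0) := by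
    intro i hi
    rw [TT_eq g (D.hd i hi).1 (D.hd i hi).2, TT_eq _ (D.hd i hi).1 (D.hd i hi).2, sq, Finset.sum_mul_sum,
      ← Finset.sum_sub_distrib, Finset.mul_sum]
    refine Finset.sum_congr rfl fun p hp => ?_
    have e2 : (if p ∣ d i then g p ^ 2 else 0) = ∑ q ∈ Pr x, if p = q then (if p ∣ d i then g p ^ 2 else 0) else 0 := by
      rw [Finset.sum_ite_eq, if_pos hp]
    rw [e2, ← Finset.sum_sub_distrib, Finset.mul_sum]
    refine Finset.sum_congr rfl fun q _ => ?_
    by_cases hpq : p = q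
    · subst hpq
      by_cases h : p ∣ d i <;> simp [h]; right; ring
    · by_cases h : p ∣ d i <;> by_cases h' : q ∣ d i <;> simp [h, h', hpq]; ring
  rw [Finset.sum_congr rfl e, Finset.sum_comm, sq, UU, Finset.sum_mul_sum, Finset.mul_sum]
  refine Finset.sum_le_sum fun p hp => ?_
  rw [Finset.sum_comm, Finset.mul_sum]
  refine Finset.sum_le_sum fun q hq => ?_
  by_cases hpq : p = q
  · simp only [hpq, if_true, Finset.sum_const_zero]
    have := hg q
    positivity
  · simp only [hpq, if_false]
    rw [← Finset.mul_sum]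
    calc _ ≤ g p * g q * (K / (p * q)) :=
          mul_le_mul_of_nonneg_left (D.h2 p q (mem_Pr.1 hp).2 (mem_Pr.1 hq).2 hpq) (mul_nonneg (hg p) (hg q))
      _ = _ := by field_simp

lemma TT_sub (g h : ℕ → ℝ) (n : ℕ) : TT (fun p => g p - h p) n = TT g n - TT h n := Finset.sum_sub_distrib _ _

lemma Dens.second {I : Finset ℕ} {w : ℕ → ℝ} {d : ℕ → ℕ} {x : ℕ} {K : ℝ} (D : Dens I w d x K) (hK : 0 ≤ K) {g : ℕ → ℝ}
    (hg : ∀ n, 0 ≤ g n) : ∑ i ∈ I, w i * TT g (d i) ^ 2 ≤ K * (UU x g ^ 2 + WW x g) := by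
  have h1 := D.cross hK hg
  have h2 := D.first (g := fun p => g p ^ 2) (fun _ => sq_nonneg _)
  have : ∑ i ∈ I, w i * TT g (d i) ^ 2 = ∑ i ∈ I, w i * (TT g (d i) ^ 2 - TT (fun p => g p ^ 2) (d i)) +
      ∑ i ∈ I, w i * TT (fun p => g p ^ 2) (d i) := by
    rw [← Finset.sum_add_distrib]; exact Finset.sum_congr rfl fun _ _ => by ring
  rw [this, mul_add]
  exact add_le_add h1 h2

lemma Dens.fm {I : Finset ℕ} {w : ℕ → ℝ} {d : ℕ → ℕ} {x : ℕ} {K : ℝ} (D : Dens I w d x K) (hK : 0 ≤ K) {g : ℕ → ℝ}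
    (hg : ∀ n, 0 ≤ g n) (hg1 : ∀ n, 0 ≤ g n * (g n - 1)) :
    ∑ i ∈ I, w i * (TT g (d i) * (TT g (d i) - 1)) ≤ K * (UU x g ^ 2 + VV x g) := by
  have h1 := D.cross hK hg
  have h2 := D.first (g := fun p => g p * (g p - 1)) hg1
  have e : ∀ n, TT (fun p => g p * (g p - 1)) n = TT (fun p => g p ^ 2) n - TT g n := by
    intro n; rw [← TT_sub]; exact Finset.sum_congr rfl fun _ _ => by ring
  have : ∑ i ∈ I, w i * (TT g (d i) * (TT g (d i) - 1)) = ∑ i ∈ I, w i * (TT g (d i) ^ 2 - TT (fun p => g p ^ 2) (d i)) +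
      ∑ i ∈ I, w i * TT (fun p => g p * (g p - 1)) (d i) := by
    rw [← Finset.sum_add_distrib]; exact Finset.sum_congr rfl fun _ _ => by rw [e]; ring
  rw [this, mul_add]
  exact add_le_add h1 h2

lemma card_dvd_le (x d : ℕ) (hd : 0 < d) : ((((Finset.Icc 1 x).filter (fun n => d ∣ n)).card : ℕ) : ℝ) ≤ x / d := by
  have h : (Finset.Icc 1 x).filter (fun n => d ∣ n) = (Finset.Ioc 0 x).filter (fun n => d ∣ n) := by
    congr 1
  rw [h, Nat.Ioc_filter_dvd_card_eq_div]
  exact Nat.cast_div_le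

lemma dens_nat (x : ℕ) : Dens (Finset.Icc 1 x) (fun _ => 1) (fun n => n) x x where
  hw := fun _ _ => zero_le_one
  hd := fun i hi => by have := Finset.mem_Icc.1 hi; exact ⟨by omega, this.2⟩
  h1 := fun p hp => by
    rw [Finset.sum_boole]; exact card_dvd_le x p hp.pos
  h2 := fun p q hp hq hpq => by
    rw [Finset.sum_boole]
    have := card_dvd_le x (p * q) (Nat.mul_pos hp.pos hq.pos)
    push_cast at this
    refine le_trans (le_of_eq ?_) this
    congr 2
    refine Finset.filter_congr fun n _ => ?_
    exact ⟨fun h => ((Nat.coprime_primes hp hq).2 hpq).mul_dvd_of_dvd_of_dvd h.1 h.2,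
      fun h => ⟨(dvd_mul_right _ _).trans h, (dvd_mul_left _ _).trans h⟩⟩

lemma LL_ge_one {x : ℕ} (hx : 16 ≤ x) : 1 ≤ LL x := by
  have h2 : (16:ℝ) ≤ x := by exact_mod_cast hx
  have h3 : Real.log 16 ≤ Real.log x := Real.log_le_log (by norm_num) h2
  have h4 : Real.log 16 = 4 * Real.log 2 := by
    rw [show (16:ℝ) = 2 ^ 4 by norm_num, Real.log_pow]; norm_num
  have h5 := Real.log_two_gt_d9
  have h6 := Real.exp_one_lt_d9
  unfold LL
  rw [Real.le_log_iff_exp_le (by linarith)]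
  linarith

lemma dens_prime : ∃ C : ℝ, 1 ≤ C ∧ ∀ x : ℕ, 16 ≤ x →
    Dens (Pr x) (fun p => 1 / (p:ℝ)) (fun p => p - 1) x (C * LL x) := by
  obtain ⟨C, hC, h⟩ := T1
  refine ⟨4 * C + 1, by linarith, fun x hx => ?_⟩
  have hy := LL_ge_one hx
  have hle : ∀ c : ℝ, 0 < c → c ≤ 4 → c * (C * LL x) ≤ (4 * C + 1) * LL x := fun c hc hc4 => by
    have : 0 ≤ C * LL x := by positivity
    nlinarith
  have htot : ∀ p : ℕ, p.Prime → ((p.totient : ℕ):ℝ) = (p:ℝ) - 1 := fun p hp => by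
    rw [Nat.totient_prime hp, Nat.cast_sub hp.one_le, Nat.cast_one]
  refine ⟨fun _ _ => by positivity, fun p hp => ?_, fun p hp => ?_, fun p q hp hq hpq => ?_⟩
  · have := mem_Pr.1 hp
    have := this.2.two_le
    constructor <;> omega
  · have h1 := h p x hp.one_le hx
    rw [← Finset.sum_filter]
    refine h1.trans ?_
    have hp2 : (2:ℝ) ≤ p := by exact_mod_cast hp.two_le
    rw [htot p hp, div_le_div_iff₀ (by linarith) (by linarith)]
    have h3 := hle 2 (by norm_num) (by norm_num)
    have h4 : 0 ≤ C * LL x := by positivity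
    change C * LL x * p ≤ _
    calc C * LL x * p ≤ C * LL x * (2 * (p - 1)) := mul_le_mul_of_nonneg_left (by linarith) h4
      _ = 2 * (C * LL x) * (p - 1) := by ring
      _ ≤ _ := mul_le_mul_of_nonneg_right h3 (by linarith)
  · have hco := (Nat.coprime_primes hp hq).2 hpq
    have h1 := h (p * q) x (Nat.mul_pos hp.pos hq.pos) hx
    rw [← Finset.sum_filter]
    have : (Pr x).filter (fun i => p ∣ i - 1 ∧ q ∣ i - 1) = (Pr x).filter (fun i => p * q ∣ i - 1) := by
      refine Finset.filter_congr fun n _ => ?_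
      exact ⟨fun h => hco.mul_dvd_of_dvd_of_dvd h.1 h.2,
        fun h => ⟨(dvd_mul_right _ _).trans h, (dvd_mul_left _ _).trans h⟩⟩
    rw [this]
    refine h1.trans ?_
    have hp2 : (2:ℝ) ≤ p := by exact_mod_cast hp.two_le
    have hq2 : (2:ℝ) ≤ q := by exact_mod_cast hq.two_le
    rw [Nat.totient_mul hco, Nat.cast_mul, htot p hp, htot q hq]
    have hpp : 0 < ((p:ℝ) - 1) * (q - 1) := mul_pos (by linarith) (by linarith)
    rw [div_le_div_iff₀ hpp (by positivity)]
    have h3 := hle 4 (by norm_num) (by norm_num)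
    have h4 : 0 ≤ C * LL x := by positivity
    change C * LL x * (p * q) ≤ _
    calc C * LL x * (p * q) ≤ C * LL x * (4 * ((p - 1) * (q - 1))) := by
          refine mul_le_mul_of_nonneg_left ?_ h4
          have : (p:ℝ) * q ≤ (2 * (p - 1)) * (2 * (q - 1)) := mul_le_mul (by linarith) (by linarith) (by linarith) (by linarith)
          linarith
      _ = 4 * (C * LL x) * ((p - 1) * (q - 1)) := by ring
      _ ≤ _ := mul_le_mul_of_nonneg_right h3 hpp.le

end ICM

namespace ICM

noncomputable def KC : ℝ := Classical.choose dens_prime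
lemma KC_ge : 1 ≤ KC := (Classical.choose_spec dens_prime).1
/-- the density constant for shifted primes -/
noncomputable def KK (x : ℕ) : ℝ := KC * LL x
lemma dens_pr {x : ℕ} (hx : 16 ≤ x) : Dens (Pr x) (fun p => 1 / (p:ℝ)) (fun p => p - 1) x (KK x) :=
  (Classical.choose_spec dens_prime).2 x hx
lemma KK_nonneg {x : ℕ} (hx : 16 ≤ x) : 0 ≤ KK x := mul_nonneg (by linarith [KC_ge]) (by linarith [LL_ge_one hx])

lemma UU_BB {x : ℕ} (hx : 16 ≤ x) {g : ℕ → ℝ} (hg : ∀ n, 0 ≤ g n) : UU x (BB g) ≤ KK x * UU x g := by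
  have := (dens_pr hx).first hg
  refine le_trans (le_of_eq ?_) this
  exact Finset.sum_congr rfl fun p _ => by rw [BB]; ring

lemma WW_BB {x : ℕ} (hx : 16 ≤ x) {g : ℕ → ℝ} (hg : ∀ n, 0 ≤ g n) : WW x (BB g) ≤ KK x * (UU x g ^ 2 + WW x g) := by
  have := (dens_pr hx).second (KK_nonneg hx) hg
  refine le_trans (le_of_eq ?_) this
  exact Finset.sum_congr rfl fun p _ => by rw [BB]; ring

lemma VV_BB {x : ℕ} (hx : 16 ≤ x) {g : ℕ → ℝ} (hg : ∀ n, 0 ≤ g n) (hg1 : ∀ n, 0 ≤ g n * (g n - 1)) :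
    VV x (BB g) ≤ KK x * (UU x g ^ 2 + VV x g) := by
  have := (dens_pr hx).fm (KK_nonneg hx) hg hg1
  refine le_trans (le_of_eq ?_) this
  exact Finset.sum_congr rfl fun p _ => by rw [BB]; ring

/-- truncated logarithm -/
noncomputable def ell (Y : ℝ) (q : ℕ) : ℝ := if (q:ℝ) ≤ Y then Real.log q else 0

lemma ell_nonneg (Y : ℝ) (q : ℕ) : 0 ≤ ell Y q := by
  unfold ell; split_ifs
  · exact Real.log_natCast_nonneg q
  · exact le_rfl

lemma ell_le (Y : ℝ) (q : ℕ) : ell Y q ≤ Real.log q := by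
  unfold ell; split_ifs
  · exact le_rfl
  · exact Real.log_natCast_nonneg q

lemma TT_log_le (n : ℕ) : TT (fun p => Real.log p) n ≤ Real.log n := by
  rcases Nat.eq_zero_or_pos n with h | h
  · subst h; simp [TT]
  unfold TT
  rw [← Real.log_prod (fun p hp => by exact_mod_cast (Nat.prime_of_mem_primeFactors hp).ne_zero)]
  rw [← Nat.cast_prod]
  refine Real.log_le_log ?_ ?_
  · exact_mod_cast Finset.prod_pos fun p hp => (Nat.prime_of_mem_primeFactors hp).pos
  · exact_mod_cast Nat.le_of_dvd h (Nat.prod_primeFactors_dvd n)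

lemma BB_log_le {g : ℕ → ℝ} (hg : ∀ p, p.Prime → g p ≤ Real.log p) (p : ℕ) (hp : p.Prime) : BB g p ≤ Real.log p := by
  unfold BB
  refine (TT_mono hg).trans ((TT_log_le _).trans (Real.log_le_log ?_ ?_))
  · exact_mod_cast Nat.sub_pos_of_lt hp.one_lt
  · exact_mod_cast Nat.sub_le _ _

lemma BBi_log_le {g : ℕ → ℝ} (hg : ∀ p, p.Prime → g p ≤ Real.log p) (j p : ℕ) (hp : p.Prime) :
    (BB^[j] g) p ≤ Real.log p := by
  induction j generalizing p with
  | zero => exact hg p hp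
  | succ j ih => rw [Function.iterate_succ_apply']; exact BB_log_le ih p hp

lemma ell_moments : ∃ C : ℝ, 1 ≤ C ∧ ∀ (Y : ℝ) (x : ℕ), 1 ≤ Real.log Y → 1 ≤ Y →
    UU x (ell Y) ≤ C * Real.log Y ∧ WW x (ell Y) ≤ C * Real.log Y ^ 2 := by
  obtain ⟨C, hC, h⟩ := mertens_q
  refine ⟨C + 1, by linarith, fun Y x hl hY => ?_⟩
  have hfl : 1 ≤ ⌊Y⌋₊ := Nat.le_floor (by simpa using hY)
  have hfl2 : (⌊Y⌋₊ : ℝ) ≤ Y := Nat.floor_le (by linarith)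
  have h1 : UU x (ell Y) ≤ (C + 1) * Real.log Y := by
    have a1 : UU x (ell Y) ≤ ∑ q ∈ Pr ⌊Y⌋₊, Real.log q / ((q:ℝ) - 1) := by
      unfold UU
      calc ∑ p ∈ Pr x, ell Y p / p = ∑ p ∈ (Pr x).filter (fun p : ℕ => (p:ℝ) ≤ Y), Real.log p / p := by
            rw [Finset.sum_filter]
            refine Finset.sum_congr rfl fun p _ => ?_
            unfold ell; split_ifs <;> simp
        _ ≤ ∑ p ∈ (Pr x).filter (fun p : ℕ => (p:ℝ) ≤ Y), Real.log p / ((p:ℝ) - 1) := by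
            refine Finset.sum_le_sum fun p hp => ?_
            have : (2:ℝ) ≤ p := by exact_mod_cast (mem_Pr.1 (Finset.mem_filter.1 hp).1).2.two_le
            exact div_le_div_of_nonneg_left (Real.log_natCast_nonneg p) (by linarith) (by linarith)
        _ ≤ _ := by
            refine Finset.sum_le_sum_of_subset_of_nonneg (fun p hp => ?_) (fun p hp _ => ?_)
            · have := Finset.mem_filter.1 hp
              exact mem_Pr.2 ⟨Nat.le_floor this.2, (mem_Pr.1 this.1).2⟩
            · have : (2:ℝ) ≤ p := by exact_mod_cast (mem_Pr.1 hp).2.two_le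
              exact div_nonneg (Real.log_natCast_nonneg p) (by linarith)
    have a2 := (abs_le.1 (h ⌊Y⌋₊ hfl)).2
    have a3 : Real.log ⌊Y⌋₊ ≤ Real.log Y := Real.log_le_log (by exact_mod_cast hfl) hfl2
    nlinarith
  refine ⟨h1, ?_⟩
  have h2 : WW x (ell Y) ≤ Real.log Y * UU x (ell Y) := by
    unfold WW UU
    rw [Finset.mul_sum]
    refine Finset.sum_le_sum fun p hp => ?_
    rw [sq, mul_div_assoc]
    refine mul_le_mul_of_nonneg_right ?_ (div_nonneg (ell_nonneg _ _) (Nat.cast_nonneg _))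
    unfold ell
    split_ifs with hpY
    · exact Real.log_le_log (by exact_mod_cast (mem_Pr.1 hp).2.pos) hpY
    · linarith
  calc _ ≤ _ := h2
    _ ≤ Real.log Y * ((C + 1) * Real.log Y) := mul_le_mul_of_nonneg_left h1 (by linarith)
    _ = _ := by ring

lemma UB (g : ℕ → ℝ) (hg : ∀ n, 0 ≤ g n) {x : ℕ} (hx : 16 ≤ x) (j : ℕ) : UU x (BB^[j] g) ≤ KK x ^ j * UU x g := by
  induction j with
  | zero => simp
  | succ j ih =>
    rw [Function.iterate_succ_apply']
    refine (UU_BB hx (BBi_nonneg hg j)).trans ?_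
    calc _ ≤ KK x * (KK x ^ j * UU x g) := mul_le_mul_of_nonneg_left ih (KK_nonneg hx)
      _ = _ := by ring

lemma U_ell (j : ℕ) : ∃ C : ℝ, 1 ≤ C ∧ ∀ (Y : ℝ) (x : ℕ), 16 ≤ x → 1 ≤ Real.log Y → 1 ≤ Y →
    UU x (BB^[j] (ell Y)) ≤ C * LL x ^ j * Real.log Y := by
  obtain ⟨C, hC, h⟩ := ell_moments
  have hKC := KC_ge
  refine ⟨KC ^ j * C, ?_, fun Y x hx hl hY => ?_⟩
  · have : 1 ≤ KC ^ j := one_le_pow₀ hKC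
    nlinarith
  · refine (UB _ (ell_nonneg Y) hx j).trans ?_
    calc _ ≤ KK x ^ j * (C * Real.log Y) := mul_le_mul_of_nonneg_left (h Y x hl hY).1 (pow_nonneg (KK_nonneg hx) j)
      _ = _ := by rw [KK, mul_pow]; ring

lemma W_ell_aux (j : ℕ) (C0 : ℝ) (hC0 : 1 ≤ C0)
    (h0 : ∀ (Y : ℝ) (x : ℕ), 16 ≤ x → 1 ≤ Real.log Y → 1 ≤ Y →
      WW x (BB^[j] (ell Y)) ≤ C0 * LL x ^ (2 * j) * Real.log Y ^ 2) : ∃ C : ℝ, 1 ≤ C ∧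
    ∀ (Y : ℝ) (x : ℕ), 16 ≤ x → 1 ≤ Real.log Y → 1 ≤ Y →
      WW x (BB^[j + 1] (ell Y)) ≤ C * LL x ^ (2 * j + 1) * Real.log Y ^ 2 := by
  obtain ⟨C1, hC1, h1⟩ := U_ell j
  have hKC := KC_ge
  refine ⟨KC * (C1 ^ 2 + C0), ?_, fun Y x hx hl hY => ?_⟩
  · nlinarith
  · have hy := LL_ge_one hx
    rw [Function.iterate_succ_apply']
    refine (WW_BB hx (BBi_nonneg (ell_nonneg Y) j)).trans ?_
    have hU := h1 Y x hx hl hY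
    have hU0 : 0 ≤ UU x (BB^[j] (ell Y)) := UU_nonneg (BBi_nonneg (ell_nonneg Y) j) x
    calc _ ≤ KK x * ((C1 * LL x ^ j * Real.log Y) ^ 2 + C0 * LL x ^ (2 * j) * Real.log Y ^ 2) := by
          refine mul_le_mul_of_nonneg_left (add_le_add (pow_le_pow_left₀ hU0 hU 2) (h0 Y x hx hl hY)) (KK_nonneg hx)
      _ = _ := by rw [KK]; ring

lemma W_ell0 (j : ℕ) : ∃ C : ℝ, 1 ≤ C ∧ ∀ (Y : ℝ) (x : ℕ), 16 ≤ x → 1 ≤ Real.log Y → 1 ≤ Y →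
      WW x (BB^[j] (ell Y)) ≤ C * LL x ^ (2 * j) * Real.log Y ^ 2 := by
  induction j with
  | zero =>
    obtain ⟨C, hC, h⟩ := ell_moments
    exact ⟨C, hC, fun Y x _ hl hY => by simpa using (h Y x hl hY).2⟩
  | succ j ih =>
    obtain ⟨C0, hC0, h0⟩ := ih
    obtain ⟨C, hC, h⟩ := W_ell_aux j C0 hC0 h0
    refine ⟨C, hC, fun Y x hx hl hY => (h Y x hx hl hY).trans ?_⟩
    have hy := LL_ge_one hx
    have : LL x ^ (2 * j + 1) ≤ LL x ^ (2 * (j + 1)) := pow_le_pow_right₀ hy (by omega)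
    gcongr

lemma W_ell (j : ℕ) : ∃ C : ℝ, 1 ≤ C ∧ ∀ (Y : ℝ) (x : ℕ), 16 ≤ x → 1 ≤ Real.log Y → 1 ≤ Y →
      WW x (BB^[j + 1] (ell Y)) ≤ C * LL x ^ (2 * j + 1) * Real.log Y ^ 2 := by
  obtain ⟨C0, hC0, h0⟩ := W_ell0 j
  exact W_ell_aux j C0 hC0 h0

/-- indicator of a point -/
noncomputable def del (q p : ℕ) : ℝ := if p = q then 1 else 0

/-- number of chains of length at most `j` -/
noncomputable def GG (q : ℕ) : ℕ → ℕ → ℝ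
  | 0 => del q
  | j + 1 => fun p => del q p + BB (GG q j) p

lemma GG_nat (q j p : ℕ) : ∃ m : ℕ, GG q j p = m := by
  induction j generalizing p with
  | zero => unfold GG del; split_ifs; exacts [⟨1, by simp⟩, ⟨0, by simp⟩]
  | succ j ih =>
    choose m hm using ih
    refine ⟨(if p = q then 1 else 0) + ∑ r ∈ (p - 1).primeFactors, m r, ?_⟩
    push_cast
    unfold GG del BB TT
    simp only [hm]

lemma GG_nonneg (q j p : ℕ) : 0 ≤ GG q j p := by
  obtain ⟨m, hm⟩ := GG_nat q j p; rw [hm]; positivity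

lemma natr_fm (m : ℕ) : 0 ≤ (m:ℝ) * ((m:ℝ) - 1) := by
  rcases Nat.eq_zero_or_pos m with h | h
  · simp [h]
  · have : (1:ℝ) ≤ m := by exact_mod_cast h
    exact mul_nonneg (by linarith) (by linarith)

lemma GG_fm (q j p : ℕ) : 0 ≤ GG q j p * (GG q j p - 1) := by
  obtain ⟨m, hm⟩ := GG_nat q j p; rw [hm]; exact natr_fm m

lemma GG_zero_of_lt (q j p : ℕ) (hp : p < q) : GG q j p = 0 := by
  induction j generalizing p with
  | zero => simp [GG, del, hp.ne]
  | succ j ih =>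
    simp only [GG, del, hp.ne, if_false, zero_add]
    unfold BB TT
    refine Finset.sum_eq_zero fun r hr => ih r ?_
    have := Nat.le_of_mem_primeFactors hr
    omega

lemma BB_GG_self (q j : ℕ) (hq : 1 ≤ q) : BB (GG q j) q = 0 := by
  unfold BB TT
  refine Finset.sum_eq_zero fun r hr => GG_zero_of_lt q j r ?_
  have := Nat.le_of_mem_primeFactors hr
  omega

lemma UU_del (x q : ℕ) : UU x (del q) ≤ 1 / q := by
  unfold UU del
  calc ∑ p ∈ Pr x, (if p = q then (1:ℝ) else 0) / p = ∑ p ∈ Pr x, if p = q then 1 / (q:ℝ) else 0 := by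
        refine Finset.sum_congr rfl fun p _ => ?_
        split_ifs with h
        · rw [h]
        · simp
    _ ≤ 1 / q := by
        rw [Finset.sum_ite_eq']
        split_ifs
        · exact le_rfl
        · positivity

lemma UU_add (x : ℕ) (g h : ℕ → ℝ) : UU x (fun p => g p + h p) = UU x g + UU x h := by
  unfold UU; rw [← Finset.sum_add_distrib]; exact Finset.sum_congr rfl fun _ _ => by ring

lemma GG_moments (j : ℕ) : ∃ C : ℝ, 1 ≤ C ∧ ∀ (x q : ℕ), 16 ≤ x → 1 ≤ q →
    UU x (GG q j) ≤ C * LL x ^ j / q ∧ VV x (GG q j) ≤ C * LL x ^ (2 * j) / (q:ℝ) ^ 2 := by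
  have hKC := KC_ge
  induction j with
  | zero =>
    refine ⟨1, le_rfl, fun x q hx hq => ⟨?_, ?_⟩⟩
    · simpa [GG] using UU_del x q
    · have : VV x (GG q 0) = 0 := Finset.sum_eq_zero fun p _ => by
        simp only [GG, del]; split_ifs <;> simp
      rw [this, mul_zero, pow_zero]; positivity
  | succ j ih =>
    obtain ⟨C, hC, h⟩ := ih
    refine ⟨1 + KC * (C ^ 2 + C), by nlinarith, fun x q hx hq => ?_⟩
    have hy := LL_ge_one hx
    have hq0 : (0:ℝ) < q := by exact_mod_cast hq
    obtain ⟨h1, h2⟩ := h x q hx hq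
    have hU0 : 0 ≤ UU x (GG q j) := UU_nonneg (GG_nonneg q j) x
    constructor
    · have e : UU x (GG q (j + 1)) = UU x (del q) + UU x (BB (GG q j)) := UU_add x _ _
      rw [e]
      have hyp : 1 ≤ LL x ^ (j + 1) := one_le_pow₀ hy
      calc _ ≤ 1 / (q:ℝ) + KK x * (C * LL x ^ j / q) :=
            add_le_add (UU_del x q) ((UU_BB hx (GG_nonneg q j)).trans (mul_le_mul_of_nonneg_left h1 (KK_nonneg hx)))
        _ = (1 + KC * C * LL x ^ (j + 1)) / q := by rw [KK]; ring
        _ ≤ (1 + KC * (C ^ 2 + C)) * LL x ^ (j + 1) / q := by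
            gcongr
            have : 0 ≤ KC * C ^ 2 * LL x ^ (j + 1) := by positivity
            nlinarith
    · have e : VV x (GG q (j + 1)) ≤ VV x (BB (GG q j)) := by
        refine Finset.sum_le_sum fun p _ => ?_
        refine div_le_div_of_nonneg_right (le_of_eq ?_) (Nat.cast_nonneg _)
        simp only [GG, del]
        split_ifs with hpq
        · rw [hpq, BB_GG_self q j hq]; simp
        · rw [zero_add]
      refine e.trans ((VV_BB hx (GG_nonneg q j) (GG_fm q j)).trans ?_)
      have hsq : UU x (GG q j) ^ 2 ≤ (C * LL x ^ j / q) ^ 2 := pow_le_pow_left₀ hU0 h1 2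
      have hp1 : LL x ^ (2 * j + 1) ≤ LL x ^ (2 * (j + 1)) := pow_le_pow_right₀ hy (by omega)
      calc _ ≤ KK x * ((C * LL x ^ j / q) ^ 2 + C * LL x ^ (2 * j) / (q:ℝ) ^ 2) :=
            mul_le_mul_of_nonneg_left (add_le_add hsq h2) (KK_nonneg hx)
        _ = KC * (C ^ 2 + C) * LL x ^ (2 * j + 1) / (q:ℝ) ^ 2 := by rw [KK]; ring
        _ ≤ (1 + KC * (C ^ 2 + C)) * LL x ^ (2 * (j + 1)) / (q:ℝ) ^ 2 := by
            gcongr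
            linarith

end ICM

namespace ICM

lemma AP_eq_sum (r t : ℕ) : AP r t = ∑ p ∈ Pr t, if r ∣ p - 1 then 1 / (p:ℝ) else 0 := by
  rw [AP, Finset.sum_filter]

lemma UU_BB_eq (t : ℕ) (f : ℕ → ℝ) : UU t (BB f) = ∑ r ∈ Pr t, f r * AP r t := by
  have : ∀ p ∈ Pr t, BB f p / p = ∑ r ∈ Pr t, f r * (if r ∣ p - 1 then 1 / (p:ℝ) else 0) := by
    intro p hp
    have h2 := (mem_Pr.1 hp).2.two_le
    have h3 := (mem_Pr.1 hp).1
    rw [BB, TT_eq f (x := t) (by omega) (by omega), Finset.sum_div]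
    refine Finset.sum_congr rfl fun r _ => ?_
    split_ifs <;> ring
  rw [UU, Finset.sum_congr rfl this, Finset.sum_comm]
  exact Finset.sum_congr rfl fun r _ => by rw [← Finset.mul_sum, AP_eq_sum]

/-- block base for `r > R0` -/
def Ri (R0 r : ℕ) : ℕ := R0 ^ (2 ^ Nat.log 2 (Nat.log R0 (r - 1)))

lemma Ri_spec {R0 r : ℕ} (hR : 2 ≤ R0) (hr : R0 < r) : R0 ≤ Ri R0 r ∧ Ri R0 r < r ∧ r ≤ Ri R0 r ^ 2 := by
  have h1 : R0 ^ Nat.log R0 (r - 1) ≤ r - 1 := Nat.pow_log_le_self R0 (by omega)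
  have h2 : r - 1 < R0 ^ (Nat.log R0 (r - 1) + 1) := Nat.lt_pow_succ_log_self (by omega) _
  have h3 : 1 ≤ Nat.log R0 (r - 1) := Nat.log_pos (by omega) (by omega)
  set e := Nat.log R0 (r - 1) with he
  have h4 : 2 ^ Nat.log 2 e ≤ e := Nat.pow_log_le_self 2 (by omega)
  have h5 : e < 2 ^ (Nat.log 2 e + 1) := Nat.lt_pow_succ_log_self (by omega) _
  refine ⟨Nat.le_self_pow (by positivity) R0, ?_, ?_⟩
  · have : R0 ^ (2 ^ Nat.log 2 e) ≤ R0 ^ e := Nat.pow_le_pow_right (by omega) h4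
    unfold Ri; rw [← he]; omega
  · have : R0 ^ (e + 1) ≤ R0 ^ (2 ^ (Nat.log 2 e + 1)) := Nat.pow_le_pow_right (by omega) h5
    unfold Ri; rw [← he, ← pow_mul, ← pow_succ]; omega

lemma few_large (p : ℕ) (hp : 2 ≤ p) :
    ((((p - 1).primeFactors.filter (fun r => p ≤ r ^ 30)).card : ℕ) : ℝ) ≤ 30 := by
  set s := (p - 1).primeFactors.filter (fun r => p ≤ r ^ 30) with hs
  have h1 : ∏ r ∈ s, r ≤ p - 1 := by
    refine (Nat.le_of_dvd (by omega) ?_)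
    exact (Finset.prod_dvd_prod_of_subset _ _ _ (Finset.filter_subset _ _)).trans (Nat.prod_primeFactors_dvd _)
  have h2 : p ^ s.card ≤ (∏ r ∈ s, r) ^ 30 := by
    rw [← Finset.prod_pow, ← Finset.prod_const]
    exact Finset.prod_le_prod (fun _ _ => Nat.zero_le _) (fun r hr => (Finset.mem_filter.1 hr).2)
  have h3 : (∏ r ∈ s, r) ^ 30 ≤ p ^ 30 := Nat.pow_le_pow_left (by omega) 30
  have : s.card ≤ 30 := (Nat.pow_le_pow_iff_right (by omega)).1 (h2.trans h3)
  exact_mod_cast this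

lemma sum_inv_Pr : ∃ C : ℝ, 1 ≤ C ∧ ∀ x : ℕ, 16 ≤ x → ∑ p ∈ Pr x, 1 / (p:ℝ) ≤ C * LL x := by
  obtain ⟨C, hC, h⟩ := mertens2_total
  refine ⟨1 + C, by linarith, fun x hx => ?_⟩
  have := (abs_le.1 (h x (by omega))).2
  have hy := LL_ge_one hx
  nlinarith

/-- the contribution of large prime factors of shifted primes -/
lemma small_part : ∃ C : ℝ, 1 ≤ C ∧ ∀ (x : ℕ) (f : ℕ → ℝ), 16 ≤ x → (∀ n, 0 ≤ f n) →
    ∑ p ∈ Pr x, (1 / (p:ℝ)) * ∑ r ∈ (p - 1).primeFactors.filter (fun r => p ≤ r ^ 30), f r ≤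
      C * LL x * Real.sqrt (WW x f) := by
  obtain ⟨C, hC, h⟩ := sum_inv_Pr
  have hKC := KC_ge
  refine ⟨30 * C * KC, by nlinarith [mul_le_mul hC hKC (by norm_num) (by linarith)], fun x f hx hf => ?_⟩
  have hy := LL_ge_one hx
  set h' : ℕ → ℝ := fun p => ∑ r ∈ (p - 1).primeFactors.filter (fun r => p ≤ r ^ 30), f r with hh
  have h1 := cs_w (Pr x) (fun p => 1 / (p:ℝ)) h' (fun _ _ => by positivity)
  have h2 : ∑ p ∈ Pr x, 1 / (p:ℝ) * h' p ^ 2 ≤ 30 * (KK x * WW x f) := by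
    have e : ∑ p ∈ Pr x, 1 / (p:ℝ) * TT (fun r => f r ^ 2) (p - 1) ≤ KK x * UU x (fun r => f r ^ 2) :=
      (dens_pr hx).first (fun _ => sq_nonneg _)
    have e' : UU x (fun r => f r ^ 2) = WW x f := rfl
    rw [e'] at e
    calc _ ≤ ∑ p ∈ Pr x, 30 * (1 / (p:ℝ) * TT (fun r => f r ^ 2) (p - 1)) := by
          refine Finset.sum_le_sum fun p hp => ?_
          have hcs : h' p ^ 2 ≤ 30 * TT (fun r => f r ^ 2) (p - 1) := by
            refine (sq_sum_le_card_mul_sum_sq).trans ?_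
            refine mul_le_mul (few_large p (mem_Pr.1 hp).2.two_le) ?_ (Finset.sum_nonneg fun _ _ => sq_nonneg _) (by norm_num)
            exact Finset.sum_le_sum_of_subset_of_nonneg (Finset.filter_subset _ _) (fun _ _ _ => sq_nonneg _)
          calc 1 / (p:ℝ) * h' p ^ 2 ≤ 1 / (p:ℝ) * (30 * TT (fun r => f r ^ 2) (p - 1)) :=
                mul_le_mul_of_nonneg_left hcs (by positivity)
            _ = _ := by ring
      _ ≤ _ := by rw [← Finset.mul_sum]; linarith
  have hW := WW_nonneg f x
  refine le_of_sq_le_sq ?_ (by positivity)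
  refine h1.trans ?_
  rw [mul_pow, Real.sq_sqrt hW]
  calc _ ≤ (C * LL x) * (30 * (KK x * WW x f)) :=
        mul_le_mul (h x hx) h2 (Finset.sum_nonneg fun _ _ => by positivity) (by positivity)
    _ = (30 * C * KC) * LL x ^ 2 * WW x f := by rw [KK]; ring
    _ ≤ (30 * C * KC) ^ 2 * LL x ^ 2 * WW x f := by
        have : 1 ≤ 30 * C * KC := by nlinarith [mul_le_mul hC hKC (by norm_num) (by linarith)]
        have := le_self_pow₀ this (show 2 ≠ 0 by norm_num)
        gcongr
    _ = _ := by ring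

end ICM

namespace ICM

lemma LL_Ri {R0 r : ℕ} (hR : 2 ≤ R0) (hr : R0 < r) :
    0 ≤ LL (Ri R0 r ^ 30) - LL r ∧ LL (Ri R0 r ^ 30) - LL r ≤ 4 := by
  obtain ⟨h1, h2, h3⟩ := Ri_spec hR hr
  set M := Ri R0 r
  have hM : 2 ≤ M := hR.trans h1
  have hl := log_pos_nat hM
  have e30 : LL (M ^ 30) = Real.log 30 + LL M := by
    unfold LL; push_cast; rw [Real.log_pow, Real.log_mul (by norm_num) hl.ne']; norm_num
  have e2 : LL (M ^ 2) = Real.log 2 + LL M := by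
    unfold LL; push_cast; rw [Real.log_pow, Real.log_mul (by norm_num) hl.ne']; norm_num
  have m1 := LL_mono hM h2.le
  have m2 := LL_mono (by omega : 2 ≤ r) h3
  have l30 : Real.log 30 ≤ 4 := by
    have : Real.log 30 ≤ Real.log (2 ^ 5) := Real.log_le_log (by norm_num) (by norm_num)
    rw [Real.log_pow] at this
    have := Real.log_two_lt_d9
    norm_num at *; linarith
  have l2 : Real.log 2 ≤ Real.log 30 := Real.log_le_log (by norm_num) (by norm_num)
  constructor <;> linarith

lemma c_part : ∃ C : ℝ, 0 < C ∧ ∀ R0 r t : ℕ, 2 ≤ R0 → R0 < r → r ≤ t → LL t + 1 ≤ R0 →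
    |(∑ n ∈ Finset.Ioc (Ri R0 r ^ 30) t, pinv n) / ((r:ℝ) - 1) - (LL t - LL r) / r| ≤ C / r := by
  obtain ⟨C, hC, h⟩ := mertens2
  have hl2 : 0 < Real.log 2 := Real.log_pos (by norm_num)
  refine ⟨2 * (C / Real.log 2 + 4) + 1, by positivity, fun R0 r t hR hr hrt ht => ?_⟩
  set M := Ri R0 r ^ 30 with hM
  have hM2 : 2 ≤ M := by
    have := (Ri_spec hR hr).1
    exact (hR.trans this).trans (Nat.le_self_pow (by norm_num) _)
  obtain ⟨g1, g2⟩ := LL_Ri hR hr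
  have hr3 := LL_nonneg (show 3 ≤ r by omega)
  have hrt' := LL_mono (by omega : 2 ≤ r) hrt
  have hrr : (2:ℝ) < r := by exact_mod_cast (by omega : 2 < r)
  have hrR : (R0:ℝ) + 1 ≤ r := by exact_mod_cast hr
  have key : |(∑ n ∈ Finset.Ioc M t, pinv n) - (LL t - LL r)| ≤ C / Real.log 2 + 4 := by
    rcases le_or_gt M t with hMt | hMt
    · have e := h M t hM2 hMt
      have : C / Real.log M ≤ C / Real.log 2 := by
        apply div_le_div_of_nonneg_left hC.le hl2
        exact Real.log_le_log (by norm_num) (by exact_mod_cast hM2)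
      rw [abs_le] at e ⊢
      constructor <;> linarith
    · rw [Finset.Ioc_eq_empty (by omega), Finset.sum_empty]
      have := LL_mono (by omega : 2 ≤ t) hMt.le
      have : 0 < C / Real.log 2 := by positivity
      rw [abs_le]; constructor <;> linarith
  set s := ∑ n ∈ Finset.Ioc M t, pinv n
  have hs : 0 ≤ s := Finset.sum_nonneg fun n _ => pinv_nonneg n
  set D := LL t - LL r
  set C' := C / Real.log 2 + 4
  have hC' : 0 ≤ C' := (abs_nonneg _).trans key
  have hs2 : s / ((r:ℝ) - 1) ≤ 1 + C' := by
    rw [div_le_iff₀ (by linarith)]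
    have := (abs_le.1 key).2
    have : C' ≤ C' * (r - 1) := le_mul_of_one_le_right hC' (by linarith)
    nlinarith
  have e : s / ((r:ℝ) - 1) - D / r = ((s - D) + s / ((r:ℝ) - 1)) / r := by
    have : (r:ℝ) - 1 ≠ 0 := by linarith
    field_simp; ring
  rw [e, abs_div, abs_of_pos (by linarith : (0:ℝ) < r)]
  apply div_le_div_of_nonneg_right _ (by linarith)
  refine (abs_add_le _ _).trans ?_
  rw [abs_of_nonneg (div_nonneg hs (by linarith : (0:ℝ) ≤ r - 1))]
  linarith

lemma AP_split {R0 r t : ℕ} (hR : 2 ≤ R0) (hr : R0 < r) (hp : r.Prime) :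
    AP r t = (∑ n ∈ (Finset.Ioc 0 t).filter (fun n => n ≤ Ri R0 r ^ 30), if r ∣ n - 1 then pinv n else 0)
      + ∑ n ∈ Finset.Ioc (Ri R0 r ^ 30) t, pinv n * Dl r n
      + (∑ n ∈ Finset.Ioc (Ri R0 r ^ 30) t, pinv n) / ((r:ℝ) - 1) := by
  obtain ⟨h1, h2, h3⟩ := Ri_spec hR hr
  set M := Ri R0 r ^ 30 with hM
  have hrM : r ≤ M := h3.trans (Nat.pow_le_pow_right (by omega) (by norm_num))
  rw [AP_eq, ← Finset.sum_filter_add_sum_filter_not (Finset.Ioc 0 t) (fun n => n ≤ M), add_assoc]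
  congr 1
  have : (Finset.Ioc 0 t).filter (fun n => ¬ n ≤ M) = Finset.Ioc M t := by
    ext n; simp only [Finset.mem_filter, Finset.mem_Ioc]; omega
  rw [this, Finset.sum_div, ← Finset.sum_add_distrib]
  refine Finset.sum_congr rfl fun n hn => ?_
  have hn' := Finset.mem_Ioc.1 hn
  by_cases hnp : n.Prime
  · have e0 : ((n : ZMod r)) ≠ 0 := by
      rw [Ne, ZMod.natCast_eq_zero_iff]
      intro hd
      rcases (Nat.dvd_prime hnp).1 hd with h | h
      · exact hp.one_lt.ne' h
      · omega
    unfold Dl Dz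
    rw [if_neg e0]
    by_cases hd : r ∣ n - 1
    · rw [if_pos hd, if_pos ((modEq_one_iff (by omega)).2 hd)]; ring
    · rw [if_neg hd, if_neg (fun h => hd ((modEq_one_iff (by omega)).1 h))]; ring
  · have : pinv n = 0 := by simp [pinv, hnp]
    simp [this]

end ICM

namespace ICM

lemma a_part : ∃ C : ℝ, 1 ≤ C ∧ ∀ (x t R0 : ℕ) (f : ℕ → ℝ), 16 ≤ x → t ≤ x → 2 ≤ R0 → (∀ n, 0 ≤ f n) →
    ∑ r ∈ (Pr t).filter (fun r => R0 < r), f r *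
      (∑ n ∈ (Finset.Ioc 0 t).filter (fun n => n ≤ Ri R0 r ^ 30), if r ∣ n - 1 then pinv n else 0) ≤
      C * LL x * Real.sqrt (WW x f) := by
  obtain ⟨C, hC, h⟩ := small_part
  refine ⟨C, hC, fun x t R0 f hx htx hR hf => le_trans ?_ (h x f hx hf)⟩
  have e1 : ∀ p ∈ Pr x, (1 / (p:ℝ)) * ∑ r ∈ (p - 1).primeFactors.filter (fun r => p ≤ r ^ 30), f r =
      ∑ r ∈ Pr x, f r * (if r ∣ p - 1 ∧ p ≤ r ^ 30 then 1 / (p:ℝ) else 0) := by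
    intro p hp
    obtain ⟨hp1, hp2⟩ := mem_Pr.1 hp
    have := hp2.two_le
    have e : (p - 1).primeFactors.filter (fun r => p ≤ r ^ 30) =
        (Pr x).filter (fun r => r ∣ p - 1 ∧ p ≤ r ^ 30) := by
      ext r
      simp only [Finset.mem_filter, Nat.mem_primeFactors, mem_Pr]
      constructor
      · rintro ⟨⟨a, b, c⟩, d⟩
        exact ⟨⟨(Nat.le_of_dvd (by omega) b).trans (by omega), a⟩, b, d⟩
      · rintro ⟨⟨a, b⟩, c, d⟩
        exact ⟨⟨b, c, by omega⟩, d⟩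
    rw [e, Finset.sum_filter, Finset.mul_sum]
    refine Finset.sum_congr rfl fun r _ => ?_
    split_ifs <;> ring
  rw [Finset.sum_congr rfl e1, Finset.sum_comm]
  calc _ ≤ ∑ r ∈ (Pr t).filter (fun r => R0 < r), ∑ p ∈ Pr x, f r * (if r ∣ p - 1 ∧ p ≤ r ^ 30 then 1 / (p:ℝ) else 0) := by
        refine Finset.sum_le_sum fun r hr => ?_
        rw [← Finset.mul_sum]
        refine mul_le_mul_of_nonneg_left ?_ (hf r)
        have hr0 := (Finset.mem_filter.1 hr).2
        have hRi := (Ri_spec hR hr0).2.1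
        rw [sum_Pr, Finset.sum_filter]
        calc _ ≤ ∑ n ∈ Finset.Ioc 0 t, (if n.Prime then (if r ∣ n - 1 ∧ n ≤ r ^ 30 then 1 / (n:ℝ) else 0) else 0) := by
              refine Finset.sum_le_sum fun n _ => ?_
              unfold pinv
              have : Ri R0 r ^ 30 ≤ r ^ 30 := Nat.pow_le_pow_left hRi.le 30
              by_cases h1 : n ≤ Ri R0 r ^ 30
              · have : n ≤ r ^ 30 := h1.trans this
                simp only [h1, this, and_true, if_true]
                split_ifs <;> simp
              · rw [if_neg h1]; split_ifs <;> positivity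
          _ ≤ _ := by
              refine Finset.sum_le_sum_of_subset_of_nonneg (Finset.Ioc_subset_Ioc_right htx) fun n _ _ => ?_
              split_ifs <;> positivity
    _ ≤ _ := by
        refine Finset.sum_le_sum_of_subset_of_nonneg
          ((Finset.filter_subset _ _).trans (Pr_subset htx)) fun r _ _ => ?_
        refine Finset.sum_nonneg fun p _ => mul_nonneg (hf r) ?_
        split_ifs <;> positivity

lemma b_part : ∃ C : ℝ, 0 < C ∧ ∀ (x t R0 : ℕ) (f : ℕ → ℝ), 16 ≤ x → t ≤ x → 2 ≤ R0 →
    (∀ n, 0 ≤ f n) → (∀ p, p.Prime → f p ≤ Real.log p) →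
    ∑ r ∈ (Pr t).filter (fun r => R0 < r), f r *
      |∑ n ∈ Finset.Ioc (Ri R0 r ^ 30) t, pinv n * Dl r n| ≤
      C * (1 + Real.log x) ^ 5 / Real.sqrt R0 := by
  obtain ⟨C, hC, h⟩ := T3
  refine ⟨2 * C, by positivity, fun x t R0 f hx htx hR hf hfl => ?_⟩
  have hx0 : (0:ℝ) < x := by exact_mod_cast (by omega : 0 < x)
  have hlx := log_pos_nat (show 2 ≤ x by omega)
  have hR0 : (0:ℝ) < R0 := by exact_mod_cast (by omega : 0 < R0)
  set S := (Pr t).filter (fun r => R0 < r) with hS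
  set b : ℕ → ℝ := fun r => |∑ n ∈ Finset.Ioc (Ri R0 r ^ 30) t, pinv n * Dl r n| with hb
  set ii : ℕ → ℕ := fun r => Nat.log 2 (Nat.log R0 (r - 1)) with hi
  set L := Nat.log 2 x with hL
  have hmap : ∀ r ∈ S, ii r ∈ Finset.range (L + 1) := by
    intro r hr
    have hr' := Finset.mem_filter.1 hr
    have := (mem_Pr.1 hr'.1).1
    rw [Finset.mem_range]
    have h1 : ii r ≤ Nat.log R0 (r - 1) := Nat.log_le_self _ _
    have h2 : Nat.log R0 (r - 1) ≤ Nat.log 2 (r - 1) := Nat.log_anti_left (by norm_num) hR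
    have h3 : Nat.log 2 (r - 1) ≤ L := Nat.log_mono_right (by omega)
    omega
  have hfib : ∀ i ∈ Finset.range (L + 1), ∑ r ∈ S.filter (fun r => ii r = i), b r ≤
      C * (1 + Real.log x) ^ 3 / Real.sqrt R0 := by
    intro i _
    set R := R0 ^ (2 ^ i) with hRdef
    have hRR : R0 ≤ R := Nat.le_self_pow (by positivity) R0
    have e : ∀ r ∈ S.filter (fun r => ii r = i), Ri R0 r = R := by
      intro r hr
      have := (Finset.mem_filter.1 hr).2
      simp only [Ri, hRdef, ← this, hi]
    have hb' : ∑ r ∈ S.filter (fun r => ii r = i), b r = ∑ r ∈ S.filter (fun r => ii r = i), |∑ n ∈ Finset.Ioc (R ^ 30) t, pinv n * Dl r n| :=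
      Finset.sum_congr rfl fun r hr => by simp only [hb]; rw [e r hr]
    rw [hb']
    rcases le_or_gt (R ^ 30) t with ht | ht
    · refine (h R (hR.trans hRR) _ ?_ t ht).trans ?_
      · intro r hr
        have h1 := Finset.mem_filter.1 hr
        have h2 := Finset.mem_filter.1 h1.1
        have h3 := Ri_spec hR h2.2
        rw [e r hr] at h3
        exact ⟨(mem_Pr.1 h2.1).2, h3.2.1, h3.2.2⟩
      · have ht1 : 1 ≤ t := le_trans (Nat.one_le_pow _ _ (by omega)) ht
        have ht0 : (1:ℝ) ≤ t := by exact_mod_cast ht1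
        have h1 : Real.log t ≤ Real.log x := Real.log_le_log (by linarith) (by exact_mod_cast htx)
        have h2 : 0 ≤ Real.log t := Real.log_nonneg ht0
        have h3 : Real.sqrt R0 ≤ Real.sqrt R := Real.sqrt_le_sqrt (by exact_mod_cast hRR)
        have h4 : 0 < Real.sqrt R0 := Real.sqrt_pos.2 hR0
        gcongr
    · rw [Finset.Ioc_eq_empty (by omega)]
      simp; positivity
  have hb0 : ∀ r, 0 ≤ b r := fun r => abs_nonneg _
  have hsum : ∑ r ∈ S, b r ≤ (L + 1 : ℕ) * (C * (1 + Real.log x) ^ 3 / Real.sqrt R0) := by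
    rw [← Finset.sum_fiberwise_of_maps_to hmap]
    refine (Finset.sum_le_sum hfib).trans ?_
    rw [Finset.sum_const, Finset.card_range, nsmul_eq_mul]
  have hL2 : (L:ℝ) ≤ 2 * Real.log x := by
    have h1 : (2:ℝ) ^ L ≤ x := by exact_mod_cast Nat.pow_log_le_self 2 (by omega)
    have h2 := Real.log_le_log (by positivity) h1
    rw [Real.log_pow] at h2
    have := Real.log_two_gt_d9
    have hL0 : (0:ℝ) ≤ L := Nat.cast_nonneg _
    nlinarith
  calc _ ≤ ∑ r ∈ S, Real.log x * b r := by
        refine Finset.sum_le_sum fun r hr => mul_le_mul_of_nonneg_right ?_ (hb0 r)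
        have hr' := mem_Pr.1 (Finset.mem_filter.1 hr).1
        refine (hfl r hr'.2).trans (Real.log_le_log (by exact_mod_cast hr'.2.pos) ?_)
        exact_mod_cast hr'.1.trans htx
    _ ≤ Real.log x * ((L + 1 : ℕ) * (C * (1 + Real.log x) ^ 3 / Real.sqrt R0)) := by
        rw [← Finset.mul_sum]; exact mul_le_mul_of_nonneg_left hsum hlx.le
    _ ≤ (1 + Real.log x) * ((2 * (1 + Real.log x)) * (C * (1 + Real.log x) ^ 3 / Real.sqrt R0)) := by
        have : ((L + 1 : ℕ) : ℝ) ≤ 2 * (1 + Real.log x) := by push_cast; linarith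
        gcongr
        linarith
    _ = _ := by ring

lemma AP_le {x t r : ℕ} (hx : 16 ≤ x) (htx : t ≤ x) (hr : r.Prime) : AP r t ≤ KK x / r := by
  refine (AP_mono r htx).trans ?_
  rw [AP_eq_sum]
  exact (dens_pr hx).h1 r hr

lemma LL_two_ge {r : ℕ} (hr : 2 ≤ r) : -1 ≤ LL r := by
  refine le_trans ?_ (LL_mono le_rfl hr)
  unfold LL
  rw [Real.le_log_iff_exp_le (Real.log_pos (by norm_num))]
  have h1 := Real.log_two_gt_d9
  have h2 : Real.exp (-1) ≤ 1 / 2 := by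
    rw [Real.exp_neg, ← one_div]
    exact one_div_le_one_div_of_le (by norm_num) (by linarith [Real.add_one_le_exp (1:ℝ)])
  push_cast; linarith

lemma sum_log_div_le : ∃ C : ℝ, 0 < C ∧ ∀ t : ℕ, 1 ≤ t →
    ∑ r ∈ Pr t, Real.log r / (r:ℝ) ≤ Real.log t + C := by
  obtain ⟨C, hC, h⟩ := mertens_p
  refine ⟨C, hC, fun t ht => ?_⟩
  have := (abs_le.1 (h t ht)).2
  rw [sum_Pr]
  have e : ∑ n ∈ Finset.Ioc 0 t, (if n.Prime then Real.log n / (n:ℝ) else 0) = ∑ n ∈ Finset.Ioc 0 t, lp n / n :=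
    Finset.sum_congr rfl fun n _ => by unfold lp; split_ifs <;> simp
  rw [e]; linarith

lemma step_ineq : ∃ C : ℝ, 1 ≤ C ∧ ∀ (x t R0 : ℕ) (f : ℕ → ℝ), 16 ≤ x → 3 ≤ t → t ≤ x → 2 ≤ R0 →
    LL x + 1 ≤ R0 → (∀ n, 0 ≤ f n) → (∀ p, p.Prime → f p ≤ Real.log p) →
    |UU t (BB f) - ∑ r ∈ Pr t, f r / r * (LL t - LL r)| ≤
      C * (LL x * (Real.log R0 + 1) + LL x * Real.sqrt (WW x f) + (1 + Real.log x) ^ 5 / Real.sqrt R0 + UU x f) := by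
  obtain ⟨C1, hC1, h1⟩ := a_part
  obtain ⟨C2, hC2, h2⟩ := b_part
  obtain ⟨C3, hC3, h3⟩ := c_part
  obtain ⟨C4, hC4, h4⟩ := sum_log_div_le
  have hKC := KC_ge
  refine ⟨C1 + C2 + C3 + (KC + 2) * (1 + C4), by nlinarith, fun x t R0 f hx ht htx hR hRx hf hfl => ?_⟩
  have hy := LL_ge_one hx
  have htx' := LL_mono (show 2 ≤ t by omega) htx
  rw [UU_BB_eq, ← Finset.sum_sub_distrib]
  refine (Finset.abs_sum_le_sum_abs _ _).trans ?_
  rw [← Finset.sum_filter_add_sum_filter_not (Pr t) (fun r => R0 < r)]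
  have hlR : 0 ≤ Real.log R0 := Real.log_natCast_nonneg _
  have hbig : ∑ r ∈ (Pr t).filter (fun r => R0 < r), |f r * AP r t - f r / r * (LL t - LL r)| ≤
      C1 * LL x * Real.sqrt (WW x f) + C2 * (1 + Real.log x) ^ 5 / Real.sqrt R0 + C3 * UU x f := by
    have e3 : ∑ r ∈ (Pr t).filter (fun r => R0 < r), f r * (C3 / r) ≤ C3 * UU x f := by
      rw [UU, Finset.mul_sum]
      refine (Finset.sum_le_sum_of_subset_of_nonneg
          ((Finset.filter_subset _ _).trans (Pr_subset htx)) fun r _ _ => ?_).trans (le_of_eq ?_)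
      · exact mul_nonneg (hf r) (by positivity)
      · exact Finset.sum_congr rfl fun r _ => by ring
    refine le_trans ?_ (add_le_add (add_le_add (h1 x t R0 f hx htx hR hf) (h2 x t R0 f hx htx hR hf hfl)) e3)
    rw [← Finset.sum_add_distrib, ← Finset.sum_add_distrib]
    refine Finset.sum_le_sum fun r hr => ?_
    obtain ⟨hr1, hr2⟩ := Finset.mem_filter.1 hr
    obtain ⟨hr3, hr4⟩ := mem_Pr.1 hr1
    have hc := h3 R0 r t hR hr2 hr3 (by linarith)
    rw [AP_split (t := t) hR hr2 hr4]
    set a := ∑ n ∈ (Finset.Ioc 0 t).filter (fun n => n ≤ Ri R0 r ^ 30), if r ∣ n - 1 then pinv n else 0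
    have ha : 0 ≤ a := Finset.sum_nonneg fun n _ => by split_ifs <;> first | exact pinv_nonneg n | exact le_rfl
    set b := ∑ n ∈ Finset.Ioc (Ri R0 r ^ 30) t, pinv n * Dl r n
    set c := (∑ n ∈ Finset.Ioc (Ri R0 r ^ 30) t, pinv n) / ((r:ℝ) - 1)
    have e : f r * (a + b + c) - f r / r * (LL t - LL r) = f r * (a + b + (c - (LL t - LL r) / r)) := by ring
    rw [e, abs_mul, abs_of_nonneg (hf r), ← mul_add, ← mul_add]
    refine mul_le_mul_of_nonneg_left ?_ (hf r)
    refine (abs_add_le _ _).trans (add_le_add ((abs_add_le _ _).trans ?_) hc)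
    rw [abs_of_nonneg ha]
  have hsmall : ∑ r ∈ (Pr t).filter (fun r => ¬ R0 < r), |f r * AP r t - f r / r * (LL t - LL r)| ≤
      (KC + 2) * LL x * (Real.log R0 + C4) := by
    refine le_trans ?_ (mul_le_mul_of_nonneg_left (h4 R0 (by omega)) (by positivity))
    rw [Finset.mul_sum]
    refine le_trans ?_ (Finset.sum_le_sum_of_subset_of_nonneg (s := (Pr t).filter (fun r => ¬ R0 < r)) ?_ ?_)
    · refine Finset.sum_le_sum fun r hr => ?_
      obtain ⟨hr1, hr2⟩ := Finset.mem_filter.1 hr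
      obtain ⟨hr3, hr4⟩ := mem_Pr.1 hr1
      have hA := AP_le (t := t) hx htx hr4
      have hA0 := AP_nonneg r t
      have hr0 : (0:ℝ) < r := by exact_mod_cast hr4.pos
      have hge := LL_two_ge hr4.two_le
      have hmono := LL_mono hr4.two_le hr3
      have hf0 := hf r
      have hfr := hfl r hr4
      have p1 : f r * AP r t ≤ f r * (KK x / r) := mul_le_mul_of_nonneg_left hA hf0
      have p2 : f r / r * (LL t - LL r) ≤ f r / r * (2 * LL x) :=
        mul_le_mul_of_nonneg_left (by linarith) (by positivity)
      have p3 : 0 ≤ f r * AP r t := mul_nonneg hf0 hA0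
      have p4 : 0 ≤ f r / r * (LL t - LL r) := mul_nonneg (by positivity) (by linarith)
      have p5 : f r / r ≤ Real.log r / r := div_le_div_of_nonneg_right hfr hr0.le
      have p6 : (KC + 2) * LL x * (f r / r) ≤ (KC + 2) * LL x * (Real.log r / r) :=
        mul_le_mul_of_nonneg_left p5 (by positivity)
      have p7 : f r * (KK x / r) + f r / r * (2 * LL x) = (KC + 2) * LL x * (f r / r) := by
        rw [KK]; ring
      rw [abs_le]; constructor <;> linarith
    · intro r hr
      obtain ⟨hr1, hr2⟩ := Finset.mem_filter.1 hr
      exact mem_Pr.2 ⟨by omega, (mem_Pr.1 hr1).2⟩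
    · intro r _ _
      have := Real.log_natCast_nonneg r
      positivity
  refine (add_le_add hbig hsmall).trans ?_
  have hU := UU_nonneg hf x
  have hs : 0 ≤ Real.sqrt (WW x f) := Real.sqrt_nonneg _
  have hlx := log_pos_nat (show 2 ≤ x by omega)
  set E2 := LL x * Real.sqrt (WW x f) with hE2
  set E3 := (1 + Real.log x) ^ 5 / Real.sqrt R0 with hE3
  set E1 := LL x * (Real.log R0 + 1) with hE1
  have q1 : 0 ≤ E1 := by positivity
  have q2 : 0 ≤ E2 := by positivity
  have q3 : 0 ≤ E3 := by positivity
  have r1 : C1 * LL x * Real.sqrt (WW x f) = C1 * E2 := by rw [hE2]; ring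
  have r2 : C2 * (1 + Real.log x) ^ 5 / Real.sqrt R0 = C2 * E3 := by rw [hE3]; ring
  have r3 : (KC + 2) * LL x * (Real.log R0 + C4) ≤ (KC + 2) * (1 + C4) * E1 := by
    have : Real.log R0 + C4 ≤ (1 + C4) * (Real.log R0 + 1) := by nlinarith
    calc _ ≤ (KC + 2) * LL x * ((1 + C4) * (Real.log R0 + 1)) := by gcongr
      _ = _ := by rw [hE1]; ring
  rw [r1, r2]
  set G := (KC + 2) * (1 + C4)
  have hG : 0 ≤ G := by positivity
  have : 0 ≤ (C2 + C3 + G) * E2 + (C1 + C3 + G) * E3 + (C1 + C2 + C3) * E1 + (C1 + C2 + G) * UU x f := by positivity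
  nlinarith

end ICM

namespace ICM

lemma step2 : ∃ C : ℝ, 1 ≤ C ∧ ∀ (x t : ℕ) (f : ℕ → ℝ), 16 ≤ x → 3 ≤ t → t ≤ x →
    (∀ n, 0 ≤ f n) → (∀ p, p.Prime → f p ≤ Real.log p) →
    |UU t (BB f) - ∑ r ∈ Pr t, f r / r * (LL t - LL r)| ≤
      C * (LL x ^ 2 + LL x * Real.sqrt (WW x f) + UU x f) := by
  obtain ⟨C, hC, h⟩ := step_ineq
  refine ⟨C * 44, by linarith, fun x t f hx ht htx hf hfl => ?_⟩
  have hy := LL_ge_one hx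
  have hu : 1 ≤ Real.log x := by
    have h1 := hy
    unfold LL at h1
    have := Real.log_le_sub_one_of_pos (log_pos_nat (show 2 ≤ x by omega))
    linarith
  set u := Real.log x with hu'
  have hyu : LL x + 1 ≤ u := by
    have := Real.log_le_sub_one_of_pos (show 0 < u by linarith)
    unfold LL; linarith
  have hu10 : u ≤ u ^ 10 := le_self_pow₀ hu (by norm_num)
  set R0 := ⌈u ^ 10⌉₊ with hR0
  have hR1 : u ^ 10 ≤ R0 := Nat.le_ceil _
  have hR2 : (R0:ℝ) < u ^ 10 + 1 := Nat.ceil_lt_add_one (by positivity)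
  have hR3 : 2 ≤ R0 := by
    have : (2:ℝ) ≤ R0 := by linarith
    exact_mod_cast this
  refine (h x t R0 f hx ht htx hR3 (by linarith) hf hfl).trans ?_
  rw [mul_assoc]
  refine mul_le_mul_of_nonneg_left ?_ (by linarith)
  have l1 : Real.log R0 ≤ 10 * LL x + 1 := by
    have : Real.log R0 ≤ Real.log (2 * u ^ 10) := by
      refine Real.log_le_log (by linarith) (by linarith)
    rw [Real.log_mul (by norm_num) (by positivity), Real.log_pow] at this
    have h2 := Real.log_two_lt_d9
    have e : LL x = Real.log u := rfl
    rw [e]; push_cast at this; linarith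
  have l2 : (1 + u) ^ 5 / Real.sqrt R0 ≤ 32 := by
    have hs : u ^ 5 ≤ Real.sqrt R0 := by
      apply Real.le_sqrt_of_sq_le
      calc (u ^ 5) ^ 2 = u ^ 10 := by ring
        _ ≤ _ := hR1
    rw [div_le_iff₀ (lt_of_lt_of_le (by positivity) hs)]
    calc (1 + u) ^ 5 ≤ (2 * u) ^ 5 := by gcongr; linarith
      _ = 32 * u ^ 5 := by ring
      _ ≤ _ := by gcongr
  have hU := UU_nonneg hf x
  have hs : 0 ≤ LL x * Real.sqrt (WW x f) := by positivity
  nlinarith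

lemma integ (f : ℕ → ℝ) (t : ℕ) (ht : 2 ≤ t) :
    ∑ r ∈ Pr t, f r / r * (LL t - LL r) = ∑ n ∈ Finset.Ico 2 t, UU n f * (LL (n + 1) - LL n) := by
  induction t, ht using Nat.le_induction with
  | base =>
    rw [Finset.Ico_self, Finset.sum_empty]
    refine Finset.sum_eq_zero fun r hr => ?_
    obtain ⟨h1, h2⟩ := mem_Pr.1 hr
    have := h2.two_le
    rw [show r = 2 by omega]; ring
  | succ t ht ih =>
    rw [Finset.sum_Ico_succ_top ht, ← ih, UU, Finset.sum_mul, ← Finset.sum_add_distrib,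
      sum_Pr, sum_Pr, Finset.sum_Ioc_succ_top (Nat.zero_le t)]
    have : (if (t + 1).Prime then f (t + 1) / ((t + 1 : ℕ):ℝ) * (LL (t + 1) - LL (t + 1)) else 0) = 0 := by simp
    rw [this, add_zero]
    refine Finset.sum_congr rfl fun n _ => ?_
    split_ifs <;> ring

lemma pow_diff {a b : ℝ} (ha : 0 ≤ a) (hab : a ≤ b) (j : ℕ) :
    ((j:ℝ) + 1) * (a ^ j * (b - a)) ≤ b ^ (j + 1) - a ^ (j + 1) ∧
    b ^ (j + 1) - a ^ (j + 1) ≤ ((j:ℝ) + 1) * (b ^ j * (b - a)) := by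
  have hd : 0 ≤ b - a := by linarith
  have hb : 0 ≤ b := ha.trans hab
  induction j with
  | zero => simp
  | succ j ih =>
    obtain ⟨h1, h2⟩ := ih
    have hp : a ^ (j + 1) ≤ b ^ (j + 1) := pow_le_pow_left₀ ha hab _
    have hp' : a ^ j ≤ b ^ j := pow_le_pow_left₀ ha hab _
    have e : b ^ (j + 1 + 1) - a ^ (j + 1 + 1) = b * (b ^ (j + 1) - a ^ (j + 1)) + a ^ (j + 1) * (b - a) := by ring
    have e' : b ^ (j + 1 + 1) - a ^ (j + 1 + 1) = a * (b ^ (j + 1) - a ^ (j + 1)) + b ^ (j + 1) * (b - a) := by ring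
    constructor
    · have s1 := mul_le_mul_of_nonneg_left h1 ha
      have s2 := mul_le_mul_of_nonneg_right hp hd
      push_cast; rw [e']
      calc _ = a * (((j:ℝ) + 1) * (a ^ j * (b - a))) + a ^ (j + 1) * (b - a) := by ring
        _ ≤ _ := by linarith
    · have s1 := mul_le_mul_of_nonneg_left h2 hb
      have s2 := mul_le_mul_of_nonneg_right hp hd
      push_cast; rw [e]
      calc _ ≤ b * (((j:ℝ) + 1) * (b ^ j * (b - a))) + b ^ (j + 1) * (b - a) := by linarith
        _ = _ := by ring

lemma LL3_le : LL 3 ≤ 1 := by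
  unfold LL
  have h1 := Real.log_le_sub_one_of_pos (show (0:ℝ) < Real.log (3:ℕ) from log_pos_nat (by norm_num))
  have h2 := Real.log_le_sub_one_of_pos (show (0:ℝ) < (3:ℕ) by norm_num)
  push_cast at *; linarith

lemma LL_incr {n : ℕ} (hn : 3 ≤ n) : 0 ≤ LL (n + 1) - LL n ∧ LL (n + 1) - LL n ≤ 1 := by
  have h1 := (LL_succ_sub (show 2 ≤ n by omega)).2
  have h2 := LL_mono (show 2 ≤ n by omega) (Nat.le_succ n)
  refine ⟨by linarith, h1.trans ?_⟩
  have h3 : (3:ℝ) ≤ n := by exact_mod_cast hn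
  have h4 : 1 ≤ Real.log n := by
    rw [Real.le_log_iff_exp_le (by linarith)]
    linarith [Real.exp_one_lt_three]
  rw [div_le_one (by positivity)]; nlinarith

lemma riemann (j t : ℕ) (ht : 3 ≤ t) :
    LL t ^ (j + 1) / ((j:ℝ) + 1) - LL t ^ j - 1 ≤ ∑ n ∈ Finset.Ico 3 t, LL n ^ j * (LL (n + 1) - LL n) ∧
    ∑ n ∈ Finset.Ico 3 t, LL n ^ j * (LL (n + 1) - LL n) ≤ LL t ^ (j + 1) / ((j:ℝ) + 1) := by
  have hj : (0:ℝ) < (j:ℝ) + 1 := by positivity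
  induction t, ht using Nat.le_induction with
  | base =>
    have h0 := LL_nonneg (le_refl 3)
    have h1 := LL3_le
    rw [Finset.Ico_self, Finset.sum_empty]
    have : LL 3 ^ (j + 1) / ((j:ℝ) + 1) ≤ 1 := by
      rw [div_le_one hj]
      have := pow_le_one₀ (n := j + 1) h0 h1
      have : (0:ℝ) ≤ j := Nat.cast_nonneg _
      linarith
    exact ⟨by have := pow_nonneg h0 j; linarith, by positivity⟩
  | succ t ht ih =>
    rw [Finset.sum_Ico_succ_top ht]
    have h0 := LL_nonneg ht
    obtain ⟨i1, i2⟩ := LL_incr ht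
    have hm : LL t ≤ LL (t + 1) := by linarith
    obtain ⟨d1, d2⟩ := pow_diff h0 hm j
    have hp : LL t ^ j ≤ LL (t + 1) ^ j := pow_le_pow_left₀ h0 hm j
    have g1 : LL t ^ j * (LL (t + 1) - LL t) ≤ LL (t + 1) ^ (j + 1) / ((j:ℝ) + 1) - LL t ^ (j + 1) / ((j:ℝ) + 1) := by
      rw [← sub_div, le_div_iff₀ hj]; linarith
    have g2 : LL (t + 1) ^ (j + 1) / ((j:ℝ) + 1) - LL t ^ (j + 1) / ((j:ℝ) + 1) ≤ LL (t + 1) ^ j * (LL (t + 1) - LL t) := by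
      rw [← sub_div, div_le_iff₀ hj]; linarith
    have g3 : (LL (t + 1) ^ j - LL t ^ j) * (LL (t + 1) - LL t) ≤ LL (t + 1) ^ j - LL t ^ j :=
      mul_le_of_le_one_right (by linarith) i2
    obtain ⟨ih1, ih2⟩ := ih
    constructor <;> linarith

lemma integ_asymp (f : ℕ → ℝ) (j x t : ℕ) (a E : ℝ) (ht : 3 ≤ t) (htx : t ≤ x) (hx : 16 ≤ x) (ha : 0 ≤ a)
    (hf : ∀ n, 0 ≤ f n) (hfl : ∀ p, p.Prime → f p ≤ Real.log p) (hE : 0 ≤ E)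
    (h : ∀ n, 3 ≤ n → n ≤ x → |UU n f - a * LL n ^ j| ≤ E) :
    |∑ r ∈ Pr t, f r / r * (LL t - LL r) - a * (LL t ^ (j + 1) / ((j:ℝ) + 1))| ≤
      E * LL x + a * (2 * LL x ^ j) + 2 := by
  have hy := LL_ge_one hx
  have h0 := LL_nonneg ht
  have htx' := LL_mono (show 2 ≤ t by omega) htx
  rw [integ f t (by omega), Finset.sum_eq_sum_Ico_succ_bot (by omega)]
  obtain ⟨r1, r2⟩ := riemann j t ht
  have b2 : 0 ≤ UU 2 f * (LL (2 + 1) - LL 2) ∧ UU 2 f * (LL (2 + 1) - LL 2) ≤ 2 := by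
    have e1 : UU 2 f ≤ 1 := by
      have : UU 2 f = f 2 / 2 := by
        rw [UU, sum_Pr]
        rw [show Finset.Ioc 0 2 = {1, 2} by decide]
        simp [Nat.prime_two, Nat.not_prime_one]
      have h1 := hfl 2 Nat.prime_two
      have := Real.log_two_lt_d9
      push_cast at h1
      linarith
    have e0 := UU_nonneg hf 2
    have l1 := LL_two_ge (le_refl 2)
    have l2 := LL3_le
    have l3 := LL_mono (le_refl 2) (show 2 ≤ 3 by norm_num)
    norm_num
    constructor
    · exact mul_nonneg e0 (by linarith)
    · nlinarith
  have hsum : |∑ n ∈ Finset.Ico 3 t, UU n f * (LL (n + 1) - LL n) - a * ∑ n ∈ Finset.Ico 3 t, LL n ^ j * (LL (n + 1) - LL n)| ≤ E * LL x := by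
    rw [Finset.mul_sum, ← Finset.sum_sub_distrib]
    refine (Finset.abs_sum_le_sum_abs _ _).trans ?_
    calc _ ≤ ∑ n ∈ Finset.Ico 3 t, E * (LL (n + 1) - LL n) := by
          refine Finset.sum_le_sum fun n hn => ?_
          obtain ⟨n1, n2⟩ := Finset.mem_Ico.1 hn
          have i1 := (LL_incr n1).1
          rw [show UU n f * (LL (n + 1) - LL n) - a * (LL n ^ j * (LL (n + 1) - LL n)) = (UU n f - a * LL n ^ j) * (LL (n + 1) - LL n) by ring,
            abs_mul, abs_of_nonneg i1]
          exact mul_le_mul_of_nonneg_right (h n n1 (by omega)) i1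
      _ = E * (LL t - LL 3) := by rw [← Finset.mul_sum, Finset.sum_Ico_sub LL ht]
      _ ≤ _ := by
          have := LL_nonneg (le_refl 3)
          exact mul_le_mul_of_nonneg_left (by linarith) hE
  set S := ∑ n ∈ Finset.Ico 3 t, LL n ^ j * (LL (n + 1) - LL n)
  have hp : LL t ^ j ≤ LL x ^ j := pow_le_pow_left₀ h0 htx' j
  have h1p : 1 ≤ LL x ^ j := one_le_pow₀ hy
  have m1 : a * S ≤ a * (LL t ^ (j + 1) / ((j:ℝ) + 1)) := mul_le_mul_of_nonneg_left r2 ha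
  have m2 : a * (LL t ^ (j + 1) / ((j:ℝ) + 1) - 2 * LL x ^ j) ≤ a * S := mul_le_mul_of_nonneg_left (by linarith) ha
  have hq : 0 ≤ a * (2 * LL x ^ j) := by positivity
  norm_num at hsum b2 ⊢
  rw [abs_le] at hsum ⊢
  constructor <;> linarith [hsum.1, hsum.2, b2.1, b2.2]

end ICM

namespace ICM

lemma AP_zero {r t : ℕ} (h : t < r) : AP r t = 0 := by
  rw [AP_eq_sum]
  refine Finset.sum_eq_zero fun p hp => ?_
  obtain ⟨h1, h2⟩ := mem_Pr.1 hp
  have := h2.two_le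
  rw [if_neg]
  intro hd
  have := Nat.le_of_dvd (by omega) hd
  omega

lemma UU_BB_ell (Y : ℝ) (hY : 1 ≤ Y) (t : ℕ) :
    UU t (BB (ell Y)) = ∑ q ∈ Pr ⌊Y⌋₊, Real.log q * AP q t := by
  rw [UU_BB_eq]
  have e1 : ∑ r ∈ Pr t, ell Y r * AP r t = ∑ r ∈ (Pr t).filter (fun r => r ≤ ⌊Y⌋₊), Real.log r * AP r t := by
    rw [Finset.sum_filter]
    refine Finset.sum_congr rfl fun r hr => ?_
    have hr0 : 1 ≤ r := (mem_Pr.1 hr).2.one_lt.le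
    unfold ell
    by_cases h : (r:ℝ) ≤ Y
    · rw [if_pos h, if_pos ((Nat.le_floor_iff (by linarith)).2 h)]
    · rw [if_neg h, if_neg (fun h' => h ((Nat.le_floor_iff (by linarith)).1 h')), zero_mul]
  rw [e1]
  refine Finset.sum_subset ?_ ?_
  · intro r hr
    obtain ⟨h1, h2⟩ := Finset.mem_filter.1 hr
    exact mem_Pr.2 ⟨h2, (mem_Pr.1 h1).2⟩
  · intro r hr hr'
    obtain ⟨h1, h2⟩ := mem_Pr.1 hr
    have : t < r := by
      by_contra hc
      exact hr' (Finset.mem_filter.2 ⟨mem_Pr.2 ⟨by omega, h2⟩, h1⟩)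
    rw [AP_zero this, mul_zero]

lemma floor_log {Y : ℝ} (hY : 1 ≤ Y) : Real.log Y - 1 ≤ Real.log ⌊Y⌋₊ ∧ Real.log (⌊Y⌋₊ : ℝ) ≤ Real.log Y := by
  have h1 : 1 ≤ ⌊Y⌋₊ := Nat.le_floor (by simpa using hY)
  have h1' : (1:ℝ) ≤ ⌊Y⌋₊ := by exact_mod_cast h1
  have h2 := Nat.lt_floor_add_one Y
  have h3 : (⌊Y⌋₊ : ℝ) ≤ Y := Nat.floor_le (by linarith)
  refine ⟨?_, Real.log_le_log (by linarith) h3⟩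
  have : Real.log Y ≤ Real.log (2 * ⌊Y⌋₊) := Real.log_le_log (by linarith) (by linarith)
  rw [Real.log_mul (by norm_num) (by linarith)] at this
  linarith [Real.log_two_lt_d9]

lemma mean_one : ∃ C : ℝ, 1 ≤ C ∧ ∀ (x t : ℕ) (Y : ℝ), 16 ≤ x → 1 ≤ Y → 1 ≤ Real.log Y →
    Real.log Y ^ 2 ≤ LL x → 3 ≤ t → t ≤ x →
    |UU t (BB (ell Y)) - Real.log Y * LL t| ≤ C * LL x := by
  obtain ⟨C1, hC1, h1⟩ := T2pp
  obtain ⟨C2, hC2, h2⟩ := mertens_q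
  obtain ⟨C3, hC3, h3⟩ := sum_log_div_le
  refine ⟨C1 * (1 + C3) + C2 + 1, by nlinarith, fun x t Y hx hY hl hl2 ht htx => ?_⟩
  have hy := LL_ge_one hx
  have h0 := LL_nonneg ht
  have htx' := LL_mono (show 2 ≤ t by omega) htx
  obtain ⟨f1, f2⟩ := floor_log hY
  have hfl : 1 ≤ ⌊Y⌋₊ := Nat.le_floor (by simpa using hY)
  set lam := Real.log Y with hlam
  rw [UU_BB_ell Y hY]
  have e1 : |∑ q ∈ Pr ⌊Y⌋₊, Real.log q * AP q t - LL t * ∑ q ∈ Pr ⌊Y⌋₊, Real.log q / ((q:ℝ) - 1)| ≤ C1 * (1 + C3) * LL x := by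
    rw [Finset.mul_sum, ← Finset.sum_sub_distrib]
    refine (Finset.abs_sum_le_sum_abs _ _).trans ?_
    calc _ ≤ ∑ q ∈ Pr ⌊Y⌋₊, C1 * lam * (Real.log q / q) := by
          refine Finset.sum_le_sum fun q hq => ?_
          obtain ⟨q1, q2⟩ := mem_Pr.1 hq
          have hq0 : (0:ℝ) < q := by exact_mod_cast q2.pos
          have hlq := Real.log_natCast_nonneg q
          have hlq2 : Real.log q ≤ lam := (Real.log_le_log hq0 (by exact_mod_cast q1)).trans f2
          rw [show Real.log q * AP q t - LL t * (Real.log q / ((q:ℝ) - 1)) = Real.log q * (AP q t - LL t / ((q:ℝ) - 1)) by ring,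
            abs_mul, abs_of_nonneg hlq]
          calc _ ≤ lam * (C1 * Real.log q / q) := by
                refine mul_le_mul hlq2 (h1 q t q2 ht) (abs_nonneg _) (by linarith)
            _ = _ := by ring
      _ ≤ C1 * lam * (lam + C3) := by
          rw [← Finset.mul_sum]
          refine mul_le_mul_of_nonneg_left ((h3 _ hfl).trans (by linarith)) (by positivity)
      _ ≤ C1 * ((1 + C3) * lam ^ 2) := by
          rw [mul_assoc]; refine mul_le_mul_of_nonneg_left ?_ hC1.le
          nlinarith [mul_nonneg hC3.le (show 0 ≤ lam * (lam - 1) from mul_nonneg (by linarith) (by linarith))]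
      _ ≤ C1 * ((1 + C3) * LL x) := by gcongr
      _ = _ := by ring
  have e2 : |LL t * ∑ q ∈ Pr ⌊Y⌋₊, Real.log q / ((q:ℝ) - 1) - lam * LL t| ≤ (C2 + 1) * LL x := by
    rw [show LL t * ∑ q ∈ Pr ⌊Y⌋₊, Real.log q / ((q:ℝ) - 1) - lam * LL t = (∑ q ∈ Pr ⌊Y⌋₊, Real.log q / ((q:ℝ) - 1) - lam) * LL t by ring,
      abs_mul, abs_of_nonneg h0]
    refine mul_le_mul ?_ htx' h0 (by linarith)
    have := abs_le.1 (h2 _ hfl)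
    rw [abs_le]; constructor <;> linarith [this.1, this.2]
  rw [abs_le] at *
  constructor <;> linarith [e1.1, e1.2, e2.1, e2.2]

/-- mean value asymptotics -/
theorem mean_asymp (j : ℕ) : ∃ C : ℝ, 1 ≤ C ∧ ∀ (x t : ℕ) (Y : ℝ), 16 ≤ x → 1 ≤ Y → 1 ≤ Real.log Y →
    Real.log Y ^ 2 ≤ LL x → 3 ≤ t → t ≤ x →
    |UU t (BB^[j + 1] (ell Y)) - Real.log Y / ((j + 1).factorial : ℝ) * LL t ^ (j + 1)| ≤ C * LL x ^ (j + 1) := by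
  induction j with
  | zero =>
    obtain ⟨C, hC, h⟩ := mean_one
    exact ⟨C, hC, fun x t Y hx hY hl hl2 ht htx => by simpa using h x t Y hx hY hl hl2 ht htx⟩
  | succ j ih =>
    obtain ⟨C, hC, h⟩ := ih
    obtain ⟨C1, hC1, h1⟩ := step2
    obtain ⟨C2, hC2, h2⟩ := W_ell j
    obtain ⟨C3, hC3, h3⟩ := U_ell (j + 1)
    refine ⟨C + 4 + C1 * (1 + C2 + C3), by nlinarith, fun x t Y hx hY hl hl2 ht htx => ?_⟩
    have hy := LL_ge_one hx
    have h0 := LL_nonneg ht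
    set lam := Real.log Y with hlam
    set y := LL x with hyd
    have hly : lam ≤ y := by nlinarith
    set f := BB^[j + 1] (ell Y) with hf
    have hf0 : ∀ n, 0 ≤ f n := fun n => BBi_nonneg (ell_nonneg Y) (j + 1) n
    have hfl : ∀ p, p.Prime → f p ≤ Real.log p := fun p hp => BBi_log_le (fun q _ => ell_le Y q) (j + 1) p hp
    have s1 := h1 x t f hx ht htx hf0 hfl
    have hfac : (1:ℝ) ≤ ((j + 1).factorial : ℝ) := by exact_mod_cast Nat.one_le_iff_ne_zero.2 (Nat.factorial_ne_zero _)
    have s2 := integ_asymp f (j + 1) x t (lam / ((j + 1).factorial : ℝ)) (C * y ^ (j + 1)) ht htx hx (by positivity) hf0 hfl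
      (by positivity) (fun n n1 n2 => h x n Y hx hY hl hl2 n1 n2)
    have e1 : lam / ((j + 1).factorial : ℝ) * (LL t ^ (j + 1 + 1) / (((j + 1 : ℕ):ℝ) + 1)) = lam / ((j + 1 + 1).factorial : ℝ) * LL t ^ (j + 1 + 1) := by
      rw [Nat.factorial_succ (j + 1)]; push_cast
      have : ((j + 1).factorial : ℝ) ≠ 0 := by positivity
      field_simp
    rw [e1] at s2
    rw [Function.iterate_succ_apply']
    have hyj : (1:ℝ) ≤ y ^ (j + 1 + 1) := one_le_pow₀ hy
    have hyj2 : y ^ 2 ≤ y ^ (j + 1 + 1) := pow_le_pow_right₀ hy (by omega)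
    have w1 : y * Real.sqrt (WW x f) ≤ C2 * y ^ (j + 1 + 1) := by
      have : Real.sqrt (WW x f) ≤ C2 * y ^ (j + 1) := by
        apply Real.sqrt_le_iff.2 ⟨by positivity, ?_⟩
        calc _ ≤ C2 * y ^ (2 * j + 1) * lam ^ 2 := h2 Y x hx hl hY
          _ ≤ C2 * y ^ (2 * j + 1) * y := by gcongr
          _ = C2 * (y ^ (j + 1)) ^ 2 := by ring
          _ ≤ C2 ^ 2 * (y ^ (j + 1)) ^ 2 := by gcongr; exact le_self_pow₀ hC2 (by norm_num)
          _ = _ := by ring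
      calc _ ≤ y * (C2 * y ^ (j + 1)) := by gcongr
        _ = _ := by ring
    have w2 : UU x f ≤ C3 * y ^ (j + 1 + 1) := by
      calc _ ≤ C3 * y ^ (j + 1) * lam := h3 Y x hx hl hY
        _ ≤ C3 * y ^ (j + 1) * y := by gcongr
        _ = _ := by ring
    have w3 : C1 * (y ^ 2 + y * Real.sqrt (WW x f) + UU x f) ≤ C1 * (1 + C2 + C3) * y ^ (j + 1 + 1) := by
      rw [mul_assoc]; refine mul_le_mul_of_nonneg_left ?_ (by linarith)
      linarith
    have w4 : lam / ((j + 1).factorial : ℝ) * (2 * y ^ (j + 1)) ≤ 2 * y ^ (j + 1 + 1) := by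
      calc _ ≤ y * (2 * y ^ (j + 1)) := by
            gcongr
            exact (div_le_self (by linarith) hfac).trans hly
        _ = _ := by ring
    have w5 : C * y ^ (j + 1) * y = C * y ^ (j + 1 + 1) := by ring
    have s1' := s1.trans w3
    rw [abs_le] at s1' s2 ⊢
    obtain ⟨a1, a2⟩ := s1'
    obtain ⟨b1, b2⟩ := s2
    have hring : (C + 4 + C1 * (1 + C2 + C3)) * y ^ (j + 1 + 1) = C * y ^ (j + 1 + 1) + 4 * y ^ (j + 1 + 1) + C1 * (1 + C2 + C3) * y ^ (j + 1 + 1) := by ring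
    rw [hring]
    constructor <;> linarith

end ICM

namespace ICM

/-- Turan--Kubilius -/
lemma TK (x : ℕ) (f : ℕ → ℝ) (hf : ∀ n, 0 ≤ f n) :
    ∑ n ∈ Finset.Icc 1 x, (TT f n - UU x f) ^ 2 ≤ x * (WW x f + 2 * UU x f * Real.sqrt (WW x f)) := by
  have h2 := (dens_nat x).second (Nat.cast_nonneg x) hf
  simp only [one_mul] at h2
  have hA := UU_nonneg hf x
  have hW := WW_nonneg f x
  have h3 : ∑ p ∈ Pr x, f p ≤ x * Real.sqrt (WW x f) := by
    refine le_of_sq_le_sq ?_ (by positivity)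
    rw [mul_pow, Real.sq_sqrt hW]
    have e : ∑ p ∈ Pr x, f p = ∑ p ∈ Pr x, (p:ℝ) * (f p / p) := by
      refine Finset.sum_congr rfl fun p hp => ?_
      have : (p:ℝ) ≠ 0 := by exact_mod_cast (mem_Pr.1 hp).2.ne_zero
      field_simp
    have c := cs_w (Pr x) (fun p => (p:ℝ)) (fun p => f p / p) (fun _ _ => Nat.cast_nonneg _)
    rw [e]
    refine c.trans ?_
    have e2 : ∑ p ∈ Pr x, (p:ℝ) * (f p / p) ^ 2 = WW x f := by
      refine Finset.sum_congr rfl fun p hp => ?_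
      have : (p:ℝ) ≠ 0 := by exact_mod_cast (mem_Pr.1 hp).2.ne_zero
      field_simp
    rw [e2]
    refine mul_le_mul_of_nonneg_right ?_ hW
    calc ∑ p ∈ Pr x, (p:ℝ) ≤ ∑ p ∈ Pr x, (x:ℝ) := Finset.sum_le_sum fun p hp => by exact_mod_cast (mem_Pr.1 hp).1
      _ ≤ ∑ p ∈ Finset.Ioc 0 x, (x:ℝ) := by
          refine Finset.sum_le_sum_of_subset_of_nonneg ?_ fun _ _ _ => Nat.cast_nonneg _
          intro p hp
          exact Finset.mem_Ioc.2 ⟨(mem_Pr.1 hp).2.pos, (mem_Pr.1 hp).1⟩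
      _ = (x:ℝ) ^ 2 := by simp; ring
  have h1 : x * UU x f - x * Real.sqrt (WW x f) ≤ ∑ n ∈ Finset.Icc 1 x, TT f n := by
    have e := (dens_nat x).eq f
    simp only [one_mul] at e
    rw [e]
    have : x * UU x f - ∑ p ∈ Pr x, f p ≤ ∑ p ∈ Pr x, f p * ∑ i ∈ Finset.Icc 1 x, (if p ∣ i then (1:ℝ) else 0) := by
      rw [UU, Finset.mul_sum, ← Finset.sum_sub_distrib]
      refine Finset.sum_le_sum fun p hp => ?_
      have hp0 := (mem_Pr.1 hp).2.pos
      have hp1 : (0:ℝ) < p := by exact_mod_cast hp0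
      rw [Finset.sum_boole, show (Finset.Icc 1 x).filter (fun n => p ∣ n) = (Finset.Ioc 0 x).filter (fun n => p ∣ n) from rfl,
        Nat.Ioc_filter_dvd_card_eq_div]
      have : (x:ℝ) / p - 1 ≤ ((x / p : ℕ) : ℝ) := by
        rw [div_sub_one hp1.ne', div_le_iff₀ hp1]
        have h1 := Nat.div_add_mod x p
        have h2 := Nat.mod_lt x hp0
        have h3 : (x:ℝ) = p * ((x / p : ℕ):ℝ) + ((x % p : ℕ) : ℝ) := by exact_mod_cast h1.symm
        have h4 : ((x % p : ℕ) : ℝ) ≤ p := by exact_mod_cast h2.le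
        nlinarith
      calc _ = f p * ((x:ℝ) / p - 1) := by ring
        _ ≤ _ := mul_le_mul_of_nonneg_left this (hf p)
    linarith
  have e : ∑ n ∈ Finset.Icc 1 x, (TT f n - UU x f) ^ 2 = ∑ n ∈ Finset.Icc 1 x, TT f n ^ 2 -
      2 * UU x f * ∑ n ∈ Finset.Icc 1 x, TT f n + x * UU x f ^ 2 := by
    rw [Finset.mul_sum, ← Finset.sum_sub_distrib]
    have : (x:ℝ) * UU x f ^ 2 = ∑ n ∈ Finset.Icc 1 x, UU x f ^ 2 := by simp
    rw [this, ← Finset.sum_add_distrib]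
    exact Finset.sum_congr rfl fun n _ => by ring
  rw [e]
  nlinarith [mul_le_mul_of_nonneg_left h1 hA]

lemma avg_TT (x : ℕ) (f : ℕ → ℝ) (hf : ∀ n, 0 ≤ f n) : ∑ n ∈ Finset.Icc 1 x, TT f n ≤ x * UU x f := by
  have := (dens_nat x).first hf
  simpa using this

lemma del_nonneg (q p : ℕ) : 0 ≤ del q p := by unfold del; split_ifs <;> norm_num

lemma TT_zero (g : ℕ → ℝ) : TT g 0 = 0 := by simp [TT]

/-- linear expansion over end points of chains -/
lemma expand (w : ℕ → ℝ) (i : ℕ) {n x : ℕ} (hx : n ≤ x) :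
    TT (BB^[i] w) n = ∑ p ∈ Pr x, w p * TT (BB^[i] (del p)) n := by
  induction i generalizing n with
  | zero =>
    rcases Nat.eq_zero_or_pos n with h0 | h0
    · subst h0; simp [TT_zero]
    simp only [Function.iterate_zero, id]
    rw [TT_eq w h0.ne' hx]
    refine Finset.sum_congr rfl fun p hp => ?_
    have hp' := (mem_Pr.1 hp).2
    unfold TT del
    rw [Finset.sum_ite_eq']
    by_cases h : p ∣ n
    · rw [if_pos h, if_pos (Nat.mem_primeFactors.2 ⟨hp', h, h0.ne'⟩), mul_one]
    · rw [if_neg h, if_neg (fun h' => h (Nat.dvd_of_mem_primeFactors h')), mul_zero]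
  | succ i ih =>
    simp only [Function.iterate_succ_apply']
    have e : ∀ g : ℕ → ℝ, TT (BB g) n = ∑ r ∈ n.primeFactors, TT g (r - 1) := fun _ => rfl
    simp only [e, Finset.mul_sum]
    rw [Finset.sum_comm]
    refine Finset.sum_congr rfl fun r hr => ?_
    have := Nat.le_of_mem_primeFactors hr
    exact ih (by omega)

lemma TT_sum {ι : Type*} (s : Finset ι) (g : ι → ℕ → ℝ) (n : ℕ) :
    TT (fun p => ∑ i ∈ s, g i p) n = ∑ i ∈ s, TT (g i) n := Finset.sum_comm

lemma GG_eq (q j : ℕ) : GG q j = fun n => ∑ i ∈ Finset.range (j + 1), (BB^[i] (del q)) n := by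
  induction j with
  | zero => funext n; simp [GG]
  | succ j ih =>
    funext n
    rw [Finset.sum_range_succ']
    simp only [GG, Function.iterate_zero, id, Function.iterate_succ_apply']
    rw [ih, add_comm]
    unfold BB
    rw [TT_sum]

lemma TT_GG (q j n : ℕ) : TT (GG q j) n = ∑ i ∈ Finset.range (j + 1), TT (BB^[i] (del q)) n := by
  rw [GG_eq, TT_sum]

lemma TT_GG_nat (q j n : ℕ) : ∃ m : ℕ, TT (GG q j) n = m := by
  choose m hm using GG_nat q j
  exact ⟨∑ p ∈ n.primeFactors, m p, by unfold TT; push_cast; exact Finset.sum_congr rfl fun p _ => hm p⟩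

lemma TT_GG_mono (q j n : ℕ) : TT (GG q j) n ≤ TT (GG q (j + 1)) n := by
  rw [TT_GG, TT_GG, Finset.sum_range_succ _ (j + 1)]
  linarith [TT_nonneg (BBi_nonneg (del_nonneg q) (j + 1)) n]

lemma TT_BB_GG_le (q j n : ℕ) : TT (BB (GG q j)) n ≤ TT (GG q (j + 1)) n := by
  refine TT_mono fun p _ => ?_
  simp only [GG]; linarith [del_nonneg q p]

/-- averages of factorial moments -/
lemma avg_Fm (j : ℕ) : ∃ C : ℝ, 1 ≤ C ∧ ∀ (x : ℕ) (Z : ℕ), 16 ≤ x → 1 ≤ Z →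
    ∑ n ∈ Finset.Icc 1 x, ∑ q ∈ (Pr x).filter (fun q => Z < q), Real.log q * (TT (GG q j) n * (TT (GG q j) n - 1)) ≤
      x * (C * LL x ^ (2 * j) / Z) := by
  obtain ⟨C1, hC1, h1⟩ := GG_moments j
  obtain ⟨C2, hC2, h2⟩ := lp_tail_sq
  refine ⟨(C1 ^ 2 + C1) * (C2 + 1), by nlinarith, fun x Z hx hZ => ?_⟩
  have hy := LL_ge_one hx
  have hZ0 : (0:ℝ) < Z := by exact_mod_cast hZ
  rw [Finset.sum_comm]
  have hq : ∀ q ∈ (Pr x).filter (fun q => Z < q), ∑ n ∈ Finset.Icc 1 x, Real.log q * (TT (GG q j) n * (TT (GG q j) n - 1)) ≤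
      x * ((C1 ^ 2 + C1) * LL x ^ (2 * j)) * (Real.log q / (q:ℝ) ^ 2) := by
    intro q hq
    have hq1 := (mem_Pr.1 (Finset.mem_filter.1 hq).1).2.pos
    have hq0 : (0:ℝ) < q := by exact_mod_cast hq1
    rw [← Finset.mul_sum]
    have := (dens_nat x).fm (Nat.cast_nonneg x) (GG_nonneg q j) (GG_fm q j)
    simp only [one_mul] at this
    obtain ⟨m1, m2⟩ := h1 x q hx hq1
    have m0 := UU_nonneg (GG_nonneg q j) x
    have m3 : UU x (GG q j) ^ 2 ≤ (C1 * LL x ^ j / q) ^ 2 := pow_le_pow_left₀ m0 m1 2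
    have m4 : UU x (GG q j) ^ 2 + VV x (GG q j) ≤ (C1 ^ 2 + C1) * LL x ^ (2 * j) / (q:ℝ) ^ 2 := by
      have : (C1 * LL x ^ j / q) ^ 2 = C1 ^ 2 * LL x ^ (2 * j) / (q:ℝ) ^ 2 := by
        rw [div_pow, mul_pow, ← pow_mul, mul_comm j 2]
      rw [this] at m3
      calc _ ≤ C1 ^ 2 * LL x ^ (2 * j) / (q:ℝ) ^ 2 + C1 * LL x ^ (2 * j) / (q:ℝ) ^ 2 := add_le_add m3 m2
        _ = _ := by ring
    calc _ ≤ Real.log q * (x * ((C1 ^ 2 + C1) * LL x ^ (2 * j) / (q:ℝ) ^ 2)) := by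
          refine mul_le_mul_of_nonneg_left (this.trans ?_) (Real.log_natCast_nonneg q)
          exact mul_le_mul_of_nonneg_left m4 (Nat.cast_nonneg x)
      _ = _ := by ring
  refine (Finset.sum_le_sum hq).trans ?_
  rw [← Finset.mul_sum]
  have hs : ∑ q ∈ (Pr x).filter (fun q => Z < q), Real.log q / (q:ℝ) ^ 2 ≤ (C2 + 1) / Z := by
    refine le_trans ?_ ((h2 Z x hZ).trans (div_le_div_of_nonneg_right (by linarith) hZ0.le))
    calc _ ≤ ∑ q ∈ (Pr x).filter (fun q => Z < q), lp q / (q:ℝ) ^ 2 := by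
          refine Finset.sum_le_sum fun q hq => ?_
          rw [lp, if_pos (mem_Pr.1 (Finset.mem_filter.1 hq).1).2]
      _ ≤ _ := by
          refine Finset.sum_le_sum_of_subset_of_nonneg ?_ fun q _ _ => div_nonneg (lp_nonneg q) (by positivity)
          intro q hq
          obtain ⟨a, b⟩ := Finset.mem_filter.1 hq
          exact Finset.mem_Ioc.2 ⟨b, (mem_Pr.1 a).1⟩
  calc _ ≤ x * ((C1 ^ 2 + C1) * LL x ^ (2 * j)) * ((C2 + 1) / Z) :=
        mul_le_mul_of_nonneg_left hs (by positivity)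
    _ = _ := by ring

end ICM

namespace ICM

/-- logarithm of the non-squarefree excess -/
noncomputable def e0 (m : ℕ) : ℝ := ∑ q ∈ m.primeFactors, ((m.factorization q : ℝ) - 1) * Real.log q

lemma e0_nonneg (m : ℕ) : 0 ≤ e0 m := by
  refine Finset.sum_nonneg fun q hq => mul_nonneg ?_ (Real.log_natCast_nonneg q)
  obtain ⟨h1, h2, h3⟩ := Nat.mem_primeFactors.1 hq
  have : 1 ≤ m.factorization q := (h1.dvd_iff_one_le_factorization h3).1 h2
  have : (1:ℝ) ≤ m.factorization q := by exact_mod_cast this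
  linarith

lemma e0_le {m x : ℕ} (hm : m ≠ 0) (hx : m ≤ x) :
    e0 m ≤ ∑ q ∈ Pr x, ∑ a ∈ Finset.Icc 2 x, if q ^ a ∣ m then Real.log q else 0 := by
  unfold e0
  calc _ ≤ ∑ q ∈ m.primeFactors, ∑ a ∈ Finset.Icc 2 x, if q ^ a ∣ m then Real.log q else 0 := by
        refine Finset.sum_le_sum fun q hq => ?_
        obtain ⟨h1, h2, _⟩ := Nat.mem_primeFactors.1 hq
        have hv : 1 ≤ m.factorization q := (h1.dvd_iff_one_le_factorization hm).1 h2
        set v := m.factorization q with hvd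
        have hvx : v ≤ x := by
          have : v < m := Nat.factorization_lt q hm
          omega
        calc ((v:ℝ) - 1) * Real.log q = ∑ a ∈ Finset.Icc 2 v, Real.log q := by
              rw [Finset.sum_const, Nat.card_Icc, nsmul_eq_mul]
              congr 1
              rw [show v + 1 - 2 = v - 1 by omega]; push_cast [hv]; ring
          _ = ∑ a ∈ Finset.Icc 2 v, if q ^ a ∣ m then Real.log q else 0 := by
              refine Finset.sum_congr rfl fun a ha => ?_
              rw [if_pos]
              exact (h1.pow_dvd_iff_le_factorization hm).2 (Finset.mem_Icc.1 ha).2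
          _ ≤ _ := by
              refine Finset.sum_le_sum_of_subset_of_nonneg (Finset.Icc_subset_Icc_right hvx) fun a _ _ => ?_
              split_ifs <;> first | exact Real.log_natCast_nonneg q | exact le_rfl
    _ ≤ _ := by
        refine Finset.sum_le_sum_of_subset_of_nonneg ?_ fun q _ _ => ?_
        · intro q hq
          exact mem_Pr.2 ⟨(Nat.le_of_mem_primeFactors hq).trans hx, Nat.prime_of_mem_primeFactors hq⟩
        · refine Finset.sum_nonneg fun a _ => ?_
          split_ifs <;> first | exact Real.log_natCast_nonneg q | exact le_rfl

lemma geom2 {q : ℝ} (hq : 2 ≤ q) (x : ℕ) : ∑ a ∈ Finset.Icc 2 x, 1 / q ^ a ≤ 2 / q ^ 2 := by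
  have hq0 : 0 < q := by linarith
  have : ∀ x : ℕ, ∑ a ∈ Finset.Icc 2 (x + 2), 1 / q ^ a ≤ 2 / q ^ 2 - 1 / q ^ (x + 2) := by
    intro x
    induction x with
    | zero => simp; apply le_of_eq; ring
    | succ x ih =>
      rw [show x + 1 + 2 = x + 2 + 1 by ring, Finset.sum_Icc_succ_top (by omega)]
      have : 2 * (1 / q ^ (x + 2 + 1)) ≤ 1 / q ^ (x + 2) := by
        rw [pow_succ q (x + 2), ← mul_div_assoc, div_le_div_iff₀ (by positivity) (by positivity)]
        have : 0 < q ^ (x + 2) := by positivity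
        nlinarith
      linarith
  rcases lt_or_ge x 2 with h | h
  · rw [Finset.Icc_eq_empty (by omega), Finset.sum_empty]; positivity
  · obtain ⟨k, rfl⟩ := Nat.exists_eq_add_of_le h
    rw [add_comm]
    refine (this k).trans ?_
    have : 0 < 1 / q ^ (k + 2) := by positivity
    linarith

lemma e0_avg : ∃ C : ℝ, 1 ≤ C ∧ ∀ (I : Finset ℕ) (w : ℕ → ℝ) (d : ℕ → ℕ) (x : ℕ) (K : ℝ),
    0 ≤ K → (∀ i ∈ I, 0 ≤ w i) → (∀ i ∈ I, d i ≠ 0 ∧ d i ≤ x) →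
    (∀ q a : ℕ, q.Prime → ∑ i ∈ I, (if q ^ a ∣ d i then w i else 0) ≤ K / (q:ℝ) ^ a) →
    ∑ i ∈ I, w i * e0 (d i) ≤ K * C := by
  obtain ⟨C, hC, h⟩ := lp_sq_total
  refine ⟨2 * C + 1, by linarith, fun I w d x K hK hw hd hs => ?_⟩
  calc _ ≤ ∑ i ∈ I, ∑ q ∈ Pr x, ∑ a ∈ Finset.Icc 2 x, Real.log q * (if q ^ a ∣ d i then w i else 0) := by
        refine Finset.sum_le_sum fun i hi => ?_
        refine (mul_le_mul_of_nonneg_left (e0_le (hd i hi).1 (hd i hi).2) (hw i hi)).trans (le_of_eq ?_)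
        simp only [Finset.mul_sum]
        refine Finset.sum_congr rfl fun q _ => Finset.sum_congr rfl fun a _ => ?_
        split_ifs <;> ring
    _ = ∑ q ∈ Pr x, ∑ a ∈ Finset.Icc 2 x, Real.log q * ∑ i ∈ I, (if q ^ a ∣ d i then w i else 0) := by
        rw [Finset.sum_comm]
        refine Finset.sum_congr rfl fun q _ => ?_
        rw [Finset.sum_comm]
        exact Finset.sum_congr rfl fun a _ => by rw [Finset.mul_sum]
    _ ≤ ∑ q ∈ Pr x, 2 * K * (Real.log q / (q:ℝ) ^ 2) := by
        refine Finset.sum_le_sum fun q hq => ?_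
        have hq' := (mem_Pr.1 hq).2
        have hl := Real.log_natCast_nonneg q
        have hg := geom2 (q := (q:ℝ)) (by exact_mod_cast hq'.two_le) x
        calc _ ≤ ∑ a ∈ Finset.Icc 2 x, Real.log q * (K / (q:ℝ) ^ a) :=
              Finset.sum_le_sum fun a _ => mul_le_mul_of_nonneg_left (hs q a hq') hl
          _ = Real.log q * K * ∑ a ∈ Finset.Icc 2 x, 1 / (q:ℝ) ^ a := by
              rw [Finset.mul_sum]; exact Finset.sum_congr rfl fun a _ => by ring
          _ ≤ Real.log q * K * (2 / (q:ℝ) ^ 2) := mul_le_mul_of_nonneg_left hg (by positivity)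
          _ = _ := by ring
    _ ≤ 2 * K * C := by
        rw [← Finset.mul_sum]
        refine mul_le_mul_of_nonneg_left ?_ (by positivity)
        refine le_trans (le_of_eq ?_) (h x)
        rw [sum_Pr]
        exact Finset.sum_congr rfl fun n _ => by unfold lp; split_ifs <;> simp
    _ ≤ _ := by nlinarith

lemma e0_nat : ∃ C : ℝ, 1 ≤ C ∧ ∀ x : ℕ, ∑ n ∈ Finset.Icc 1 x, e0 n ≤ x * C := by
  obtain ⟨C, hC, h⟩ := e0_avg
  refine ⟨C, hC, fun x => ?_⟩
  have := h (Finset.Icc 1 x) (fun _ => 1) (fun n => n) x x (Nat.cast_nonneg x) (fun _ _ => zero_le_one)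
    (dens_nat x).hd (fun q a hq => by
      rw [Finset.sum_boole]
      have := card_dvd_le x (q ^ a) (pow_pos hq.pos a)
      push_cast at this
      exact this)
  simpa using this

/-- excess of shifted primes -/
noncomputable def es (p : ℕ) : ℝ := e0 (p - 1)
lemma es_nonneg (p : ℕ) : 0 ≤ es p := e0_nonneg _

lemma UU_es : ∃ C : ℝ, 1 ≤ C ∧ ∀ x : ℕ, 16 ≤ x → UU x es ≤ C * LL x := by
  obtain ⟨C, hC, h⟩ := e0_avg
  obtain ⟨C1, hC1, h1⟩ := T1
  refine ⟨2 * C1 * C + 1, by nlinarith [mul_pos hC1 (by linarith : 0 < C)], fun x hx => ?_⟩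
  have hy := LL_ge_one hx
  have := h (Pr x) (fun p => 1 / (p:ℝ)) (fun p => p - 1) x (2 * C1 * LL x) (by positivity) (fun _ _ => by positivity)
    (dens_pr hx).hd (fun q a hq => by
      rw [← Finset.sum_filter]
      refine (h1 (q ^ a) x (Nat.one_le_pow _ _ hq.pos) hx).trans ?_
      have hq2 : (2:ℝ) ≤ q := by exact_mod_cast hq.two_le
      have ht : (q:ℝ) ^ a / 2 ≤ ((q ^ a).totient : ℝ) := by
        rcases Nat.eq_zero_or_pos a with ha | ha
        · subst ha; simp; norm_num
        · rw [Nat.totient_prime_pow hq ha]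
          push_cast [hq.one_le]
          obtain ⟨b, rfl⟩ := Nat.exists_eq_succ_of_ne_zero ha.ne'
          simp only [Nat.succ_eq_add_one, Nat.add_sub_cancel, pow_succ]
          have : 0 < (q:ℝ) ^ b := by positivity
          nlinarith
      have hq0 : 0 < (q:ℝ) ^ a := by positivity
      change C1 * LL x / _ ≤ _
      rw [div_le_div_iff₀ (by linarith) hq0]
      have : 0 ≤ C1 * LL x := by positivity
      nlinarith)
  have e : UU x es = ∑ i ∈ Pr x, 1 / (i:ℝ) * e0 (i - 1) := Finset.sum_congr rfl fun p _ => by unfold es; ring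
  rw [e]
  nlinarith

lemma U_es (j : ℕ) : ∃ C : ℝ, 1 ≤ C ∧ ∀ x : ℕ, 16 ≤ x → UU x (BB^[j] es) ≤ C * LL x ^ (j + 1) := by
  obtain ⟨C, hC, h⟩ := UU_es
  have hKC := KC_ge
  refine ⟨KC ^ j * C, one_le_mul_of_one_le_of_one_le (one_le_pow₀ hKC) hC, fun x hx => ?_⟩
  refine (UB es es_nonneg hx j).trans ?_
  calc _ ≤ KK x ^ j * (C * LL x) := mul_le_mul_of_nonneg_left (h x hx) (pow_nonneg (KK_nonneg hx) j)
    _ = _ := by rw [KK]; ring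

end ICM

namespace ICM

lemma car_eq {n : ℕ} (hn : n ≠ 0) : carmichael n = ArithmeticFunction.carmichael n :=
  (ArithmeticFunction.carmichael_eq_exponent hn).symm

lemma car_dvd_tot {n : ℕ} (hn : n ≠ 0) : carmichael n ∣ n.totient := by
  rw [car_eq hn]; exact ArithmeticFunction.carmichael_dvd_totient n

lemma car_ne {n : ℕ} (hn : n ≠ 0) : carmichael n ≠ 0 := fun h => by
  have := car_dvd_tot hn
  rw [h, zero_dvd_iff, Nat.totient_eq_zero] at this
  exact hn this

lemma car_le_tot {n : ℕ} (hn : n ≠ 0) : carmichael n ≤ n.totient :=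
  Nat.le_of_dvd (Nat.totient_pos.2 (Nat.pos_of_ne_zero hn)) (car_dvd_tot hn)

lemma car_le {n : ℕ} (hn : n ≠ 0) : carmichael n ≤ n := (car_le_tot hn).trans (Nat.totient_le n)

lemma cari_ne {n : ℕ} (hn : n ≠ 0) (j : ℕ) : carmichael^[j] n ≠ 0 := by
  induction j with
  | zero => simpa
  | succ j ih => rw [Function.iterate_succ_apply']; exact car_ne ih

lemma cari_le {n : ℕ} (hn : n ≠ 0) (j : ℕ) : carmichael^[j] n ≤ n := by
  induction j with
  | zero => simp
  | succ j ih => rw [Function.iterate_succ_apply']; exact (car_le (cari_ne hn j)).trans ih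

lemma tot_fact {m : ℕ} (hm : m ≠ 0) {q : ℕ} (hq : q.Prime) :
    m.totient.factorization q = (m.factorization q - 1) + ∑ p ∈ m.primeFactors, (p - 1).factorization q := by
  have h := congrArg (fun t => t.factorization q) (Nat.totient_mul_prod_primeFactors m)
  have h1 : ∀ p ∈ m.primeFactors, p ≠ 0 := fun p hp => (Nat.prime_of_mem_primeFactors hp).ne_zero
  have h2 : ∀ p ∈ m.primeFactors, p - 1 ≠ 0 := fun p hp => by
    have := (Nat.prime_of_mem_primeFactors hp).two_le; omega
  have ht : m.totient ≠ 0 := (Nat.totient_pos.2 (Nat.pos_of_ne_zero hm)).ne'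
  beta_reduce at h
  rw [Nat.factorization_mul ht (Finset.prod_ne_zero_iff.2 h1),
    Nat.factorization_mul hm (Finset.prod_ne_zero_iff.2 h2), Nat.factorization_prod h1,
    Nat.factorization_prod h2] at h
  simp only [Finsupp.add_apply, Finsupp.finsetSum_apply] at h
  have h3 : ∑ p ∈ m.primeFactors, p.factorization q = if q ∈ m.primeFactors then 1 else 0 := by
    rw [← Finset.sum_ite_eq' m.primeFactors q (fun _ => 1)]
    refine Finset.sum_congr rfl fun p hp => ?_
    rw [(Nat.prime_of_mem_primeFactors hp).factorization, Finsupp.single_apply]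
  rw [h3] at h
  split_ifs at h with hc
  · have : 1 ≤ m.factorization q :=
      (hq.dvd_iff_one_le_factorization hm).1 (Nat.dvd_of_mem_primeFactors hc)
    omega
  · have : m.factorization q = 0 := by
      rw [← Finsupp.notMem_support_iff, Nat.support_factorization]; exact hc
    omega

lemma pow_dvd_lcm {q t : ℕ} (hq : q.Prime) (ht : 1 ≤ t) (s : Finset ℕ) (f : ℕ → ℕ) (hf : ∀ p ∈ s, f p ≠ 0)
    (h : q ^ t ∣ s.lcm f) : ∃ p ∈ s, q ^ t ∣ f p := by
  classical
  induction s using Finset.induction_on with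
  | empty =>
    simp at h
    rcases h with h | h
    · exact absurd h hq.one_lt.ne'
    · omega
  | insert a s ha ih =>
    rw [Finset.lcm_insert] at h
    have hs : s.lcm f ≠ 0 := by
      intro h0; rw [Finset.lcm_eq_zero_iff] at h0
      obtain ⟨p, hp, hp0⟩ := h0
      exact hf p (Finset.mem_insert_of_mem hp) hp0
    have ha' := hf a (Finset.mem_insert_self _ _)
    have h' : q ^ t ∣ Nat.lcm (f a) (s.lcm f) := h
    rw [hq.pow_dvd_iff_le_factorization (Nat.lcm_ne_zero ha' hs), Nat.factorization_lcm ha' hs,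
      Finsupp.sup_apply, le_sup_iff] at h'
    rcases h' with h' | h'
    · exact ⟨a, Finset.mem_insert_self _ _, (hq.pow_dvd_iff_le_factorization ha').2 h'⟩
    · obtain ⟨p, hp, hp2⟩ := ih (fun p hp => hf p (Finset.mem_insert_of_mem hp))
        ((hq.pow_dvd_iff_le_factorization hs).2 h')
      exact ⟨p, Finset.mem_insert_of_mem hp, hp2⟩

lemma car_fact_le {m : ℕ} (hm : m ≠ 0) {q : ℕ} (hq : q.Prime) :
    (carmichael m).factorization q ≤ m.factorization q - 1 ∨
      ∃ p ∈ m.primeFactors, (carmichael m).factorization q ≤ (p - 1).factorization q := by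
  set t := (carmichael m).factorization q with htd
  rcases Nat.eq_zero_or_pos t with h0 | h0
  · left; omega
  have : NeZero m := ⟨hm⟩
  have hd : q ^ t ∣ carmichael m := Nat.ordProj_dvd _ _
  rw [car_eq hm, ArithmeticFunction.carmichael_factorization m] at hd
  obtain ⟨p, hp, h⟩ := pow_dvd_lcm hq h0 _ _ (fun p hp => by
    have : p ^ m.factorization p ≠ 0 := pow_ne_zero _ (Nat.prime_of_mem_primeFactors hp).ne_zero
    rw [← car_eq this]; exact car_ne this) hd
  have hpp := Nat.prime_of_mem_primeFactors hp
  have hpos : 0 < m.factorization p := hpp.factorization_pos_of_dvd hm (Nat.dvd_of_mem_primeFactors hp)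
  have h2 := h.trans (ArithmeticFunction.carmichael_dvd_totient _)
  rw [Nat.totient_prime_pow hpp hpos] at h2
  by_cases hqp : q = p
  · left
    subst hqp
    have hc : Nat.Coprime (q ^ t) (q - 1) :=
      Nat.Coprime.pow_left _ ((Nat.coprime_self_sub_right hq.one_le).2 (Nat.coprime_one_right q))
    have := hc.dvd_of_dvd_mul_right h2
    exact (Nat.pow_dvd_pow_iff_le_right hq.one_lt).1 this
  · right
    refine ⟨p, hp, ?_⟩
    have hc : Nat.Coprime (q ^ t) (p ^ (m.factorization p - 1)) :=
      Nat.Coprime.pow _ _ ((Nat.coprime_primes hq hpp).2 hqp)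
    have := hc.dvd_of_dvd_mul_left h2
    exact (hq.pow_dvd_iff_le_factorization (by have := hpp.two_le; omega)).1 this

lemma sub_one_dvd_car {m p : ℕ} (hm : m ≠ 0) (hp : p.Prime) (h : p ∣ m) : p - 1 ∣ carmichael m := by
  rw [car_eq hm]
  by_cases h2 : p = 2
  · subst h2; simp
  · have := ArithmeticFunction.carmichael_pow_of_prime_ne_two 1 hp h2
    rw [pow_one, Nat.totient_prime hp] at this
    rw [← this]
    exact ArithmeticFunction.carmichael_dvd h

lemma car_fact_ge {m p : ℕ} (hm : m ≠ 0) (hp : p ∈ m.primeFactors) (q : ℕ) :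
    (p - 1).factorization q ≤ (carmichael m).factorization q := by
  have hpp := Nat.prime_of_mem_primeFactors hp
  have := sub_one_dvd_car hm hpp (Nat.dvd_of_mem_primeFactors hp)
  exact (Nat.factorization_le_iff_dvd (by have := hpp.two_le; omega) (car_ne hm)).2 this q

/-- logarithm as a sum over primes -/
lemma log_eq_fact {m x : ℕ} (hm : m ≠ 0) (hx : m ≤ x) :
    Real.log m = ∑ q ∈ Pr x, (m.factorization q : ℝ) * Real.log q := by
  conv_lhs => rw [← Nat.prod_factorization_pow_eq_self hm]
  unfold Finsupp.prod
  push_cast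
  rw [Real.log_prod (fun p hp => by
    have : p ≠ 0 := (Nat.prime_of_mem_primeFactors (by simpa using hp)).ne_zero
    positivity)]
  simp only [Real.log_pow]
  rw [Nat.support_factorization]
  refine Finset.sum_subset ?_ ?_
  · intro q hq
    exact mem_Pr.2 ⟨(Nat.le_of_mem_primeFactors hq).trans hx, Nat.prime_of_mem_primeFactors hq⟩
  · intro q _ hq
    have : m.factorization q = 0 := by
      rw [← Finsupp.notMem_support_iff, Nat.support_factorization]; exact hq
    simp [this]

lemma e0_eq {m x : ℕ} (hm : m ≠ 0) (hx : m ≤ x) :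
    e0 m = ∑ q ∈ Pr x, ((m.factorization q - 1 : ℕ) : ℝ) * Real.log q := by
  unfold e0
  rw [Finset.sum_congr rfl (g := fun q => ((m.factorization q - 1 : ℕ) : ℝ) * Real.log q)]
  · refine Finset.sum_subset ?_ ?_
    · intro q hq
      exact mem_Pr.2 ⟨(Nat.le_of_mem_primeFactors hq).trans hx, Nat.prime_of_mem_primeFactors hq⟩
    · intro q _ hq
      have : m.factorization q = 0 := by
        rw [← Finsupp.notMem_support_iff, Nat.support_factorization]; exact hq
      simp [this]
  · intro q hq
    obtain ⟨h1, h2, h3⟩ := Nat.mem_primeFactors.1 hq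
    have : 1 ≤ m.factorization q := (h1.dvd_iff_one_le_factorization h3).1 h2
    push_cast [this]; rfl

lemma TTes_eq {m x : ℕ} (hx : m ≤ x) :
    TT es m = ∑ q ∈ Pr x, ((∑ p ∈ m.primeFactors, ((p - 1).factorization q - 1) : ℕ) : ℝ) * Real.log q := by
  unfold TT es
  push_cast
  simp only [Finset.sum_mul]
  rw [Finset.sum_comm]
  refine Finset.sum_congr rfl fun p hp => ?_
  have hpp := Nat.prime_of_mem_primeFactors hp
  have := Nat.le_of_mem_primeFactors hp
  exact e0_eq (by have := hpp.two_le; omega) (by omega)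

/-- number of prime factors `p` of `m` with `q ∣ p - 1` -/
lemma TTdel_eq (q m : ℕ) : TT (BB (del q)) m = ((∑ p ∈ m.primeFactors, if q ∈ (p - 1).primeFactors then 1 else 0 : ℕ) : ℝ) := by
  unfold TT
  push_cast
  refine Finset.sum_congr rfl fun p _ => ?_
  unfold BB TT del
  rw [Finset.sum_ite_eq']

end ICM

namespace ICM

lemma pf_ind {q r : ℕ} (hq : q.Prime) (hr : r ≠ 0) :
    r.factorization q = (r.factorization q - 1) + (if q ∈ r.primeFactors then 1 else 0) := by
  split_ifs with h
  · have : 1 ≤ r.factorization q := (hq.dvd_iff_one_le_factorization hr).1 (Nat.dvd_of_mem_primeFactors h)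
    omega
  · have : r.factorization q = 0 := by
      rw [← Finsupp.notMem_support_iff, Nat.support_factorization]; exact h
    omega

lemma sumfact_eq {m q : ℕ} (hq : q.Prime) :
    ∑ p ∈ m.primeFactors, (p - 1).factorization q = ∑ p ∈ m.primeFactors, ((p - 1).factorization q - 1) +
      ∑ p ∈ m.primeFactors, (if q ∈ (p - 1).primeFactors then 1 else 0) := by
  rw [← Finset.sum_add_distrib]
  refine Finset.sum_congr rfl fun p hp => pf_ind hq ?_
  have := (Nat.prime_of_mem_primeFactors hp).two_le; omega

lemma Dq_upper {m q : ℕ} (hm : m ≠ 0) (hq : q.Prime) :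
    m.totient.factorization q ≤ (carmichael m).factorization q + (m.factorization q - 1) +
      ∑ p ∈ m.primeFactors, ((p - 1).factorization q - 1) +
      ((∑ p ∈ m.primeFactors, (if q ∈ (p - 1).primeFactors then 1 else 0)) - 1) := by
  rw [tot_fact hm hq, sumfact_eq hq]
  by_cases h : ∃ p ∈ m.primeFactors, q ∈ (p - 1).primeFactors
  · obtain ⟨p, hp, hqp⟩ := h
    have h1 := car_fact_ge hm hp q
    have h2 : 1 ≤ (p - 1).factorization q :=
      (hq.dvd_iff_one_le_factorization (Nat.mem_primeFactors.1 hqp).2.2).1 (Nat.dvd_of_mem_primeFactors hqp)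
    omega
  · push Not at h
    have : ∑ p ∈ m.primeFactors, (if q ∈ (p - 1).primeFactors then 1 else 0) = 0 :=
      Finset.sum_eq_zero fun p hp => if_neg (h p hp)
    omega

lemma Dq_upper0 {m q : ℕ} (hm : m ≠ 0) (hq : q.Prime) :
    m.totient.factorization q ≤ (carmichael m).factorization q + (m.factorization q - 1) +
      ∑ p ∈ m.primeFactors, ((p - 1).factorization q - 1) +
      (∑ p ∈ m.primeFactors, (if q ∈ (p - 1).primeFactors then 1 else 0)) := by
  have := Dq_upper hm hq
  omega

lemma Dq_lower0 {m : ℕ} (hm : m ≠ 0) (q : ℕ) :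
    (carmichael m).factorization q ≤ m.totient.factorization q :=
  (Nat.factorization_le_iff_dvd (car_ne hm) (Nat.totient_pos.2 (Nat.pos_of_ne_zero hm)).ne').2 (car_dvd_tot hm) q

lemma Dq_lower {m q : ℕ} (hm : m ≠ 0) (hq : q.Prime) :
    (carmichael m).factorization q + (∑ p ∈ m.primeFactors, (if q ∈ (p - 1).primeFactors then 1 else 0)) ≤
      m.totient.factorization q + 1 := by
  rw [tot_fact hm hq, sumfact_eq hq]
  rcases car_fact_le hm hq with h | ⟨p, hp, h⟩
  · omega
  · have h1 : (p - 1).factorization q - 1 ≤ ∑ p ∈ m.primeFactors, ((p - 1).factorization q - 1) :=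
      Finset.single_le_sum (f := fun p => (p - 1).factorization q - 1) (fun _ _ => Nat.zero_le _) hp
    omega

lemma e0_car {m : ℕ} (hm : m ≠ 0) : e0 (carmichael m) ≤ e0 m + TT es m := by
  rw [e0_eq (car_ne hm) (car_le hm), e0_eq hm le_rfl, TTes_eq (le_refl m), ← Finset.sum_add_distrib]
  refine Finset.sum_le_sum fun q hq => ?_
  have hqp := (mem_Pr.1 hq).2
  rw [← add_mul]
  refine mul_le_mul_of_nonneg_right ?_ (Real.log_natCast_nonneg q)
  norm_cast
  rcases car_fact_le hm hqp with h | ⟨p, hp, h⟩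
  · omega
  · have h1 : (p - 1).factorization q - 1 ≤ ∑ p ∈ m.primeFactors, ((p - 1).factorization q - 1) :=
      Finset.single_le_sum (f := fun p => (p - 1).factorization q - 1) (fun _ _ => Nat.zero_le _) hp
    omega

/-- loss in one step -/
noncomputable def XC (m : ℕ) : ℝ := Real.log m.totient - Real.log (carmichael m)

lemma XC_eq {m x : ℕ} (hm : m ≠ 0) (hx : m ≤ x) :
    XC m = ∑ q ∈ Pr x, ((m.totient.factorization q : ℝ) - (carmichael m).factorization q) * Real.log q := by
  unfold XC
  rw [log_eq_fact (Nat.totient_pos.2 (Nat.pos_of_ne_zero hm)).ne' ((Nat.totient_le m).trans hx),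
    log_eq_fact (car_ne hm) ((car_le hm).trans hx), ← Finset.sum_sub_distrib]
  exact Finset.sum_congr rfl fun q _ => by ring

/-- the part of a natural number above one -/
lemma XC_upper {m x : ℕ} (hm : m ≠ 0) (hx : m ≤ x) (Y : ℝ) (R : ℕ → ℝ) 
    (hR : ∀ q, q.Prime → ∀ N : ℕ, TT (BB (del q)) m = N → ((N - 1 : ℕ) : ℝ) ≤ R q) :
    XC m ≤ TT (BB (ell Y)) m + e0 m + TT es m +
      ∑ q ∈ (Pr x).filter (fun q => ⌊Y⌋₊ < q), Real.log q * R q := by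
  have hex := expand (ell Y) 1 hx
  simp only [Function.iterate_one] at hex
  rw [XC_eq hm hx, hex, e0_eq hm hx, TTes_eq hx, Finset.sum_filter, ← Finset.sum_add_distrib,
    ← Finset.sum_add_distrib, ← Finset.sum_add_distrib]
  refine Finset.sum_le_sum fun q hq => ?_
  have hqp := (mem_Pr.1 hq).2
  have hlog := Real.log_natCast_nonneg q
  have hN := TTdel_eq q m
  have u0 := Dq_upper0 hm hqp
  have u1 := Dq_upper hm hqp
  have hRq := hR q hqp _ hN
  rw [hN]
  set N := ∑ p ∈ m.primeFactors, (if q ∈ (p - 1).primeFactors then 1 else 0) with hNd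
  set E := ∑ p ∈ m.primeFactors, ((p - 1).factorization q - 1) with hE
  set a := m.factorization q - 1
  set f := m.totient.factorization q
  set l := (carmichael m).factorization q
  unfold ell
  by_cases hc : (q:ℝ) ≤ Y
  · have h1 : ¬ ⌊Y⌋₊ < q := not_lt.2 (Nat.le_floor hc)
    rw [if_pos hc, if_neg h1]
    have : (f:ℝ) ≤ l + a + E + N := by exact_mod_cast u0
    nlinarith
  · have h1 : ⌊Y⌋₊ < q := by
      rw [Nat.floor_lt' hqp.ne_zero]; exact not_le.1 hc
    rw [if_neg hc, if_pos h1]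
    have : (f:ℝ) ≤ l + a + E + (N - 1 : ℕ) := by exact_mod_cast u1
    nlinarith

lemma XC_lower {m x : ℕ} (hm : m ≠ 0) (hx : m ≤ x) (Y : ℝ) :
    TT (BB (ell Y)) m - ∑ n ∈ Finset.Ioc 0 ⌊Y⌋₊, lp n ≤ XC m := by
  have hex := expand (ell Y) 1 hx
  simp only [Function.iterate_one] at hex
  have h1 : ∑ q ∈ Pr x, ell Y q ≤ ∑ n ∈ Finset.Ioc 0 ⌊Y⌋₊, lp n := by
    calc ∑ q ∈ Pr x, ell Y q = ∑ q ∈ (Pr x).filter (fun q : ℕ => (q:ℝ) ≤ Y), lp q := by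
          rw [Finset.sum_filter]
          refine Finset.sum_congr rfl fun q hq => ?_
          unfold ell lp
          rw [if_pos (mem_Pr.1 hq).2]
      _ ≤ _ := by
          refine Finset.sum_le_sum_of_subset_of_nonneg ?_ fun n _ _ => lp_nonneg n
          intro q hq
          obtain ⟨hq1, hq2⟩ := Finset.mem_filter.1 hq
          exact Finset.mem_Ioc.2 ⟨(mem_Pr.1 hq1).2.pos, Nat.le_floor hq2⟩
  have h2 : TT (BB (ell Y)) m - ∑ q ∈ Pr x, ell Y q ≤ XC m := by
    rw [XC_eq hm hx, hex, ← Finset.sum_sub_distrib]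
    refine Finset.sum_le_sum fun q hq => ?_
    have hqp := (mem_Pr.1 hq).2
    have hlog := Real.log_natCast_nonneg q
    have u0 := Dq_lower0 hm q
    have u1 := Dq_lower hm hqp
    rw [TTdel_eq q m]
    set N := ∑ p ∈ m.primeFactors, (if q ∈ (p - 1).primeFactors then 1 else 0) with hNd
    set f := m.totient.factorization q
    set l := (carmichael m).factorization q
    have u0' : (l:ℝ) ≤ f := by exact_mod_cast u0
    have u1' : (l:ℝ) + N ≤ f + 1 := by exact_mod_cast u1
    unfold ell
    split_ifs
    · nlinarith
    · nlinarith
  linarith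

end ICM

namespace ICM

lemma dvd_car_prime {n r : ℕ} (hn : n ≠ 0) (hr : r.Prime) (h : r ∣ carmichael n) :
    r ∣ n ∨ ∃ s ∈ n.primeFactors, r ∣ s - 1 := by
  have h1 := (hr.dvd_iff_one_le_factorization (car_ne hn)).1 h
  rcases car_fact_le hn hr with h2 | ⟨s, hs, h2⟩
  · left
    exact (hr.dvd_iff_one_le_factorization hn).2 (by omega)
  · right
    have := (Nat.prime_of_mem_primeFactors hs).two_le
    exact ⟨s, hs, (hr.dvd_iff_one_le_factorization (by omega)).2 (by omega)⟩

lemma single_le_TT {g : ℕ → ℝ} (hg : ∀ n, 0 ≤ g n) {p n : ℕ} (hp : p.Prime) (hn : n ≠ 0) (h : p ∣ n) :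
    g p ≤ TT g n :=
  Finset.single_le_sum (f := g) (fun i _ => hg i) (Nat.mem_primeFactors.2 ⟨hp, h, hn⟩)

lemma one_le_GG {p j n : ℕ} (hp : p.Prime) (hn : n ≠ 0) (h : p ∣ carmichael^[j] n) : 1 ≤ TT (GG p j) n := by
  induction j generalizing n with
  | zero =>
    simp only [Function.iterate_zero, id_eq] at h
    have := single_le_TT (g := GG p 0) (GG_nonneg p 0) hp hn h
    refine le_trans ?_ this
    simp [GG, del]
  | succ j ih =>
    rw [Function.iterate_succ_apply] at h
    have h1 := ih (car_ne hn) h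
    have h2 : ∃ r ∈ (carmichael n).primeFactors, 0 < GG p j r := by
      by_contra hcon
      push Not at hcon
      have : TT (GG p j) (carmichael n) ≤ 0 := Finset.sum_nonpos hcon
      linarith
    obtain ⟨r, hr, hr0⟩ := h2
    have hr1 : 1 ≤ GG p j r := by
      obtain ⟨t, ht⟩ := GG_nat p j r
      rw [ht] at hr0 ⊢
      exact_mod_cast hr0
    have hrp := Nat.prime_of_mem_primeFactors hr
    rcases dvd_car_prime hn hrp (Nat.dvd_of_mem_primeFactors hr) with h3 | ⟨s, hs, h3⟩
    · exact (hr1.trans (single_le_TT (GG_nonneg p j) hrp hn h3)).trans (TT_GG_mono p j n)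
    · have hsp := Nat.prime_of_mem_primeFactors hs
      have hs2 := hsp.two_le
      have h4 : 1 ≤ BB (GG p j) s :=
        hr1.trans (single_le_TT (n := s - 1) (GG_nonneg p j) hrp (by omega) h3)
      exact (h4.trans (single_le_TT (BB_nonneg (GG_nonneg p j)) hsp hn
        (Nat.dvd_of_mem_primeFactors hs))).trans (TT_BB_GG_le p j n)

lemma TT_cari_le {w : ℕ → ℝ} (hw : ∀ n, 0 ≤ w n) {n : ℕ} (hn : n ≠ 0) (j : ℕ) :
    TT w (carmichael^[j] n) ≤ ∑ i ∈ Finset.range (j + 1), TT (BB^[i] w) n := by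
  have h1 : ∑ i ∈ Finset.range (j + 1), TT (BB^[i] w) n = ∑ p ∈ Pr n, w p * TT (GG p j) n := by
    rw [Finset.sum_congr rfl fun i _ => expand w i (le_refl n), Finset.sum_comm]
    refine Finset.sum_congr rfl fun p _ => ?_
    rw [TT_GG, Finset.mul_sum]
  rw [h1, TT_eq w (cari_ne hn j) (cari_le hn j)]
  refine Finset.sum_le_sum fun p hp => ?_
  split_ifs with h
  · have := one_le_GG (mem_Pr.1 hp).2 hn h
    nlinarith [hw p]
  · exact mul_nonneg (hw p) (TT_nonneg (GG_nonneg p j) n)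

lemma N_le_GG (q j : ℕ) {n : ℕ} (hn : n ≠ 0) :
    TT (BB (del q)) (carmichael^[j] n) ≤ TT (GG q (j + 1)) n := by
  refine (TT_cari_le (BB_nonneg (del_nonneg q)) hn j).trans ?_
  rw [TT_GG, Finset.sum_range_succ' _ (j + 1)]
  have := TT_nonneg (BBi_nonneg (del_nonneg q) 0) n
  simp only [← Function.iterate_succ_apply, Nat.succ_eq_add_one]
  linarith

lemma e0_cari {n : ℕ} (hn : n ≠ 0) (j : ℕ) :
    e0 (carmichael^[j] n) ≤ e0 n + ∑ i ∈ Finset.range j, TT es (carmichael^[i] n) := by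
  induction j with
  | zero => simp
  | succ j ih =>
    rw [Function.iterate_succ_apply', Finset.sum_range_succ]
    linarith [e0_car (cari_ne hn j)]

/-- upper error term -/
noncomputable def G1 (x : ℕ) (Y : ℝ) (j n : ℕ) : ℝ :=
  ∑ i ∈ Finset.range j, TT (BB^[i + 1] (ell Y)) n + e0 n +
    ∑ i ∈ Finset.range (j + 1), ∑ l ∈ Finset.range (i + 1), TT (BB^[l] es) n +
    ∑ q ∈ (Pr x).filter (fun q => ⌊Y⌋₊ < q), Real.log q * (TT (GG q (j + 1)) n * (TT (GG q (j + 1)) n - 1))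

/-- lower error term -/
noncomputable def G2 (x : ℕ) (z : ℝ) (j n : ℕ) : ℝ :=
  TT (BB^[j] (ell z)) n +
    ∑ q ∈ (Pr x).filter (fun q => ⌊z⌋₊ < q), Real.log q * (TT (GG q j) n * (TT (GG q j) n - 1))

lemma XC_upper_iter {n x : ℕ} (hn : n ≠ 0) (hx : n ≤ x) (Y : ℝ) (j : ℕ) :
    XC (carmichael^[j] n) ≤ TT (BB^[j + 1] (ell Y)) n + G1 x Y j n := by
  have h1 := XC_upper (cari_ne hn j) ((cari_le hn j).trans hx) Y
    (fun q => TT (GG q (j + 1)) n * (TT (GG q (j + 1)) n - 1)) (by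
      intro q hq N hN
      have h := N_le_GG q j hn
      rw [hN] at h
      obtain ⟨M, hM⟩ := TT_GG_nat q (j + 1) n
      rw [hM] at h ⊢
      rcases Nat.eq_zero_or_pos M with h0 | h0
      · subst h0
        have : N = 0 := by
          have : (N:ℝ) ≤ 0 := by simpa using h
          exact_mod_cast le_antisymm this (Nat.cast_nonneg N)
        subst this; simp
      · have hNM : N ≤ M := by exact_mod_cast h
        have h1 : ((N - 1 : ℕ):ℝ) ≤ ((M - 1 : ℕ):ℝ) := by exact_mod_cast Nat.sub_le_sub_right hNM 1
        rw [Nat.cast_sub h0] at h1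
        have h2 : (1:ℝ) ≤ M := by exact_mod_cast h0
        push_cast at h1
        nlinarith)
  have h2 := TT_cari_le (BB_nonneg (ell_nonneg Y)) hn j
  simp only [← Function.iterate_succ_apply] at h2
  rw [Finset.sum_range_succ] at h2
  have h3 := e0_cari hn j
  have h4 : ∑ i ∈ Finset.range j, TT es (carmichael^[i] n) + TT es (carmichael^[j] n) ≤
      ∑ i ∈ Finset.range (j + 1), ∑ l ∈ Finset.range (i + 1), TT (BB^[l] es) n := by
    rw [← Finset.sum_range_succ (fun i => TT es (carmichael^[i] n))]
    exact Finset.sum_le_sum fun i _ => TT_cari_le es_nonneg hn i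
  unfold G1
  simp only [Nat.succ_eq_add_one] at h2
  linarith

lemma car_dvd_car {a b : ℕ} (hb : b ≠ 0) (h : a ∣ b) : carmichael a ∣ carmichael b := by
  have ha : a ≠ 0 := fun h0 => hb (by rw [h0, zero_dvd_iff] at h; exact h)
  rw [car_eq ha, car_eq hb]; exact ArithmeticFunction.carmichael_dvd h

lemma cari_dvd_cari {a b : ℕ} (hb : b ≠ 0) (h : a ∣ b) (j : ℕ) : carmichael^[j] a ∣ carmichael^[j] b := by
  induction j with
  | zero => simpa
  | succ j ih =>
    rw [Function.iterate_succ_apply', Function.iterate_succ_apply']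
    exact car_dvd_car (cari_ne hb j) ih

lemma chain_dvd {p j n : ℕ} (hn : n ≠ 0) (h : 0 < TT (BB^[j] (del p)) n) : p ∣ carmichael^[j] n := by
  induction j generalizing n with
  | zero =>
    by_contra hcon
    have : TT (BB^[0] (del p)) n = 0 := by
      refine Finset.sum_eq_zero fun q hq => ?_
      simp only [Function.iterate_zero, id_eq, del] at hcon ⊢
      rw [if_neg]; rintro rfl; exact hcon (Nat.dvd_of_mem_primeFactors hq)
    linarith
  | succ j ih =>
    rw [Function.iterate_succ_apply'] at h
    have h2 : ∃ s ∈ n.primeFactors, 0 < BB (BB^[j] (del p)) s := by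
      by_contra hcon
      push Not at hcon
      have : TT (BB (BB^[j] (del p))) n ≤ 0 := Finset.sum_nonpos hcon
      linarith
    obtain ⟨s, hs, h3⟩ := h2
    have hsp := Nat.prime_of_mem_primeFactors hs
    have hs2 := hsp.two_le
    have h4 := ih (n := s - 1) (by omega) h3
    rw [Function.iterate_succ_apply]
    exact h4.trans (cari_dvd_cari (car_ne hn) (sub_one_dvd_car hn hsp (Nat.dvd_of_mem_primeFactors hs)) j)

lemma chain_lower {w : ℕ → ℝ} (hw : ∀ n, 0 ≤ w n) (hwl : ∀ p : ℕ, p.Prime → w p ≤ Real.log p) {n x : ℕ}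
    (hn : n ≠ 0) (hx : n ≤ x) (z : ℝ) (j : ℕ) :
    TT (BB^[j] w) n ≤ TT w (carmichael^[j] n) + G2 x z j n := by
  unfold G2
  rw [expand w j hx, expand (ell z) j hx, TT_eq w (cari_ne hn j) ((cari_le hn j).trans hx), Finset.sum_filter,
    ← Finset.sum_add_distrib, ← Finset.sum_add_distrib]
  refine Finset.sum_le_sum fun p hp => ?_
  have hpp := (mem_Pr.1 hp).2
  have hlog := Real.log_natCast_nonneg p
  have hc0 : 0 ≤ TT (BB^[j] (del p)) n := TT_nonneg (BBi_nonneg (del_nonneg p) j) n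
  have hcG : TT (BB^[j] (del p)) n ≤ TT (GG p j) n := by
    rw [TT_GG, Finset.sum_range_succ]
    have : 0 ≤ ∑ i ∈ Finset.range j, TT (BB^[i] (del p)) n :=
      Finset.sum_nonneg fun i _ => TT_nonneg (BBi_nonneg (del_nonneg p) i) n
    linarith
  have hF : 0 ≤ TT (GG p j) n * (TT (GG p j) n - 1) := by
    obtain ⟨M, hM⟩ := TT_GG_nat p j n
    rw [hM]; exact natr_fm M
  have hw1 := hwl p hpp
  have hw0 := hw p
  have hi : 0 ≤ if p ∣ carmichael^[j] n then w p else 0 := by split_ifs <;> first | exact hw0 | exact le_rfl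
  unfold ell
  by_cases hc : (p:ℝ) ≤ z
  · have h1 : ¬ ⌊z⌋₊ < p := not_lt.2 (Nat.le_floor hc)
    rw [if_pos hc, if_neg h1]
    have := mul_le_mul_of_nonneg_right hw1 hc0
    linarith
  · have h1 : ⌊z⌋₊ < p := by
      rw [Nat.floor_lt' hpp.ne_zero]; exact not_le.1 hc
    rw [if_neg hc, if_pos h1]
    rcases hc0.eq_or_lt with h0 | h0
    · rw [← h0]
      have := mul_nonneg hlog hF
      linarith
    · rw [if_pos (chain_dvd hn h0)]
      have hG1 : 1 ≤ TT (GG p j) n := by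
        have : 0 < TT (GG p j) n := by linarith
        obtain ⟨M, hM⟩ := TT_GG_nat p j n
        rw [hM] at this ⊢
        exact_mod_cast this
      set c := TT (BB^[j] (del p)) n
      set G := TT (GG p j) n
      have h2 : w p * (c - 1) ≤ w p * (G * (G - 1)) := mul_le_mul_of_nonneg_left (by nlinarith) hw0
      have h3 := mul_le_mul_of_nonneg_right hw1 hF
      linarith

lemma XC_lower_iter {n x : ℕ} (hn : n ≠ 0) (hx : n ≤ x) (Y z : ℝ) (j : ℕ) :
    TT (BB^[j + 1] (ell Y)) n ≤ XC (carmichael^[j] n) + G2 x z j n + ∑ n ∈ Finset.Ioc 0 ⌊Y⌋₊, lp n := by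
  have h1 := XC_lower (cari_ne hn j) ((cari_le hn j).trans hx) Y
  have h2 := chain_lower (BB_nonneg (ell_nonneg Y)) (fun p hp => BBi_log_le (fun q _ => ell_le Y q) 1 p hp)
    hn hx z j
  rw [← Function.iterate_succ_apply] at h2
  simp only [Nat.succ_eq_add_one] at h2
  linarith

end ICM

namespace ICM

/-- admissible `x` -/
def Adm (j x : ℕ) : Prop := 16 ≤ x ∧ 3 ≤ LL x ∧ ((2 * (j:ℝ) + 2) * Real.log (LL x)) ^ 4 ≤ LL x

lemma Adm.L1 {j x : ℕ} (h : Adm j x) : 1 ≤ Real.log (LL x) := by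
  rw [Real.le_log_iff_exp_le (by linarith [h.2.1])]
  linarith [Real.exp_one_lt_three, h.2.1]

lemma Adm.facts {j x : ℕ} (h : Adm j x) {i : ℕ} (hi : i ≤ 2 * j + 2) (hi1 : 1 ≤ i) :
    1 ≤ LL x ^ i ∧ 1 ≤ Real.log (LL x ^ i) ∧ Real.log (LL x ^ i) ≤ LL x ∧ Real.log (LL x ^ i) ^ 4 ≤ LL x ∧
      Real.log (LL x ^ i) ^ 2 ≤ LL x ∧ LL x ^ i / 2 ≤ ((⌊LL x ^ i⌋₊ : ℕ):ℝ) ∧ 1 ≤ ⌊LL x ^ i⌋₊ := by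
  have hL := h.L1
  have hy := h.2.1
  have h1 : 1 ≤ LL x ^ i := one_le_pow₀ (by linarith)
  have hi' : (i:ℝ) ≤ 2 * j + 2 := by exact_mod_cast hi
  have hi1' : (1:ℝ) ≤ i := by exact_mod_cast hi1
  have e : Real.log (LL x ^ i) = i * Real.log (LL x) := Real.log_pow _ _
  have h2 : 1 ≤ Real.log (LL x ^ i) := by rw [e]; nlinarith
  have h4 : Real.log (LL x ^ i) ^ 4 ≤ LL x := by
    refine le_trans ?_ h.2.2
    refine pow_le_pow_left₀ (by linarith) ?_ 4
    rw [e]; nlinarith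
  have hf : 1 ≤ ⌊LL x ^ i⌋₊ := Nat.one_le_floor_iff _ |>.2 h1
  refine ⟨h1, h2, ?_, h4, ?_, ?_, hf⟩
  · calc _ = Real.log (LL x ^ i) ^ 1 := (pow_one _).symm
      _ ≤ Real.log (LL x ^ i) ^ 4 := pow_le_pow_right₀ h2 (by norm_num)
      _ ≤ _ := h4
  · exact (pow_le_pow_right₀ h2 (by norm_num)).trans h4
  · have := Nat.lt_floor_add_one (LL x ^ i)
    have hf' : (1:ℝ) ≤ (⌊LL x ^ i⌋₊ : ℕ) := by exact_mod_cast hf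
    linarith

lemma sum_bound_unif {ι : Type*} (s : Finset ι) (P : ℕ → Prop) (F : ι → ℕ → ℝ) (B : ℕ → ℝ) (hB : ∀ x, P x → 0 ≤ B x)
    (h : ∀ i ∈ s, ∃ C : ℝ, 1 ≤ C ∧ ∀ x, P x → F i x ≤ C * B x) :
    ∃ C : ℝ, 1 ≤ C ∧ ∀ x, P x → ∑ i ∈ s, F i x ≤ C * B x := by
  classical
  induction s using Finset.induction_on with
  | empty => exact ⟨1, le_rfl, fun x hx => by simpa using hB x hx⟩
  | insert a s ha ih =>
    obtain ⟨C1, hC1, h1⟩ := ih fun i hi => h i (Finset.mem_insert_of_mem hi)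
    obtain ⟨C2, hC2, h2⟩ := h a (Finset.mem_insert_self _ _)
    refine ⟨C2 + C1, by linarith, fun x hx => ?_⟩
    rw [Finset.sum_insert ha, add_mul]
    exact add_le_add (h2 x hx) (h1 x hx)

lemma avg_G1 (j : ℕ) : ∃ C : ℝ, 1 ≤ C ∧ ∀ x : ℕ, Adm j x →
    ∑ n ∈ Finset.Icc 1 x, G1 x (LL x ^ (j + 1)) j n ≤ C * (x * LL x ^ (j + 1)) := by
  have hB : ∀ x, Adm j x → 0 ≤ (x:ℝ) * LL x ^ (j + 1) := fun x hx =>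
    mul_nonneg (Nat.cast_nonneg _) (pow_nonneg (by linarith [hx.2.1]) _)
  obtain ⟨C1, hC1, h1⟩ := sum_bound_unif (Finset.range j) (Adm j)
    (fun i x => ∑ n ∈ Finset.Icc 1 x, TT (BB^[i + 1] (ell (LL x ^ (j + 1)))) n) (fun x => x * LL x ^ (j + 1)) hB (by
      intro i hi
      obtain ⟨C, hC, h⟩ := U_ell (i + 1)
      refine ⟨C, hC, fun x hx => ?_⟩
      obtain ⟨f1, f2, f3, f4, f5, f6, f7⟩ := hx.facts (i := j + 1) (by omega) (by omega)
      refine (avg_TT x _ (BBi_nonneg (ell_nonneg _) _)).trans ?_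
      have h' := h _ x hx.1 f2 f1
      have hy := hx.2.1
      have hij : LL x ^ (i + 1) ≤ LL x ^ j := pow_le_pow_right₀ (by linarith) (by have := Finset.mem_range.1 hi; omega)
      have hy0 : 0 ≤ LL x ^ (i + 1) := pow_nonneg (by linarith) _
      have : C * LL x ^ (i + 1) * Real.log (LL x ^ (j + 1)) ≤ C * (LL x ^ (j + 1)) := by
        have hm := mul_le_mul hij f3 (by linarith) (by linarith)
        rw [← pow_succ (LL x) j] at hm
        rw [mul_assoc]
        exact mul_le_mul_of_nonneg_left hm (by linarith)
      calc _ ≤ (x:ℝ) * (C * (LL x ^ (j + 1))) := mul_le_mul_of_nonneg_left (h'.trans this) (Nat.cast_nonneg _)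
        _ = _ := by ring)
  obtain ⟨C2, hC2, h2⟩ := e0_nat
  obtain ⟨C3, hC3, h3⟩ := sum_bound_unif (Finset.range (j + 1)) (Adm j)
    (fun i x => ∑ l ∈ Finset.range (i + 1), ∑ n ∈ Finset.Icc 1 x, TT (BB^[l] es) n) (fun x => x * LL x ^ (j + 1)) hB (by
      intro i hi
      refine sum_bound_unif (Finset.range (i + 1)) (Adm j) _ _ hB fun l hl => ?_
      obtain ⟨C, hC, h⟩ := U_es l
      refine ⟨C, hC, fun x hx => ?_⟩
      refine (avg_TT x _ (BBi_nonneg es_nonneg _)).trans ?_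
      have hy := hx.2.1
      have hij : LL x ^ (l + 1) ≤ LL x ^ (j + 1) := pow_le_pow_right₀ (by linarith) (by
        have := Finset.mem_range.1 hi
        have := Finset.mem_range.1 hl
        omega)
      calc _ ≤ (x:ℝ) * (C * (LL x ^ (j + 1))) := mul_le_mul_of_nonneg_left
            ((h x hx.1).trans (mul_le_mul_of_nonneg_left hij (by linarith))) (Nat.cast_nonneg _)
        _ = _ := by ring)
  obtain ⟨C4, hC4, h4⟩ := avg_Fm (j + 1)
  refine ⟨C1 + C2 + C3 + 2 * C4, by linarith, fun x hx => ?_⟩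
  obtain ⟨f1, f2, f3, f4, f5, f6, f7⟩ := hx.facts (i := j + 1) (by omega) (by omega)
  have k1 := h1 x hx
  have k2 := h2 x
  have k3 := h3 x hx
  have k4 := h4 x _ hx.1 f7
  have hx0 : (0:ℝ) ≤ x := Nat.cast_nonneg x
  have k2' : (x:ℝ) * C2 ≤ C2 * (x * LL x ^ (j + 1)) := by
    have := mul_le_mul_of_nonneg_left f1 (mul_nonneg hx0 (by linarith : 0 ≤ C2))
    linarith
  have k4' : (x:ℝ) * (C4 * LL x ^ (2 * (j + 1)) / (⌊LL x ^ (j + 1)⌋₊ : ℕ)) ≤ 2 * C4 * (x * LL x ^ (j + 1)) := by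
    have hp : 0 < LL x ^ (j + 1) := by linarith
    have : C4 * LL x ^ (2 * (j + 1)) / (⌊LL x ^ (j + 1)⌋₊ : ℕ) ≤ 2 * C4 * LL x ^ (j + 1) := by
      rw [div_le_iff₀ (by linarith), show 2 * (j + 1) = (j + 1) + (j + 1) by ring, pow_add]
      have := mul_le_mul_of_nonneg_left f6 (mul_nonneg (by linarith : 0 ≤ 2 * C4) hp.le)
      linarith
    calc _ ≤ (x:ℝ) * (2 * C4 * LL x ^ (j + 1)) := mul_le_mul_of_nonneg_left this hx0
      _ = _ := by ring
  have e : ∑ n ∈ Finset.Icc 1 x, G1 x (LL x ^ (j + 1)) j n =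
      ∑ i ∈ Finset.range j, ∑ n ∈ Finset.Icc 1 x, TT (BB^[i + 1] (ell (LL x ^ (j + 1)))) n +
      ∑ n ∈ Finset.Icc 1 x, e0 n +
      ∑ i ∈ Finset.range (j + 1), ∑ l ∈ Finset.range (i + 1), ∑ n ∈ Finset.Icc 1 x, TT (BB^[l] es) n +
      ∑ n ∈ Finset.Icc 1 x, ∑ q ∈ (Pr x).filter (fun q => ⌊LL x ^ (j + 1)⌋₊ < q),
        Real.log q * (TT (GG q (j + 1)) n * (TT (GG q (j + 1)) n - 1)) := by
    unfold G1
    rw [Finset.sum_add_distrib, Finset.sum_add_distrib, Finset.sum_add_distrib]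
    congr 1
    congr 1
    · congr 1
      exact Finset.sum_comm
    · rw [Finset.sum_comm]
      exact Finset.sum_congr rfl fun i _ => Finset.sum_comm
  rw [e]
  linarith

lemma avg_G2 (j : ℕ) : ∃ C : ℝ, 1 ≤ C ∧ ∀ x : ℕ, Adm j x →
    ∑ n ∈ Finset.Icc 1 x, G2 x (LL x ^ (2 * j + 2)) j n ≤ C * (x * LL x ^ (j + 1)) := by
  obtain ⟨C1, hC1, h1⟩ := U_ell j
  obtain ⟨C4, hC4, h4⟩ := avg_Fm j
  refine ⟨C1 + 2 * C4, by linarith, fun x hx => ?_⟩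
  obtain ⟨f1, f2, f3, f4, f5, f6, f7⟩ := hx.facts (i := 2 * j + 2) (by omega) (by omega)
  have hy := hx.2.1
  have k4 := h4 x _ hx.1 f7
  have hx0 : (0:ℝ) ≤ x := Nat.cast_nonneg x
  have k1 : ∑ n ∈ Finset.Icc 1 x, TT (BB^[j] (ell (LL x ^ (2 * j + 2)))) n ≤ C1 * (x * LL x ^ (j + 1)) := by
    refine (avg_TT x _ (BBi_nonneg (ell_nonneg _) _)).trans ?_
    have h' := h1 _ x hx.1 f2 f1
    have hy0 : 0 ≤ LL x ^ j := pow_nonneg (by linarith) _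
    have : C1 * LL x ^ j * Real.log (LL x ^ (2 * j + 2)) ≤ C1 * (LL x ^ (j + 1)) := by
      rw [mul_assoc, pow_succ _ j]
      exact mul_le_mul_of_nonneg_left (mul_le_mul_of_nonneg_left f3 hy0) (by linarith)
    calc _ ≤ (x:ℝ) * (C1 * (LL x ^ (j + 1))) := mul_le_mul_of_nonneg_left (h'.trans this) hx0
      _ = _ := by ring
  have k4' : (x:ℝ) * (C4 * LL x ^ (2 * j) / (⌊LL x ^ (2 * j + 2)⌋₊ : ℕ)) ≤ 2 * C4 * (x * LL x ^ (j + 1)) := by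
    have hp : 0 < LL x ^ (2 * j + 2) := by linarith
    have hp1 : 1 ≤ LL x ^ (j + 1) := one_le_pow₀ (by linarith)
    have hle : LL x ^ (2 * j) ≤ LL x ^ (2 * j + 2) := pow_le_pow_right₀ (by linarith) (by omega)
    have : C4 * LL x ^ (2 * j) / (⌊LL x ^ (2 * j + 2)⌋₊ : ℕ) ≤ 2 * C4 * LL x ^ (j + 1) := by
      rw [div_le_iff₀ (by linarith)]
      calc C4 * LL x ^ (2 * j) ≤ C4 * LL x ^ (2 * j + 2) := mul_le_mul_of_nonneg_left hle (by linarith)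
        _ ≤ 2 * C4 * (⌊LL x ^ (2 * j + 2)⌋₊ : ℕ) := by nlinarith
        _ ≤ _ := by
          have h0 : 0 ≤ 2 * C4 * ((⌊LL x ^ (2 * j + 2)⌋₊ : ℕ):ℝ) :=
            mul_nonneg (by linarith) (Nat.cast_nonneg _)
          have := mul_le_mul_of_nonneg_left hp1 h0
          linarith
    calc _ ≤ (x:ℝ) * (2 * C4 * LL x ^ (j + 1)) := mul_le_mul_of_nonneg_left this hx0
      _ = _ := by ring
  unfold G2
  rw [Finset.sum_add_distrib]
  linarith

end ICM

namespace ICM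

lemma TK_L1 (j : ℕ) : ∃ C : ℝ, 1 ≤ C ∧ ∀ x : ℕ, Adm j x →
    ∑ n ∈ Finset.Icc 1 x, |TT (BB^[j + 1] (ell (LL x ^ (j + 1)))) n - UU x (BB^[j + 1] (ell (LL x ^ (j + 1))))| ≤
      C * (x * LL x ^ (j + 1)) := by
  obtain ⟨CU, hCU, hU⟩ := U_ell (j + 1)
  obtain ⟨CW, hCW, hW⟩ := W_ell j
  refine ⟨CW + 2 * CU * CW, by nlinarith, fun x hx => ?_⟩
  obtain ⟨f1, f2, f3, f4, f5, f6, f7⟩ := hx.facts (i := j + 1) (by omega) (by omega)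
  have hy := hx.2.1
  set f := BB^[j + 1] (ell (LL x ^ (j + 1))) with hf
  have hf0 : ∀ n, 0 ≤ f n := BBi_nonneg (ell_nonneg _) _
  have hU' := hU _ x hx.1 f2 f1
  have hW' := hW _ x hx.1 f2 f1
  rw [← hf] at hU' hW'
  have hTK := TK x f hf0
  set l := Real.log (LL x ^ (j + 1)) with hl
  set y := LL x with hyd
  have hyp : 0 < y := by linarith
  have hy1 : 0 < y ^ (j + 1) := by positivity
  have hy2 : 0 < y ^ (2 * j + 1) := by positivity
  have e2 : y ^ (2 * j + 1) * y = (y ^ (j + 1)) ^ 2 := by ring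
  have w1 : WW x f ≤ CW * (y ^ (j + 1)) ^ 2 := by
    refine hW'.trans ?_
    rw [← e2, ← mul_assoc]
    exact mul_le_mul_of_nonneg_left f5 (by positivity)
  have w2 : l * Real.sqrt (WW x f) ≤ CW * y ^ (j + 1) := by
    have h1 : Real.sqrt (WW x f) ≤ Real.sqrt (CW * y ^ (2 * j + 1) * l ^ 2) := Real.sqrt_le_sqrt hW'
    have hl0 : 0 ≤ l := by linarith
    calc l * Real.sqrt (WW x f) ≤ l * Real.sqrt (CW * y ^ (2 * j + 1) * l ^ 2) := mul_le_mul_of_nonneg_left h1 hl0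
      _ ≤ CW * y ^ (j + 1) := by
        refine le_trans (le_abs_self _) (abs_le_of_sq_le_sq ?_ (by positivity))
        rw [mul_pow, Real.sq_sqrt (by positivity)]
        calc l ^ 2 * (CW * y ^ (2 * j + 1) * l ^ 2) = CW * y ^ (2 * j + 1) * l ^ 4 := by ring
          _ ≤ CW * y ^ (2 * j + 1) * y := mul_le_mul_of_nonneg_left f4 (by positivity)
          _ = CW * (y ^ (j + 1)) ^ 2 := by rw [mul_assoc, e2]
          _ ≤ CW ^ 2 * (y ^ (j + 1)) ^ 2 := mul_le_mul_of_nonneg_right (by nlinarith) (by positivity)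
          _ = _ := by ring
  have w3 : UU x f * Real.sqrt (WW x f) ≤ CU * CW * (y ^ (j + 1)) ^ 2 := by
    calc UU x f * Real.sqrt (WW x f) ≤ CU * y ^ (j + 1) * l * Real.sqrt (WW x f) :=
          mul_le_mul_of_nonneg_right hU' (Real.sqrt_nonneg _)
      _ = CU * y ^ (j + 1) * (l * Real.sqrt (WW x f)) := by ring
      _ ≤ CU * y ^ (j + 1) * (CW * y ^ (j + 1)) := mul_le_mul_of_nonneg_left w2 (by positivity)
      _ = _ := by ring
  have hx0 : (0:ℝ) ≤ x := Nat.cast_nonneg x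
  have hC1 : 1 ≤ CW + 2 * CU * CW := by nlinarith
  set K := CW + 2 * CU * CW with hK
  have hV : WW x f + 2 * UU x f * Real.sqrt (WW x f) ≤ K ^ 2 * (y ^ (j + 1)) ^ 2 := by
    have : K * (y ^ (j + 1)) ^ 2 ≤ K ^ 2 * (y ^ (j + 1)) ^ 2 := mul_le_mul_of_nonneg_right (by nlinarith) (by positivity)
    have e : K * (y ^ (j + 1)) ^ 2 = CW * (y ^ (j + 1)) ^ 2 + 2 * (CU * CW * (y ^ (j + 1)) ^ 2) := by rw [hK]; ring
    linarith
  refine le_trans (le_abs_self _) (abs_le_of_sq_le_sq ?_ (by positivity))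
  have hcs := sq_sum_le_card_mul_sum_sq (s := Finset.Icc 1 x) (f := fun n => |TT f n - UU x f|)
  simp only [sq_abs, Nat.card_Icc, Nat.add_sub_cancel] at hcs
  calc _ ≤ (x:ℝ) * ∑ n ∈ Finset.Icc 1 x, (TT f n - UU x f) ^ 2 := hcs
    _ ≤ (x:ℝ) * (x * (K ^ 2 * (y ^ (j + 1)) ^ 2)) :=
      mul_le_mul_of_nonneg_left (hTK.trans (mul_le_mul_of_nonneg_left hV hx0)) hx0
    _ = _ := by ring

lemma XC_L1 (j : ℕ) : ∃ C : ℝ, 1 ≤ C ∧ ∀ x : ℕ, Adm j x →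
    ∑ n ∈ Finset.Icc 1 x, |XC (carmichael^[j] n) - LL x ^ (j + 1) * Real.log (LL x) / (j.factorial : ℝ)| ≤
      C * (x * LL x ^ (j + 1)) := by
  obtain ⟨C1, hC1, h1⟩ := TK_L1 j
  obtain ⟨C2, hC2, h2⟩ := mean_asymp j
  obtain ⟨C3, hC3, h3⟩ := avg_G1 j
  obtain ⟨C4, hC4, h4⟩ := avg_G2 j
  obtain ⟨C5, hC5, h5⟩ := theta_bound
  refine ⟨C1 + C2 + C3 + C4 + C5, by linarith, fun x hx => ?_⟩
  obtain ⟨f1, f2, f3, f4, f5, f6, f7⟩ := hx.facts (i := j + 1) (by omega) (by omega)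
  have k1 := h1 x hx
  have k2 := h2 x x _ hx.1 f1 f2 f5 (by have := hx.1; omega) le_rfl
  have k3 := h3 x hx
  have k4 := h4 x hx
  have k5 := h5 ⌊LL x ^ (j + 1)⌋₊
  have k5' : ∑ n ∈ Finset.Ioc 0 ⌊LL x ^ (j + 1)⌋₊, lp n ≤ C5 * LL x ^ (j + 1) :=
    k5.trans (mul_le_mul_of_nonneg_left (Nat.floor_le (by linarith)) hC5.le)
  have e : Real.log (LL x ^ (j + 1)) / ((j + 1).factorial : ℝ) * LL x ^ (j + 1) =
      LL x ^ (j + 1) * Real.log (LL x) / (j.factorial : ℝ) := by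
    rw [Real.log_pow, Nat.factorial_succ]
    have : (j.factorial : ℝ) ≠ 0 := by positivity
    have : (j:ℝ) + 1 ≠ 0 := by positivity
    push_cast
    field_simp
  rw [e] at k2
  set Y := LL x ^ (j + 1) with hY
  set U := UU x (BB^[j + 1] (ell Y)) with hU
  set M := Y * Real.log (LL x) / (j.factorial : ℝ) with hM
  set z := LL x ^ (2 * j + 2) with hz
  have hpt : ∀ n ∈ Finset.Icc 1 x, |XC (carmichael^[j] n) - M| ≤
      |TT (BB^[j + 1] (ell Y)) n - U| + (C2 + C5) * Y + G1 x Y j n + G2 x z j n := by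
    intro n hn
    obtain ⟨hn1, hn2⟩ := Finset.mem_Icc.1 hn
    have hn0 : n ≠ 0 := by omega
    have a1 := XC_upper_iter hn0 hn2 Y j
    have a2 := XC_lower_iter hn0 hn2 Y z j
    have g2 : 0 ≤ G2 x z j n := by
      unfold G2
      refine add_nonneg (TT_nonneg (BBi_nonneg (ell_nonneg _) _) n) (Finset.sum_nonneg fun q _ => ?_)
      obtain ⟨m, hm⟩ := TT_GG_nat q j n
      rw [hm]; exact mul_nonneg (Real.log_natCast_nonneg q) (natr_fm m)
    have g1 : 0 ≤ G1 x Y j n := by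
      unfold G1
      refine add_nonneg (add_nonneg (add_nonneg ?_ (e0_nonneg n)) ?_) (Finset.sum_nonneg fun q _ => ?_)
      · exact Finset.sum_nonneg fun i _ => TT_nonneg (BBi_nonneg (ell_nonneg _) _) n
      · exact Finset.sum_nonneg fun i _ => Finset.sum_nonneg fun l _ => TT_nonneg (BBi_nonneg es_nonneg _) n
      obtain ⟨m, hm⟩ := TT_GG_nat q (j + 1) n
      rw [hm]; exact mul_nonneg (Real.log_natCast_nonneg q) (natr_fm m)
    have b1 := abs_le.1 k2
    have b2 := neg_abs_le (TT (BB^[j + 1] (ell Y)) n - U)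
    have b3 := le_abs_self (TT (BB^[j + 1] (ell Y)) n - U)
    obtain ⟨b4, b5⟩ := b1
    have b6 : 0 ≤ C5 * Y := mul_nonneg hC5.le (by linarith)
    rw [add_mul]
    rw [abs_le]
    constructor <;> linarith
  refine (Finset.sum_le_sum hpt).trans ?_
  rw [Finset.sum_add_distrib, Finset.sum_add_distrib, Finset.sum_add_distrib, Finset.sum_const, Nat.card_Icc,
    Nat.add_sub_cancel, nsmul_eq_mul]
  linarith

end ICM

namespace ICM

lemma tot_loss : ∃ C : ℝ, 1 ≤ C ∧ ∀ m x : ℕ, m ≠ 0 → m ≤ x → 16 ≤ x →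
    0 ≤ Real.log m - Real.log m.totient ∧ Real.log m - Real.log m.totient ≤ C * LL x := by
  obtain ⟨C, hC, h⟩ := mertens2_total
  refine ⟨2 * (1 + C), by linarith, fun m x hm hx h16 => ?_⟩
  have ht : 0 < m.totient := Nat.totient_pos.2 (Nat.pos_of_ne_zero hm)
  constructor
  · have : Real.log m.totient ≤ Real.log m :=
      Real.log_le_log (by exact_mod_cast ht) (by exact_mod_cast Nat.totient_le m)
    linarith
  have h1 : ∀ p ∈ m.primeFactors, ((p:ℕ):ℝ) ≠ 0 := fun p hp => by
    exact_mod_cast (Nat.prime_of_mem_primeFactors hp).ne_zero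
  have h2 : ∀ p ∈ m.primeFactors, ((p - 1 : ℕ):ℝ) ≠ 0 := fun p hp => by
    have := (Nat.prime_of_mem_primeFactors hp).two_le
    exact_mod_cast (by omega : p - 1 ≠ 0)
  have e := congrArg (fun t : ℕ => Real.log (t:ℝ)) (Nat.totient_mul_prod_primeFactors m)
  beta_reduce at e
  rw [Nat.cast_mul, Nat.cast_mul, Nat.cast_prod, Nat.cast_prod,
    Real.log_mul (by exact_mod_cast ht.ne') (Finset.prod_ne_zero_iff.2 h1),
    Real.log_mul (by exact_mod_cast hm) (Finset.prod_ne_zero_iff.2 h2), Real.log_prod h1, Real.log_prod h2] at e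
  have e2 : Real.log m - Real.log m.totient = ∑ p ∈ m.primeFactors, (Real.log p - Real.log ((p - 1 : ℕ):ℝ)) := by
    rw [Finset.sum_sub_distrib]; linarith
  rw [e2]
  have e3 : ∀ p ∈ m.primeFactors, Real.log p - Real.log ((p - 1 : ℕ):ℝ) ≤ 2 * (1 / (p:ℝ)) := by
    intro p hp
    have hp2 := (Nat.prime_of_mem_primeFactors hp).two_le
    have hp2' : (2:ℝ) ≤ p := by exact_mod_cast hp2
    have hc : ((p - 1 : ℕ):ℝ) = p - 1 := by push_cast [show 1 ≤ p by omega]; ring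
    rw [← Real.log_div (h1 p hp) (h2 p hp), hc]
    have : Real.log ((p:ℝ) / (p - 1)) ≤ (p:ℝ) / (p - 1) - 1 :=
      Real.log_le_sub_one_of_pos (div_pos (by linarith) (by linarith))
    refine this.trans ?_
    have e4 : (p:ℝ) / (p - 1) - 1 = 1 / (p - 1) := by
      have : (p:ℝ) - 1 ≠ 0 := by linarith
      field_simp; ring
    rw [e4, ← mul_div_assoc, div_le_div_iff₀ (by linarith) (by linarith)]
    linarith
  have e5 : ∑ p ∈ m.primeFactors, 2 * (1 / (p:ℝ)) ≤ ∑ p ∈ Pr x, 2 * (1 / (p:ℝ)) := by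
    refine Finset.sum_le_sum_of_subset_of_nonneg ?_ fun p _ _ => by positivity
    intro q hq
    exact mem_Pr.2 ⟨(Nat.le_of_mem_primeFactors hq).trans hx, Nat.prime_of_mem_primeFactors hq⟩
  rw [← Finset.mul_sum, ← Finset.mul_sum] at e5
  have e6 := (abs_le.1 (h x (by omega))).2
  have hy := LL_ge_one h16
  have := Finset.sum_le_sum e3
  rw [← Finset.mul_sum] at this
  nlinarith

lemma telescope {n : ℕ} (hn : n ≠ 0) (k : ℕ) :
    Real.log n - Real.log (carmichael^[k] n : ℕ) = ∑ j ∈ Finset.range k, XC (carmichael^[j] n) +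
      ∑ j ∈ Finset.range k, (Real.log (carmichael^[j] n : ℕ) - Real.log ((carmichael^[j] n).totient : ℕ)) := by
  induction k with
  | zero => simp
  | succ k ih =>
    rw [Finset.sum_range_succ, Finset.sum_range_succ, Function.iterate_succ_apply']
    unfold XC at ih ⊢
    linarith

lemma Adm.mono {j k x : ℕ} (h : Adm k x) (hj : j ≤ k) : Adm j x := by
  refine ⟨h.1, h.2.1, le_trans ?_ h.2.2⟩
  have hL := h.L1
  have hj' : (j:ℝ) ≤ k := by exact_mod_cast hj
  have : (0:ℝ) ≤ j := Nat.cast_nonneg j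
  refine pow_le_pow_left₀ (mul_nonneg (by linarith) (by linarith)) ?_ 4
  exact mul_le_mul_of_nonneg_right (by linarith) (by linarith)

lemma main_L1 (k : ℕ) : ∃ C : ℝ, 1 ≤ C ∧ ∀ x : ℕ, Adm k x →
    ∑ n ∈ Finset.Icc 1 x, |Real.log ((n:ℝ) / ((carmichael^[k + 1] n : ℕ):ℝ)) -
      LL x ^ (k + 1) * Real.log (LL x) / (k.factorial : ℝ)| ≤ C * (x * LL x ^ (k + 1)) := by
  obtain ⟨C1, hC1, h1⟩ := XC_L1 k
  obtain ⟨C2, hC2, h2⟩ := tot_loss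
  have hB : ∀ x, Adm k x → 0 ≤ (x:ℝ) * LL x ^ (k + 1) := fun x hx =>
    mul_nonneg (Nat.cast_nonneg _) (pow_nonneg (by linarith [hx.2.1]) _)
  obtain ⟨C3, hC3, h3⟩ := sum_bound_unif (Finset.range k) (Adm k)
    (fun j x => ∑ n ∈ Finset.Icc 1 x, |XC (carmichael^[j] n)|) (fun x => x * LL x ^ (k + 1)) hB (by
      intro j hj
      have hjk := Finset.mem_range.1 hj
      obtain ⟨C, hC, h⟩ := XC_L1 j
      refine ⟨C + 1, by linarith, fun x hx => ?_⟩
      have hj := hx.mono hjk.le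
      have hy := hx.2.1
      have h' := h x hj
      set M := LL x ^ (j + 1) * Real.log (LL x) / (j.factorial : ℝ) with hM
      have hL := hx.L1
      have hLy : Real.log (LL x) ≤ LL x := (Real.log_le_sub_one_of_pos (by linarith)).trans (by linarith)
      have hp : 0 < LL x ^ (j + 1) := pow_pos (by linarith) _
      have hpk : LL x ^ (j + 1) * LL x ≤ LL x ^ (k + 1) := by
        rw [← pow_succ]; exact pow_le_pow_right₀ (by linarith) (by omega)
      have hpk' : LL x ^ (j + 1) ≤ LL x ^ (k + 1) := pow_le_pow_right₀ (by linarith) (by omega)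
      have hM0 : 0 ≤ M := by positivity
      have hM1 : M ≤ LL x ^ (k + 1) := by
        have hf : (1:ℝ) ≤ j.factorial := by exact_mod_cast Nat.one_le_iff_ne_zero.2 (Nat.factorial_ne_zero j)
        calc M ≤ LL x ^ (j + 1) * Real.log (LL x) := div_le_self (by positivity) hf
          _ ≤ LL x ^ (j + 1) * LL x := mul_le_mul_of_nonneg_left hLy hp.le
          _ ≤ _ := hpk
      have hx0 : (0:ℝ) ≤ x := Nat.cast_nonneg x
      calc _ ≤ ∑ n ∈ Finset.Icc 1 x, (|XC (carmichael^[j] n) - M| + LL x ^ (k + 1)) := by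
            refine Finset.sum_le_sum fun n _ => ?_
            have := abs_sub_abs_le_abs_sub (XC (carmichael^[j] n)) M
            rw [abs_of_nonneg hM0] at this
            linarith
        _ = ∑ n ∈ Finset.Icc 1 x, |XC (carmichael^[j] n) - M| + x * LL x ^ (k + 1) := by
            rw [Finset.sum_add_distrib, Finset.sum_const, Nat.card_Icc, Nat.add_sub_cancel, nsmul_eq_mul]
        _ ≤ C * (x * LL x ^ (j + 1)) + x * LL x ^ (k + 1) := by linarith
        _ ≤ C * (x * LL x ^ (k + 1)) + x * LL x ^ (k + 1) := by
            have := mul_le_mul_of_nonneg_left (mul_le_mul_of_nonneg_left hpk' hx0) (by linarith : 0 ≤ C)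
            linarith
        _ = _ := by ring)
  refine ⟨C1 + C3 + (k + 1) * C2, by have : (0:ℝ) ≤ k := Nat.cast_nonneg k; nlinarith, fun x hx => ?_⟩
  have k1 := h1 x hx
  have k3 := h3 x hx
  set M := LL x ^ (k + 1) * Real.log (LL x) / (k.factorial : ℝ) with hM
  have hy := hx.2.1
  have hyk : LL x ≤ LL x ^ (k + 1) := le_self_pow₀ (by linarith) (by omega)
  have hpt : ∀ n ∈ Finset.Icc 1 x, |Real.log ((n:ℝ) / ((carmichael^[k + 1] n : ℕ):ℝ)) - M| ≤
      |XC (carmichael^[k] n) - M| + ∑ j ∈ Finset.range k, |XC (carmichael^[j] n)| +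
        (k + 1) * C2 * LL x ^ (k + 1) := by
    intro n hn
    obtain ⟨hn1, hn2⟩ := Finset.mem_Icc.1 hn
    have hn0 : n ≠ 0 := by omega
    rw [Real.log_div (by exact_mod_cast hn0) (by exact_mod_cast cari_ne hn0 (k + 1)), telescope hn0,
      Finset.sum_range_succ]
    set D := ∑ j ∈ Finset.range (k + 1), (Real.log (carmichael^[j] n : ℕ) - Real.log ((carmichael^[j] n).totient : ℕ))
      with hD
    have hD1 : |D| ≤ (k + 1) * C2 * LL x ^ (k + 1) := by
      have q1 : ∀ j ∈ Finset.range (k + 1), |Real.log (carmichael^[j] n : ℕ) -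
          Real.log ((carmichael^[j] n).totient : ℕ)| ≤ C2 * LL x ^ (k + 1) := by
        intro j _
        obtain ⟨a, b⟩ := h2 _ x (cari_ne hn0 j) ((cari_le hn0 j).trans hn2) hx.1
        rw [abs_of_nonneg a]
        exact b.trans (mul_le_mul_of_nonneg_left hyk (by linarith))
      refine (Finset.abs_sum_le_sum_abs _ _).trans ((Finset.sum_le_sum q1).trans ?_)
      rw [Finset.sum_const, Finset.card_range, nsmul_eq_mul]
      push_cast
      linarith
    have hS := Finset.abs_sum_le_sum_abs (fun j => XC (carmichael^[j] n)) (Finset.range k)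
    set S := ∑ j ∈ Finset.range k, XC (carmichael^[j] n)
    have e : S + XC (carmichael^[k] n) + D - M = (XC (carmichael^[k] n) - M) + S + D := by ring
    rw [e]
    have := abs_add_three (XC (carmichael^[k] n) - M) S D
    linarith
  refine (Finset.sum_le_sum hpt).trans ?_
  rw [Finset.sum_add_distrib, Finset.sum_add_distrib, Finset.sum_const, Nat.card_Icc,
    Nat.add_sub_cancel, nsmul_eq_mul, Finset.sum_comm]
  linarith

lemma eventually_Adm (k : ℕ) (T : ℝ) : ∀ᶠ x : ℕ in atTop, Adm k x ∧ T ≤ Real.log (LL x) := by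
  have hLL : Tendsto (fun x : ℕ => LL x) atTop atTop :=
    Real.tendsto_log_atTop.comp (Real.tendsto_log_atTop.comp tendsto_natCast_atTop_atTop)
  have hL : Tendsto (fun x : ℕ => Real.log (LL x)) atTop atTop := Real.tendsto_log_atTop.comp hLL
  have h4 : ∀ᶠ y : ℝ in atTop, ((2 * (k:ℝ) + 2) * Real.log y) ^ 4 ≤ y := by
    have := (Real.isLittleO_pow_log_id_atTop (n := 4)).bound
      (show (0:ℝ) < 1 / (2 * (k:ℝ) + 2) ^ 4 by positivity)
    filter_upwards [this, eventually_ge_atTop 0] with y hy hy0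
    simp only [id_eq, Real.norm_eq_abs, abs_of_nonneg hy0] at hy
    rw [mul_pow]
    have h5 := (le_abs_self _).trans hy
    have hp : (0:ℝ) < (2 * (k:ℝ) + 2) ^ 4 := by positivity
    calc _ ≤ (2 * (k:ℝ) + 2) ^ 4 * (1 / (2 * (k:ℝ) + 2) ^ 4 * y) := mul_le_mul_of_nonneg_left h5 hp.le
      _ = y := by field_simp
  filter_upwards [eventually_ge_atTop 16, hLL.eventually_ge_atTop 3, hLL.eventually h4,
    hL.eventually_ge_atTop T] with x a b c d
  exact ⟨⟨a, b, c⟩, d⟩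

end ICM

namespace ICM

lemma compare_M {k : ℕ} {y u : ℝ} (hy : 3 ≤ y) (hu : y - 1 ≤ u) (huy : u ≤ y) :
    y ^ k * (Real.log y - 1 - k) ≤ u ^ k * Real.log u ∧ u ^ k * Real.log u ≤ y ^ k * Real.log y := by
  have hL : 1 ≤ Real.log y := by
    rw [Real.le_log_iff_exp_le (by linarith)]; linarith [Real.exp_one_lt_three]
  have hLy : Real.log y ≤ y := (Real.log_le_sub_one_of_pos (by linarith)).trans (by linarith)
  have hu0 : 0 < u := by linarith
  have hyp : 0 < y := by linarith
  have hlu : Real.log u ≤ Real.log y := Real.log_le_log hu0 huy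
  have hlu0 : 0 ≤ Real.log u := Real.log_nonneg (by linarith)
  have huk : u ^ k ≤ y ^ k := pow_le_pow_left₀ hu0.le huy k
  have hyk : 0 < y ^ k := pow_pos hyp k
  have huk0 : 0 < u ^ k := pow_pos hu0 k
  refine ⟨?_, mul_le_mul huk hlu hlu0 hyk.le⟩
  have h1 : Real.log y - 1 ≤ Real.log u := by
    have : Real.log (y / u) ≤ y / u - 1 := Real.log_le_sub_one_of_pos (by positivity)
    rw [Real.log_div hyp.ne' hu0.ne'] at this
    have h2 : y / u ≤ 2 := by rw [div_le_iff₀ hu0]; linarith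
    linarith
  have h2 : y ^ k * (1 - k / y) ≤ u ^ k := by
    have hb := one_add_mul_le_pow (a := -(1 / y)) (by
      have : 1 / y ≤ 1 := by rw [div_le_one hyp]; linarith
      linarith) k
    have e : (y * (1 + -(1 / y))) = y - 1 := by field_simp; ring
    calc y ^ k * (1 - k / y) = y ^ k * (1 + k * -(1 / y)) := by ring
      _ ≤ y ^ k * (1 + -(1 / y)) ^ k := mul_le_mul_of_nonneg_left hb hyk.le
      _ = (y - 1) ^ k := by rw [← mul_pow, e]
      _ ≤ u ^ k := pow_le_pow_left₀ (by linarith) hu k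
  calc y ^ k * (Real.log y - 1 - k) ≤ y ^ k * ((1 - k / y) * (Real.log y - 1)) := by
        refine mul_le_mul_of_nonneg_left ?_ hyk.le
        have h3 : (k:ℝ) / y * (Real.log y - 1) ≤ k := by
          rw [div_mul_eq_mul_div, div_le_iff₀ hyp]
          exact mul_le_mul_of_nonneg_left (by linarith) (Nat.cast_nonneg k)
        linarith
    _ = (y ^ k * (1 - k / y)) * (Real.log y - 1) := by ring
    _ ≤ u ^ k * (Real.log y - 1) := mul_le_mul_of_nonneg_right h2 (by linarith)
    _ ≤ u ^ k * Real.log u := mul_le_mul_of_nonneg_left h1 huk0.le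

lemma LL_close {n x : ℕ} (hx : 16 ≤ x) (hn : x ≤ n * n) (hnx : n ≤ x) : LL x - 1 ≤ LL n ∧ LL n ≤ LL x := by
  have hn4 : 4 ≤ n := by nlinarith
  refine ⟨?_, LL_mono (by omega) hnx⟩
  have hx' : (0:ℝ) < x := by exact_mod_cast (by omega : 0 < x)
  have hn' : (n:ℝ) ≠ 0 := by exact_mod_cast (by omega : n ≠ 0)
  have h1 : Real.log x ≤ 2 * Real.log n := by
    have : Real.log x ≤ Real.log ((n:ℝ) * n) := Real.log_le_log hx' (by exact_mod_cast hn)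
    rw [Real.log_mul hn' hn'] at this; linarith
  have h2 : 0 < Real.log x := log_pos_nat (by omega)
  have h3 : 0 < Real.log n := log_pos_nat (by omega)
  have h4 : LL x ≤ Real.log (2 * Real.log n) := Real.log_le_log h2 h1
  rw [Real.log_mul (by norm_num) h3.ne'] at h4
  have := Real.log_two_lt_d9
  unfold LL at h4 ⊢
  linarith

/-- the exceptional set is small -/
lemma bad_card (k : ℕ) (ε : ℝ) (hε : 0 < ε) : ∃ C : ℝ, ∀ᶠ x : ℕ in atTop,
      (((Finset.Icc 1 x).filter (fun n : ℕ =>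
          |Real.log ((n : ℝ) / ((carmichael^[k + 1] n : ℕ) : ℝ)) -
            (1 / (Nat.factorial k : ℝ)) * (Real.log (Real.log n)) ^ (k + 1) *
              Real.log (Real.log (Real.log n))| >
          ε * (Real.log (Real.log n)) ^ (k + 1) * Real.log (Real.log (Real.log n)))).card : ℝ)
        / (x : ℝ) ≤ C / Real.log (LL x) + 1 / Real.sqrt x := by
  obtain ⟨C, hC, h⟩ := main_L1 k
  refine ⟨4 * C / ε, ?_⟩
  filter_upwards [eventually_Adm k (2 * ((k:ℝ) + 2) + 4 * ((k:ℝ) + 2) / ε)] with x hx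
  obtain ⟨hA, hT⟩ := hx
  have hy := hA.2.1
  have hL := hA.L1
  have hmain := h x hA
  set y := LL x with hyd
  set L := Real.log y with hLd
  have hk0 : (0:ℝ) ≤ k := Nat.cast_nonneg k
  have hT1 : 2 * ((k:ℝ) + 2) ≤ L := by
    have : 0 ≤ 4 * ((k:ℝ) + 2) / ε := by positivity
    linarith
  have hT2 : 4 * ((k:ℝ) + 2) ≤ ε * L := by
    have : 4 * ((k:ℝ) + 2) / ε ≤ L := by linarith
    rw [div_le_iff₀ hε] at this; linarith
  have hyk : 0 < y ^ (k + 1) := pow_pos (by linarith) _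
  have hx0 : (0:ℝ) < x := by exact_mod_cast (by have := hA.1; omega : 0 < x)
  set F : ℕ → ℝ := fun n => |Real.log ((n:ℝ) / ((carmichael^[k + 1] n : ℕ):ℝ)) - y ^ (k + 1) * L / (k.factorial : ℝ)| with hF
  set S := (Finset.Icc 1 x).filter (fun n : ℕ => y ^ (k + 1) * (ε * L / 4) ≤ F n) with hS
  have hSc : (S.card : ℝ) * (y ^ (k + 1) * (ε * L / 4)) ≤ C * (x * y ^ (k + 1)) := by
    refine le_trans ?_ hmain
    calc (S.card : ℝ) * (y ^ (k + 1) * (ε * L / 4)) = ∑ n ∈ S, y ^ (k + 1) * (ε * L / 4) := by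
          rw [Finset.sum_const, nsmul_eq_mul]
      _ ≤ ∑ n ∈ S, F n := Finset.sum_le_sum fun n hn => (Finset.mem_filter.1 hn).2
      _ ≤ ∑ n ∈ Finset.Icc 1 x, F n :=
        Finset.sum_le_sum_of_subset_of_nonneg (Finset.filter_subset _ _) fun n _ _ => abs_nonneg _
  have hsub : (Finset.Icc 1 x).filter (fun n : ℕ =>
          |Real.log ((n : ℝ) / ((carmichael^[k + 1] n : ℕ) : ℝ)) -
            (1 / (Nat.factorial k : ℝ)) * (Real.log (Real.log n)) ^ (k + 1) *
              Real.log (Real.log (Real.log n))| >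
          ε * (Real.log (Real.log n)) ^ (k + 1) * Real.log (Real.log (Real.log n))) ⊆
        S ∪ Finset.Icc 1 (Nat.sqrt x) := by
    intro n hn
    obtain ⟨hn1, hn2⟩ := Finset.mem_filter.1 hn
    obtain ⟨hn3, hn4⟩ := Finset.mem_Icc.1 hn1
    rw [Finset.mem_union]
    by_cases hc : n ≤ Nat.sqrt x
    · right; exact Finset.mem_Icc.2 ⟨hn3, hc⟩
    left
    rw [hS, Finset.mem_filter]
    refine ⟨hn1, ?_⟩
    have hnn : x ≤ n * n := (Nat.sqrt_lt.1 (not_le.1 hc)).le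
    obtain ⟨u1, u2⟩ := LL_close hA.1 hnn hn4
    obtain ⟨m1, m2⟩ := compare_M (k := k + 1) hy u1 u2
    change ε * (LL n) ^ (k + 1) * Real.log (LL n) < |Real.log ((n : ℝ) / ((carmichael^[k + 1] n : ℕ) : ℝ)) -
            (1 / (Nat.factorial k : ℝ)) * (LL n) ^ (k + 1) * Real.log (LL n)| at hn2
    rw [mul_assoc, mul_assoc] at hn2
    set Mn := LL n ^ (k + 1) * Real.log (LL n) with hMn
    set f := Real.log ((n : ℝ) / ((carmichael^[k + 1] n : ℕ) : ℝ)) with hf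
    set c := 1 / (Nat.factorial k : ℝ) with hcd
    have hc0 : 0 ≤ c := by positivity
    have hc1 : c ≤ 1 := by
      rw [hcd, div_le_one (by positivity)]
      exact_mod_cast Nat.one_le_iff_ne_zero.2 (Nat.factorial_ne_zero k)
    have eF : F n = |f - c * (y ^ (k + 1) * L)| := by
      simp only [hF, hcd]; congr 2; ring
    rw [eF]
    have t1 : |f - c * Mn| ≤ |f - c * (y ^ (k + 1) * L)| + |c * (y ^ (k + 1) * L - Mn)| := by
      have := abs_add_le (f - c * (y ^ (k + 1) * L)) (c * (y ^ (k + 1) * L - Mn))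
      rwa [show f - c * (y ^ (k + 1) * L) + c * (y ^ (k + 1) * L - Mn) = f - c * Mn by ring] at this
    have d0 : 0 ≤ y ^ (k + 1) * L - Mn := by linarith
    have d1 : y ^ (k + 1) * L - Mn ≤ y ^ (k + 1) * (k + 2) := by
      push_cast at m1
      have : y ^ (k + 1) * (L - 1 - (k + 1)) = y ^ (k + 1) * L - y ^ (k + 1) * (k + 2) := by ring
      linarith
    rw [abs_of_nonneg (mul_nonneg hc0 d0)] at t1
    have d2 : c * (y ^ (k + 1) * L - Mn) ≤ y ^ (k + 1) * (k + 2) :=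
      (mul_le_of_le_one_left d0 hc1).trans d1
    have d3 : y ^ (k + 1) * (L / 2) ≤ Mn := by
      have : y ^ (k + 1) * (k + 2) ≤ y ^ (k + 1) * (L / 2) := mul_le_mul_of_nonneg_left (by linarith) hyk.le
      linarith
    have d4 : ε * (y ^ (k + 1) * (L / 2)) ≤ ε * Mn := mul_le_mul_of_nonneg_left d3 hε.le
    have d5 : y ^ (k + 1) * (k + 2) ≤ y ^ (k + 1) * (ε * L / 4) := mul_le_mul_of_nonneg_left (by linarith) hyk.le
    linarith
  have hcard := (Finset.card_le_card hsub).trans (Finset.card_union_le _ _)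
  rw [Nat.card_Icc, Nat.add_sub_cancel] at hcard
  have hcard' := (Nat.cast_le (α := ℝ)).2 hcard
  push_cast at hcard'
  have hsq : ((Nat.sqrt x : ℕ):ℝ) ≤ Real.sqrt x := by
    refine Real.le_sqrt_of_sq_le ?_
    exact_mod_cast Nat.sqrt_le' x
  have hSc' : (S.card : ℝ) ≤ 4 * C / ε / L * x := by
    have h1 : (S.card : ℝ) * (ε * L / 4) * y ^ (k + 1) ≤ C * x * y ^ (k + 1) := by linarith
    have h2 := le_of_mul_le_mul_right h1 hyk
    have hεL : 0 < ε * L := by positivity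
    rw [div_div, div_mul_eq_mul_div, le_div_iff₀ hεL]
    linarith
  rw [div_le_iff₀ hx0, add_mul]
  have e : 1 / Real.sqrt x * x = Real.sqrt x := by
    rw [one_div_mul_eq_div, Real.div_sqrt]
  rw [e]
  linarith

end ICM

/-- The normal order of `log (n / λ_k(n))` is `(1/(k-1)!) (log log n)^k log log log n`. -/
theorem normal_order_log_iterated_carmichael (k : ℕ) (hk : 1 ≤ k) (ε : ℝ) (hε : 0 < ε) :
    Tendsto (fun x : ℕ =>
      ((Finset.Icc 1 x).filter (fun n : ℕ =>
          |Real.log ((n : ℝ) / ((carmichael^[k] n : ℕ) : ℝ)) -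
            (1 / (Nat.factorial (k - 1) : ℝ)) * (Real.log (Real.log n)) ^ k *
              Real.log (Real.log (Real.log n))| >
          ε * (Real.log (Real.log n)) ^ k * Real.log (Real.log (Real.log n)))).card
        / (x : ℝ))
      atTop (nhds 0) := by
  obtain ⟨K, rfl⟩ := Nat.exists_eq_add_of_le' hk
  obtain ⟨C, hC⟩ := ICM.bad_card K ε hε
  have hL : Tendsto (fun x : ℕ => Real.log (ICM.LL x)) atTop atTop :=
    Real.tendsto_log_atTop.comp
      (Real.tendsto_log_atTop.comp (Real.tendsto_log_atTop.comp tendsto_natCast_atTop_atTop))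
  have hs : Tendsto (fun x : ℕ => Real.sqrt (x:ℝ)) atTop atTop :=
    Real.tendsto_sqrt_atTop.comp tendsto_natCast_atTop_atTop
  have h1 : Tendsto (fun x : ℕ => C / Real.log (ICM.LL x) + 1 / Real.sqrt x) atTop (nhds 0) := by
    have := (hL.const_div_atTop C).add (hs.const_div_atTop 1)
    simpa using this
  refine squeeze_zero' (Eventually.of_forall fun x => by positivity) ?_ h1
  simpa only [Nat.add_sub_cancel] using hC
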